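/- Let M₁, M₂ be positive integers and ℓ₁, ℓ₂ integers with 1 ≤ ℓ₁ ≤ M₁, 1 ≤ ℓ₂ ≤ M₂. For T ≥ 10 set y = T^{3/4} and H = T⁸, and let R(x) = R₀(x;y) + R*₁₂(x;y,H) + R*₂₁(x;y,H). Then for every ε > 0, ∫_{T/2}^T R(x)⁴ dx = (1/(32π⁴)) · C₄(ℓ₁/M₁, ℓ₂/M₂) · ∫_{T/2}^T x dx + O(T^{2−1/8+ε}), where the implied constant depends at most on M₁, M₂ and ε. -/

import Mathlib

open Real MeasureTheory Finset
open scoped Classical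

noncomputable section

/-- The phase `h ℓ₂/M₂ + r ℓ₁/M₁ + 1/8` attached to a factorization pair `p = (h, r)`. -/
def phase (M₁ M₂ ℓ₁ ℓ₂ : ℕ) (p : ℕ × ℕ) : ℝ :=
  ((p.1 : ℝ) * ℓ₂) / M₂ + ((p.2 : ℝ) * ℓ₁) / M₁ + 1/8

/-- The series `s_{4;v}` with sign pattern `(1, e₂, e₃, e₄)`. -/
def s4 (M₁ M₂ ℓ₁ ℓ₂ : ℕ) (e₂ e₃ e₄ : ℝ) : ℝ :=
  ∑' q : ℕ × ℕ × ℕ × ℕ,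
    if 0 < q.1 ∧ 0 < q.2.1 ∧ 0 < q.2.2.1 ∧ 0 < q.2.2.2 ∧
        Real.sqrt q.1 + e₂ * Real.sqrt q.2.1 + e₃ * Real.sqrt q.2.2.1
          + e₄ * Real.sqrt q.2.2.2 = 0 then
      ((q.1 : ℝ) * q.2.1 * q.2.2.1 * q.2.2.2) ^ (-(3:ℝ)/4) *
        ∑ p₁ ∈ Nat.divisorsAntidiagonal q.1, ∑ p₂ ∈ Nat.divisorsAntidiagonal q.2.1,
        ∑ p₃ ∈ Nat.divisorsAntidiagonal q.2.2.1, ∑ p₄ ∈ Nat.divisorsAntidiagonal q.2.2.2,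
          Real.cos (2 * π * (phase M₁ M₂ ℓ₁ ℓ₂ p₁ + e₂ * phase M₁ M₂ ℓ₁ ℓ₂ p₂
            + e₃ * phase M₁ M₂ ℓ₁ ℓ₂ p₃ + e₄ * phase M₁ M₂ ℓ₁ ℓ₂ p₄))
    else 0

/-- `C₄(ℓ₁/M₁, ℓ₂/M₂) = Σ_{v=1}^3 binom(3,v) s_{4;v}`. -/
def C4 (M₁ M₂ ℓ₁ ℓ₂ : ℕ) : ℝ :=
  3 * s4 M₁ M₂ ℓ₁ ℓ₂ 1 1 (-1) + 3 * s4 M₁ M₂ ℓ₁ ℓ₂ 1 (-1) (-1)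
    + s4 M₁ M₂ ℓ₁ ℓ₂ (-1) (-1) (-1)

/-- `τ(n,x) = Σ_{hr=n} cos(4π√(nx) − 2π(hℓ₂/M₂ + rℓ₁/M₁ + 1/8))`. -/
def tau (M₁ M₂ ℓ₁ ℓ₂ n : ℕ) (x : ℝ) : ℝ :=
  ∑ p ∈ Nat.divisorsAntidiagonal n,
    Real.cos (4 * π * Real.sqrt (n * x) - 2 * π * phase M₁ M₂ ℓ₁ ℓ₂ p)

/-- `R₀(x;y) = (x^{1/4}/(√2 π)) Σ_{n ≤ y} τ(n,x) n^{−3/4}`. -/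
def R0 (M₁ M₂ ℓ₁ ℓ₂ : ℕ) (y x : ℝ) : ℝ :=
  x ^ ((1:ℝ)/4) / (Real.sqrt 2 * π) *
    ∑ n ∈ Finset.Icc 1 ⌊y⌋₊, tau M₁ M₂ ℓ₁ ℓ₂ n x * (n : ℝ) ^ (-(3:ℝ)/4)

/-- `J = ⌊(log T − 2 log log T)/log 2⌋`. -/
def Jof (T : ℝ) : ℤ := ⌊(Real.log T - 2 * Real.log (Real.log T)) / Real.log 2⌋

/-- The `Σ′` weight: a point strictly inside `(α,β)` counts with weight `1`, and each
endpoint counts with weight `1/2`. -/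
def wprime (α β t : ℝ) : ℝ :=
  (if α < t ∧ t < β then 1 else 0) + (if t = α then 1/2 else 0) + (if t = β then 1/2 else 0)

/-- `τ₁₂(n,x;H)`: the `Σ′`-sum over factorizations `n = hr` with `1 ≤ h ≤ H` and
`hM₁/M₂ ≤ r ≤ 2^{J+1} h M₁/M₂` of `cos(4π√(nx) − 2π(hℓ₂/M₂ + rℓ₁/M₁ + 1/8))`. -/
def tau12H (M₁ M₂ ℓ₁ ℓ₂ : ℕ) (T H : ℝ) (n : ℕ) (x : ℝ) : ℝ :=
  ∑ p ∈ Nat.divisorsAntidiagonal n,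
    if (p.1 : ℝ) ≤ H then
      wprime ((p.1 : ℝ) * M₁ / M₂) ((2:ℝ) ^ (Jof T + 1) * p.1 * M₁ / M₂) (p.2 : ℝ) *
        Real.cos (4 * π * Real.sqrt (n * x) - 2 * π * phase M₁ M₂ ℓ₁ ℓ₂ p)
    else 0

/-- `R*₁₂(x;y,H) = (x^{1/4}/(√2π)) Σ_{y < n ≤ 2^{J+1}H²M₁/M₂} τ₁₂(n,x;H) n^{−3/4}`. -/
def Rstar12 (M₁ M₂ ℓ₁ ℓ₂ : ℕ) (T y H x : ℝ) : ℝ :=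
  x ^ ((1:ℝ)/4) / (Real.sqrt 2 * π) *
    ∑ n ∈ (Finset.Icc 1 ⌊(2:ℝ) ^ (Jof T + 1) * H ^ 2 * M₁ / M₂⌋₊).filter
        (fun n : ℕ => y < (n : ℝ)),
      tau12H M₁ M₂ ℓ₁ ℓ₂ T H n x * (n : ℝ) ^ (-(3:ℝ)/4)

/-- `R(x) = R₀(x;y) + R*₁₂(x;y,H) + R*₂₁(x;y,H)` with `y = T^{3/4}` and `H = T⁸`. -/
def Rfull (M₁ M₂ ℓ₁ ℓ₂ : ℕ) (T x : ℝ) : ℝ :=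
  R0 M₁ M₂ ℓ₁ ℓ₂ (T ^ ((3:ℝ)/4)) x
    + Rstar12 M₁ M₂ ℓ₁ ℓ₂ T (T ^ ((3:ℝ)/4)) (T ^ 8) x
    + Rstar12 M₂ M₁ ℓ₂ ℓ₁ T (T ^ ((3:ℝ)/4)) (T ^ 8) x

/-- Divisor bound. -/
theorem divisor_bound (ε : ℝ) (hε : 0 < ε) :
    ∃ C : ℝ, 1 ≤ C ∧ ∀ n : ℕ, 1 ≤ n → ((Nat.divisors n).card : ℝ) ≤ C * (n : ℝ) ^ ε := by
  set K : ℝ := max 1 (1 / (ε * Real.log 2)) with hK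
  have hl2 : 0 < Real.log 2 := Real.log_pos (by norm_num)
  have hK1 : 1 ≤ K := le_max_left _ _
  have hK2 : 1 ≤ K * (ε * Real.log 2) := by
    have : 1 / (ε * Real.log 2) ≤ K := le_max_right _ _
    rwa [div_le_iff₀ (by positivity)] at this
  obtain ⟨B, hB⟩ := exists_nat_gt ((2:ℝ) ^ (1/ε))
  refine ⟨K ^ B, one_le_pow₀ hK1, fun n hn => ?_⟩
  have hn0 : n ≠ 0 := by omega
  have key : ∀ p ∈ n.primeFactors, ((n.factorization p : ℝ) + 1) ≤
      (if p < B then K else 1) * ((p:ℝ) ^ (n.factorization p)) ^ ε := by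
    intro p hp
    have hpp : p.Prime := Nat.prime_of_mem_primeFactors hp
    have hp2 : (2:ℝ) ≤ p := by exact_mod_cast hpp.two_le
    set a := n.factorization p
    have e1 : ((p:ℝ) ^ a) ^ ε = ((p:ℝ) ^ ε) ^ a := by
      rw [← Real.rpow_natCast, ← Real.rpow_natCast, ← Real.rpow_mul (by positivity),
        ← Real.rpow_mul (by positivity), mul_comm]
    rw [e1]
    split_ifs with h
    · have h2 : (1 + ε * Real.log 2) ^ a ≤ ((p:ℝ) ^ ε) ^ a := by
        apply pow_le_pow_left₀ (by positivity)
        calc 1 + ε * Real.log 2 ≤ Real.exp (ε * Real.log 2) := by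
              linarith [Real.add_one_le_exp (ε * Real.log 2)]
          _ = (2:ℝ) ^ ε := by rw [Real.rpow_def_of_pos (by norm_num), mul_comm]
          _ ≤ _ := Real.rpow_le_rpow (by norm_num) hp2 hε.le
      have h3 : 1 + (a:ℝ) * (ε * Real.log 2) ≤ (1 + ε * Real.log 2) ^ a :=
        one_add_mul_le_pow (by nlinarith [mul_pos hε hl2]) a
      have : (a:ℝ) + 1 ≤ K * (1 + (a:ℝ) * (ε * Real.log 2)) := by
        have : (0:ℝ) ≤ a := by positivity
        nlinarith
      exact this.trans (mul_le_mul_of_nonneg_left (h3.trans h2) (by linarith))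
    · rw [one_mul]
      have hpB : (B:ℝ) ≤ p := by exact_mod_cast not_lt.mp h
      have : (2:ℝ) ≤ (p:ℝ) ^ ε := by
        calc (2:ℝ) = ((2:ℝ) ^ (1/ε)) ^ ε := by
              rw [← Real.rpow_mul (by norm_num), one_div, inv_mul_cancel₀ hε.ne', Real.rpow_one]
          _ ≤ _ := Real.rpow_le_rpow (by positivity) (hB.le.trans hpB) hε.le
      calc (a:ℝ) + 1 ≤ (2:ℝ) ^ a := by
            have := Nat.lt_two_pow_self (n := a)
            exact_mod_cast this
        _ ≤ _ := pow_le_pow_left₀ (by norm_num) this a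
  have h1 : ((Nat.divisors n).card : ℝ) = ∏ p ∈ n.primeFactors, ((n.factorization p : ℝ) + 1) := by
    rw [Nat.card_divisors hn0]; push_cast; rfl
  have h2 : (n : ℝ) ^ ε = ∏ p ∈ n.primeFactors, ((p:ℝ) ^ (n.factorization p)) ^ ε := by
    rw [Real.finsetProd_rpow _ _ (fun i _ => by positivity)]
    congr 1
    conv_lhs => rw [← Nat.prod_factorization_pow_eq_self hn0]
    rw [Finsupp.prod]; push_cast; rfl
  rw [h1, h2]
  refine (Finset.prod_le_prod (fun i _ => by positivity) key).trans ?_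
  rw [Finset.prod_mul_distrib]
  apply mul_le_mul_of_nonneg_right _ (Finset.prod_nonneg fun i _ => by positivity)
  rw [Finset.prod_ite, Finset.prod_const, Finset.prod_const_one, mul_one]
  apply pow_le_pow_right₀ hK1
  calc _ ≤ (Finset.range B).card := Finset.card_le_card (by
        intro p hp; simp at hp ⊢; exact hp.2)
    _ = B := Finset.card_range B

/-- Points with separated values in a short interval. -/
theorem card_le_of_gap (S : Finset ℤ) (g D : ℝ) (hg : 0 < g) (hD : 0 ≤ D)
    (h : ∀ x ∈ S, ∀ y ∈ S, x ≤ y → g * ((y:ℝ) - x) ≤ D) : (S.card : ℝ) ≤ 1 + D / g := by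
  rcases S.eq_empty_or_nonempty with rfl | hS
  · simp; positivity
  · have hsub : S ⊆ Finset.Icc (S.min' hS) (S.max' hS) := fun x hx =>
      Finset.mem_Icc.mpr ⟨S.min'_le x hx, S.le_max' x hx⟩
    have h1 := Finset.card_le_card hsub
    rw [Int.card_Icc] at h1
    have hmm : S.min' hS ≤ S.max' hS := S.min'_le _ (S.max'_mem hS)
    have h2 := h _ (S.min'_mem hS) _ (S.max'_mem hS) hmm
    have h3 : (S.card : ℝ) ≤ (S.max' hS : ℝ) + 1 - S.min' hS := by
      have : (S.card : ℤ) ≤ S.max' hS + 1 - S.min' hS := by omega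
      exact_mod_cast this
    have : (S.max' hS : ℝ) - S.min' hS ≤ D / g := by
      rw [le_div_iff₀ hg]; linarith
    linarith

theorem card_le_of_gap_nat (S : Finset ℕ) (g D : ℝ) (hg : 0 < g) (hD : 0 ≤ D)
    (h : ∀ x ∈ S, ∀ y ∈ S, x ≤ y → g * ((y:ℝ) - x) ≤ D) : (S.card : ℝ) ≤ 1 + D / g := by
  have := card_le_of_gap (S.map Nat.castEmbedding) g D hg hD (by
    intro x hx y hy hxy
    simp only [Finset.mem_map, Nat.castEmbedding_apply] at hx hy
    obtain ⟨a, ha, rfl⟩ := hx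
    obtain ⟨b, hb, rfl⟩ := hy
    have := h a ha b hb (by exact_mod_cast hxy)
    exact_mod_cast this)
  simpa using this

theorem card_eq_sum_mul {α γ ι : Type*} [DecidableEq ι] (P : Finset α) (Q : Finset γ) (b : α → ι) (c : γ → ι)
    (I : Finset ι) (hI : ∀ p ∈ P, b p ∈ I) :
    ((P ×ˢ Q).filter (fun x => b x.1 = c x.2)).card =
      ∑ i ∈ I, (P.filter (fun p => b p = i)).card * (Q.filter (fun q => c q = i)).card := by
  rw [Finset.card_eq_sum_card_fiberwise (f := fun x => b x.1) (t := I)]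
  · apply Finset.sum_congr rfl
    intro i _
    rw [← Finset.card_product]
    congr 1
    ext ⟨p, q⟩
    simp only [Finset.mem_filter, Finset.mem_product]
    constructor
    · rintro ⟨⟨⟨h1, h2⟩, h3⟩, h4⟩
      exact ⟨⟨h1, h4⟩, h2, h3 ▸ h4⟩
    · rintro ⟨⟨h1, h4⟩, h2, h3⟩
      exact ⟨⟨⟨h1, h2⟩, h4.trans h3.symm⟩, h4⟩
  · intro x hx
    simp only [Finset.coe_filter, Finset.mem_product, Set.mem_ofPred_eq] at hx
    exact hI _ hx.1.1

theorem card_eq_sq_le {α γ ι : Type*} [DecidableEq ι] (P : Finset α) (Q : Finset γ) (b : α → ι) (c : γ → ι) :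
    (((P ×ˢ Q).filter (fun x => b x.1 = c x.2)).card : ℝ) ^ 2 ≤
      (((P ×ˢ P).filter (fun x => b x.1 = b x.2)).card : ℝ) *
      (((Q ×ˢ Q).filter (fun x => c x.1 = c x.2)).card : ℝ) := by
  set I := P.image b ∪ Q.image c
  have h1 : ∀ p ∈ P, b p ∈ I := fun p hp => Finset.mem_union_left _ (Finset.mem_image_of_mem _ hp)
  have h2 : ∀ p ∈ Q, c p ∈ I := fun p hp => Finset.mem_union_right _ (Finset.mem_image_of_mem _ hp)
  rw [card_eq_sum_mul P Q b c I h1, card_eq_sum_mul P P b b I h1, card_eq_sum_mul Q Q c c I h2]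
  push_cast
  have := Finset.sum_mul_sq_le_sq_mul_sq I (fun i => ((P.filter (fun p => b p = i)).card : ℝ))
    (fun i => ((Q.filter (fun p => c p = i)).card : ℝ))
  simpa only [sq] using this

theorem card_key_le {α ι κ : Type*} [DecidableEq ι] [DecidableEq κ] (P : Finset α) (b : α → ι) (k : α → κ) (K : ℕ)
    (hK : (P.image k).card ≤ K) :
    (((P ×ˢ P).filter (fun x => b x.1 = b x.2)).card : ℝ) ≤
      K * (((P ×ˢ P).filter (fun x => b x.1 = b x.2 ∧ k x.1 = k x.2)).card : ℝ) := by
  have e1 := card_eq_sum_mul P P b b (P.image b) (fun p hp => Finset.mem_image_of_mem _ hp)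
  have e2 := card_eq_sum_mul P P (fun p => (b p, k p)) (fun p => (b p, k p))
    (P.image b ×ˢ P.image k) (fun p hp => Finset.mem_product.mpr
      ⟨Finset.mem_image_of_mem _ hp, Finset.mem_image_of_mem _ hp⟩)
  simp only [Prod.mk.injEq] at e2
  rw [e1, e2, Finset.sum_product]
  push_cast
  rw [Finset.mul_sum]
  apply Finset.sum_le_sum
  intro i _
  have e3 : ((P.filter (fun p => b p = i)).card : ℝ) =
      ∑ j ∈ P.image k, ((P.filter (fun p => (b p, k p) = (i, j))).card : ℝ) := by
    rw [Finset.card_eq_sum_card_fiberwise (f := k) (t := P.image k)]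
    · push_cast
      apply Finset.sum_congr rfl
      intro j _
      congr 2
      ext p; simp [Finset.mem_filter, and_assoc]
    · intro p hp
      simp only [Finset.coe_filter, Set.mem_ofPred_eq] at hp
      exact Finset.mem_coe.mpr (Finset.mem_image_of_mem _ hp.1)
  rw [e3, ← sq]
  refine (sq_sum_le_card_mul_sum_sq).trans ?_
  simp only [sq, Prod.mk.injEq]
  apply mul_le_mul_of_nonneg_right (by exact_mod_cast hK)
  exact Finset.sum_nonneg fun _ _ => by positivity

theorem card_close_sq_le {α γ : Type*} (P : Finset α) (Q : Finset γ) (f : α → ℝ) (g : γ → ℝ)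
    (δ : ℝ) (hδ : 0 < δ) :
    (((P ×ˢ Q).filter (fun x => |f x.1 - g x.2| ≤ δ)).card : ℝ) ^ 2 ≤
      9 * ((((P ×ˢ P).filter (fun x => ⌊f x.1 / δ⌋ = ⌊f x.2 / δ⌋)).card : ℝ) *
      (((Q ×ˢ Q).filter (fun x => ⌊g x.1 / δ⌋ = ⌊g x.2 / δ⌋)).card : ℝ)) := by
  set E := (((P ×ˢ P).filter (fun x => ⌊f x.1 / δ⌋ = ⌊f x.2 / δ⌋)).card : ℝ) *
      (((Q ×ˢ Q).filter (fun x => ⌊g x.1 / δ⌋ = ⌊g x.2 / δ⌋)).card : ℝ) with hE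
  have hE0 : 0 ≤ E := by positivity
  have h1 : ∀ t : ℤ, (((P ×ˢ Q).filter (fun x => ⌊f x.1 / δ⌋ = ⌊g x.2 / δ⌋ + t)).card : ℝ)
      ≤ Real.sqrt E := by
    intro t
    apply Real.le_sqrt_of_sq_le
    have := card_eq_sq_le P Q (fun p => ⌊f p / δ⌋) (fun q => ⌊g q / δ⌋ + t)
    simp only [add_left_inj] at this
    rw [hE]
    convert this
  have hsub : (P ×ˢ Q).filter (fun x => |f x.1 - g x.2| ≤ δ) ⊆
      ((P ×ˢ Q).filter (fun x => ⌊f x.1 / δ⌋ = ⌊g x.2 / δ⌋ + (-1)) ∪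
      (P ×ˢ Q).filter (fun x => ⌊f x.1 / δ⌋ = ⌊g x.2 / δ⌋ + 0)) ∪
      (P ×ˢ Q).filter (fun x => ⌊f x.1 / δ⌋ = ⌊g x.2 / δ⌋ + 1) := by
    intro x hx
    simp only [Finset.mem_filter, Finset.mem_union] at hx ⊢
    obtain ⟨hx1, hx2⟩ := hx
    have hh : |f x.1 / δ - g x.2 / δ| ≤ 1 := by
      rw [← sub_div, abs_div, abs_of_pos hδ, div_le_one hδ]; exact hx2
    rw [abs_le] at hh
    have a1 := Int.floor_le (f x.1 / δ)
    have a2 := Int.lt_floor_add_one (f x.1 / δ)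
    have a3 := Int.floor_le (g x.2 / δ)
    have a4 := Int.lt_floor_add_one (g x.2 / δ)
    have b1 : ⌊f x.1 / δ⌋ < ⌊g x.2 / δ⌋ + 2 := by
      have : (⌊f x.1 / δ⌋ : ℝ) < ⌊g x.2 / δ⌋ + 2 := by linarith
      exact_mod_cast this
    have b2 : ⌊g x.2 / δ⌋ < ⌊f x.1 / δ⌋ + 2 := by
      have : (⌊g x.2 / δ⌋ : ℝ) < ⌊f x.1 / δ⌋ + 2 := by linarith
      exact_mod_cast this
    have : ⌊f x.1 / δ⌋ = ⌊g x.2 / δ⌋ + (-1) ∨ ⌊f x.1 / δ⌋ = ⌊g x.2 / δ⌋ + 0 ∨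
      ⌊f x.1 / δ⌋ = ⌊g x.2 / δ⌋ + 1 := by omega
    tauto
  have h2 := (Finset.card_le_card hsub).trans ((Finset.card_union_le _ _).trans
    (add_le_add_left (Finset.card_union_le _ _) _))
  have h3 : (((P ×ˢ Q).filter (fun x => |f x.1 - g x.2| ≤ δ)).card : ℝ) ≤ 3 * Real.sqrt E := by
    have h2' := (Nat.cast_le (α := ℝ)).mpr h2
    push_cast at h2'
    have := h1 (-1); have := h1 0; have := h1 1
    linarith
  calc _ ≤ (3 * Real.sqrt E) ^ 2 := pow_le_pow_left₀ (by positivity) h3 2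
    _ = 9 * E := by rw [mul_pow, Real.sq_sqrt hE0]; norm_num

theorem sqrt_gap {x y N : ℝ} (hx : 0 ≤ x) (hxy : x ≤ y) (hy : y ≤ 2 * N) (hN : 0 < N) :
    (y - x) ≤ 3 * Real.sqrt N * (Real.sqrt y - Real.sqrt x) := by
  have h1 : Real.sqrt y ≤ 3 / 2 * Real.sqrt N := by
    have : (3/2 * Real.sqrt N) = Real.sqrt (9/4 * N) := by
      rw [Real.sqrt_mul (by norm_num), show (9/4:ℝ) = (3/2)^2 by norm_num,
        Real.sqrt_sq (by norm_num)]
    rw [this]; exact Real.sqrt_le_sqrt (by linarith)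
  have h2 : Real.sqrt x ≤ Real.sqrt y := Real.sqrt_le_sqrt hxy
  have h3 : y - x = (Real.sqrt y - Real.sqrt x) * (Real.sqrt y + Real.sqrt x) := by
    have := Real.sq_sqrt hx; have := Real.sq_sqrt (hx.trans hxy); nlinarith
  rw [h3]
  nlinarith

/-- Window count for square roots. -/
theorem card_sqrt_window (N : ℕ) (hN : 1 ≤ N) (D δ : ℝ) (hδ : 0 < δ) :
    (((Finset.Ico N (2*N)).filter (fun n : ℕ => |Real.sqrt n - D| ≤ δ)).card : ℝ)
      ≤ 1 + 6 * δ * Real.sqrt N := by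
  have hN' : (0:ℝ) < N := by exact_mod_cast hN
  have hs : 0 < Real.sqrt N := Real.sqrt_pos.mpr hN'
  have := card_le_of_gap_nat ((Finset.Ico N (2*N)).filter (fun n : ℕ => |Real.sqrt n - D| ≤ δ))
    (1 / (3 * Real.sqrt N)) (2 * δ) (by positivity) (by positivity) (by
      intro x hx y hy hxy
      simp only [Finset.mem_filter, Finset.mem_Ico, abs_le] at hx hy
      have h2 : (y:ℝ) ≤ 2 * N := by exact_mod_cast hy.1.2.le
      have := sqrt_gap (x := x) (y := y) (by positivity) (by exact_mod_cast hxy) h2 hN'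
      rw [one_div, inv_mul_le_iff₀ (by positivity)]
      refine this.trans ?_
      apply mul_le_mul_of_nonneg_left _ (by positivity)
      linarith [hx.2.1, hy.2.2])
  refine this.trans (le_of_eq ?_)
  field_simp; ring

/-- Window count for differences of square roots. -/
theorem card_sqrt_diff_window (N : ℕ) (hN : 1 ≤ N) (l : ℕ) (hl : 1 ≤ l) (D δ : ℝ) (hδ : 0 < δ) :
    (((Finset.Ico N (2*N)).filter (fun n : ℕ => n + l < 2 * N ∧
      |Real.sqrt ((n + l : ℕ):ℝ) - Real.sqrt n - D| ≤ δ)).card : ℝ)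
      ≤ 1 + 27 * δ * Real.sqrt N ^ 3 / l := by
  have hN' : (0:ℝ) < N := by exact_mod_cast hN
  have hl' : (0:ℝ) < l := by exact_mod_cast hl
  have hs : 0 < Real.sqrt N := Real.sqrt_pos.mpr hN'
  have := card_le_of_gap_nat ((Finset.Ico N (2*N)).filter (fun n : ℕ => n + l < 2 * N ∧
      |Real.sqrt ((n + l : ℕ):ℝ) - Real.sqrt n - D| ≤ δ))
    (2 * l / (27 * Real.sqrt N ^ 3)) (2 * δ) (by positivity) (by positivity) (by
      intro x hx y hy hxy
      simp only [Finset.mem_filter, Finset.mem_Ico, abs_le] at hx hy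
      have hxy' : (x:ℝ) ≤ y := by exact_mod_cast hxy
      have h2 : (y:ℝ) ≤ 2 * N := by exact_mod_cast hy.1.2.le
      have h2l : ((y + l : ℕ):ℝ) ≤ 2 * N := by exact_mod_cast hy.2.1.le
      have h1l : ((x + l : ℕ):ℝ) ≤ 2 * N := by exact_mod_cast hx.2.1.le
      have g1 := sqrt_gap (x := x) (y := y) (by positivity) hxy' h2 hN'
      have g2 := sqrt_gap (x := ((x + l : ℕ):ℝ)) (y := ((y + l : ℕ):ℝ)) (by positivity)
        (by exact_mod_cast (by omega)) h2l hN'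
      have up : ∀ z : ℝ, z ≤ 2 * N → Real.sqrt z ≤ 3/2 * Real.sqrt N := by
        intro z hz
        have : (3/2 * Real.sqrt N) = Real.sqrt (9/4 * N) := by
          rw [Real.sqrt_mul (by norm_num), show (9/4:ℝ) = (3/2)^2 by norm_num,
            Real.sqrt_sq (by norm_num)]
        rw [this]; exact Real.sqrt_le_sqrt (by linarith)
      set a := Real.sqrt x with ha
      set b := Real.sqrt y with hb
      set c := Real.sqrt ((x + l : ℕ):ℝ) with hc
      set d := Real.sqrt ((y + l : ℕ):ℝ) with hd
      have u1 := up _ (hxy'.trans h2)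
      have u2 := up _ h2
      have u3 := up _ h1l
      have u4 := up _ h2l
      rw [← ha] at u1; rw [← hb] at u2; rw [← hc] at u3; rw [← hd] at u4
      have a0 : 0 < a := Real.sqrt_pos.mpr (by
        have : 1 ≤ x := by omega
        exact_mod_cast this)
      have hab : a ≤ b := Real.sqrt_le_sqrt hxy'
      have hac : a ≤ c := Real.sqrt_le_sqrt (by push_cast; linarith)
      have hbd : b ≤ d := Real.sqrt_le_sqrt (by push_cast; linarith)
      have hcd : c ≤ d := Real.sqrt_le_sqrt (by push_cast; linarith)
      have e1 : (c - a) * (c + a) = l := by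
        have h1 : c ^ 2 = ((x + l : ℕ):ℝ) := Real.sq_sqrt (by positivity)
        have h2 : a ^ 2 = x := Real.sq_sqrt (by positivity)
        push_cast at h1; nlinarith
      have e2 : (d - b) * (d + b) = l := by
        have h1 : d ^ 2 = ((y + l : ℕ):ℝ) := Real.sq_sqrt (by positivity)
        have h2 : b ^ 2 = y := Real.sq_sqrt (by positivity)
        push_cast at h1; nlinarith
      have e3 : ((c - a) - (d - b)) * ((c + a) * (d + b)) = l * ((d - c) + (b - a)) := by
        have : ((c - a) - (d - b)) * ((c + a) * (d + b)) =
          ((c - a) * (c + a)) * (d + b) - ((d - b) * (d + b)) * (c + a) := by ring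
        rw [this, e1, e2]; ring
      set s := Real.sqrt N
      have hp : 0 < (c + a) * (d + b) := mul_pos (by linarith) (by linarith)
      have e4 : (c + a) * (d + b) ≤ 9 * s ^ 2 := by
        calc (c + a) * (d + b) ≤ (3 * s) * (3 * s) :=
              mul_le_mul (by linarith) (by linarith) (by linarith) (by linarith)
          _ = 9 * s ^ 2 := by ring
      have hge : 0 ≤ (c - a) - (d - b) := by
        have : 0 ≤ ((c - a) - (d - b)) * ((c + a) * (d + b)) := by
          rw [e3]; apply mul_nonneg hl'.le; linarith
        exact nonneg_of_mul_nonneg_left this hp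
      have e5 : 2 * (l * ((y:ℝ) - x)) ≤ 3 * s * (l * ((d - c) + (b - a))) := by
        push_cast at g2
        have h1 := mul_le_mul_of_nonneg_left g1 hl'.le
        have h2 := mul_le_mul_of_nonneg_left g2 hl'.le
        linarith
      have e6 : ((c - a) - (d - b)) ≤ 2 * δ := by linarith [hx.2.2.2, hy.2.2.1]
      have e7 : l * ((d - c) + (b - a)) ≤ (2 * δ) * (9 * s ^ 2) := by
        rw [← e3]; exact mul_le_mul e6 e4 hp.le (by linarith)
      rw [div_mul_eq_mul_div, div_le_iff₀ (by positivity)]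
      have h1 := mul_le_mul_of_nonneg_left e7 (show 0 ≤ 3 * s by linarith)
      linarith)
  refine this.trans (le_of_eq ?_)
  field_simp

theorem card_le_sum_fiber {α β : Type*} [DecidableEq β] (S : Finset α) (f : α → β) (t : Finset β)
    (hf : ∀ x ∈ S, f x ∈ t) (B : β → ℝ)
    (h : ∀ b ∈ t, ((S.filter (fun x => f x = b)).card : ℝ) ≤ B b) :
    (S.card : ℝ) ≤ ∑ b ∈ t, B b := by
  rw [Finset.card_eq_sum_card_fiberwise (f := f) (t := t) hf]
  push_cast
  apply Finset.sum_le_sum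
  intro b hb
  convert h b hb

theorem card_le_of_inj {α β : Type*} (S : Finset α) (t : Finset β) (f : α → β)
    (hf : ∀ x ∈ S, f x ∈ t) (hi : ∀ x ∈ S, ∀ y ∈ S, f x = f y → x = y) :
    (S.card : ℝ) ≤ t.card := by
  exact_mod_cast Finset.card_le_card_of_injOn f hf (fun x hx y hy h => hi x hx y hy h)

theorem sum_inv_le_log (K N : ℕ) (hK : K ≤ N) :
    ∑ l ∈ Finset.Icc 1 K, (1:ℝ) / l ≤ 1 + Real.log N := by
  have h1 : ∑ l ∈ Finset.Icc 1 K, (1:ℝ) / l ≤ ∑ l ∈ Finset.Icc 1 N, (1:ℝ) / l :=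
    Finset.sum_le_sum_of_subset_of_nonneg (Finset.Icc_subset_Icc_right hK)
      (fun _ _ _ => by positivity)
  have h2 := harmonic_le_one_add_log N
  rw [harmonic_eq_sum_Icc] at h2
  push_cast at h2
  simp only [one_div] at h1 ⊢
  exact h1.trans h2

/-- the set of near-coincidences with close coordinates. -/
def nearSet (N1 N3 L : ℕ) (ε : ℤ) (δ : ℝ) : Finset ((ℕ × ℕ) × (ℕ × ℕ)) :=
  ((Finset.Ico N1 (2*N1) ×ˢ Finset.Ico N3 (2*N3)) ×ˢ
    (Finset.Ico N1 (2*N1) ×ˢ Finset.Ico N3 (2*N3))).filter (fun x =>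
      x.2.2 < x.1.2 ∧ x.1.2 * L < x.2.2 * L + N3 ∧ x.1.1 * L < x.2.1 * L + N1 ∧
      x.2.1 * L < x.1.1 * L + N1 ∧
      |(Real.sqrt x.1.2 - Real.sqrt x.2.2) + ε * (Real.sqrt x.1.1 - Real.sqrt x.2.1)| ≤ δ)

theorem card_MM (N1 L : ℕ) (h1 : 1 ≤ L) (h2 : L ≤ N1) :
    (((Finset.Ico N1 (2*N1) ×ˢ Finset.Ico N1 (2*N1)).filter (fun x : ℕ × ℕ =>
      x.1 * L < x.2 * L + N1 ∧ x.2 * L < x.1 * L + N1)).card : ℝ) ≤ 3 * (N1:ℝ) ^ 2 / L := by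
  have hL : (0:ℝ) < L := by exact_mod_cast h1
  have hLN : (L:ℝ) ≤ N1 := by exact_mod_cast h2
  refine (card_le_sum_fiber _ (fun x => x.1) (Finset.Ico N1 (2*N1)) ?_ (fun _ => 3 * (N1:ℝ) / L)
    ?_).trans ?_
  · intro x hx; simp only [Finset.mem_filter, Finset.mem_product] at hx; exact hx.1.1
  · intro m _
    have e1 := card_le_of_inj (((Finset.Ico N1 (2*N1) ×ˢ Finset.Ico N1 (2*N1)).filter
      (fun x : ℕ × ℕ => x.1 * L < x.2 * L + N1 ∧ x.2 * L < x.1 * L + N1)).filter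
        (fun x => x.1 = m)) ((Finset.Ico N1 (2*N1)).filter (fun y =>
          m * L < y * L + N1 ∧ y * L < m * L + N1)) (fun x => x.2) (by
        intro x hx
        simp only [Finset.mem_filter, Finset.mem_product] at hx ⊢
        obtain ⟨⟨⟨_, h⟩, h3⟩, h4⟩ := hx
        rw [← h4]; exact ⟨h, h3⟩) (by
        intro x hx y hy hxy
        simp only [Finset.mem_filter] at hx hy
        exact Prod.ext (hx.2.trans hy.2.symm) hxy)
    refine e1.trans ?_
    refine (card_le_of_gap_nat _ (L:ℝ) (2 * N1) hL (by positivity) ?_).trans ?_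
    · intro x hx y hy _
      simp only [Finset.mem_filter] at hx hy
      have a : (m:ℝ) * L ≤ x * L + N1 := by exact_mod_cast hx.2.1.le
      have b : (y:ℝ) * L ≤ m * L + N1 := by exact_mod_cast hy.2.2.le
      linarith
    · rw [← sub_nonneg]
      have : 3 * (N1:ℝ) / L - (1 + 2 * N1 / L) = (N1 - L) / L := by field_simp; ring
      rw [this]; apply div_nonneg <;> linarith
  · rw [Finset.sum_const, Nat.card_Ico, nsmul_eq_mul]
    have : 2 * N1 - N1 = N1 := by omega
    rw [this]; apply le_of_eq; ring

theorem card_nearSet (N1 N3 L : ℕ) (ε : ℤ) (δ : ℝ) (hδ : 0 < δ) (hL : 1 ≤ L) (hL1 : L ≤ N1)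
    (h13 : N1 ≤ N3) :
    ((nearSet N1 N3 L ε δ).card : ℝ) ≤ (3 * (N1:ℝ) ^ 2 / L) *
      ((N3:ℝ) / L + 27 * δ * Real.sqrt N3 ^ 3 * (1 + Real.log N3)) := by
  have hL0 : (0:ℝ) < L := by exact_mod_cast hL
  set MM := (Finset.Ico N1 (2*N1) ×ˢ Finset.Ico N1 (2*N1)).filter (fun x : ℕ × ℕ =>
      x.1 * L < x.2 * L + N1 ∧ x.2 * L < x.1 * L + N1) with hMM
  have hN3 : 1 ≤ N3 := by omega
  refine (card_le_sum_fiber _ (fun x => ((x.1.1, x.2.1), x.1.2 - x.2.2))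
    (MM ×ˢ Finset.Icc 1 (N3 / L)) ?_ (fun b => 1 + 27 * δ * Real.sqrt N3 ^ 3 / (b.2:ℕ)) ?_).trans ?_
  · intro x hx
    simp only [nearSet, Finset.mem_filter, Finset.mem_product, hMM, Finset.mem_Icc] at hx ⊢
    obtain ⟨⟨⟨h1, h2⟩, h3, h4⟩, h5, h6, h7, h8, _⟩ := hx
    refine ⟨⟨⟨h1, h3⟩, h7, h8⟩, by omega, ?_⟩
    rw [Nat.le_div_iff_mul_le (by omega), Nat.sub_mul]
    omega
  · rintro ⟨⟨m, m'⟩, l⟩ hb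
    simp only [Finset.mem_product, Finset.mem_Icc] at hb
    have := card_sqrt_diff_window N3 hN3 l hb.2.1
      (-(ε * (Real.sqrt m - Real.sqrt m'))) δ hδ
    refine le_trans ?_ this
    apply card_le_of_inj _ _ (fun x => x.2.2)
    · intro x hx
      simp only [nearSet, Finset.mem_filter, Finset.mem_product, Prod.mk.injEq,
        Finset.mem_Ico] at hx ⊢
      obtain ⟨⟨⟨⟨h1, h2⟩, h3, h4⟩, h5, h6, h7, h8, h9⟩, ⟨h10, h11⟩, h12⟩ := hx
      have : x.2.2 + l = x.1.2 := by omega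
      rw [this]
      refine ⟨h4, h2.2, ?_⟩
      rw [h10, h11] at h9
      convert h9 using 2
      ring
    · intro x hx y hy hxy
      simp only [nearSet, Finset.mem_filter, Finset.mem_product, Prod.mk.injEq,
        Finset.mem_Ico] at hx hy
      have a1 := hx.2; have a2 := hy.2
      have a3 := hx.1.2.1; have a4 := hy.1.2.1
      have : x.1.2 = y.1.2 := by omega
      exact Prod.ext (Prod.ext (by rw [a1.1.1, a2.1.1]) this)
        (Prod.ext (by rw [a1.1.2, a2.1.2]) hxy)
  · rw [Finset.sum_product]
    simp only
    rw [Finset.sum_const, nsmul_eq_mul]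
    apply mul_le_mul (card_MM N1 L hL hL1) _ _ (by positivity)
    · rw [Finset.sum_add_distrib]
      apply add_le_add
      · simp only [Finset.sum_const, Nat.card_Icc, nsmul_eq_mul, mul_one]
        rw [Nat.add_sub_cancel]; exact Nat.cast_div_le
      · have : ∀ l ∈ Finset.Icc 1 (N3 / L), 27 * δ * Real.sqrt N3 ^ 3 / (l:ℕ)
            = 27 * δ * Real.sqrt N3 ^ 3 * ((1:ℝ) / l) := fun l _ => by ring
        rw [Finset.sum_congr rfl this, ← Finset.mul_sum]
        apply mul_le_mul_of_nonneg_left _ (by positivity)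
        exact sum_inv_le_log _ _ (Nat.div_le_self _ _)
    · exact Finset.sum_nonneg fun _ _ => by positivity

theorem sqrt_gap_one {N x y : ℕ} (hxy : x < y) (hy : y ≤ 2 * N) (hN : 1 ≤ N) {δ : ℝ}
    (hδ : δ * Real.sqrt N < 1/4) : δ < Real.sqrt y - Real.sqrt x := by
  have hN' : (0:ℝ) < N := by exact_mod_cast hN
  have hs : 0 < Real.sqrt N := Real.sqrt_pos.mpr hN'
  have h1 : (x:ℝ) + 1 ≤ y := by exact_mod_cast hxy
  have := sqrt_gap (x := x) (y := y) (N := N) (by positivity) (by linarith) (by exact_mod_cast hy) hN'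
  by_contra hcon
  push Not at hcon
  nlinarith

theorem energy_bound {ι : Type*} [DecidableEq ι] (N1 N3 : ℕ) (h1 : 1 ≤ N1) (h13 : N1 ≤ N3) (ε : ℤ)
    (hε : ε = 1 ∨ ε = -1) (δ : ℝ) (hδ : 0 < δ) (b : ℕ × ℕ → ι)
    (hb : ∀ p ∈ Finset.Ico N1 (2*N1) ×ˢ Finset.Ico N3 (2*N3),
      ∀ p' ∈ Finset.Ico N1 (2*N1) ×ˢ Finset.Ico N3 (2*N3), b p = b p' →
      |(Real.sqrt p.2 - Real.sqrt p'.2) + ε * (Real.sqrt p.1 - Real.sqrt p'.1)| ≤ δ) :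
    ((((Finset.Ico N1 (2*N1) ×ˢ Finset.Ico N3 (2*N3)) ×ˢ
      (Finset.Ico N1 (2*N1) ×ˢ Finset.Ico N3 (2*N3))).filter (fun x => b x.1 = b x.2)).card : ℝ)
    ≤ 400 * (1 + Real.log N3) * (Real.sqrt N1 ^ 3 * N3 + δ * Real.sqrt N3 ^ 3 * (N1:ℝ) ^ 2) := by
  set B := Finset.Ico N1 (2*N1) ×ˢ Finset.Ico N3 (2*N3) with hB
  have hN1 : (1:ℝ) ≤ N1 := by exact_mod_cast h1
  have hN3 : (1:ℝ) ≤ N3 := by exact_mod_cast h1.trans h13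
  have hlog : 0 ≤ Real.log N3 := Real.log_nonneg hN3
  set s1 := Real.sqrt N1 with hs1
  set s3 := Real.sqrt N3 with hs3
  have hs1p : 1 ≤ s1 := Real.one_le_sqrt.mpr hN1
  have hs3p : 1 ≤ s3 := Real.one_le_sqrt.mpr hN3
  have hs1q : s1 ^ 2 = N1 := Real.sq_sqrt (by linarith)
  have hs3q : s3 ^ 2 = N3 := Real.sq_sqrt (by linarith)
  have hcardB : (B.card : ℝ) = N1 * N3 := by
    rw [hB, Finset.card_product, Nat.card_Ico, Nat.card_Ico]
    have a : 2 * N1 - N1 = N1 := by omega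
    have c : 2 * N3 - N3 = N3 := by omega
    rw [a, c]; push_cast; rfl
  rcases le_or_gt (1/4) (δ * s3) with hc | hc
  · -- trivial case
    have key : (((B ×ˢ B).filter (fun x => b x.1 = b x.2)).card : ℝ) ≤
        ∑ _y ∈ (Finset.Ico N1 (2*N1)) ×ˢ B, (1 + 6 * δ * s3) := by
      apply card_le_sum_fiber _ (fun x => (x.1.1, x.2))
      · intro x hx
        simp only [Finset.mem_filter, Finset.mem_product] at hx ⊢
        have := hx.1.1; rw [hB, Finset.mem_product] at this
        exact ⟨this.1, hx.1.2⟩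
      · rintro ⟨m, p'⟩ _
        refine le_trans ?_ (card_sqrt_window N3 (h1.trans h13)
          (Real.sqrt p'.2 - ε * (Real.sqrt m - Real.sqrt p'.1)) δ hδ)
        apply card_le_of_inj _ _ (fun x => x.1.2)
        · intro x hx
          simp only [Finset.mem_filter, Finset.mem_product, Prod.mk.injEq] at hx ⊢
          obtain ⟨⟨⟨hx1, hx2⟩, hx3⟩, hx4, hx5⟩ := hx
          have := hb _ hx1 _ hx2 hx3
          rw [hB, Finset.mem_product] at hx1
          refine ⟨hx1.2, ?_⟩
          rw [hx4, hx5] at this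
          convert this using 2; ring
        · intro x hx y hy hxy
          simp only [Finset.mem_filter, Prod.mk.injEq] at hx hy
          exact Prod.ext (Prod.ext (hx.2.1.trans hy.2.1.symm) hxy) (hx.2.2.trans hy.2.2.symm)
    refine key.trans ?_
    rw [Finset.sum_const, nsmul_eq_mul, Finset.card_product, Nat.card_Ico]
    have a : 2 * N1 - N1 = N1 := by omega
    rw [a]; push_cast; rw [hcardB]
    have h5 : 1 + 6 * δ * s3 ≤ 10 * (δ * s3) := by linarith
    have h6 : (N1:ℝ) * (N1 * N3) * (1 + 6 * δ * s3) ≤ (N1:ℝ) * (N1 * N3) * (10 * (δ * s3)) :=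
      mul_le_mul_of_nonneg_left h5 (by positivity)
    have h7 : (N1:ℝ) * (N1 * N3) * (10 * (δ * s3)) = 10 * (δ * s3 ^ 3 * (N1:ℝ) ^ 2) := by
      rw [← hs3q]; ring
    have h8 : 0 ≤ s1 ^ 3 * (N3:ℝ) := by positivity
    have h9 : 0 ≤ δ * s3 ^ 3 * (N1:ℝ) ^ 2 := by positivity
    calc _ ≤ 10 * (δ * s3 ^ 3 * (N1:ℝ) ^ 2) := h6.trans h7.le
      _ ≤ 400 * (1 + 0) * (s1 ^ 3 * N3 + δ * s3 ^ 3 * (N1:ℝ) ^ 2) := by linarith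
      _ ≤ _ := by gcongr
  · set L := Nat.sqrt N1 with hLdef
    have hL : 1 ≤ L := Nat.le_sqrt.mpr (by omega)
    have hLL : L * L ≤ N1 := Nat.sqrt_le N1
    have hLN : L ≤ N1 := Nat.sqrt_le_self N1
    have hL2 : N1 < (L+1) * (L+1) := Nat.lt_succ_sqrt N1
    have hLr : (1:ℝ) ≤ L := by exact_mod_cast hL
    have hLs : (L:ℝ) ≤ s1 := Real.le_sqrt_of_sq_le (by rw [sq]; exact_mod_cast hLL)
    have hsL : s1 ≤ 2 * L := by
      rw [hs1, Real.sqrt_le_left (by positivity)]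
      have : (N1:ℝ) < (L+1) * (L+1) := by exact_mod_cast hL2
      nlinarith
    set k : ℕ × ℕ → ℤ := fun p => ((p.2 * L / N3 : ℕ) : ℤ) - ε * ((p.1 * L / N1 : ℕ) : ℤ) with hk
    have hbox : ∀ N n : ℕ, 1 ≤ N → n ∈ Finset.Ico N (2*N) → L ≤ n * L / N ∧ n * L / N < 2 * L := by
      intro N n hN hn
      rw [Finset.mem_Ico] at hn
      constructor
      · rw [Nat.le_div_iff_mul_le (by omega)]; nlinarith
      · rw [Nat.div_lt_iff_lt_mul (by omega)]; nlinarith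
    have himg : (B.image k).card ≤ 2 * L := by
      rcases hε with he | he
      · have : B.image k ⊆ Finset.Ico (-(L:ℤ)) L := by
          intro z hz
          rw [Finset.mem_image] at hz
          obtain ⟨p, hp, rfl⟩ := hz
          rw [hB, Finset.mem_product] at hp
          have a1 := hbox N1 _ h1 hp.1
          have a2 := hbox N3 _ (h1.trans h13) hp.2
          simp only [hk, he, Finset.mem_Ico]
          omega
        refine (Finset.card_le_card this).trans ?_
        rw [Int.card_Ico]; omega
      · have : B.image k ⊆ Finset.Ico (2*(L:ℤ)) (4 * L) := by
          intro z hz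
          rw [Finset.mem_image] at hz
          obtain ⟨p, hp, rfl⟩ := hz
          rw [hB, Finset.mem_product] at hp
          have a1 := hbox N1 _ h1 hp.1
          have a2 := hbox N3 _ (h1.trans h13) hp.2
          simp only [hk, he, Finset.mem_Ico]
          omega
        refine (Finset.card_le_card this).trans ?_
        rw [Int.card_Ico]; omega
    have hdiv : ∀ N n n' : ℕ, 1 ≤ N → n * L / N = n' * L / N → n * L < n' * L + N := by
      intro N n n' hN h
      have e1 := Nat.div_add_mod (n * L) N
      have e2 := Nat.div_add_mod (n' * L) N
      have e3 := Nat.mod_lt (n * L) (show 0 < N by omega)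
      rw [h] at e1
      omega
    have hc1 : δ * s1 < 1/4 := by
      have : s1 ≤ s3 := Real.sqrt_le_sqrt (by exact_mod_cast h13)
      nlinarith
    -- structure of pairs
    have hstruct : ∀ p ∈ B, ∀ p' ∈ B, b p = b p' → k p = k p' → p'.2 < p.2 →
        (p.2 * L / N3 = p'.2 * L / N3 ∧ p.1 * L / N1 = p'.1 * L / N1) := by
      intro p hp p' hp' hbp hkp hlt
      have hcl := hb p hp p' hp' hbp
      rw [hB, Finset.mem_product, Finset.mem_Ico, Finset.mem_Ico] at hp hp'
      have g1 := sqrt_gap_one hlt hp.2.2.le (h1.trans h13) hc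
      have mono3 : p'.2 * L / N3 ≤ p.2 * L / N3 :=
        Nat.div_le_div_right (Nat.mul_le_mul_right _ hlt.le)
      rw [abs_le] at hcl
      simp only [hk] at hkp
      rcases hε with he | he
      · subst he
        simp only [Int.cast_one, one_mul] at hcl hkp
        have : p.1 < p'.1 := by
          by_contra hcon
          have : Real.sqrt p'.1 ≤ Real.sqrt p.1 :=
            Real.sqrt_le_sqrt (by exact_mod_cast not_lt.mp hcon)
          linarith [hcl.2]
        have mono1 : p.1 * L / N1 ≤ p'.1 * L / N1 :=
          Nat.div_le_div_right (Nat.mul_le_mul_right _ this.le)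
        omega
      · subst he
        push_cast at hcl
        simp only [neg_mul, one_mul] at hcl hkp
        have : p'.1 < p.1 := by
          by_contra hcon
          have : Real.sqrt p.1 ≤ Real.sqrt p'.1 :=
            Real.sqrt_le_sqrt (by exact_mod_cast not_lt.mp hcon)
          linarith [hcl.2]
        have mono1 : p'.1 * L / N1 ≤ p.1 * L / N1 :=
          Nat.div_le_div_right (Nat.mul_le_mul_right _ this.le)
        omega
    have hnear : ∀ p ∈ B, ∀ p' ∈ B, b p = b p' → k p = k p' → p'.2 < p.2 →
        (p, p') ∈ nearSet N1 N3 L ε δ := by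
      intro p hp p' hp' hbp hkp hlt
      obtain ⟨a1, a2⟩ := hstruct p hp p' hp' hbp hkp hlt
      simp only [nearSet, Finset.mem_filter]
      exact ⟨Finset.mem_product.mpr ⟨hp, hp'⟩, hlt, hdiv _ _ _ (h1.trans h13) a1,
        hdiv _ _ _ h1 a2, hdiv _ _ _ h1 a2.symm, hb p hp p' hp' hbp⟩
    have hsub : (B ×ˢ B).filter (fun x => b x.1 = b x.2 ∧ k x.1 = k x.2) ⊆
        (B.image (fun p => (p, p)) ∪ nearSet N1 N3 L ε δ) ∪
          (nearSet N1 N3 L ε δ).image Prod.swap := by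
      rintro ⟨p, p'⟩ hx
      simp only [Finset.mem_filter, Finset.mem_product] at hx
      obtain ⟨⟨hp, hp'⟩, hbp, hkp⟩ := hx
      rcases lt_trichotomy p.2 p'.2 with h | h | h
      · apply Finset.mem_union_right
        rw [Finset.mem_image]
        exact ⟨(p', p), hnear p' hp' p hp hbp.symm hkp.symm h, rfl⟩
      · apply Finset.mem_union_left; apply Finset.mem_union_left
        rw [Finset.mem_image]
        have hcl := hb p hp p' hp' hbp
        refine ⟨p, hp, ?_⟩
        have : p.1 = p'.1 := by
          rw [h, sub_self, zero_add] at hcl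
          have hcl2 : |Real.sqrt p.1 - Real.sqrt p'.1| ≤ δ := by
            rw [abs_mul] at hcl
            have : |(ε:ℝ)| = 1 := by rcases hε with he | he <;> simp [he]
            rwa [this, one_mul] at hcl
          rw [hB, Finset.mem_product, Finset.mem_Ico, Finset.mem_Ico] at hp hp'
          rw [abs_le] at hcl2
          by_contra hne
          rcases lt_or_gt_of_ne hne with hlt | hlt
          · have := sqrt_gap_one hlt hp'.1.2.le h1 hc1; linarith [hcl2.1]
          · have := sqrt_gap_one hlt hp.1.2.le h1 hc1; linarith [hcl2.2]
        rw [Prod.ext this h]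
      · apply Finset.mem_union_left; apply Finset.mem_union_right
        exact hnear p hp p' hp' hbp hkp h
    have hcard2 : (((B ×ˢ B).filter (fun x => b x.1 = b x.2 ∧ k x.1 = k x.2)).card : ℝ) ≤
        N1 * N3 + 2 * (nearSet N1 N3 L ε δ).card := by
      have q1 := Finset.card_le_card hsub
      have q2 := Finset.card_union_le (B.image (fun p => (p, p)) ∪ nearSet N1 N3 L ε δ)
        ((nearSet N1 N3 L ε δ).image Prod.swap)
      have q3 := Finset.card_union_le (B.image (fun p => (p, p))) (nearSet N1 N3 L ε δ)
      have q4 : (B.image (fun p => (p, p))).card ≤ B.card := Finset.card_image_le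
      have q5 : ((nearSet N1 N3 L ε δ).image Prod.swap).card ≤ (nearSet N1 N3 L ε δ).card :=
        Finset.card_image_le
      have q6 : ((B ×ˢ B).filter (fun x => b x.1 = b x.2 ∧ k x.1 = k x.2)).card ≤
        B.card + 2 * (nearSet N1 N3 L ε δ).card := by omega
      rw [← hcardB]
      exact_mod_cast q6
    have hK := card_key_le B b k (2 * L) himg
    have hn := card_nearSet N1 N3 L ε δ hδ hL hLN h13
    have hL0 : (0:ℝ) < L := by linarith
    have hfin : (2 * (L:ℝ)) * (N1 * N3 + 2 * ((3 * (N1:ℝ) ^ 2 / L) *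
      ((N3:ℝ) / L + 27 * δ * s3 ^ 3 * (1 + Real.log N3)))) ≤
      400 * (1 + Real.log N3) * (s1 ^ 3 * N3 + δ * s3 ^ 3 * (N1:ℝ) ^ 2) := by
      have e1 : (2 * (L:ℝ)) * (N1 * N3 + 2 * ((3 * (N1:ℝ) ^ 2 / L) *
        ((N3:ℝ) / L + 27 * δ * s3 ^ 3 * (1 + Real.log N3)))) =
        2 * L * N1 * N3 + 12 * ((N1:ℝ) ^ 2 / L) * N3
          + 324 * (1 + Real.log N3) * (δ * s3 ^ 3 * (N1:ℝ) ^ 2) := by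
        field_simp; ring
      have e2 : (L:ℝ) * N1 ≤ s1 ^ 3 := by rw [← hs1q]; nlinarith
      have e3 : (N1:ℝ) ^ 2 / L ≤ 2 * s1 ^ 3 := by
        rw [div_le_iff₀ hL0, ← hs1q]
        have : 0 ≤ s1 ^ 3 := by positivity
        nlinarith
      have e4 : 2 * L * N1 * N3 + 12 * ((N1:ℝ) ^ 2 / L) * N3 ≤ 26 * (s1 ^ 3 * N3) := by
        have := mul_le_mul_of_nonneg_right e2 (show (0:ℝ) ≤ N3 by linarith)
        have := mul_le_mul_of_nonneg_right e3 (show (0:ℝ) ≤ N3 by linarith)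
        linarith
      rw [e1]
      have h8 : 0 ≤ s1 ^ 3 * (N3:ℝ) := by positivity
      have h9 : 0 ≤ δ * s3 ^ 3 * (N1:ℝ) ^ 2 := by positivity
      have h10 : 0 ≤ Real.log N3 * (s1 ^ 3 * (N3:ℝ)) := by positivity
      have h11 : 0 ≤ Real.log N3 * (δ * s3 ^ 3 * (N1:ℝ) ^ 2) := by positivity
      linarith
    refine le_trans ?_ hfin
    convert hK.trans (mul_le_mul_of_nonneg_left (hcard2.trans
      (add_le_add_right (mul_le_mul_of_nonneg_left hn (by norm_num)) _)) (by positivity)) using 2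
    push_cast; ring

theorem card_le_of_cong (S : Finset ℕ) (q U : ℕ) (hq : 1 ≤ q) (hU : ∀ x ∈ S, x ≤ U)
    (h : ∀ x ∈ S, ∀ y ∈ S, x ≤ y → q ∣ 2 * (y - x)) : (S.card : ℝ) ≤ 1 + 2 * U / q := by
  have hq0 : (0:ℝ) < q := by exact_mod_cast hq
  rcases S.eq_empty_or_nonempty with rfl | hS
  · simp; positivity
  · set x1 := S.min' hS
    have hmin : ∀ x ∈ S, x1 ≤ x := fun x hx => S.min'_le x hx
    have hm : x1 ∈ S := S.min'_mem hS
    have h1 := card_le_of_inj S (Finset.range (2 * U / q + 1)) (fun x => 2 * (x - x1) / q) (by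
      intro x hx
      rw [Finset.mem_range, Nat.lt_succ_iff]
      exact Nat.div_le_div_right (by have := hU x hx; omega)) (by
      intro x hx y hy hxy
      have a := Nat.div_mul_cancel (h x1 hm x hx (hmin x hx))
      have b := Nat.div_mul_cancel (h x1 hm y hy (hmin y hy))
      rw [hxy] at a
      have := hmin x hx; have := hmin y hy
      omega)
    rw [Finset.card_range] at h1
    refine h1.trans ?_
    push_cast
    have : ((2 * U / q : ℕ) : ℝ) ≤ ((2 * U : ℕ):ℝ) / q := Nat.cast_div_le
    push_cast at this
    linarith

theorem dvd_two_mul_of_roots (A x0 z x : ℤ) (d f : ℤ) (hA : A = d * f) (hc : IsCoprime x0 A)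
    (h1 : d ∣ x - x0) (h2 : f ∣ x + x0) (hz1 : d ∣ z) (hz2 : f ∣ z) : A ∣ 2 * z := by
  have hg2 : (Int.gcd d f : ℤ) ∣ 2 := by
    have a1 : (Int.gcd d f : ℤ) ∣ 2 * x0 := by
      have : 2 * x0 = (x + x0) - (x - x0) := by ring
      rw [this]
      exact dvd_sub ((Int.gcd_dvd_right ..).trans h2) ((Int.gcd_dvd_left ..).trans h1)
    have a2 : (Int.gcd d f : ℤ) ∣ A := by rw [hA]; exact (Int.gcd_dvd_left ..).mul_right _
    have : IsCoprime (Int.gcd d f : ℤ) x0 := (hc.symm.of_isCoprime_of_dvd_left a2)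
    exact this.dvd_of_dvd_mul_right a1
  obtain ⟨t, ht⟩ := hg2
  have hb := Int.gcd_eq_gcd_ab d f
  obtain ⟨p, hp⟩ := hz1
  obtain ⟨q, hq⟩ := hz2
  refine ⟨t * (Int.gcdA d f * q + Int.gcdB d f * p), ?_⟩
  have e : (Int.gcd d f : ℤ) * z = A * (Int.gcdA d f * q + Int.gcdB d f * p) := by
    rw [hb, hA]
    calc (d * Int.gcdA d f + f * Int.gcdB d f) * z = d * Int.gcdA d f * z + f * Int.gcdB d f * z := by ring
      _ = d * Int.gcdA d f * (f * q) + f * Int.gcdB d f * (d * p) := by rw [← hq, ← hp]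
      _ = _ := by ring
  calc 2 * z = t * ((Int.gcd d f : ℤ) * z) := by rw [ht]; ring
    _ = _ := by rw [e]; ring

theorem root_count (a : ℕ) (ha : 1 ≤ a) (p : ℤ) (U : ℕ) :
    (((Finset.Icc 1 U).filter (fun u : ℕ => Nat.Coprime u a ∧ ((a:ℤ) ^ 2) ∣ (u:ℤ) ^ 2 - p)).card : ℝ)
      ≤ (Nat.divisors (a ^ 2)).card * (1 + 2 * U / (a:ℝ) ^ 2) := by
  set S := (Finset.Icc 1 U).filter (fun u : ℕ => Nat.Coprime u a ∧ ((a:ℤ) ^ 2) ∣ (u:ℤ) ^ 2 - p)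
    with hS
  rcases S.eq_empty_or_nonempty with h | ⟨x0, hx0⟩
  · rw [h]; simp; positivity
  have ha2 : 1 ≤ a ^ 2 := Nat.one_le_pow _ _ ha
  have key := card_le_sum_fiber S (fun x => Nat.gcd (a ^ 2) (Int.natAbs ((x:ℤ) - x0)))
    (Nat.divisors (a ^ 2)) (fun x _ => by
      rw [Nat.mem_divisors]; exact ⟨Nat.gcd_dvd_left _ _, by omega⟩)
    (fun _ => 1 + 2 * U / (a:ℝ) ^ 2) (by
      intro d hd
      have := card_le_of_cong (S.filter (fun x => Nat.gcd (a ^ 2) (Int.natAbs ((x:ℤ) - x0)) = d))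
        (a ^ 2) U ha2 (by
          intro x hx
          simp only [hS, Finset.mem_filter, Finset.mem_Icc] at hx; exact hx.1.1.2) (by
          intro x hx y hy hxy
          simp only [hS, Finset.mem_filter, Finset.mem_Icc] at hx hy hx0
          obtain ⟨⟨_, hxc, hxd⟩, hxg⟩ := hx
          obtain ⟨⟨_, hyc, hyd⟩, hyg⟩ := hy
          obtain ⟨_, h0c, h0d⟩ := hx0
          rw [Nat.mem_divisors] at hd
          obtain ⟨f, hf⟩ := hd.1
          have hd0 : d ≠ 0 := by rintro rfl; simp at hf; omega
          have hdx : (d:ℤ) ∣ (x:ℤ) - x0 := by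
            rw [← hxg]; exact Int.natCast_dvd.mpr (Nat.gcd_dvd_right _ _)
          have hdy : (d:ℤ) ∣ (y:ℤ) - x0 := by
            rw [← hyg]; exact Int.natCast_dvd.mpr (Nat.gcd_dvd_right _ _)
          have hA : ((a:ℤ) ^ 2) = d * f := by exact_mod_cast hf
          have hfx : ∀ w : ℕ, ((a:ℤ) ^ 2) ∣ (w:ℤ) ^ 2 - p →
              Nat.gcd (a ^ 2) (Int.natAbs ((w:ℤ) - x0)) = d → (f:ℤ) ∣ (w:ℤ) + x0 := by
            intro w hw hg
            have h1 : ((a:ℤ) ^ 2) ∣ ((w:ℤ) - x0) * (w + x0) := by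
              have : ((w:ℤ) - x0) * (w + x0) = (w ^ 2 - p) - ((x0:ℤ) ^ 2 - p) := by ring
              rw [this]; exact dvd_sub hw h0d
            have h2 : (a ^ 2) ∣ Int.natAbs ((w:ℤ) - x0) * Int.natAbs ((w:ℤ) + x0) := by
              rw [← Int.natAbs_mul, ← Int.natCast_dvd]; push_cast; exact h1
            have h3 : f ∣ Int.natAbs ((w:ℤ) + x0) := by
              obtain ⟨r, hr⟩ : d ∣ Int.natAbs ((w:ℤ) - x0) := by rw [← hg]; exact Nat.gcd_dvd_right _ _
              rw [hr, hf] at hg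
              rw [Nat.gcd_mul_left] at hg
              have hco : Nat.Coprime f r := by
                have : d * Nat.gcd f r = d * 1 := by omega
                exact Nat.eq_of_mul_eq_mul_left (by omega) this
              rw [hf, hr, mul_assoc] at h2
              have h4 := Nat.dvd_of_mul_dvd_mul_left (by omega) h2
              exact hco.dvd_of_dvd_mul_left h4
            exact Int.natCast_dvd.mpr h3
          have hc : IsCoprime (x0:ℤ) ((a:ℤ) ^ 2) :=
            IsCoprime.pow_right (Nat.isCoprime_iff_coprime.mpr h0c)
          have := dvd_two_mul_of_roots ((a:ℤ)^2) x0 ((y:ℤ) - x) x d f hA hc hdx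
            (hfx x hxd hxg) (by have := dvd_sub hdy hdx; simpa using this)
            (by have := dvd_sub (hfx y hyd hyg) (hfx x hxd hxg); simpa using this)
          have e : ((2 * (y - x) : ℕ) : ℤ) = 2 * ((y:ℤ) - x) := by push_cast [hxy]; ring
          rw [← e] at this
          exact_mod_cast this)
      push_cast at this
      exact this)
  rw [Finset.sum_const, nsmul_eq_mul] at key
  exact key

/-- dyadic box -/
def dbox (N : Fin 4 → ℕ) : Finset (Fin 4 → ℕ) := Fintype.piFinset (fun i => Finset.Ico (N i) (2 * N i))

def Del (e : Fin 4 → ℤ) (n : Fin 4 → ℕ) : ℝ := ∑ i, (e i : ℝ) * √(n i)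

theorem Del_eq (e : Fin 4 → ℤ) (n : Fin 4 → ℕ) :
    Del e n = e 0 * √(n 0) + e 1 * √(n 1) + e 2 * √(n 2) + e 3 * √(n 3) := by
  simp [Del, Fin.sum_univ_four]

theorem floor_close {a b δ : ℝ} (hδ : 0 < δ) (h : ⌊a / δ⌋ = ⌊b / δ⌋) : |a - b| ≤ δ := by
  have := Int.abs_sub_lt_one_of_floor_eq_floor h
  rw [← sub_div, abs_div, abs_of_pos hδ, div_lt_one hδ] at this
  exact this.le

theorem sgn_mul_self {e : ℤ} (h : e = 1 ∨ e = -1) : (e:ℝ) * e = 1 := by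
  rcases h with rfl | rfl <;> norm_num

theorem sign_abs {e : ℤ} (h : e = 1 ∨ e = -1) : |(e:ℝ)| = 1 := by
  rcases h with rfl | rfl <;> norm_num

theorem pair_energy (N1 N3 : ℕ) (h1 : 1 ≤ N1) (h13 : N1 ≤ N3) (a c : ℤ) (ha : a = 1 ∨ a = -1)
    (hc : c = 1 ∨ c = -1) (δ : ℝ) (hδ : 0 < δ) :
    ((((Ico N1 (2*N1) ×ˢ Ico N3 (2*N3)) ×ˢ (Ico N1 (2*N1) ×ˢ Ico N3 (2*N3))).filter
      (fun x : (ℕ × ℕ) × (ℕ × ℕ) => ⌊((a:ℝ) * √x.1.1 + c * √x.1.2) / δ⌋ = ⌊((a:ℝ) * √x.2.1 + c * √x.2.2) / δ⌋)).card : ℝ)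
      ≤ 400*(1+log N3)*(√N1^3*N3+δ*√N3^3*(N1:ℝ)^2) := by
  refine energy_bound N1 N3 h1 h13 (a * c) (by rcases ha with rfl | rfl <;> rcases hc with rfl | rfl <;> simp) δ hδ
    (fun p : ℕ × ℕ => ⌊((a:ℝ) * √p.1 + c * √p.2) / δ⌋) ?_
  intro p _ p' _ h
  have h1 := floor_close hδ h
  have h2 : (√(p.2:ℝ) - √(p'.2:ℝ)) + ((a * c : ℤ) : ℝ) * (√(p.1:ℝ) - √(p'.1:ℝ))
      = c * (((a:ℝ) * √p.1 + c * √p.2) - ((a:ℝ) * √p'.1 + c * √p'.2)) := by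
    push_cast
    have := sgn_mul_self hc
    linear_combination (-(√(p.2:ℝ) - √(p'.2:ℝ))) * this
  rw [h2, abs_mul, sign_abs hc, one_mul]
  exact h1

theorem quad_energy (N : Fin 4 → ℕ) (e : Fin 4 → ℤ) (he : ∀ i, e i = 1 ∨ e i = -1)
    (hN : ∀ i, 1 ≤ N i) (h02 : N 0 ≤ N 2) (h13 : N 1 ≤ N 3) (δ : ℝ) (hδ : 0 < δ) :
    (((dbox N).filter (fun n => |Del e n| ≤ δ)).card : ℝ) ^ 2 ≤
      9 * ((400*(1+log (N 2))*(√(N 0)^3*(N 2)+δ*√(N 2)^3*(N 0:ℝ)^2)) *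
        (400*(1+log (N 3))*(√(N 1)^3*(N 3)+δ*√(N 3)^3*(N 1:ℝ)^2))) := by
  set P := Ico (N 0) (2*N 0) ×ˢ Ico (N 2) (2*N 2)
  set Q := Ico (N 1) (2*N 1) ×ˢ Ico (N 3) (2*N 3)
  set f : ℕ × ℕ → ℝ := fun p => (e 0 : ℝ) * √p.1 + e 2 * √p.2
  set g : ℕ × ℕ → ℝ := fun p => ((-e 1 : ℤ) : ℝ) * √p.1 + ((-e 3 : ℤ) : ℝ) * √p.2
  have key := card_close_sq_le P Q f g δ hδ
  have a1 := pair_energy (N 0) (N 2) (hN 0) h02 (e 0) (e 2) (he 0) (he 2) δ hδ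
  have a2 := pair_energy (N 1) (N 3) (hN 1) h13 (-e 1) (-e 3) (by have := he 1; omega) (by have := he 3; omega) δ hδ
  have inj := card_le_of_inj ((dbox N).filter (fun n => |Del e n| ≤ δ))
    ((P ×ˢ Q).filter (fun x => |f x.1 - g x.2| ≤ δ)) (fun n => ((n 0, n 2), (n 1, n 3))) (by
      intro n hn
      simp only [Finset.mem_filter, dbox, Fintype.mem_piFinset] at hn
      simp only [Finset.mem_filter, Finset.mem_product, P, Q]
      refine ⟨⟨⟨hn.1 0, hn.1 2⟩, hn.1 1, hn.1 3⟩, ?_⟩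
      have h := hn.2
      rw [Del_eq] at h
      convert h using 2
      simp only [f, g]; push_cast; ring) (by
      intro x _ y _ hxy
      simp only [Prod.mk.injEq] at hxy
      funext i
      fin_cases i
      · exact hxy.1.1
      · exact hxy.2.1
      · exact hxy.1.2
      · exact hxy.2.2)
  calc _ ≤ (((P ×ˢ Q).filter (fun x => |f x.1 - g x.2| ≤ δ)).card : ℝ) ^ 2 := by gcongr
    _ ≤ _ := key
    _ ≤ _ := by gcongr

/-- primitive approximations set -/
def Agk (N0 N1 M U : ℕ) (ζ : ℝ) : Finset (ℕ × ℕ × ℕ × ℕ) :=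
  ((Ico N0 (2*N0)) ×ˢ (Ico N1 (2*N1)) ×ˢ (Ico M (2*M)) ×ˢ (Icc 1 U)).filter
    (fun x => Nat.Coprime x.2.2.2 x.2.2.1 ∧ 0 < |(x.2.2.2:ℝ) - 4 * x.2.2.1 * √((x.1 * x.2.1 : ℕ):ℝ)|
      ∧ |(x.2.2.2:ℝ) - 4 * x.2.2.1 * √((x.1 * x.2.1 : ℕ):ℝ)| ≤ ζ)

theorem frac_count (M : ℕ) (hM : 1 ≤ M) (θ ζ : ℝ) (hζ : 0 < ζ) (S : Finset (ℕ × ℕ))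
    (h : ∀ x ∈ S, x.1 ∈ Ico M (2*M) ∧ Nat.Coprime x.2 x.1 ∧ |(x.2:ℝ) - x.1 * θ| ≤ ζ) :
    (S.card : ℝ) ≤ 2 + 8 * ζ * M := by
  have hM0 : (0:ℝ) < M := by exact_mod_cast hM
  set f : ℕ × ℕ → ℤ := fun x => ⌊4 * (M:ℝ)^2 * (x.2 / x.1)⌋ with hf
  have hinj : ∀ x ∈ S, ∀ y ∈ S, f x = f y → x = y := by
    intro x hx y hy hxy
    obtain ⟨hx1, hx2, hx3⟩ := h x hx
    obtain ⟨hy1, hy2, hy3⟩ := h y hy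
    rw [Finset.mem_Ico] at hx1 hy1
    have hx0 : (0:ℝ) < x.1 := by exact_mod_cast (by omega : 0 < x.1)
    have hy0 : (0:ℝ) < y.1 := by exact_mod_cast (by omega : 0 < y.1)
    have hxM : (x.1:ℝ) < 2 * M := by exact_mod_cast hx1.2
    have hyM : (y.1:ℝ) < 2 * M := by exact_mod_cast hy1.2
    have h1 := Int.abs_sub_lt_one_of_floor_eq_floor hxy
    have h2 : 4 * (M:ℝ)^2 * (x.2 / x.1) - 4 * (M:ℝ)^2 * (y.2 / y.1)
      = 4 * (M:ℝ)^2 / (x.1 * y.1) * (x.2 * y.1 - y.2 * x.1) := by field_simp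
    rw [h2, abs_mul, abs_of_pos (by positivity)] at h1
    have h3 : 1 < 4 * (M:ℝ)^2 / (x.1 * y.1) := by
      rw [lt_div_iff₀ (by positivity)]
      nlinarith
    have h4 : |(x.2:ℝ) * y.1 - y.2 * x.1| < 1 := by
      by_contra hc
      push Not at hc
      nlinarith
    have h5 : ((x.2:ℤ) * y.1 - y.2 * x.1) = 0 := by
      have : |((x.2:ℤ) * y.1 - y.2 * x.1)| < 1 := by exact_mod_cast h4
      exact Int.abs_lt_one_iff.mp this
    have h6 : x.2 * y.1 = y.2 * x.1 := by
      have : (x.2:ℤ) * y.1 = y.2 * x.1 := by linarith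
      exact_mod_cast this
    have e1 : x.1 ∣ y.1 := by
      have : x.1 ∣ x.2 * y.1 := h6 ▸ Dvd.intro_left _ rfl
      exact (Nat.Coprime.dvd_of_dvd_mul_left hx2.symm this)
    have e2 : y.1 ∣ x.1 := by
      have : y.1 ∣ y.2 * x.1 := h6 ▸ Dvd.intro_left _ rfl
      exact (Nat.Coprime.dvd_of_dvd_mul_left hy2.symm this)
    have e3 := Nat.dvd_antisymm e1 e2
    rw [e3] at h6
    have e4 := Nat.eq_of_mul_eq_mul_right (by omega : 0 < y.1) h6
    exact Prod.ext e3 e4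
  have h1 : S.card = (S.image f).card := (Finset.card_image_of_injOn (fun x hx y hy h => hinj x hx y hy h)).symm
  rw [h1]
  have := card_le_of_gap (S.image f) 1 (8 * ζ * M + 1) one_pos (by positivity) (by
    intro a ha b hb _
    rw [Finset.mem_image] at ha hb
    obtain ⟨x, hx, rfl⟩ := ha
    obtain ⟨y, hy, rfl⟩ := hb
    obtain ⟨hx1, hx2, hx3⟩ := h x hx
    obtain ⟨hy1, hy2, hy3⟩ := h y hy
    rw [Finset.mem_Ico] at hx1 hy1
    have key : ∀ z : ℕ × ℕ, M ≤ z.1 → |(z.2:ℝ) - z.1 * θ| ≤ ζ → |4 * (M:ℝ)^2 * (z.2 / z.1) - 4 * (M:ℝ)^2 * θ| ≤ 4 * ζ * M := by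
      intro z hz hz2
      have hz0 : (0:ℝ) < z.1 := by exact_mod_cast (by omega : 0 < z.1)
      have hzM : (M:ℝ) ≤ z.1 := by exact_mod_cast hz
      have : 4 * (M:ℝ)^2 * (z.2 / z.1) - 4 * (M:ℝ)^2 * θ = 4 * (M:ℝ)^2 / z.1 * (z.2 - z.1 * θ) := by
        field_simp
      rw [this, abs_mul, abs_of_pos (by positivity)]
      calc _ ≤ 4 * (M:ℝ)^2 / M * ζ := by gcongr
        _ = _ := by field_simp
    have k1 := abs_le.mp (key x hx1.1 hx3)
    have k2 := abs_le.mp (key y hy1.1 hy3)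
    have f1 := Int.lt_floor_add_one (4 * (M:ℝ)^2 * ((x.2:ℝ) / x.1))
    have f2 := Int.floor_le (4 * (M:ℝ)^2 * ((y.2:ℝ) / y.1))
    simp only [hf]
    linarith [k1.1, k2.2])
  linarith

theorem card_le_sum_fiber' {α β : Type*} (S : Finset α) (f : α → β) (t : Finset β)
    (hf : ∀ x ∈ S, f x ∈ t) (B : β → ℝ)
    (h : ∀ b ∈ t, ∀ S' : Finset α, (∀ x ∈ S', x ∈ S ∧ f x = b) → (S'.card : ℝ) ≤ B b) :
    (S.card : ℝ) ≤ ∑ b ∈ t, B b :=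
  card_le_sum_fiber S f t hf B (fun b hb => h b hb _ (fun x hx => by simpa using hx))

theorem Agk_bound1 (N0 N1 M U : ℕ) (hM : 1 ≤ M) (ζ : ℝ) (hζ : 0 < ζ) :
    ((Agk N0 N1 M U ζ).card : ℝ) ≤ (N0:ℝ) * N1 * (2 + 8 * ζ * M) := by
  have h := card_le_sum_fiber' (Agk N0 N1 M U ζ) (fun x => (x.1, x.2.1)) (Ico N0 (2*N0) ×ˢ Ico N1 (2*N1)) (by
    intro x hx
    simp only [Agk, Finset.mem_filter, Finset.mem_product] at hx ⊢
    exact ⟨hx.1.1, hx.1.2.1⟩) (fun _ => 2 + 8 * ζ * M) (by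
    intro b hb S hS
    refine le_trans (card_le_of_inj S (S.image
      (fun x => (x.2.2.1, x.2.2.2))) (fun x => (x.2.2.1, x.2.2.2)) (fun x hx => Finset.mem_image_of_mem _ hx) ?_)
      (frac_count M hM (4 * √((b.1 * b.2 : ℕ):ℝ)) ζ hζ _ ?_)
    · intro x hx y hy hxy
      simp only [Prod.mk.injEq] at hxy
      have := (hS x hx).2.trans (hS y hy).2.symm
      simp only [Prod.mk.injEq] at this
      exact Prod.ext this.1 (Prod.ext this.2 (Prod.ext hxy.1 hxy.2))
    · intro z hz
      rw [Finset.mem_image] at hz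
      obtain ⟨x, hx, rfl⟩ := hz
      obtain ⟨hx, rfl⟩ := hS x hx
      simp only [Agk, Finset.mem_filter, Finset.mem_product] at hx
      obtain ⟨⟨_, _, h3, _⟩, h5, _, h7⟩ := hx
      refine ⟨h3, h5, ?_⟩
      convert h7 using 2
      ring)
  refine h.trans ?_
  simp only [Finset.sum_const, Finset.card_product, Nat.card_Ico, nsmul_eq_mul]
  have e1 : 2 * N0 - N0 = N0 := by omega
  have e2 : 2 * N1 - N1 = N1 := by omega
  rw [e1, e2]; push_cast; rfl

theorem Agk_bound2 (N0 N1 M U : ℕ) (h0 : 1 ≤ N0) (h1 : 1 ≤ N1) (hM : 1 ≤ M) (ζ : ℝ) (hζ : 0 < ζ)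
    (hζ1 : ζ ≤ 1/2) (D : ℝ) (L : ℕ) (hD : ∀ n, 1 ≤ n → n ≤ L → ((Nat.divisors n).card : ℝ) ≤ D)
    (hL1 : 4 * (N0 * N1) ≤ L) (hL2 : (2 * M)^2 ≤ L) :
    ((Agk N0 N1 M U ζ).card : ℝ) ≤
      D^2 * (66 * ζ * M^2 * √((N0 * N1 : ℕ):ℝ) + 2244 * ζ * M * ((N0 * N1 : ℕ):ℝ)) := by
  set W : ℝ := ((N0 * N1 : ℕ):ℝ) with hW
  have hW1 : 1 ≤ W := by rw [hW]; exact_mod_cast Nat.mul_pos h0 h1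
  have hM0 : (1:ℝ) ≤ M := by exact_mod_cast hM
  have hsW : 1 ≤ √W := Real.one_le_sqrt.mpr hW1
  have hD0 : 0 ≤ D := le_trans (by positivity) (hD 1 le_rfl (by nlinarith))
  set P : ℝ := 33 * ζ * M * √W with hP
  have hP0 : 0 ≤ P := by positivity
  set UU : ℕ := ⌊17 * (M:ℝ) * √W⌋₊ with hUU
  have hfacts : ∀ x ∈ Agk N0 N1 M U ζ, (1 ≤ x.1 * x.2.1 ∧ x.1 * x.2.1 ≤ L) ∧ x.2.2.2 ∈ Icc 1 UU ∧
      ((x.2.2.2:ℤ)^2 - 16 * (x.2.2.1:ℤ)^2 * ((x.1 * x.2.1 : ℕ):ℤ)) ∈ (Icc (-⌊P⌋) ⌊P⌋).erase 0 := by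
    intro x hx
    simp only [Agk, Finset.mem_filter, Finset.mem_product, Finset.mem_Ico, Finset.mem_Icc] at hx
    obtain ⟨⟨⟨a1, a2⟩, ⟨b1, b2⟩, ⟨c1, c2⟩, d1, d2⟩, hc, hp, hz⟩ := hx
    obtain ⟨a, b, α, u⟩ := x
    simp only at a1 a2 b1 b2 c1 c2 d1 d2 hc hp hz ⊢
    set w : ℕ := a * b with hw
    have hw1 : 1 ≤ w := Nat.mul_pos (by omega) (by omega)
    have hw2 : w ≤ 4 * (N0 * N1) := by rw [hw]; nlinarith
    have hsw : √(w:ℝ) ≤ 2 * √W := by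
      have : (w:ℝ) ≤ 2^2 * W := by rw [hW]; norm_num; exact_mod_cast hw2
      calc √(w:ℝ) ≤ √(2^2 * W) := Real.sqrt_le_sqrt this
        _ = _ := by rw [Real.sqrt_mul (by norm_num), Real.sqrt_sq (by norm_num)]
    have hα : (α:ℝ) ≤ 2 * M := by exact_mod_cast c2.le
    have hα0 : (1:ℝ) ≤ α := by exact_mod_cast hM.trans c1
    have hprod : (α:ℝ) * √(w:ℝ) ≤ 4 * (M * √W) := by
      calc (α:ℝ) * √(w:ℝ) ≤ (2 * M) * (2 * √W) := by gcongr
        _ = _ := by ring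
    have hMW : 1 ≤ (M:ℝ) * √W := by nlinarith
    have hz' := abs_le.mp hz
    have hu : (u:ℝ) ≤ 17 * M * √W := by linarith
    refine ⟨⟨hw1, hw2.trans hL1⟩, Finset.mem_Icc.mpr ⟨d1, Nat.le_floor hu⟩, ?_⟩
    have hcast : (((u:ℤ)^2 - 16 * (α:ℤ)^2 * (w:ℤ) : ℤ):ℝ) = (u - 4 * α * √(w:ℝ)) * (u + 4 * α * √(w:ℝ)) := by
      push_cast
      have := Real.sq_sqrt (by positivity : (0:ℝ) ≤ w)
      linear_combination (16 * (α:ℝ)^2) * this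
    have hu1 : (1:ℝ) ≤ u := by exact_mod_cast d1
    have hpos : 0 < (u:ℝ) + 4 * α * √(w:ℝ) := by positivity
    have habs : |(((u:ℤ)^2 - 16 * (α:ℤ)^2 * (w:ℤ) : ℤ):ℝ)| ≤ P := by
      rw [hcast, abs_mul, abs_of_pos hpos, hP]
      calc _ ≤ ζ * (33 * (M * √W)) := by gcongr; linarith
        _ = _ := by ring
    have hne : ((u:ℤ)^2 - 16 * (α:ℤ)^2 * (w:ℤ)) ≠ 0 := by
      intro h0
      rw [h0] at hcast
      have : (u:ℝ) - 4 * α * √(w:ℝ) = 0 := by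
        rcases mul_eq_zero.mp (hcast.symm.trans Int.cast_zero) with h | h
        · exact h
        · linarith
      rw [this] at hp; simp at hp
    rw [Finset.mem_erase, Finset.mem_Icc]
    have h2 := abs_le.mp habs
    refine ⟨hne, ?_, Int.le_floor.mpr h2.2⟩
    have : -((u:ℤ)^2 - 16 * (α:ℤ)^2 * (w:ℤ)) ≤ ⌊P⌋ := Int.le_floor.mpr (by push_cast at h2 ⊢; linarith)
    linarith
  have hmemα : ∀ x ∈ Agk N0 N1 M U ζ, x.2.2.1 ∈ Ico M (2*M) ∧ Nat.Coprime x.2.2.2 x.2.2.1 := by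
    intro x hx
    simp only [Agk, Finset.mem_filter, Finset.mem_product] at hx
    exact ⟨hx.1.2.2.1, hx.2.1⟩
  have h := card_le_sum_fiber' (Agk N0 N1 M U ζ)
    (fun x => (x.2.2.1, ((x.2.2.2:ℤ)^2 - 16 * (x.2.2.1:ℤ)^2 * ((x.1 * x.2.1 : ℕ):ℤ))))
    (Ico M (2*M) ×ˢ (Icc (-⌊P⌋) ⌊P⌋).erase 0) (by
      intro x hx
      rw [Finset.mem_product]
      exact ⟨(hmemα x hx).1, (hfacts x hx).2.2⟩) (fun _ => D^2 * (1 + 34 * √W / M)) (by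
      intro q hq S hS
      rw [Finset.mem_product, Finset.mem_Ico] at hq
      obtain ⟨α, p⟩ := q
      simp only at hq
      have hα1 : 1 ≤ α := by omega
      have hαM : (M:ℝ) ≤ α := by exact_mod_cast hq.1.1
      have hS' : ∀ x ∈ S, x ∈ Agk N0 N1 M U ζ ∧ x.2.2.1 = α ∧
          ((x.2.2.2:ℤ)^2 - 16 * (α:ℤ)^2 * ((x.1 * x.2.1 : ℕ):ℤ)) = p := by
        intro x hx
        obtain ⟨a1, a2⟩ := hS x hx
        rw [Prod.mk.injEq] at a2
        exact ⟨a1, a2.1, a2.1 ▸ a2.2⟩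
      have r := root_count α hα1 p UU
      have h2 := card_le_sum_fiber' S (fun x => x.2.2.2) ((Finset.Icc 1 UU).filter (fun u : ℕ => Nat.Coprime u α ∧ ((α:ℤ) ^ 2) ∣ (u:ℤ) ^ 2 - p)) (by
        intro x hx
        obtain ⟨a1, a2, a3⟩ := hS' x hx
        rw [Finset.mem_filter]
        refine ⟨(hfacts x a1).2.1, a2 ▸ (hmemα x a1).2, ⟨16 * ((x.1 * x.2.1 : ℕ):ℤ), by rw [← a3]; ring⟩⟩)
        (fun _ => D) (by
        intro u hu S2 hS2
        rcases S2.eq_empty_or_nonempty with h | ⟨x0, hx0⟩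
        · rw [h]; simpa using hD0
        · obtain ⟨b1, b2⟩ := hS2 x0 hx0
          obtain ⟨c1, c2, c3⟩ := hS' x0 b1
          have hw := (hfacts x0 c1).1
          refine le_trans (card_le_of_inj S2 (Nat.divisors (x0.1 * x0.2.1)) (fun x => x.1) ?_ ?_) (hD _ hw.1 hw.2)
          all_goals
            have hsame : ∀ x ∈ S2, x.1 * x.2.1 = x0.1 * x0.2.1 ∧ x.2.2.1 = α ∧ x.2.2.2 = u := by
              intro x hx
              obtain ⟨d1, d2⟩ := hS2 x hx
              obtain ⟨e1, e2, e3⟩ := hS' x d1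
              refine ⟨?_, e2, d2⟩
              rw [d2] at e3
              rw [b2] at c3
              have : 16 * (α:ℤ)^2 * ((x.1 * x.2.1 : ℕ):ℤ) = 16 * (α:ℤ)^2 * ((x0.1 * x0.2.1 : ℕ):ℤ) := by linarith
              have hh : (16 * (α:ℤ)^2) ≠ 0 := by positivity
              exact_mod_cast mul_left_cancel₀ hh this
          · intro x hx
            rw [Nat.mem_divisors]
            exact ⟨⟨x.2.1, (hsame x hx).1.symm⟩, by omega⟩
          · intro x hx y hy hxy
            obtain ⟨e1, e2, e3⟩ := hsame x hx
            obtain ⟨f1, f2, f3⟩ := hsame y hy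
            have hx0 : 0 < x.1 := Nat.pos_of_ne_zero (by rintro h; rw [h, zero_mul] at e1; omega)
            have : x.2.1 = y.2.1 := by
              rw [← hxy, ← e1] at f1
              exact (Nat.eq_of_mul_eq_mul_left hx0 f1).symm
            exact Prod.ext hxy (Prod.ext this (Prod.ext (e2.trans f2.symm) (e3.trans f3.symm))))
      refine h2.trans ?_
      rw [Finset.sum_const, nsmul_eq_mul]
      have r2 : ((Nat.divisors (α^2)).card : ℝ) ≤ D := hD _ (Nat.one_le_pow _ _ hα1) (by
        refine le_trans ?_ hL2
        exact Nat.pow_le_pow_left (by omega) 2)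
      have hUU' : (UU:ℝ) ≤ 17 * M * √W := Nat.floor_le (by positivity)
      have r3 : 2 * (UU:ℝ) / (α:ℝ)^2 ≤ 34 * √W / M := by
        calc 2 * (UU:ℝ) / (α:ℝ)^2 ≤ 2 * (17 * M * √W) / (M:ℝ)^2 := by gcongr
          _ = _ := by field_simp; ring
      calc _ ≤ (D * (1 + 34 * √W / M)) * D := by
            gcongr
            refine r.trans ?_
            gcongr
        _ = _ := by ring)
  refine h.trans ?_
  rw [Finset.sum_const, nsmul_eq_mul, Finset.card_product, Nat.card_Ico, Finset.card_erase_of_mem (by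
    rw [Finset.mem_Icc]
    have : 0 ≤ ⌊P⌋ := Int.floor_nonneg.mpr hP0
    omega), Int.card_Icc]
  have e1 : 2 * M - M = M := by omega
  have hP2 : (((⌊P⌋ + 1 - -⌊P⌋).toNat - 1 : ℕ):ℝ) ≤ 2 * P := by
    have : 0 ≤ ⌊P⌋ := Int.floor_nonneg.mpr hP0
    have h3 : (((⌊P⌋ + 1 - -⌊P⌋).toNat - 1 : ℕ):ℤ) = 2 * ⌊P⌋ := by omega
    have h4 : (((⌊P⌋ + 1 - -⌊P⌋).toNat - 1 : ℕ):ℝ) = 2 * (⌊P⌋:ℝ) := by exact_mod_cast h3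
    rw [h4]
    linarith [Int.floor_le P]
  rw [e1, Nat.cast_mul]
  calc _ ≤ (M:ℝ) * (2 * P) * (D^2 * (1 + 34 * √W / M)) := by gcongr
    _ = D^2 * (66 * ζ * M^2 * √W + 2244 * ζ * M * (√W * √W)) := by
      rw [hP]; field_simp; ring
    _ = _ := by rw [Real.mul_self_sqrt (by linarith)]

theorem Agk_comb (N0 N1 M U : ℕ) (h0 : 1 ≤ N0) (h1 : 1 ≤ N1) (hM : 1 ≤ M) (ζ : ℝ) (hζ : 0 < ζ)
    (hζ1 : ζ ≤ 1/2) (D : ℝ) (hD1 : 1 ≤ D) (L : ℕ) (hD : ∀ n, 1 ≤ n → n ≤ L → ((Nat.divisors n).card : ℝ) ≤ D)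
    (hL1 : 4 * (N0 * N1) ≤ L) (hL2 : (2 * M)^2 ≤ L) :
    ((Agk N0 N1 M U ζ).card : ℝ) ≤
      12 * D * √ζ * M * (√((N0 * N1 : ℕ):ℝ) * √√((N0 * N1 : ℕ):ℝ)) + 2252 * D^2 * ζ * M * ((N0 * N1 : ℕ):ℝ) := by
  have b1 := Agk_bound1 N0 N1 M U hM ζ hζ
  have b2 := Agk_bound2 N0 N1 M U h0 h1 hM ζ hζ hζ1 D L hD hL1 hL2
  set W : ℝ := ((N0 * N1 : ℕ):ℝ) with hW
  have hWW : (N0:ℝ) * N1 = W := by rw [hW]; push_cast; ring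
  have hW1 : 1 ≤ W := by rw [hW]; exact_mod_cast Nat.mul_pos h0 h1
  have hM0 : (1:ℝ) ≤ M := by exact_mod_cast hM
  rw [hWW] at b1
  set A := ((Agk N0 N1 M U ζ).card : ℝ)
  have key : min (2 * W) (66 * D^2 * ζ * M^2 * √W) ≤ 12 * D * √ζ * M * (√W * √√W) := by
    refine abs_le_of_sq_le_sq' ?_ (by positivity) |>.2
    have e1 : (12 * D * √ζ * M * (√W * √√W))^2 = 144 * D^2 * ζ * M^2 * (W * √W) := by
      have a1 := Real.sq_sqrt hζ.le
      have a2 := Real.sq_sqrt (by linarith : 0 ≤ W)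
      have a3 := Real.sq_sqrt (Real.sqrt_nonneg W)
      calc _ = 144 * D^2 * (√ζ)^2 * M^2 * ((√W)^2 * (√√W)^2) := by ring
        _ = _ := by rw [a1, a2, a3]
    rw [e1, sq]
    calc _ ≤ (2 * W) * (66 * D^2 * ζ * M^2 * √W) := by
          apply mul_le_mul (min_le_left _ _) (min_le_right _ _) _ (by positivity)
          apply le_min <;> positivity
      _ = 132 * (D^2 * ζ * M^2 * (W * √W)) := by ring
      _ ≤ 144 * (D^2 * ζ * M^2 * (W * √W)) := by gcongr; norm_num
      _ = _ := by ring
  have hx : 8 * ζ * M * W ≤ 8 * D^2 * ζ * M * W := by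
    have : 1 ≤ D^2 := one_le_pow₀ hD1
    have h3 : 0 ≤ 8 * ζ * M * W := by positivity
    nlinarith
  have hy : 0 ≤ D^2 * ζ * M * W := by positivity
  have hz : 0 ≤ ζ * M * W := by positivity
  rcases le_total (2 * W) (66 * D^2 * ζ * M^2 * √W) with h | h
  · rw [min_eq_left h] at key
    linarith
  · rw [min_eq_right h] at key
    linarith

def Aset (N0 N1 N : ℕ) (η : ℝ) : Finset (ℕ × ℕ × ℕ × ℕ) :=
  ((Ico N0 (2*N0)) ×ˢ (Ico N1 (2*N1)) ×ˢ (Icc 1 (4*N)) ×ˢ (Icc 1 (40*N^2))).filter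
    (fun x => 0 < |(x.2.2.2:ℝ) - 4 * x.2.2.1 * √((x.1 * x.2.1 : ℕ):ℝ)|
      ∧ |(x.2.2.2:ℝ) - 4 * x.2.2.1 * √((x.1 * x.2.1 : ℕ):ℝ)| ≤ η)

theorem Aset_bound (N0 N1 N : ℕ) (h0 : 1 ≤ N0) (h1 : 1 ≤ N1) (h0N : N0 ≤ N) (h1N : N1 ≤ N) (η : ℝ) (hη : 0 < η)
    (hη1 : η ≤ 1/2) (D : ℝ) (hD1 : 1 ≤ D) (hD : ∀ n, 1 ≤ n → n ≤ 64 * N^2 → ((Nat.divisors n).card : ℝ) ≤ D) :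
    ((Aset N0 N1 N η).card : ℝ) ≤ (1 + log (4*N)) * (Nat.log 2 (4*N) + 1) *
      (D^2 * (48 * √η * N * (√((N0 * N1 : ℕ):ℝ) * √√((N0 * N1 : ℕ):ℝ)) + 9008 * η * N * ((N0 * N1 : ℕ):ℝ))) := by
  set W : ℝ := ((N0 * N1 : ℕ):ℝ) with hW
  have hN1 : 1 ≤ N := h0.trans h0N
  have hW1 : 1 ≤ W := by rw [hW]; exact_mod_cast Nat.mul_pos h0 h1
  set X := D^2 * (48 * √η * N * (√W * √√W) + 9008 * η * N * W) with hX
  have hX0 : 0 ≤ X := by positivity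
  have key := card_le_sum_fiber' (Aset N0 N1 N η)
    (fun x => (Nat.gcd x.2.2.1 x.2.2.2, Nat.log 2 (x.2.2.1 / Nat.gcd x.2.2.1 x.2.2.2)))
    (Icc 1 (4*N) ×ˢ range (Nat.log 2 (4*N) + 1)) (by
      intro x hx
      simp only [Aset, Finset.mem_filter, Finset.mem_product, Finset.mem_Icc, Finset.mem_range] at hx ⊢
      obtain ⟨⟨_, _, ⟨c1, c2⟩, d1, d2⟩, _⟩ := hx
      refine ⟨⟨Nat.gcd_pos_of_pos_left _ c1, (Nat.gcd_le_left _ c1).trans c2⟩, ?_⟩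
      rw [Nat.lt_succ_iff]
      exact Nat.log_mono_right ((Nat.div_le_self _ _).trans c2)) (fun q => X * (1 / (q.1:ℝ))) (by
      rintro ⟨g, k⟩ hq S hS
      simp only [Finset.mem_product, Finset.mem_Icc, Finset.mem_range] at hq
      have hg0 : (1:ℝ) ≤ g := by exact_mod_cast hq.1.1
      have hS' : ∀ x ∈ S, x ∈ Aset N0 N1 N η ∧ Nat.gcd x.2.2.1 x.2.2.2 = g ∧ 2^k ≤ x.2.2.1 / g ∧ x.2.2.1 / g < 2 * 2^k
          ∧ g * (x.2.2.1 / g) = x.2.2.1 ∧ g * (x.2.2.2 / g) = x.2.2.2 := by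
        intro x hx
        obtain ⟨a1, a2⟩ := hS x hx
        simp only [Prod.mk.injEq] at a2
        obtain ⟨b1, b2⟩ := a2
        have d1 : g ∣ x.2.2.1 := b1 ▸ Nat.gcd_dvd_left _ _
        have d2 : g ∣ x.2.2.2 := b1 ▸ Nat.gcd_dvd_right _ _
        rw [b1] at b2
        have a3 := a1
        simp only [Aset, Finset.mem_filter, Finset.mem_product, Finset.mem_Icc] at a3
        have hm : x.2.2.1 / g ≠ 0 := by
          have := Nat.div_pos (Nat.le_of_dvd a3.1.2.2.1.1 d1) (by omega : 0 < g)
          omega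
        refine ⟨a1, b1, ?_, ?_, Nat.mul_div_cancel' d1, Nat.mul_div_cancel' d2⟩
        · rw [← b2]; exact Nat.pow_log_le_self 2 hm
        · rw [← b2, ← pow_succ']; exact Nat.lt_pow_succ_log_self (by norm_num) _
      rcases S.eq_empty_or_nonempty with h | ⟨x0, hx0⟩
      · rw [h, Finset.card_empty, Nat.cast_zero]; positivity
      have hgk : g * 2^k ≤ 4 * N := by
        obtain ⟨a1, a2, a3, a4, a5, a6⟩ := hS' x0 hx0
        simp only [Aset, Finset.mem_filter, Finset.mem_product, Finset.mem_Icc] at a1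
        calc g * 2^k ≤ g * (x0.2.2.1 / g) := Nat.mul_le_mul_left _ a3
          _ ≤ 4 * N := by rw [a5]; exact a1.1.2.2.1.2
      have hgkr : (g:ℝ) * 2^k ≤ 4 * N := by exact_mod_cast hgk
      have hk4 : 2^k ≤ 4 * N := le_trans (Nat.le_mul_of_pos_left _ (by omega)) hgk
      have hζ1 : η / g ≤ η := div_le_self hη.le hg0
      have hζ0 : 0 < η / g := by positivity
      have hc := Agk_comb N0 N1 (2^k) (40 * N^2) h0 h1 Nat.one_le_two_pow (η / g) hζ0 (by linarith) D hD1
        (64 * N^2) hD (by nlinarith [Nat.mul_le_mul h0N h1N]) (by nlinarith [Nat.mul_le_mul hk4 hk4])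
      have hinj := card_le_of_inj S (Agk N0 N1 (2^k) (40 * N^2) (η / g))
        (fun x => (x.1, x.2.1, x.2.2.1 / g, x.2.2.2 / g)) (by
          intro x hx
          obtain ⟨a1, a2, a3, a4, a5, a6⟩ := hS' x hx
          simp only [Aset, Finset.mem_filter, Finset.mem_product, Finset.mem_Icc] at a1
          simp only [Agk, Finset.mem_filter, Finset.mem_product, Finset.mem_Icc]
          obtain ⟨⟨q1, q2, q3, q4, q5⟩, q6, q7⟩ := a1
          have e5 : ((x.2.2.1:ℕ):ℝ) = g * ((x.2.2.1 / g : ℕ):ℝ) := by exact_mod_cast a5.symm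
          have e6 : ((x.2.2.2:ℕ):ℝ) = g * ((x.2.2.2 / g : ℕ):ℝ) := by exact_mod_cast a6.symm
          have e7 : ((x.2.2.2:ℕ):ℝ) - 4 * (x.2.2.1:ℕ) * √((x.1 * x.2.1 : ℕ):ℝ) =
            g * (((x.2.2.2 / g : ℕ):ℝ) - 4 * ((x.2.2.1 / g : ℕ):ℝ) * √((x.1 * x.2.1 : ℕ):ℝ)) := by
            rw [e5, e6]; ring
          rw [e7, abs_mul, abs_of_pos (by linarith : (0:ℝ) < g)] at q6 q7
          refine ⟨⟨q1, q2, Finset.mem_Ico.mpr ⟨a3, a4⟩, ?_, (Nat.div_le_self _ _).trans q5⟩, ?_, ?_, ?_⟩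
          · apply Nat.pos_of_ne_zero
            intro h; rw [h] at a6; omega
          · rw [Nat.Coprime, Nat.gcd_comm]
            have : 0 < Nat.gcd x.2.2.1 x.2.2.2 := by omega
            rw [← a2]
            exact Nat.coprime_div_gcd_div_gcd this
          · exact pos_of_mul_pos_right q6 (by linarith)
          · rw [le_div_iff₀ (by linarith)]; linarith) (by
          intro x hx y hy hxy
          obtain ⟨a1, a2, a3, a4, a5, a6⟩ := hS' x hx
          obtain ⟨b1, b2, b3, b4, b5, b6⟩ := hS' y hy
          simp only [Prod.mk.injEq] at hxy
          obtain ⟨e1, e2, e3, e4⟩ := hxy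
          rw [e3] at a5; rw [e4] at a6
          exact Prod.ext e1 (Prod.ext e2 (Prod.ext (a5.symm.trans b5) (a6.symm.trans b6))))
      refine hinj.trans (hc.trans ?_)
      rw [← hW]
      have hM4 : (((2^k : ℕ)):ℝ) ≤ 4 * N / g := by
        rw [le_div_iff₀ (by linarith)]; push_cast; linarith
      have hsq : √(η / g) ≤ √η := Real.sqrt_le_sqrt hζ1
      have hDD : D ≤ D^2 := by nlinarith
      calc _ ≤ 12 * D^2 * √η * (4 * N / g) * (√W * √√W) + 2252 * D^2 * η * (4 * N / g) * W := by gcongr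
        _ = _ := by rw [hX]; field_simp; ring)
  refine key.trans ?_
  rw [Finset.sum_product]
  simp only [Finset.sum_const, Finset.card_range, nsmul_eq_mul]
  rw [← Finset.mul_sum, ← Finset.mul_sum]
  have := sum_inv_le_log (4*N) (4*N) le_rfl
  push_cast at this ⊢
  calc _ ≤ ((Nat.log 2 (4*N):ℝ) + 1) * (X * (1 + log (4 * N))) := by gcongr
    _ = _ := by ring

set_option maxHeartbeats 1000000 in
theorem quad_core (N a b c d : ℕ) (ha : 1 ≤ a) (hb : 1 ≤ b) (hc : 1 ≤ c) (hd : 1 ≤ d)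
    (ha' : a < 2 * N) (hb' : b < 2 * N) (hc' : c < 2 * N) (hd' : d < 2 * N)
    (e0 e1 e2 e3 : ℤ) (h0 : e0 = 1 ∨ e0 = -1) (h1 : e1 = 1 ∨ e1 = -1) (h2 : e2 = 1 ∨ e2 = -1)
    (h3 : e3 = 1 ∨ e3 = -1) (δ : ℝ) (hδ : 0 < δ) (hδN : 144 * (δ * √N ^ 3) ≤ 1)
    (hΔ : (e0:ℝ) * √a + e1 * √b + e2 * √c + e3 * √d ≠ 0)
    (hΔ' : |(e0:ℝ) * √a + e1 * √b + e2 * √c + e3 * √d| ≤ δ) (m v : ℤ) (hm : m = (c:ℤ) + d - a - b)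
    (hv : v = e0 * e1 * (4 * (a * b) + m^2 - 4 * (c * d))) :
    ((0 < m ∧ 0 < v) ∨ (m < 0 ∧ v < 0)) ∧ |(v:ℝ) - 4 * m * √((a * b : ℕ):ℝ)| ≤ 72 * (δ * √N ^ 3) ∧
      0 < |(v:ℝ) - 4 * m * √((a * b : ℕ):ℝ)| := by
  have hN1 : 1 ≤ N := by omega
  have hNr : (1:ℝ) ≤ N := by exact_mod_cast hN1
  have hsN : 1 ≤ √(N:ℝ) := Real.one_le_sqrt.mpr hNr
  set sN := √(N:ℝ) with hsNdef
  have hsN2 : sN^2 = N := Real.sq_sqrt (by positivity)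
  have bnd : ∀ n : ℕ, n < 2 * N → √(n:ℝ) ≤ 3/2 * sN := by
    intro n hn
    rw [Real.sqrt_le_left (by positivity)]
    have : (n:ℝ) ≤ 2 * N := by exact_mod_cast hn.le
    nlinarith
  have bnd1 : ∀ n : ℕ, 1 ≤ n → 1 ≤ √(n:ℝ) := fun n hn => Real.one_le_sqrt.mpr (by exact_mod_cast hn)
  have ba := bnd a ha'; have bb := bnd b hb'; have bc := bnd c hc'; have bd := bnd d hd'
  have ca := bnd1 a ha; have cb := bnd1 b hb; have cc := bnd1 c hc; have cd := bnd1 d hd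
  have qa := Real.sq_sqrt (Nat.cast_nonneg (α := ℝ) a)
  have qb := Real.sq_sqrt (Nat.cast_nonneg (α := ℝ) b)
  have qc := Real.sq_sqrt (Nat.cast_nonneg (α := ℝ) c)
  have qd := Real.sq_sqrt (Nat.cast_nonneg (α := ℝ) d)
  have hmul : √((a * b : ℕ):ℝ) = √(a:ℝ) * √(b:ℝ) := by
    push_cast; exact Real.sqrt_mul (by positivity) _
  rw [hmul]
  set x := √(a:ℝ); set y := √(b:ℝ); set z := √(c:ℝ); set t := √(d:ℝ)
  set E0 : ℝ := (e0:ℝ); set E1 : ℝ := (e1:ℝ); set E2 : ℝ := (e2:ℝ); set E3 : ℝ := (e3:ℝ)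
  have s0 : E0 * E0 = 1 := sgn_mul_self h0
  have s1 : E1 * E1 = 1 := sgn_mul_self h1
  have s2 : E2 * E2 = 1 := sgn_mul_self h2
  have s3 : E3 * E3 = 1 := sgn_mul_self h3
  have a0 : |E0| = 1 := sign_abs h0
  have a1 : |E1| = 1 := sign_abs h1
  have a2 : |E2| = 1 := sign_abs h2
  have a3 : |E3| = 1 := sign_abs h3
  have hmr : (m:ℝ) = z^2 + t^2 - x^2 - y^2 := by rw [hm, qa, qb, qc, qd]; push_cast; ring
  have hvr : (v:ℝ) = E0 * E1 * (4 * (x^2 * y^2) + (m:ℝ)^2 - 4 * (z^2 * t^2)) := by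
    rw [hv, qa, qb, qc, qd]; push_cast; ring
  set A := 2 * (E0 * E1) * (x * y) - m with hA
  set B := 2 * (E2 * E3) * (z * t) with hB
  set Δ := E0 * x + E1 * y + E2 * z + E3 * t with hΔdef
  set S := E0 * x + E1 * y - E2 * z - E3 * t with hS
  have hAB : A - B = Δ * S := by
    rw [hA, hB, hΔdef, hS, hmr]
    linear_combination (-x^2) * s0 - y^2 * s1 + z^2 * s2 + t^2 * s3
  have hAB2 : (A - B) * (A + B) = E0 * E1 * (v - 4 * m * (x * y)) := by
    rw [hA, hB, hvr]
    linear_combination (4 * x^2*y^2*E1^2 - (4 * x^2 * y^2 + (m:ℝ)^2 - 4 * z^2*t^2) * E1 * E1) * s0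
      + (4*x^2*y^2 - (4 * x^2 * y^2 + (m:ℝ)^2 - 4 * z^2*t^2)) * s1 - 4*z^2*t^2*E3^2 * s2 - 4 * z^2*t^2 * s3
  have hSb : |S| ≤ 6 * sN := by
    have t0 : |E0 * x| = x := by rw [abs_mul, a0, one_mul, abs_of_pos (by linarith)]
    have t1 : |E1 * y| = y := by rw [abs_mul, a1, one_mul, abs_of_pos (by linarith)]
    have t2 : |E2 * z| = z := by rw [abs_mul, a2, one_mul, abs_of_pos (by linarith)]
    have t3 : |E3 * t| = t := by rw [abs_mul, a3, one_mul, abs_of_pos (by linarith)]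
    have u1 := abs_sub (E0 * x + E1 * y - E2 * z) (E3 * t)
    have u2 := abs_sub (E0 * x + E1 * y) (E2 * z)
    have u3 := abs_add_le (E0 * x) (E1 * y)
    rw [hS]; linarith
  have hABs : |A - B| ≤ 6 * (δ * sN) := by
    rw [hAB, abs_mul]
    calc _ ≤ δ * (6 * sN) := by gcongr
      _ = _ := by ring
  have hδs : 144 * (δ * sN) ≤ 1 := by
    refine le_trans ?_ hδN
    have : sN ≤ sN^3 := le_self_pow₀ hsN (by norm_num)
    gcongr
  have hδ1 : 144 * δ ≤ 1 := by
    have := le_mul_of_one_le_right hδ.le hsN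
    linarith
  have hBabs : |B| = 2 * (z * t) := by
    rw [hB, abs_mul, abs_mul, abs_mul, a2, a3, abs_of_pos (by norm_num : (0:ℝ) < 2), abs_of_pos (by positivity)]; ring
  have hzt : z * t ≤ 2 * N := by
    have h1 : (c:ℝ) ≤ 2 * N := by exact_mod_cast hc'.le
    have h2 : (d:ℝ) ≤ 2 * N := by exact_mod_cast hd'.le
    have := sq_nonneg (z - t); linarith [sub_sq z t]
  have hxy : x * y ≤ 2 * N := by
    have h1 : (a:ℝ) ≤ 2 * N := by exact_mod_cast ha'.le
    have h2 : (b:ℝ) ≤ 2 * N := by exact_mod_cast hb'.le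
    have := sq_nonneg (x - y); linarith [sub_sq x y]
  have hzt1 : 1 ≤ z * t := one_le_mul_of_one_le_of_one_le cc cd
  have hxy1 : 1 ≤ x * y := one_le_mul_of_one_le_of_one_le ca cb
  have hmabs : |(m:ℝ)| ≤ 4 * N := by
    have h1 : |m| ≤ 4 * N := by rw [hm, abs_le]; omega
    exact_mod_cast h1
  have hABp : |A + B| ≤ 12 * N := by
    have u1 := abs_add_le A B
    have u2 := abs_sub (2 * (E0 * E1) * (x * y)) (m:ℝ)
    have u3 : |2 * (E0 * E1) * (x * y)| = 2 * (x * y) := by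
      rw [abs_mul, abs_mul, abs_mul, a0, a1, abs_of_pos (by norm_num : (0:ℝ) < 2), abs_of_pos (by positivity)]; ring
    rw [← hA] at u2
    linarith
  have hE : |E0 * E1| = 1 := by rw [abs_mul, a0, a1]; norm_num
  have hmain : |(v:ℝ) - 4 * m * (x * y)| = |A - B| * |A + B| := by
    rw [← abs_mul, hAB2, abs_mul, hE, one_mul]
  have hle : |(v:ℝ) - 4 * m * (x * y)| ≤ 72 * (δ * sN ^ 3) := by
    rw [hmain]
    calc |A - B| * |A + B| ≤ (6 * (δ * sN)) * (12 * N) := by gcongr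
      _ = 72 * (δ * sN ^ 3) := by rw [← hsN2]; ring
  have hpos : 0 < |(v:ℝ) - 4 * m * (x * y)| := by
    rw [hmain]
    apply mul_pos
    · rw [abs_pos, hAB]
      refine mul_ne_zero hΔ ?_
      intro hS0
      -- S = 0: Δ = 2 (E0 x + E1 y)
      have hD2 : Δ = 2 * (E0 * x + E1 * y) := by rw [hΔdef]; linarith
      have hsmall : |E0 * x + E1 * y| ≤ δ / 2 := by
        rw [hD2, abs_mul, abs_of_pos (by norm_num : (0:ℝ) < 2)] at hΔ'; linarith
      have hne : E0 * x + E1 * y ≠ 0 := by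
        intro h; rw [hD2, h] at hΔ; simp at hΔ
      have hprod : (E0 * x + E1 * y) * (E0 * x - E1 * y) = ((a:ℝ) - b) := by
        rw [← qa, ← qb]; linear_combination x^2 * s0 - y^2 * s1
      have hab : a ≠ b := by
        rintro rfl
        rw [sub_self] at hprod
        rcases mul_eq_zero.mp hprod with h | h
        · exact hne h
        · have hxx : x = y := rfl
          have : |E0 * x + E1 * y| = 2 * x := by
            have : E0 * x + E1 * y = 2 * (E0 * x) := by linarith
            rw [this, abs_mul, abs_mul, a0, abs_of_pos (by linarith : 0 < x)]; norm_num
          linarith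
      have h1 : 1 ≤ |(a:ℝ) - b| := by
        have : 1 ≤ |(a:ℤ) - b| := Int.one_le_abs (by omega)
        exact_mod_cast this
      rw [← hprod, abs_mul] at h1
      have h2 : |E0 * x - E1 * y| ≤ 3 * sN := by
        have u := abs_sub (E0 * x) (E1 * y)
        rw [abs_mul, abs_mul, a0, a1, abs_of_pos (by linarith : 0 < x), abs_of_pos (by linarith : 0 < y)] at u
        linarith
      have h3 : |E0 * x + E1 * y| * |E0 * x - E1 * y| ≤ (δ/2) * (3 * sN) := by gcongr
      have h4 : (δ/2) * (3 * sN) = 3/2 * (δ * sN) := by ring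
      linarith
    · rw [abs_pos]
      intro h
      have : A - B = - (2 * B) := by linarith
      rw [this, abs_neg, abs_mul, hBabs, abs_of_pos (by norm_num : (0:ℝ) < 2)] at hABs
      linarith
  refine ⟨?_, hle, hpos⟩
  have hlt : |(v:ℝ) - 4 * m * (x * y)| < 1 := by linarith
  have hlt' := abs_lt.mp hlt
  rcases lt_trichotomy m 0 with hm0 | hm0 | hm0
  · right
    refine ⟨hm0, ?_⟩
    have : (m:ℝ) ≤ -1 := by exact_mod_cast (by omega : m ≤ -1)
    have h6 : (m:ℝ) * (x * y) ≤ -1 * 1 := by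
      have := mul_le_mul (by linarith : (1:ℝ) ≤ -m) hxy1 (by norm_num) (by linarith)
      linarith
    have h5 : (v:ℝ) < 0 := by linarith [hlt'.2]
    exact_mod_cast h5
  · exfalso
    rw [hm0] at hlt hpos
    simp only [Int.cast_zero, mul_zero, zero_mul, sub_zero] at hlt hpos
    have h6 : |v| < 1 := by exact_mod_cast hlt
    have h7 : 0 < |v| := by exact_mod_cast hpos
    omega
  · left
    refine ⟨hm0, ?_⟩
    have : (1:ℝ) ≤ m := by exact_mod_cast (by omega : 1 ≤ m)
    have h6 : 1 * 1 ≤ (m:ℝ) * (x * y) := mul_le_mul this hxy1 (by norm_num) (by linarith)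
    have h5 : 0 < (v:ℝ) := by linarith [hlt'.1]
    exact_mod_cast h5

theorem arith_count (N : Fin 4 → ℕ) (e : Fin 4 → ℤ) (he : ∀ i, e i = 1 ∨ e i = -1)
    (hN : ∀ i, 1 ≤ N i) (hN3 : ∀ i, N i ≤ N 3) (δ : ℝ) (hδ : 0 < δ)
    (hδN : 144 * (δ * √(N 3) ^ 3) ≤ 1) :
    (((dbox N).filter (fun n => Del e n ≠ 0 ∧ |Del e n| ≤ δ)).card : ℝ) ≤
      4 * ((Aset (N 0) (N 1) (N 3) (72 * (δ * √(N 3) ^ 3))).card : ℝ) := by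
  set mm : (Fin 4 → ℕ) → ℤ := fun n => (n 2:ℤ) + n 3 - n 0 - n 1 with hmm
  set vv : (Fin 4 → ℕ) → ℤ := fun n => e 0 * e 1 * (4 * (n 0 * n 1) + (mm n)^2 - 4 * (n 2 * n 3)) with hvv
  have hcore : ∀ n ∈ (dbox N).filter (fun n => Del e n ≠ 0 ∧ |Del e n| ≤ δ),
      (∀ i, n i ∈ Ico (N i) (2 * N i)) ∧
      ((0 < mm n ∧ 0 < vv n) ∨ (mm n < 0 ∧ vv n < 0)) ∧ |(vv n:ℝ) - 4 * mm n * √((n 0 * n 1 : ℕ):ℝ)| ≤ 72 * (δ * √(N 3) ^ 3) ∧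
      0 < |(vv n:ℝ) - 4 * mm n * √((n 0 * n 1 : ℕ):ℝ)| := by
    intro n hn
    simp only [Finset.mem_filter, dbox, Fintype.mem_piFinset] at hn
    obtain ⟨h1, h2, h3⟩ := hn
    rw [Del_eq] at h2 h3
    have g : ∀ i, 1 ≤ n i ∧ n i < 2 * N 3 := by
      intro i
      have := Finset.mem_Ico.mp (h1 i)
      have := hN i; have := hN3 i
      omega
    exact ⟨h1, quad_core (N 3) (n 0) (n 1) (n 2) (n 3) (g 0).1 (g 1).1 (g 2).1 (g 3).1 (g 0).2 (g 1).2 (g 2).2 (g 3).2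
      (e 0) (e 1) (e 2) (e 3) (he 0) (he 1) (he 2) (he 3) δ hδ hδN h2 h3 _ _ rfl rfl⟩
  have inj := card_le_of_inj ((dbox N).filter (fun n => Del e n ≠ 0 ∧ |Del e n| ≤ δ))
    ((Aset (N 0) (N 1) (N 3) (72 * (δ * √(N 3) ^ 3))) ×ˢ (Finset.univ : Finset (Bool × Bool)))
    (fun n => ((n 0, n 1, (mm n).natAbs, (vv n).natAbs), (decide (0 < mm n), decide (n 2 ≤ n 3)))) (by
      intro n hn
      obtain ⟨h1, h2, h3, h4⟩ := hcore n hn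
      simp only [Aset, Finset.mem_filter, Finset.mem_product, Finset.mem_Icc, Finset.mem_univ, and_true]
      have hb : ∀ i, n i < 2 * N 3 := by
        intro i
        have := Finset.mem_Ico.mp (h1 i)
        have := hN3 i
        omega
      have habs : |(((vv n).natAbs : ℕ):ℝ) - 4 * ((mm n).natAbs:ℕ) * √((n 0 * n 1 : ℕ):ℝ)|
          = |(vv n:ℝ) - 4 * mm n * √((n 0 * n 1 : ℕ):ℝ)| := by
        rw [Nat.cast_natAbs, Nat.cast_natAbs]
        rcases h2 with ⟨p1, p2⟩ | ⟨p1, p2⟩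
        · rw [abs_of_pos p1, abs_of_pos p2]
        · rw [abs_of_neg p1, abs_of_neg p2, ← abs_neg]
          congr 1
          push_cast; ring
      have hmle : (mm n).natAbs ≤ 4 * N 3 := by
        have := hb 0; have := hb 1; have := hb 2; have := hb 3
        simp only [hmm]; omega
      refine ⟨⟨h1 0, h1 1, ⟨by omega, hmle⟩, ⟨by omega, ?_⟩⟩, ?_, ?_⟩
      · rw [habs.symm] at h3
        have hw : √((n 0 * n 1 : ℕ):ℝ) ≤ 2 * N 3 := by
          rw [Real.sqrt_le_left (by positivity)]
          have : n 0 * n 1 ≤ (2 * N 3)^2 := by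
            rw [sq]; exact Nat.mul_le_mul (hb 0).le (hb 1).le
          exact_mod_cast this
        have h5 := (abs_le.mp h3).2
        have h6 : (((mm n).natAbs:ℕ):ℝ) ≤ 4 * N 3 := by exact_mod_cast hmle
        have h7 : (1:ℝ) ≤ N 3 := by exact_mod_cast hN 3
        have h8 : (((mm n).natAbs:ℕ):ℝ) * √((n 0 * n 1 : ℕ):ℝ) ≤ (4 * N 3) * (2 * N 3) := by gcongr
        have : (((vv n).natAbs : ℕ):ℝ) ≤ 40 * (N 3:ℝ)^2 := by
          have h9 : (1:ℝ) ≤ (N 3:ℝ)^2 := one_le_pow₀ h7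
          linarith
        exact_mod_cast this
      · rw [habs]; exact h4
      · rw [habs]; exact h3) (by
      intro x hx y hy hxy
      obtain ⟨h1, h2, h3, h4⟩ := hcore x hx
      obtain ⟨k1, k2, k3, k4⟩ := hcore y hy
      simp only [Prod.mk.injEq, decide_eq_decide] at hxy
      obtain ⟨⟨p0, p1, p2, p3⟩, p4, p5⟩ := hxy
      have q2 : mm x = mm y := by omega
      have q3 : vv x = vv y := by omega
      have hsum : (x 2:ℤ) + x 3 = y 2 + y 3 := by
        have := q2
        simp only [hmm, p0, p1] at this; omega
      have hprod : (x 2:ℤ) * x 3 = y 2 * y 3 := by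
        have := q3
        simp only [hvv, p0, p1] at this
        rw [q2] at this
        have hne : e 0 * e 1 ≠ 0 := by
          rcases he 0 with h | h <;> rcases he 1 with h' | h' <;> rw [h, h'] <;> norm_num
        have := mul_left_cancel₀ hne this
        linarith
      have hor : ((x 2:ℤ) - y 2) * (x 2 - y 3) = 0 := by
        have : (x 3:ℤ) = y 2 + y 3 - x 2 := by linarith
        rw [this] at hprod
        linear_combination -hprod
      have h23 : x 2 = y 2 ∧ x 3 = y 3 := by
        rcases mul_eq_zero.mp hor with h | h <;> omega
      funext i
      fin_cases i
      · exact p0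
      · exact p1
      · exact h23.1
      · exact h23.2)
  refine inj.trans ?_
  rw [Finset.card_product]
  simp
  linarith

theorem dbox_card (N : Fin 4 → ℕ) : ((dbox N).card : ℝ) = N 0 * N 1 * N 2 * N 3 := by
  rw [dbox, Fintype.card_piFinset]
  simp only [Nat.card_Ico, Fin.prod_univ_four]
  push_cast
  have : ∀ i, 2 * N i - N i = N i := fun i => by omega
  simp [this]

theorem window_count (N : Fin 4 → ℕ) (hN : ∀ i, 1 ≤ N i) (e : Fin 4 → ℤ) (he : ∀ i, e i = 1 ∨ e i = -1)
    (δ : ℝ) (hδ : 0 < δ) :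
    (((dbox N).filter (fun n => |Del e n| ≤ δ)).card : ℝ) ≤ N 0 * N 1 * N 2 * (1 + 6 * δ * √(N 3)) := by
  have h := card_le_sum_fiber' ((dbox N).filter (fun n => |Del e n| ≤ δ)) (fun n => (n 0, n 1, n 2))
    (Ico (N 0) (2 * N 0) ×ˢ Ico (N 1) (2 * N 1) ×ˢ Ico (N 2) (2 * N 2)) (by
      intro n hn
      simp only [Finset.mem_filter, dbox, Fintype.mem_piFinset] at hn
      simp only [Finset.mem_product]
      exact ⟨hn.1 0, hn.1 1, hn.1 2⟩) (fun _ => 1 + 6 * δ * √(N 3)) (by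
      intro b hb S hS
      refine le_trans (card_le_of_inj S _ (fun n => n 3) ?_ ?_)
        (card_sqrt_window (N 3) (hN 3) (- (e 3) * (e 0 * √b.1 + e 1 * √b.2.1 + e 2 * √b.2.2)) δ hδ)
      · intro n hn
        obtain ⟨h1, rfl⟩ := hS n hn
        simp only [Finset.mem_filter, dbox, Fintype.mem_piFinset] at h1
        rw [Finset.mem_filter]
        refine ⟨h1.1 3, ?_⟩
        have h2 := h1.2
        rw [Del_eq] at h2
        have h3 : √(n 3:ℝ) - (- (e 3:ℝ) * (e 0 * √(n 0) + e 1 * √(n 1) + e 2 * √(n 2))) =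
          e 3 * (e 0 * √(n 0) + e 1 * √(n 1) + e 2 * √(n 2) + e 3 * √(n 3)) := by
          linear_combination (-√(n 3:ℝ)) * sgn_mul_self (he 3)
        rw [h3, abs_mul, sign_abs (he 3), one_mul]
        exact h2
      · intro x hx y hy hxy
        have h1 := (hS x hx).2.trans (hS y hy).2.symm
        simp only [Prod.mk.injEq] at h1
        funext i
        fin_cases i
        · exact h1.1
        · exact h1.2.1
        · exact h1.2.2
        · exact hxy)
  refine h.trans ?_
  rw [Finset.sum_const, nsmul_eq_mul, Finset.card_product, Finset.card_product]
  simp only [Nat.card_Ico]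
  have : ∀ i, 2 * N i - N i = N i := fun i => by omega
  rw [this, this, this]
  push_cast
  apply le_of_eq; ring

/-- far boxes are empty -/
theorem Del_far (N : Fin 4 → ℕ) (e : Fin 4 → ℤ) (he : ∀ i, e i = 1 ∨ e i = -1)
    (h01 : N 0 ≤ N 2) (h12 : N 1 ≤ N 2) (hfar : 64 * N 2 ≤ N 3) (h1 : 1 ≤ N 3) (n : Fin 4 → ℕ) (hn : n ∈ dbox N) :
    0.4 * √(N 3) < |Del e n| := by
  simp only [dbox, Fintype.mem_piFinset] at hn
  have hs : 0 < √(N 3:ℝ) := Real.sqrt_pos.mpr (by exact_mod_cast h1)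
  have key : ∀ i, N i ≤ N 2 → √(n i:ℝ) ≤ 0.19 * √(N 3) := by
    intro i hi
    have := Finset.mem_Ico.mp (hn i)
    have h2 : 32 * n i ≤ N 3 := by omega
    have h3 : 32 * (n i:ℝ) ≤ N 3 := by exact_mod_cast h2
    rw [Real.sqrt_le_left (by positivity), mul_pow, Real.sq_sqrt (by positivity)]
    norm_num
    have : (0:ℝ) ≤ N 3 := by positivity
    linarith
  have k0 := key 0 h01; have k1 := key 1 h12; have k2 := key 2 le_rfl
  have k3 : √(N 3:ℝ) ≤ √(n 3:ℝ) := Real.sqrt_le_sqrt (by exact_mod_cast (Finset.mem_Ico.mp (hn 3)).1)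
  rw [Del_eq]
  have t : ∀ i, |(e i:ℝ) * √(n i)| = √(n i) := fun i => by
    rw [abs_mul, sign_abs (he i), one_mul, abs_of_nonneg (Real.sqrt_nonneg _)]
  have u1 := abs_add_le (-((e 0:ℝ) * √(n 0))) (-((e 1:ℝ) * √(n 1)))
  have u2 := abs_add_le (-((e 0:ℝ) * √(n 0)) + -((e 1:ℝ) * √(n 1))) (-((e 2:ℝ) * √(n 2)))
  have u3 := abs_add_le (-((e 0:ℝ) * √(n 0)) + -((e 1:ℝ) * √(n 1)) + (-((e 2:ℝ) * √(n 2))))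
    (e 0 * √(n 0) + e 1 * √(n 1) + e 2 * √(n 2) + e 3 * √(n 3))
  have e3 : -((e 0:ℝ) * √(n 0)) + -((e 1:ℝ) * √(n 1)) + (-((e 2:ℝ) * √(n 2))) +
    (e 0 * √(n 0) + e 1 * √(n 1) + e 2 * √(n 2) + e 3 * √(n 3)) = e 3 * √(n 3) := by ring
  rw [e3, t 3] at u3
  rw [abs_neg, abs_neg, t 0, t 1] at u1
  rw [abs_neg ((e 2:ℝ) * √(n 2)), t 2] at u2
  linarith

theorem case_i {x y z w t δ : ℝ} (hx : 1 ≤ x) (hy : 1 ≤ y) (hz : 1 ≤ z) (hw : 1 ≤ w) (hzw : z ≤ w)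
    (hxy : x * y ≤ t^6) (hδ : 0.4 * w^2 ≤ δ) :
    x^4 * y^4 * z^4 * w^4 ≤ 3 * (t^6 * δ * (x * y * z * w)^3) := by
  have h1 : x * y * z * w ≤ 3 * (t^6 * δ) := by
    have h0 : 0 ≤ t^6 := by positivity
    calc x * y * z * w ≤ t^6 * w * w := by gcongr
      _ = t^6 * w^2 := by ring
      _ ≤ t^6 * (3 * δ) := by gcongr; norm_num at hδ; linarith [sq_nonneg w]
      _ = _ := by ring
  calc x^4 * y^4 * z^4 * w^4 = (x * y * z * w) * (x * y * z * w)^3 := by ring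
    _ ≤ (3 * (t^6 * δ)) * (x * y * z * w)^3 := by gcongr
    _ = _ := by ring

theorem case_iii {x y z w t δ : ℝ} (hx : 1 ≤ x) (hy : 1 ≤ y) (hz : 1 ≤ z) (hw : 1 ≤ w) (ht : 1 ≤ t)
    (hxw : x ≤ w) (hyz : y ≤ z)
    (hxy : x * y ≤ t^6) (hδ0 : 0 < δ) (hδ : 1 ≤ t^8 * δ) (hwz : w ≤ 3 * z) (htw : t ≤ w) :
    (x^6 * z^4 + δ * z^6 * x^8) * (y^6 * w^4 + δ * w^6 * y^8) ≤ 12 * (t^6 * δ * (x * y * z * w)^3)^2 := by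
  have e1 : 1 ≤ 9 * (t^6 * δ)^2 * z^2 * w^2 := by
    calc (1:ℝ) = 1^2 := by norm_num
      _ ≤ (t^8 * δ)^2 := by gcongr
      _ = (t^6 * δ)^2 * t^2 * t^2 := by ring
      _ ≤ (t^6 * δ)^2 * w^2 * w^2 := by gcongr
      _ ≤ (t^6 * δ)^2 * (3 * z)^2 * w^2 := by gcongr
      _ = _ := by ring
  have e2 : δ ≤ (t^6 * δ)^2 := by
    have : t^8 ≤ t^12 := pow_le_pow_right₀ ht (by norm_num)
    have : 1 ≤ t^12 * δ := hδ.trans (by gcongr)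
    calc δ = 1 * δ := by ring
      _ ≤ (t^12 * δ) * δ := by gcongr
      _ = _ := by ring
  set P := t^6 * δ with hP
  have c1 : x^6 * z^4 * (y^6 * w^4) ≤ 9 * (P * (x * y * z * w)^3)^2 := by
    calc x^6 * z^4 * (y^6 * w^4) = 1 * (x^6 * z^4 * (y^6 * w^4)) := by ring
      _ ≤ (9 * P^2 * z^2 * w^2) * (x^6 * z^4 * (y^6 * w^4)) := by gcongr
      _ = _ := by ring
  have c2 : x^6 * z^4 * (δ * w^6 * y^8) ≤ (P * (x * y * z * w)^3)^2 := by
    calc x^6 * z^4 * (δ * w^6 * y^8) = x^6 * z^4 * w^6 * y^6 * (δ * y^2) := by ring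
      _ ≤ x^6 * z^4 * w^6 * y^6 * (P^2 * z^2) := by gcongr
      _ = _ := by ring
  have c3 : δ * z^6 * x^8 * (y^6 * w^4) ≤ (P * (x * y * z * w)^3)^2 := by
    calc δ * z^6 * x^8 * (y^6 * w^4) = x^6 * z^6 * w^4 * y^6 * (δ * x^2) := by ring
      _ ≤ x^6 * z^6 * w^4 * y^6 * (P^2 * w^2) := by gcongr
      _ = _ := by ring
  have c4 : δ * z^6 * x^8 * (δ * w^6 * y^8) ≤ (P * (x * y * z * w)^3)^2 := by
    calc δ * z^6 * x^8 * (δ * w^6 * y^8) = x^6 * z^6 * w^6 * y^6 * ((x * y) * δ)^2 := by ring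
      _ ≤ x^6 * z^6 * w^6 * y^6 * (t^6 * δ)^2 := by gcongr
      _ = _ := by rw [← hP]; ring
  have e : (x^6 * z^4 + δ * z^6 * x^8) * (y^6 * w^4 + δ * w^6 * y^8) = x^6 * z^4 * (y^6 * w^4) + x^6 * z^4 * (δ * w^6 * y^8)
    + δ * z^6 * x^8 * (y^6 * w^4) + δ * z^6 * x^8 * (δ * w^6 * y^8) := by ring
  rw [e]; linarith

theorem case_iv {x y z w t δ : ℝ} (hx : 1 ≤ x) (hy : 1 ≤ y) (hz : 1 ≤ z) (hw : 1 ≤ w) (ht : 1 ≤ t)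
    (hxw : x ≤ w) (hyw : y ≤ w) (hzw : z ≤ w) (hδ0 : 0 < δ) (hwt : w ≤ t) (hδ : 1 ≤ 144 * (δ * w^6)) :
    x^4 * y^4 * z^4 * (1 + 6 * δ * w^2) ≤ 1000 * (t^6 * δ * (x * y * z * w)^3) := by
  have h0 : x * y * z ≤ w^3 := by
    calc x * y * z ≤ w * w * w := by gcongr
      _ = _ := by ring
  have h6 : w^6 ≤ t^6 := by gcongr
  have h2 : w^2 ≤ t^6 := by
    calc w^2 ≤ t^2 := by gcongr
      _ ≤ t^6 := pow_le_pow_right₀ ht (by norm_num)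
  have h1 : x * y * z * (1 + 6 * δ * w^2) ≤ 1000 * (t^6 * δ) * w^3 := by
    calc x * y * z * (1 + 6 * δ * w^2) ≤ w^3 * (144 * (δ * w^6) + 6 * δ * w^2) := by gcongr
      _ ≤ w^3 * (144 * (δ * t^6) + 6 * δ * t^6) := by gcongr
      _ = 150 * (w^3 * (t^6 * δ)) := by ring
      _ ≤ 1000 * (w^3 * (t^6 * δ)) := by gcongr; norm_num
      _ = _ := by ring
  calc x^4 * y^4 * z^4 * (1 + 6 * δ * w^2) = (x * y * z)^3 * (x * y * z * (1 + 6 * δ * w^2)) := by ring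
    _ ≤ (x * y * z)^3 * (1000 * (t^6 * δ) * w^3) := by gcongr
    _ = _ := by ring

theorem case_v {x y z w t δ : ℝ} (hx : 1 ≤ x) (hy : 1 ≤ y) (hz : 1 ≤ z) (hw : 1 ≤ w) (ht : 1 ≤ t)
    (hxw : x ≤ w) (hyw : y ≤ w) (hδ0 : 0 < δ) (hwt : w ≤ t) (hδ : 1 ≤ t^8 * δ) (hwz : w ≤ 3 * z) :
    4 * (48 * √(72 * (δ * (w^2)^3)) * w^4 * ((x * y)^2 * (x * y)) + 9008 * (72 * (δ * (w^2)^3)) * w^4 * (x * y)^4)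
      ≤ 100000000 * (t^6 * δ * (x * y * z * w)^3) := by
  set r := √δ with hr
  have hr2 : r^2 = δ := Real.sq_sqrt hδ0.le
  have hr0 : 0 < r := Real.sqrt_pos.mpr hδ0
  have hrt : 1 ≤ r * t^4 := by
    rw [← hr2, show t^8 * r^2 = (r * t^4)^2 by ring] at hδ
    exact (one_le_sq_iff₀ (by positivity)).mp hδ
  have hs : √(72 * (δ * (w^2)^3)) ≤ 9 * (r * w^3) := by
    rw [Real.sqrt_le_left (by positivity), ← hr2]
    have : 0 ≤ r^2 * w^6 := by positivity
    calc 72 * (r^2 * (w^2)^3) = 72 * (r^2 * w^6) := by ring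
      _ ≤ 81 * (r^2 * w^6) := by linarith
      _ = _ := by ring
  have hz3 : w^6 ≤ 27 * (z^3 * w^3) := by
    calc w^6 = w^3 * w^3 := by ring
      _ ≤ (3 * z)^3 * w^3 := by gcongr
      _ = _ := by ring
  have f1 : r * w^7 ≤ 27 * (t^6 * r^2 * (z^3 * w^3)) := by
    calc r * w^7 = 1 * (r * w * w^6) := by ring
      _ ≤ (r * t^4) * (r * t * (27 * (z^3 * w^3))) := by gcongr
      _ = 27 * (t^5 * r^2 * (z^3 * w^3)) := by ring
      _ ≤ _ := by gcongr <;> norm_num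
  have f2 : w^10 * (x * y) ≤ 27 * (t^6 * (z^3 * w^3)) := by
    calc w^10 * (x * y) ≤ w^10 * (w * w) := by gcongr
      _ = w^6 * w^6 := by ring
      _ ≤ t^6 * (27 * (z^3 * w^3)) := by gcongr
      _ = _ := by ring
  calc _ ≤ 4 * (48 * (9 * (r * w^3)) * w^4 * ((x * y)^2 * (x * y)) + 9008 * (72 * (δ * (w^2)^3)) * w^4 * (x * y)^4) := by gcongr
    _ = 1728 * ((x * y)^3 * (r * w^7)) + 2594304 * (r^2 * (x * y)^3 * (w^10 * (x * y))) := by rw [← hr2]; ring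
    _ ≤ 1728 * ((x * y)^3 * (27 * (t^6 * r^2 * (z^3 * w^3)))) + 2594304 * (r^2 * (x * y)^3 * (27 * (t^6 * (z^3 * w^3)))) := by gcongr
    _ = 70092864 * (t^6 * δ * (x * y * z * w)^3) := by rw [← hr2]; ring
    _ ≤ _ := by gcongr; norm_num

set_option maxHeartbeats 1000000 in
theorem count_sorted (N : Fin 4 → ℕ) (e : Fin 4 → ℤ) (he : ∀ i, e i = 1 ∨ e i = -1)
    (q : Fin 4 → ℝ) (hq1 : ∀ i, 1 ≤ q i) (hqN : ∀ i, (N i:ℝ) = q i ^ 4)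
    (h01 : q 0 ≤ q 1) (h12 : q 1 ≤ q 2) (h23 : q 2 ≤ q 3) (t δ F D : ℝ) (ht : 1 ≤ t) (hqt : q 3 ≤ t^3)
    (hδ : 0 < δ) (hδt : 1 ≤ t^8 * δ) (hF1 : 1 ≤ F) (hFlog : 1 + log (N 3) ≤ F)
    (hD1 : 1 ≤ D) (hD : ∀ n, 1 ≤ n → n ≤ 64 * (N 3)^2 → ((Nat.divisors n).card : ℝ) ≤ D)
    (hFD : (1 + log (4*N 3)) * (Nat.log 2 (4*N 3) + 1) * D^2 ≤ F) :
    (((dbox N).filter (fun n => Del e n ≠ 0 ∧ |Del e n| ≤ δ)).card : ℝ) ≤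
      100000000 * F * (t^6 * δ * (q 0 * q 1 * q 2 * q 3)^3) := by
  have hN : ∀ i, 1 ≤ N i := by
    intro i
    have : (1:ℝ) ≤ N i := by rw [hqN]; exact one_le_pow₀ (hq1 i)
    exact_mod_cast this
  have hsq : ∀ i, √(N i:ℝ) = q i ^ 2 := by
    intro i
    have : 0 ≤ q i := by linarith [hq1 i]
    rw [hqN, show q i ^ 4 = (q i ^ 2)^2 by ring, Real.sqrt_sq (by positivity)]
  have hle : ∀ i j, q i ≤ q j → N i ≤ N j := by
    intro i j h
    have : (N i:ℝ) ≤ N j := by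
      rw [hqN, hqN]; exact pow_le_pow_left₀ (by linarith [hq1 i]) h 4
    exact_mod_cast this
  set Sset := (dbox N).filter (fun n => Del e n ≠ 0 ∧ |Del e n| ≤ δ) with hSset
  have hsub : ((Sset.card:ℕ):ℝ) ≤ (((dbox N).filter (fun n => |Del e n| ≤ δ)).card : ℝ) := by
    exact_mod_cast Finset.card_le_card (fun n hn => by
      simp only [hSset, Finset.mem_filter] at hn ⊢; exact ⟨hn.1, hn.2.2⟩)
  have htriv : ((Sset.card:ℕ):ℝ) ≤ ((dbox N).card:ℝ) := by
    exact_mod_cast Finset.card_le_card (Finset.filter_subset _ _)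
  have hcard := dbox_card N
  have hwin := window_count N hN e he δ hδ
  have hen := quad_energy N e he hN (hle 0 2 (h01.trans h12)) (hle 1 3 (h12.trans h23)) δ hδ
  have hfar := Del_far N e he (hle 0 2 (h01.trans h12)) (hle 1 2 h12)
  have har := arith_count N e he hN (fun i => by
    fin_cases i
    · exact hle 0 3 (h01.trans (h12.trans h23))
    · exact hle 1 3 (h12.trans h23)
    · exact hle 2 3 h23
    · exact le_rfl) δ hδ
  have hA := fun (hη : 72 * (δ * √(N 3)^3) ≤ 1/2) => Aset_bound (N 0) (N 1) (N 3) (hN 0) (hN 1) (hle 0 3 (h01.trans (h12.trans h23)))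
    (hle 1 3 (h12.trans h23)) (72 * (δ * √(N 3)^3)) (by
      have := hsq 3
      have h1 := hq1 3
      rw [this]; positivity) hη D hD1 hD
  have hlog2 : log (N 2) ≤ log (N 3) := Real.log_le_log (by exact_mod_cast hN 2) (by exact_mod_cast hle 2 3 h23)
  have hlogpos : 0 ≤ log (N 2) := Real.log_nonneg (by exact_mod_cast hN 2)
  have hq64 : ¬ (64 * N 2 ≤ N 3) → q 3 ≤ 3 * q 2 := by
    intro h
    by_contra hc
    push Not at hc
    apply h
    have : (64:ℝ) * N 2 ≤ N 3 := by
      rw [hqN, hqN]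
      have := pow_le_pow_left₀ (by linarith [hq1 2]) hc.le 4
      rw [mul_pow] at this
      have : 0 ≤ q 2 ^ 4 := by positivity
      linarith
    exact_mod_cast this
  have hW : √((N 0 * N 1 : ℕ):ℝ) = (q 0 * q 1)^2 := by
    have a0 := hq1 0; have a1 := hq1 1
    push_cast
    rw [hqN, hqN, show q 0 ^ 4 * q 1 ^ 4 = ((q 0 * q 1)^2)^2 by ring, Real.sqrt_sq (by positivity)]
  have hW2 : √√((N 0 * N 1 : ℕ):ℝ) = q 0 * q 1 := by
    have a0 := hq1 0; have a1 := hq1 1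
    rw [hW, Real.sqrt_sq (by positivity)]
  have hW0 : ((N 0 * N 1 : ℕ):ℝ) = (q 0 * q 1)^4 := by push_cast; rw [hqN, hqN]; ring
  rw [hW2, hW, hW0] at hA
  rw [hsq 0, hsq 1, hsq 2, hsq 3, hqN 0, hqN 1, hqN 2, hqN 3] at hen
  rw [hsq 3, hqN 0, hqN 1, hqN 2] at hwin
  rw [hsq 3] at hfar hA har
  rw [hqN 0, hqN 1, hqN 2, hqN 3] at hcard
  have a0 := hq1 0; have a1 := hq1 1; have a2 := hq1 2; have a3 := hq1 3
  rw [hqN 2, hqN 3] at hlog2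
  rw [hqN 3] at hFlog
  rw [hqN 2] at hlogpos
  have hN3 := hN 3
  rw [hqN 3] at hA hFD
  generalize hLG : (Nat.log 2 (4 * N 3) : ℝ) = LG at hA hFD
  have hLG0 : 0 ≤ LG := by rw [← hLG]; positivity
  generalize hx : q 0 = x at *
  generalize hy : q 1 = y at *
  generalize hz : q 2 = z at *
  generalize hw : q 3 = w at *
  have hS0 : 0 ≤ t^6 * δ * (x * y * z * w)^3 := by positivity
  have pxy : x * y ≤ t^6 := by
    calc x * y ≤ t^3 * t^3 := by gcongr <;> linarith
      _ = t^6 := by ring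
  have hxw : x ≤ w := by linarith
  have hyw : y ≤ w := by linarith
  have hFX : ∀ c : ℝ, 0 ≤ c → c ≤ 100000000 → c * (t^6 * δ * (x * y * z * w)^3) ≤ 100000000 * F * (t^6 * δ * (x * y * z * w)^3) := by
    intro c hc hc2
    apply mul_le_mul_of_nonneg_right _ hS0
    linarith
  by_cases hi : 0.4 * w^2 ≤ δ
  · have := case_i a0 a1 a2 a3 h23 pxy hi
    rw [hcard] at htriv
    exact htriv.trans (this.trans (hFX 3 (by norm_num) (by norm_num)))
  push Not at hi
  by_cases hii : 64 * N 2 ≤ N 3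
  · have hemp : Sset = ∅ := by
      rw [hSset, Finset.filter_eq_empty_iff]
      intro n hn hc
      have := hfar hii hN3 n hn
      linarith [hc.2]
    rw [hemp]
    have := hFX 0 le_rfl (by norm_num)
    simpa using this
  have hwz := hq64 hii
  by_cases hiii : t ≤ w
  · have h3 := case_iii a0 a1 a2 a3 ht hxw h12 pxy hδ hδt hwz hiii
    refine le_trans hsub ?_
    refine abs_le_of_sq_le_sq' ?_ (by positivity) |>.2
    refine hen.trans ?_
    have hlz : 1 + log (z^4) ≤ F := by linarith
    have hlw : 0 ≤ log (w^4) := hlogpos.trans hlog2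
    have e1 : ((x^2)^3 * z^4 + δ * (z^2)^3 * (x^4)^2) = x^6 * z^4 + δ * z^6 * x^8 := by ring
    have e2 : ((y^2)^3 * w^4 + δ * (w^2)^3 * (y^4)^2) = y^6 * w^4 + δ * w^6 * y^8 := by ring
    rw [e1, e2]
    calc _ ≤ 9 * ((400 * F * (x^6 * z^4 + δ * z^6 * x^8)) * (400 * F * (y^6 * w^4 + δ * w^6 * y^8))) := by
          gcongr
      _ = 1440000 * F^2 * ((x^6 * z^4 + δ * z^6 * x^8) * (y^6 * w^4 + δ * w^6 * y^8)) := by ring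
      _ ≤ 1440000 * F^2 * (12 * (t^6 * δ * (x * y * z * w)^3)^2) := by gcongr
      _ = 17280000 * (F^2 * (t^6 * δ * (x * y * z * w)^3)^2) := by ring
      _ ≤ 10000000000000000 * (F^2 * (t^6 * δ * (x * y * z * w)^3)^2) := by gcongr; norm_num
      _ = _ := by ring
  push Not at hiii
  by_cases hiv : 144 * (δ * (w^2)^3) ≤ 1
  · have h5 := case_v a0 a1 a2 a3 ht hxw hyw hδ hiii.le hδt hwz
    refine (har hiv).trans ?_
    have h6 := hA (by linarith)
    set Y := 48 * √(72 * (δ * (w^2)^3)) * w^4 * ((x * y)^2 * (x * y)) + 9008 * (72 * (δ * (w^2)^3)) * w^4 * (x * y)^4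
      with hY
    have hY0 : 0 ≤ Y := by positivity
    calc _ ≤ 4 * ((1 + log (4 * w^4)) * (LG + 1) * (D^2 * Y)) := by gcongr
      _ = ((1 + log (4 * w^4)) * (LG + 1) * D^2) * (4 * Y) := by ring
      _ ≤ F * (100000000 * (t^6 * δ * (x * y * z * w)^3)) := by gcongr
      _ = _ := by ring
  · push Not at hiv
    have h4 := case_iv a0 a1 a2 a3 ht hxw hyw h23 hδ hiii.le (by
      have : (w^2)^3 = w^6 := by ring
      rw [this] at hiv; exact hiv.le)
    exact hsub.trans (hwin.trans (h4.trans (hFX 1000 (by norm_num) (by norm_num))))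

theorem log_pow_bound (ε : ℝ) (hε : 0 < ε) : ∃ C : ℝ, 1 ≤ C ∧ ∀ T : ℝ, 1 ≤ T → 1 + log (4 * T) ≤ C * T ^ ε := by
  refine ⟨1 + 4 ^ ε / ε, by have : 0 < (4:ℝ) ^ ε / ε := by positivity
                            linarith, fun T hT => ?_⟩
  have h1 := Real.log_le_rpow_div (by linarith : 0 ≤ 4 * T) hε
  rw [Real.mul_rpow (by norm_num) (by linarith)] at h1
  have h2 : 1 ≤ T ^ ε := Real.one_le_rpow hT hε.le
  calc 1 + log (4 * T) ≤ T ^ ε + 4 ^ ε * T ^ ε / ε := by linarith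
    _ = _ := by ring

theorem Del_perm (σ : Equiv.Perm (Fin 4)) (e : Fin 4 → ℤ) (n : Fin 4 → ℕ) : Del (e ∘ σ) (n ∘ σ) = Del e n := by
  unfold Del
  exact Equiv.sum_comp σ (fun i => (e i : ℝ) * √(n i))

theorem count_perm (σ : Equiv.Perm (Fin 4)) (N : Fin 4 → ℕ) (e : Fin 4 → ℤ) (p : ℝ → Prop) :
    (((dbox N).filter (fun n => p (Del e n))).card : ℝ) ≤
      (((dbox (N ∘ σ)).filter (fun n => p (Del (e ∘ σ) n))).card : ℝ) := by
  refine card_le_of_inj _ _ (fun n => n ∘ σ) ?_ ?_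
  · intro n hn
    simp only [Finset.mem_filter, dbox, Fintype.mem_piFinset] at hn ⊢
    exact ⟨fun i => hn.1 (σ i), by rw [Del_perm]; exact hn.2⟩
  · intro x _ y _ h
    funext i
    have := congrFun h (σ.symm i)
    simpa using this

theorem natlog_le (n : ℕ) (hn : 1 ≤ n) : (Nat.log 2 n : ℝ) ≤ 2 * log n := by
  have h1 : ((2 ^ Nat.log 2 n : ℕ):ℝ) ≤ n := by exact_mod_cast Nat.pow_log_le_self 2 (by omega)
  have h2 := Real.log_le_log (by positivity) h1
  push_cast at h2
  rw [Real.log_pow] at h2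
  have h3 : 0.5 < log 2 := by have := Real.log_two_gt_d9; linarith
  have h4 : (0:ℝ) ≤ Nat.log 2 n := by positivity
  nlinarith

theorem count_bound (ε : ℝ) (hε : 0 < ε) : ∃ C : ℝ, 1 ≤ C ∧ ∀ T : ℝ, 1 ≤ T → ∀ (e : Fin 4 → ℤ),
    (∀ i, e i = 1 ∨ e i = -1) → ∀ N : Fin 4 → ℕ, (∀ i, 1 ≤ N i) → (∀ i, (N i:ℝ) ≤ T ^ (3/4:ℝ)) →
    ∀ δ : ℝ, T ^ (-(1/2):ℝ) ≤ δ →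
    (((dbox N).filter (fun n => Del e n ≠ 0 ∧ |Del e n| ≤ δ)).card : ℝ) ≤
      C * T ^ ε * (T ^ (3/8:ℝ) * δ * ∏ i, (N i:ℝ) ^ (3/4:ℝ)) := by
  obtain ⟨C1, hC1, hd⟩ := divisor_bound (ε/8) (by positivity)
  obtain ⟨C2, hC2, hl⟩ := log_pow_bound (ε/4) (by positivity)
  refine ⟨100000000 * (2 * C2^2 * C1^2 * (64:ℝ)^(ε/4)), ?_, ?_⟩
  · have h64 : 1 ≤ (64:ℝ)^(ε/4) := Real.one_le_rpow (by norm_num) (by positivity)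
    have a1 : 1 ≤ C1^2 := one_le_pow₀ hC1
    have a2 : 1 ≤ C2^2 := one_le_pow₀ hC2
    have : 1 ≤ C2^2 * C1^2 * (64:ℝ)^(ε/4) := one_le_mul_of_one_le_of_one_le (one_le_mul_of_one_le_of_one_le a2 a1) h64
    linarith
  intro T hT e he N hN hNT δ hδ
  have hT0 : 0 < T := by linarith
  set σ := Tuple.sort N
  have hmono : Monotone (N ∘ σ) := Tuple.monotone_sort N
  set N' := N ∘ σ with hN'
  have hN'1 : ∀ i, 1 ≤ N' i := fun i => hN (σ i)
  have hN'T : ∀ i, (N' i:ℝ) ≤ T ^ (3/4:ℝ) := fun i => hNT (σ i)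
  have hN'T1 : ∀ i, (N' i:ℝ) ≤ T := fun i => (hN'T i).trans (by
    calc T ^ (3/4:ℝ) ≤ T ^ (1:ℝ) := Real.rpow_le_rpow_of_exponent_le hT (by norm_num)
      _ = T := Real.rpow_one T)
  set q : Fin 4 → ℝ := fun i => (N' i:ℝ) ^ (1/4:ℝ) with hq
  have hδ0 : 0 < δ := lt_of_lt_of_le (by positivity) hδ
  set D := C1 * (64 * T^2) ^ (ε/8) with hD
  have hT2 : 1 ≤ T^2 := one_le_pow₀ hT
  have hD1 : 1 ≤ D := one_le_mul_of_one_le_of_one_le hC1 (Real.one_le_rpow (by linarith) (by positivity))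
  have hL1 : 0 ≤ log (4 * T) := Real.log_nonneg (by linarith)
  set F := 2 * (1 + log (4*T))^2 * D^2 with hF
  have hD2 : 1 ≤ D^2 := one_le_pow₀ hD1
  have hFT : F ≤ (2 * C2^2 * C1^2 * (64:ℝ)^(ε/4)) * T ^ ε := by
    have h1 : D^2 = C1^2 * (64:ℝ)^(ε/4) * T^(ε/2) := by
      rw [hD, Real.mul_rpow (by norm_num) (by positivity), ← Real.rpow_natCast T 2, ← Real.rpow_mul hT0.le]
      rw [mul_pow, mul_pow, ← Real.rpow_natCast ((64:ℝ)^(ε/8)) 2, ← Real.rpow_mul (by norm_num),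
        ← Real.rpow_natCast (T ^ _) 2, ← Real.rpow_mul hT0.le]
      have e1 : ε / 8 * ((2:ℕ):ℝ) = ε/4 := by push_cast; ring
      have e2 : ((2:ℕ):ℝ) * (ε / 8) * ((2:ℕ):ℝ) = ε/2 := by push_cast; ring
      rw [e1, e2]; ring
    have h2 : (1 + log (4*T))^2 ≤ C2^2 * T^(ε/2) := by
      calc (1 + log (4*T))^2 ≤ (C2 * T^(ε/4))^2 := by gcongr; exact hl T hT
        _ = C2^2 * T^(ε/2) := by
          rw [mul_pow, ← Real.rpow_natCast (T^(ε/4)) 2, ← Real.rpow_mul hT0.le]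
          congr 2; push_cast; ring
    have h3 : T^ε = T^(ε/2) * T^(ε/2) := by rw [← Real.rpow_add hT0]; congr 1; ring
    rw [hF, h1, h3]
    calc _ ≤ 2 * (C2^2 * T^(ε/2)) * (C1^2 * (64:ℝ)^(ε/4) * T^(ε/2)) := by gcongr
      _ = _ := by ring
  have hpow : ∀ k : ℕ, (T ^ (1/16:ℝ))^k = T ^ ((k:ℝ)/16) := by
    intro k
    rw [← Real.rpow_natCast, ← Real.rpow_mul hT0.le]; congr 1; ring
  have hlogN : log (4 * N' 3) ≤ log (4 * T) := by
    apply Real.log_le_log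
    · have := hN'1 3
      positivity
    · have := hN'T1 3
      linarith
  have hlogN0 : 0 ≤ log (4 * N' 3) := by
    apply Real.log_nonneg
    have : (1:ℝ) ≤ N' 3 := by exact_mod_cast hN'1 3
    linarith
  have hq1 : ∀ i, 1 ≤ q i := fun i => Real.one_le_rpow (by exact_mod_cast hN'1 i) (by norm_num)
  have hqle : ∀ i j : Fin 4, i ≤ j → q i ≤ q j := by
    intro i j hij
    exact Real.rpow_le_rpow (by positivity) (by exact_mod_cast hmono hij) (by norm_num)
  have key := count_sorted N' (e ∘ σ) (fun i => he (σ i)) q hq1 (fun i => by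
      simp only [hq]
      rw [← Real.rpow_natCast, ← Real.rpow_mul (by positivity)]
      norm_num) (hqle 0 1 (by decide)) (hqle 1 2 (by decide)) (hqle 2 3 (by decide))
      (T ^ (1/16:ℝ)) δ F D (Real.one_le_rpow hT (by norm_num)) (by
        rw [hpow 3]
        calc q 3 ≤ (T ^ (3/4:ℝ)) ^ (1/4:ℝ) := Real.rpow_le_rpow (by positivity) (hN'T 3) (by norm_num)
          _ = T ^ ((3:ℕ)/16:ℝ) := by rw [← Real.rpow_mul hT0.le]; congr 1; norm_num) hδ0 (by
        rw [hpow 8]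
        calc (1:ℝ) = T ^ (((8:ℕ):ℝ)/16) * T ^ (-(1/2):ℝ) := by
              rw [← Real.rpow_add hT0]; norm_num
          _ ≤ _ := by gcongr) (by
        have : 1 ≤ (1 + log (4*T))^2 := one_le_pow₀ (by linarith)
        nlinarith) (by
        have h1 : log (N' 3) ≤ log (4 * T) := by
          refine (Real.log_le_log ?_ ?_).trans hlogN
          · exact_mod_cast hN'1 3
          · have : (0:ℝ) ≤ N' 3 := by positivity
            linarith
        have h2 : 1 + log (4*T) ≤ (1 + log (4*T))^2 := by nlinarith
        have h3 : 0 ≤ (1 + log (4*T))^2 := by positivity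
        nlinarith) hD1 (by
        intro n h1 h2
        refine (hd n h1).trans ?_
        rw [hD]
        gcongr
        have : (n:ℝ) ≤ 64 * (N' 3:ℝ)^2 := by exact_mod_cast h2
        refine this.trans ?_
        gcongr
        exact hN'T1 3) (by
        rw [hF]
        apply mul_le_mul_of_nonneg_right _ (by positivity)
        have h1 := natlog_le (4 * N' 3) (by have := hN'1 3; omega)
        push_cast at h1
        calc (1 + log (4 * N' 3)) * (Nat.log 2 (4 * N' 3) + 1)
            ≤ (1 + log (4 * T)) * (2 * log (4 * T) + 1) := by
              gcongr
              exact h1.trans (by linarith)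
          _ ≤ _ := by nlinarith)
  have hperm := count_perm σ N e (fun d => d ≠ 0 ∧ |d| ≤ δ)
  refine le_trans (le_of_eq (by congr!)) (hperm.trans (le_trans (le_of_eq (by congr!)) (key.trans ?_)))
  have hprod : (q 0 * q 1 * q 2 * q 3)^3 = ∏ i, (N i:ℝ) ^ (3/4:ℝ) := by
    rw [← Equiv.prod_comp σ, Fin.prod_univ_four]
    have : ∀ i, (N (σ i):ℝ)^(3/4:ℝ) = q i ^ 3 := by
      intro i
      simp only [hq, hN', Function.comp]
      rw [← Real.rpow_natCast, ← Real.rpow_mul (by positivity)]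
      norm_num
    rw [this, this, this, this]; ring
  rw [hprod, hpow 6]
  have e6 : T ^ (((6:ℕ):ℝ)/16) = T ^ (3/8:ℝ) := by congr 1; norm_num
  rw [e6]
  have hP0 : 0 ≤ T ^ (3/8:ℝ) * δ * ∏ i, (N i:ℝ) ^ (3/4:ℝ) := by
    have : 0 ≤ ∏ i, (N i:ℝ) ^ (3/4:ℝ) := Finset.prod_nonneg (fun i _ => by positivity)
    positivity
  calc _ ≤ 100000000 * ((2 * C2^2 * C1^2 * (64:ℝ)^(ε/4)) * T ^ ε) * (T ^ (3/8:ℝ) * δ * ∏ i, (N i:ℝ) ^ (3/4:ℝ)) := by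
        gcongr
    _ = _ := by ring

/-- weight attached to a quadruple -/
def wt (n : Fin 4 → ℕ) : ℝ := ∏ i, (((Nat.divisors (n i)).card : ℝ) * (n i : ℝ) ^ (-(3:ℝ)/4))

theorem wt_nonneg (n : Fin 4 → ℕ) : 0 ≤ wt n := Finset.prod_nonneg (fun i _ => by positivity)

theorem dyadic_min {ι : Type*} (S : Finset ι) (D : ι → ℝ) (P : ℝ) (hP : 0 < P) (J : ℕ)
    (hD : ∀ n ∈ S, |D n| ≤ 2 ^ J / P) :
    ∑ n ∈ S, min P (1 / |D n|) ≤ ∑ j ∈ range (J+1), 2 * P / 2 ^ j * ((S.filter (fun n => |D n| ≤ 2 ^ j / P)).card : ℝ) := by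
  have h1 : ∀ n ∈ S, min P (1 / |D n|) ≤ ∑ j ∈ range (J+1), if |D n| ≤ 2^j / P then 2 * P / 2 ^ j else 0 := by
    intro n hn
    have hex : ∃ j : ℕ, |D n| ≤ 2 ^ j / P := ⟨J, hD n hn⟩
    have hf := Nat.find_spec hex
    have hle : Nat.find hex ≤ J := Nat.find_min' hex (hD n hn)
    have hs := Finset.single_le_sum (f := fun j => if |D n| ≤ 2^j / P then 2 * P / 2 ^ j else 0) (s := range (J+1))
      (fun j _ => by split_ifs <;> positivity) (Finset.mem_range.2 (Nat.lt_succ_of_le hle))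
    refine le_trans ?_ hs
    simp only [hf, if_true]
    rcases Nat.eq_zero_or_pos (Nat.find hex) with h0 | h0
    · rw [h0]
      refine (min_le_left _ _).trans ?_
      rw [pow_zero]; linarith
    · refine (min_le_right _ _).trans ?_
      have hm := Nat.find_min hex (m := Nat.find hex - 1) (by omega)
      push Not at hm
      obtain ⟨m, hm'⟩ : ∃ m, Nat.find hex = m + 1 := ⟨Nat.find hex - 1, by omega⟩
      rw [hm'] at hm ⊢
      simp only [Nat.add_sub_cancel] at hm
      have h2 : 0 < (2:ℝ)^m / P := by positivity
      calc 1 / |D n| ≤ 1 / (2 ^ m / P) := one_div_le_one_div_of_le h2 hm.le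
        _ = 2 * P / 2 ^ (m+1) := by field_simp; ring
  refine (Finset.sum_le_sum h1).trans ?_
  rw [Finset.sum_comm]
  refine Finset.sum_le_sum (fun j _ => ?_)
  rw [← Finset.sum_filter, Finset.sum_const, nsmul_eq_mul, mul_comm]

theorem Del_le (e : Fin 4 → ℤ) (he : ∀ i, e i = 1 ∨ e i = -1) (n : Fin 4 → ℕ) (B : ℝ) (h : ∀ i, √(n i) ≤ B) :
    |Del e n| ≤ 4 * B := by
  unfold Del
  refine (Finset.abs_sum_le_sum_abs _ _).trans ?_
  have : ∀ i ∈ (Finset.univ : Finset (Fin 4)), |(e i:ℝ) * √(n i)| ≤ B := by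
    intro i _
    rw [abs_mul, abs_of_nonneg (Real.sqrt_nonneg _)]
    have : |(e i:ℝ)| = 1 := by rcases he i with h | h <;> simp [h]
    rw [this, one_mul]; exact h i
  refine (Finset.sum_le_sum this).trans ?_
  simp

theorem mem_dbox_log (n : Fin 4 → ℕ) (h : ∀ i, 1 ≤ n i) : n ∈ dbox (fun i => 2 ^ (Nat.log 2 (n i))) := by
  simp only [dbox, Fintype.mem_piFinset, Finset.mem_Ico]
  intro i
  have hi := h i
  refine ⟨Nat.pow_log_le_self 2 (by omega), ?_⟩
  have := Nat.lt_pow_succ_log_self (b := 2) (by norm_num) (n i)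
  rw [pow_succ] at this
  omega

theorem wt_box (N : Fin 4 → ℕ) (hN : ∀ i, 1 ≤ N i) (n : Fin 4 → ℕ) (hn : n ∈ dbox N) (D : ℝ)
    (hD : ∀ i, ((Nat.divisors (n i)).card : ℝ) ≤ D) :
    wt n ≤ D ^ 4 * (∏ i, (N i:ℝ) ^ (3/4:ℝ))⁻¹ := by
  unfold wt
  have h : ∀ i ∈ (Finset.univ : Finset (Fin 4)), (((Nat.divisors (n i)).card : ℝ) * (n i : ℝ) ^ (-(3:ℝ)/4)) ≤ D * ((N i:ℝ) ^ (3/4:ℝ))⁻¹ := by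
    intro i _
    simp only [dbox, Fintype.mem_piFinset, Finset.mem_Ico] at hn
    have h1 : (N i:ℝ) ≤ n i := by exact_mod_cast (hn i).1
    have h0 : (0:ℝ) < N i := by exact_mod_cast hN i
    have h2 : (n i:ℝ) ^ (-(3:ℝ)/4) ≤ ((N i:ℝ) ^ (3/4:ℝ))⁻¹ := by
      rw [show (-(3:ℝ)/4) = -(3/4) by norm_num, Real.rpow_neg (by positivity)]
      gcongr
    have h3 : (0:ℝ) ≤ (Nat.divisors (n i)).card := by positivity
    exact mul_le_mul (hD i) h2 (by positivity) (h3.trans (hD i))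
  refine (Finset.prod_le_prod (fun i _ => by positivity) h).trans (le_of_eq ?_)
  rw [Finset.prod_mul_distrib, Finset.prod_inv_distrib]
  simp

theorem offdiag (ε : ℝ) (hε : 0 < ε) : ∃ C : ℝ, 1 ≤ C ∧ ∀ T : ℝ, 1 ≤ T → ∀ (e : Fin 4 → ℤ),
    (∀ i, e i = 1 ∨ e i = -1) → ∀ S : Finset (Fin 4 → ℕ),
    (∀ n ∈ S, Del e n ≠ 0 ∧ ∀ i, 1 ≤ n i ∧ (n i : ℝ) ≤ T ^ (3/4:ℝ)) →
    ∑ n ∈ S, wt n * min (T ^ (1/2:ℝ)) (1 / |Del e n|) ≤ C * T ^ (3/8 + ε) := by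
  obtain ⟨C0, hC0, hcb⟩ := count_bound (ε/4) (by positivity)
  obtain ⟨C1, hC1, hd⟩ := divisor_bound (ε/16) (by positivity)
  obtain ⟨C2, hC2, hl⟩ := log_pow_bound (ε/10) (by positivity)
  refine ⟨(2 * C2)^4 * (C1^4 * (4 * (2 * C2) * C0)) , ?_, ?_⟩
  · have a1 : 1 ≤ C1^4 := one_le_pow₀ hC1
    have a2 : 1 ≤ (2 * C2)^4 := one_le_pow₀ (by linarith)
    have a3 : 1 ≤ (4 * (2 * C2) * C0) := by nlinarith
    exact one_le_mul_of_one_le_of_one_le a2 (one_le_mul_of_one_le_of_one_le a1 a3)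
  intro T hT e he S hS
  have hT0 : 0 < T := by linarith
  have hT34 : T ^ (3/4:ℝ) ≤ T := by
    calc T ^ (3/4:ℝ) ≤ T ^ (1:ℝ) := Real.rpow_le_rpow_of_exponent_le hT (by norm_num)
      _ = T := Real.rpow_one T
  set P := T ^ (1/2:ℝ) with hP
  have hP0 : 0 < P := by positivity
  have hPP : P * P = T := by rw [hP, ← Real.rpow_add hT0]; norm_num
  set K := Nat.log 2 ⌊4 * T⌋₊ + 1 with hK
  have h4T : 1 ≤ ⌊4 * T⌋₊ := by rw [Nat.one_le_floor_iff]; linarith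
  have hKle : (K:ℝ) ≤ 2 * C2 * T ^ (ε/10) := by
    have h1 := natlog_le ⌊4*T⌋₊ h4T
    have h2 : log (⌊4*T⌋₊:ℝ) ≤ log (4*T) := Real.log_le_log (by exact_mod_cast h4T) (Nat.floor_le (by linarith))
    have h3 := hl T hT
    rw [hK]; push_cast; linarith
  have h2K : 4 * T ≤ 2 ^ K := by
    have := Nat.lt_pow_succ_log_self (b := 2) (by norm_num) ⌊4*T⌋₊
    have h2 : ((⌊4*T⌋₊ + 1 : ℕ):ℝ) ≤ ((2 ^ K : ℕ):ℝ) := by exact_mod_cast this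
    push_cast at h2
    have := Nat.lt_floor_add_one (4*T)
    linarith
  set t : Finset (Fin 4 → ℕ) := Fintype.piFinset (fun _ => range K) with ht
  have hmaps : ∀ n ∈ S, (fun i => Nat.log 2 (n i)) ∈ t := by
    intro n hn
    rw [ht, Fintype.mem_piFinset]
    intro i
    rw [Finset.mem_range, hK, Nat.lt_succ_iff]
    apply Nat.log_mono_right
    apply Nat.le_floor
    have := ((hS n hn).2 i).2
    linarith
  rw [← Finset.sum_fiberwise_of_maps_to hmaps]
  set B := C1^4 * T^(ε/4) * (4 * (2 * C2 * T^(ε/10)) * (C0 * T^(ε/4) * T^(3/8:ℝ))) with hB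
  have hbox : ∀ k ∈ t, ∑ n ∈ S.filter (fun n => (fun i => Nat.log 2 (n i)) = k), wt n * min P (1 / |Del e n|) ≤ B := by
    intro k hk
    set S' := S.filter (fun n => (fun i => Nat.log 2 (n i)) = k) with hS'
    by_cases hne : S'.Nonempty
    swap
    · rw [Finset.not_nonempty_iff_eq_empty] at hne
      rw [hne, Finset.sum_empty]; positivity
    set N : Fin 4 → ℕ := fun i => 2 ^ k i with hN
    have hN1 : ∀ i, 1 ≤ N i := fun i => Nat.one_le_two_pow
    have hmem : ∀ n ∈ S', n ∈ S ∧ n ∈ dbox N := by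
      intro n hn
      rw [hS', Finset.mem_filter] at hn
      refine ⟨hn.1, ?_⟩
      have := mem_dbox_log n (fun i => ((hS n hn.1).2 i).1)
      rw [hN, ← hn.2]; exact this
    have hNT : ∀ i, (N i:ℝ) ≤ T ^ (3/4:ℝ) := by
      obtain ⟨n, hn⟩ := hne
      intro i
      have h1 := (hmem n hn).2
      simp only [dbox, Fintype.mem_piFinset, Finset.mem_Ico] at h1
      have h2 := ((hS n (hmem n hn).1).2 i).2
      have h3 : (N i:ℝ) ≤ n i := by exact_mod_cast (h1 i).1
      linarith
    set Q := ∏ i, (N i:ℝ) ^ (3/4:ℝ) with hQ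
    have hQ0 : 0 < Q := Finset.prod_pos (fun i _ => by
      have : (0:ℝ) < N i := by exact_mod_cast hN1 i
      positivity)
    have hw : ∀ n ∈ S', wt n ≤ C1^4 * T^(ε/4) * Q⁻¹ := by
      intro n hn
      refine (wt_box N hN1 n (hmem n hn).2 (C1 * T^(ε/16)) ?_).trans (le_of_eq ?_)
      · intro i
        have := (hS n (hmem n hn).1).2 i
        refine (hd _ this.1).trans ?_
        gcongr
        linarith
      · rw [mul_pow, ← Real.rpow_natCast (T^(ε/16)) 4, ← Real.rpow_mul hT0.le]
        congr 3; push_cast; ring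
    have hDle : ∀ n ∈ S', |Del e n| ≤ 2 ^ K / P := by
      intro n hn
      have h1 : |Del e n| ≤ 4 * P := by
        apply Del_le e he
        intro i
        rw [hP, ← Real.sqrt_eq_rpow]
        apply Real.sqrt_le_sqrt
        have := ((hS n (hmem n hn).1).2 i).2
        linarith
      rw [le_div_iff₀ hP0]
      calc |Del e n| * P ≤ 4 * P * P := by gcongr
        _ = 4 * T := by rw [mul_assoc, hPP]
        _ ≤ _ := h2K
    have hdy := dyadic_min S' (fun n => Del e n) P hP0 (K-1+1) (by
      have : K - 1 + 1 = K := by omega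
      rw [this]; exact hDle)
    have hK1 : K - 1 + 1 = K := by omega
    rw [hK1] at hdy
    have hcount : ∀ j ∈ range (K+1), 2 * P / 2 ^ j * ((S'.filter (fun n => |Del e n| ≤ 2 ^ j / P)).card : ℝ)
        ≤ 2 * (C0 * T^(ε/4) * T^(3/8:ℝ)) * Q := by
      intro j _
      have h1 : ((S'.filter (fun n => |Del e n| ≤ 2 ^ j / P)).card : ℝ) ≤
          C0 * T^(ε/4) * (T^(3/8:ℝ) * (2^j / P) * Q) := by
        refine le_trans ?_ (hcb T hT e he N hN1 hNT (2^j/P) ?_)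
        · have : (S'.filter (fun n => |Del e n| ≤ 2 ^ j / P)) ⊆ ((dbox N).filter (fun n => Del e n ≠ 0 ∧ |Del e n| ≤ 2^j / P)) := by
            intro n hn
            rw [Finset.mem_filter] at hn ⊢
            exact ⟨(hmem n hn.1).2, (hS n (hmem n hn.1).1).1, hn.2⟩
          exact_mod_cast Finset.card_le_card this
        · rw [Real.rpow_neg hT0.le, hP, inv_eq_one_div]
          gcongr
          exact one_le_pow₀ (by norm_num)
      calc _ ≤ 2 * P / 2 ^ j * (C0 * T^(ε/4) * (T^(3/8:ℝ) * (2^j / P) * Q)) := by gcongr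
        _ = _ := by field_simp
    have hmin : ∑ n ∈ S', min P (1 / |Del e n|) ≤ (K+1) * (2 * (C0 * T^(ε/4) * T^(3/8:ℝ)) * Q) := by
      refine hdy.trans ((Finset.sum_le_sum hcount).trans (le_of_eq ?_))
      rw [Finset.sum_const, Finset.card_range, nsmul_eq_mul]; push_cast; ring
    have hK2 : (K:ℝ) + 1 ≤ 2 * (2 * C2 * T^(ε/10)) := by
      have : (1:ℝ) ≤ K := by rw [hK]; push_cast; linarith [Nat.cast_nonneg (α := ℝ) (Nat.log 2 ⌊4 * T⌋₊)]
      linarith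
    calc ∑ n ∈ S', wt n * min P (1 / |Del e n|) ≤ ∑ n ∈ S', C1^4 * T^(ε/4) * Q⁻¹ * min P (1 / |Del e n|) := by
          refine Finset.sum_le_sum (fun n hn => ?_)
          have := hw n hn
          gcongr
      _ = C1^4 * T^(ε/4) * Q⁻¹ * ∑ n ∈ S', min P (1 / |Del e n|) := by rw [Finset.mul_sum]
      _ ≤ C1^4 * T^(ε/4) * Q⁻¹ * ((K+1) * (2 * (C0 * T^(ε/4) * T^(3/8:ℝ)) * Q)) := by gcongr
      _ ≤ C1^4 * T^(ε/4) * Q⁻¹ * ((2 * (2 * C2 * T^(ε/10))) * (2 * (C0 * T^(ε/4) * T^(3/8:ℝ)) * Q)) := by gcongr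
      _ = B := by rw [hB]; field_simp; ring
  refine (Finset.sum_le_sum hbox).trans ?_
  rw [Finset.sum_const, nsmul_eq_mul]
  have hcard : (t.card:ℝ) ≤ (2 * C2 * T^(ε/10))^4 := by
    rw [ht, Fintype.card_piFinset]
    simp only [Finset.card_range, Finset.prod_const, Finset.card_univ, Fintype.card_fin]
    push_cast
    gcongr
  calc (t.card:ℝ) * B ≤ (2 * C2 * T^(ε/10))^4 * B := by gcongr
    _ = (2 * C2)^4 * (C1^4 * (4 * (2 * C2) * C0)) * ((T^(ε/10))^5 * T^(ε/4) * T^(ε/4) * T^(3/8:ℝ)) := by rw [hB]; ring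
    _ = _ := by
      congr 1
      rw [← Real.rpow_natCast (T^(ε/10)) 5, ← Real.rpow_mul hT0.le, ← Real.rpow_add hT0, ← Real.rpow_add hT0, ← Real.rpow_add hT0]
      congr 1; push_cast; ring

theorem diag_sorted (N : Fin 4 → ℕ) (e : Fin 4 → ℤ) (he : ∀ i, e i = 1 ∨ e i = -1) (hN : ∀ i, 1 ≤ N i)
    (q : Fin 4 → ℝ) (hq : ∀ i, 1 ≤ q i) (hqN : ∀ i, q i ^ 4 = N i)
    (h01 : q 0 ≤ q 1) (h12 : q 1 ≤ q 2) (h23 : q 2 ≤ q 3) :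
    (((dbox N).filter (fun n => Del e n = 0)).card : ℝ) * q 3 ^ 2 ≤
      8 * 2400 * (1 + log (N 3)) * (q 0 * q 1 * q 2 * q 3) ^ 3 := by
  have hlog : 0 ≤ log (N 3) := Real.log_natCast_nonneg _
  have hq0 : ∀ i, 0 < q i := fun i => by linarith [hq i]
  have p0 := hq0 0
  have p1 := hq0 1
  have p2 := hq0 2
  have p3 := hq0 3
  have hsq : ∀ i, √(N i:ℝ) = q i ^ 2 := by
    intro i
    rw [← hqN i, show q i ^ 4 = (q i ^ 2)^2 by ring]
    exact Real.sqrt_sq (by positivity)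
  have hle : ∀ i j, q i ≤ q j → N i ≤ N j := by
    intro i j h
    have : (N i:ℝ) ≤ N j := by
      rw [← hqN, ← hqN]
      have := hq0 i
      gcongr
    exact_mod_cast this
  by_cases hemp : ((dbox N).filter (fun n => Del e n = 0)) = ∅
  · rw [hemp, Finset.card_empty]
    have : 0 ≤ 8 * 2400 * (1 + log (N 3)) * (q 0 * q 1 * q 2 * q 3) ^ 3 := by positivity
    simpa using this
  obtain ⟨n, hn⟩ := Finset.nonempty_iff_ne_empty.2 hemp
  rw [Finset.mem_filter] at hn
  have h64 : N 3 < 64 * N 2 := by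
    by_contra hc
    push Not at hc
    have := Del_far N e he (hle 0 2 (h01.trans h12)) (hle 1 2 h12) hc (hN 3) n hn.1
    rw [hn.2, abs_zero] at this
    have := Real.sqrt_nonneg (N 3:ℝ)
    linarith
  have hq64 : q 3 ^ 4 ≤ 64 * q 2 ^ 4 := by
    rw [hqN, hqN]
    exact_mod_cast h64.le
  have hq32 : q 3 ^ 2 ≤ 8 * q 2 ^ 2 := by
    refine (abs_le_of_sq_le_sq' (a := q 3 ^ 2) (b := 8 * q 2 ^ 2) ?_ (by positivity)).2
    nlinarith
  set δ : ℝ := (q 3 ^ 12)⁻¹ with hδ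
  have hδ0 : 0 < δ := by positivity
  have hen := quad_energy N e he hN (hle 0 2 (h01.trans h12)) (hle 1 3 (h12.trans h23)) δ hδ0
  set Z := (((dbox N).filter (fun n => Del e n = 0)).card : ℝ) with hZ
  have hZle : Z ≤ (((dbox N).filter (fun n => |Del e n| ≤ δ)).card : ℝ) := by
    rw [hZ]
    have : ((dbox N).filter (fun n => Del e n = 0)) ⊆ ((dbox N).filter (fun n => |Del e n| ≤ δ)) := by
      intro n hn
      rw [Finset.mem_filter] at hn ⊢
      refine ⟨hn.1, ?_⟩
      rw [hn.2, abs_zero]; exact hδ0.le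
    exact_mod_cast Finset.card_le_card this
  have hZ0 : 0 ≤ Z := by positivity
  set L := 1 + log (N 3) with hL
  have hL2 : 1 + log (N 2) ≤ L := by
    rw [hL]
    have : log (N 2) ≤ log (N 3) := Real.log_le_log (by exact_mod_cast hN 2) (by exact_mod_cast hle 2 3 h23)
    linarith
  have hA : √(N 0)^3*(N 2)+δ*√(N 2)^3*(N 0:ℝ)^2 ≤ 2 * (q 0 ^ 6 * q 2 ^ 4) := by
    rw [hsq, hsq, ← hqN, ← hqN]
    have : δ * (q 2 ^ 2)^3 * (q 0 ^ 4)^2 ≤ q 0 ^ 6 * q 2 ^ 4 := by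
      rw [hδ, inv_mul_eq_div, div_mul_eq_mul_div, div_le_iff₀ (by positivity)]
      have a1 : q 0 ^ 2 ≤ q 3 ^ 2 := by gcongr; linarith
      have a2 : q 2 ^ 6 ≤ q 3 ^ 6 := by gcongr
      have a3 : 1 ≤ q 3 ^ 4 := one_le_pow₀ (hq 3)
      have a4 : 1 ≤ q 2 ^ 4 := one_le_pow₀ (hq 2)
      calc (q 2 ^ 2)^3 * (q 0 ^ 4)^2 = q 2 ^ 6 * q 0 ^ 2 * 1 * 1 * q 0 ^ 6 := by ring
        _ ≤ q 3 ^ 6 * q 3 ^ 2 * q 3 ^ 4 * q 2 ^ 4 * q 0 ^ 6 := by gcongr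
        _ = _ := by ring
    calc _ ≤ (q 0 ^ 2)^3 * q 2 ^ 4 + q 0 ^ 6 * q 2 ^ 4 := by linarith
      _ = _ := by ring
  have hBb : √(N 1)^3*(N 3)+δ*√(N 3)^3*(N 1:ℝ)^2 ≤ 2 * (q 1 ^ 6 * q 3 ^ 4) := by
    rw [hsq, hsq, ← hqN, ← hqN]
    have : δ * (q 3 ^ 2)^3 * (q 1 ^ 4)^2 ≤ q 1 ^ 6 * q 3 ^ 4 := by
      rw [hδ, inv_mul_eq_div, div_mul_eq_mul_div, div_le_iff₀ (by positivity)]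
      have a1 : q 1 ^ 2 ≤ q 3 ^ 2 := by gcongr; linarith
      have a3 : 1 ≤ q 3 ^ 4 := one_le_pow₀ (hq 3)
      calc (q 3 ^ 2)^3 * (q 1 ^ 4)^2 = q 3 ^ 6 * q 1 ^ 2 * 1 * 1 * q 1 ^ 6 := by ring
        _ ≤ q 3 ^ 6 * q 3 ^ 2 * q 3 ^ 4 * q 3 ^ 4 * q 1 ^ 6 := by gcongr
        _ = _ := by ring
    calc _ ≤ (q 1 ^ 2)^3 * q 3 ^ 4 + q 1 ^ 6 * q 3 ^ 4 := by linarith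
      _ = _ := by ring
  have hZ2 : Z ^ 2 ≤ (2400 * L * (q 0 ^ 3 * q 1 ^ 3 * q 2 ^ 2 * q 3 ^ 2))^2 := by
    have hL2' : 0 ≤ 1 + log (N 2) := by have := Real.log_natCast_nonneg (N 2); linarith
    calc Z ^ 2 ≤ _ := pow_le_pow_left₀ hZ0 hZle 2
      _ ≤ _ := hen
      _ ≤ 9 * ((400 * L * (2 * (q 0 ^ 6 * q 2 ^ 4))) * (400 * L * (2 * (q 1 ^ 6 * q 3 ^ 4)))) := by
        gcongr
      _ = _ := by ring
  have hZ3 := (abs_le_of_sq_le_sq' hZ2 (by positivity)).2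
  calc Z * q 3 ^ 2 ≤ (2400 * L * (q 0 ^ 3 * q 1 ^ 3 * q 2 ^ 2 * q 3 ^ 2)) * (8 * q 2 ^ 2) := by gcongr
    _ = 8 * 2400 * L * (q 0 ^ 3 * q 1 ^ 3 * q 2 ^ 3 * q 3 ^ 2) * q 2 := by ring
    _ ≤ 8 * 2400 * L * (q 0 ^ 3 * q 1 ^ 3 * q 2 ^ 3 * q 3 ^ 2) * q 3 := by gcongr
    _ = _ := by ring

/-- box diagonal count, unsorted -/
theorem diag_box : ∀ (e : Fin 4 → ℤ), (∀ i, e i = 1 ∨ e i = -1) → ∀ N : Fin 4 → ℕ, (∀ i, 1 ≤ N i) →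
    ∃ M : ℕ, (∀ i, N i ≤ M) ∧ (∃ i, N i = M) ∧
    (((dbox N).filter (fun n => Del e n = 0)).card : ℝ) ≤
      8 * 2400 * (1 + log M) * (M:ℝ) ^ (-(1/2):ℝ) * ∏ i, (N i:ℝ) ^ (3/4:ℝ) := by
  intro e he N hN
  set σ := Tuple.sort N
  have hmono : Monotone (N ∘ σ) := Tuple.monotone_sort N
  set N' := N ∘ σ with hN'
  have hN'1 : ∀ i, 1 ≤ N' i := fun i => hN (σ i)
  set q : Fin 4 → ℝ := fun i => (N' i:ℝ) ^ (1/4:ℝ) with hq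
  have hq1 : ∀ i, 1 ≤ q i := fun i => Real.one_le_rpow (by exact_mod_cast hN'1 i) (by norm_num)
  have hqle : ∀ i j : Fin 4, i ≤ j → q i ≤ q j := by
    intro i j hij
    exact Real.rpow_le_rpow (by positivity) (by exact_mod_cast hmono hij) (by norm_num)
  refine ⟨N' 3, ?_, ⟨σ 3, rfl⟩, ?_⟩
  · intro i
    have h1 : N i = N' (σ.symm i) := by simp [hN']
    rw [h1]; apply hmono
    exact Fin.le_last (n := 3) _
  have key := diag_sorted N' (e ∘ σ) (fun i => he (σ i)) hN'1 q hq1 (fun i => by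
      simp only [hq]
      rw [← Real.rpow_natCast, ← Real.rpow_mul (by positivity)]
      norm_num) (hqle 0 1 (by decide)) (hqle 1 2 (by decide)) (hqle 2 3 (by decide))
  have hperm := count_perm σ N e (fun d => d = 0)
  have hprod : (q 0 * q 1 * q 2 * q 3)^3 = ∏ i, (N i:ℝ) ^ (3/4:ℝ) := by
    rw [← Equiv.prod_comp σ, Fin.prod_univ_four]
    have : ∀ i, (N (σ i):ℝ)^(3/4:ℝ) = q i ^ 3 := by
      intro i
      simp only [hq, hN', Function.comp]
      rw [← Real.rpow_natCast, ← Real.rpow_mul (by positivity)]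
      norm_num
    rw [this, this, this, this]; ring
  rw [hprod] at key
  have hMp : (0:ℝ) < N' 3 := by exact_mod_cast hN'1 3
  have hM : (N' 3:ℝ) ^ (-(1/2):ℝ) * q 3 ^ 2 = 1 := by
    simp only [hq]
    rw [← Real.rpow_natCast, ← Real.rpow_mul (by positivity), ← Real.rpow_add hMp]
    norm_num
  refine le_trans (le_of_eq (by congr!)) (hperm.trans ?_)
  have hqp : 0 < q 3 ^ 2 := by have := hq1 3; positivity
  refine le_of_mul_le_mul_right ?_ hqp
  refine le_trans (le_of_eq (by congr!)) (key.trans (le_of_eq ?_))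
  rw [show 8 * 2400 * (1 + log (N' 3)) * (N' 3:ℝ) ^ (-(1/2):ℝ) * (∏ i, (N i:ℝ) ^ (3/4:ℝ)) * q 3 ^ 2 =
    8 * 2400 * (1 + log (N' 3)) * (∏ i, (N i:ℝ) ^ (3/4:ℝ)) * ((N' 3:ℝ) ^ (-(1/2):ℝ) * q 3 ^ 2) by ring, hM]
  ring

theorem diag_tail : ∃ C : ℝ, 1 ≤ C ∧ ∀ (e : Fin 4 → ℤ),
    (∀ i, e i = 1 ∨ e i = -1) → ∀ Y : ℝ, 1 ≤ Y → ∀ S : Finset (Fin 4 → ℕ),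
    (∀ n ∈ S, Del e n = 0 ∧ (∀ i, 1 ≤ n i) ∧ ∃ i, Y ≤ n i) →
    ∑ n ∈ S, wt n ≤ C * Y ^ (-(1/4):ℝ) := by
  obtain ⟨C1, hC1, hd⟩ := divisor_bound (1/64) (by norm_num)
  obtain ⟨C2, hC2, hl⟩ := log_pow_bound (1/16) (by norm_num)
  set G : ℝ := ∑' k : ℕ, ((2:ℝ) ^ (-(1/64):ℝ))^k with hG
  have hg1 : (2:ℝ) ^ (-(1/64):ℝ) < 1 := Real.rpow_lt_one_of_one_lt_of_neg (by norm_num) (by norm_num)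
  have hg0 : 0 < (2:ℝ) ^ (-(1/64):ℝ) := by positivity
  have hsum := summable_geometric_of_lt_one hg0.le hg1
  set A := 8 * 2400 * C2 * (C1^4 * 2^(1/16:ℝ)) * 2^(1/4:ℝ) with hA
  refine ⟨max 1 (G ^ 4 * A), le_max_left _ _, ?_⟩
  intro e he Y hY S hS
  have hY0 : 0 < Y := by linarith
  have hmaps : ∀ n ∈ S, (fun i => Nat.log 2 (n i)) ∈ S.image (fun n i => Nat.log 2 (n i)) := by
    intro n hn; exact Finset.mem_image_of_mem _ hn
  set t := S.image (fun n i => Nat.log 2 (n i)) with ht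
  rw [← Finset.sum_fiberwise_of_maps_to hmaps]
  have hbox : ∀ k ∈ t, ∑ n ∈ S.filter (fun n => (fun i => Nat.log 2 (n i)) = k), wt n ≤
      A * Y ^ (-(1/4):ℝ) * ∏ i, ((2:ℝ) ^ (-(1/64):ℝ))^(k i) := by
    intro k hk
    set S' := S.filter (fun n => (fun i => Nat.log 2 (n i)) = k) with hS'
    obtain ⟨n0, hn0, hn0k⟩ := Finset.mem_image.1 hk
    set N : Fin 4 → ℕ := fun i => 2 ^ k i with hN
    have hN1 : ∀ i, 1 ≤ N i := fun i => Nat.one_le_two_pow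
    have hmem : ∀ n ∈ S', n ∈ S ∧ n ∈ dbox N := by
      intro n hn
      rw [hS', Finset.mem_filter] at hn
      refine ⟨hn.1, ?_⟩
      have := mem_dbox_log n (hS n hn.1).2.1
      rw [hN, ← hn.2]; exact this
    obtain ⟨M, hM1, ⟨im, him⟩, hMc⟩ := diag_box e he N hN1
    have hMpos : (1:ℝ) ≤ M := by rw [← him]; exact_mod_cast hN1 im
    have hM0 : (0:ℝ) < M := by linarith
    have hYM : Y ≤ 2 * M := by
      obtain ⟨i, hi⟩ := (hS n0 hn0).2.2
      have h1 := (hmem n0 (by rw [hS', Finset.mem_filter]; exact ⟨hn0, hn0k⟩)).2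
      simp only [dbox, Fintype.mem_piFinset, Finset.mem_Ico] at h1
      have h2 : (n0 i:ℝ) ≤ 2 * M := by
        have := (h1 i).2.le.trans (Nat.mul_le_mul_left 2 (hM1 i))
        exact_mod_cast this
      linarith
    set Q := ∏ i, (N i:ℝ) ^ (3/4:ℝ) with hQ
    have hQ0 : 0 < Q := Finset.prod_pos (fun i _ => by
      have : (0:ℝ) < N i := by exact_mod_cast hN1 i
      positivity)
    have hw : ∀ n ∈ S', wt n ≤ C1^4 * 2^(1/16:ℝ) * (M:ℝ)^(1/16:ℝ) * Q⁻¹ := by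
      intro n hn
      refine (wt_box N hN1 n (hmem n hn).2 (C1 * (2 * M)^(1/64:ℝ)) ?_).trans (le_of_eq ?_)
      · intro i
        have h1 := (hmem n hn).2
        simp only [dbox, Fintype.mem_piFinset, Finset.mem_Ico] at h1
        have h2 : (n i:ℝ) ≤ 2 * M := by
          have := (h1 i).2.le.trans (Nat.mul_le_mul_left 2 (hM1 i))
          exact_mod_cast this
        refine (hd _ ((hS n (hmem n hn).1).2.1 i)).trans ?_
        gcongr
      · have e1 : (1/64:ℝ) * ((4:ℕ):ℝ) = 1/16 := by norm_num
        rw [mul_pow, ← Real.rpow_natCast (_^(1/64:ℝ)) 4, ← Real.rpow_mul (by positivity), e1,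
          Real.mul_rpow (by norm_num) hM0.le]
        ring
    have hcard : (S'.card:ℝ) ≤ 8 * 2400 * (1 + log M) * (M:ℝ) ^ (-(1/2):ℝ) * Q := by
      refine le_trans ?_ hMc
      have : S' ⊆ (dbox N).filter (fun n => Del e n = 0) := by
        intro n hn
        rw [Finset.mem_filter]
        exact ⟨(hmem n hn).2, (hS n (hmem n hn).1).1⟩
      exact_mod_cast Finset.card_le_card this
    have hlog : 1 + log M ≤ C2 * (M:ℝ)^(1/16:ℝ) := by
      refine le_trans ?_ (hl M hMpos)
      have : log M ≤ log (4 * M) := Real.log_le_log hM0 (by linarith)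
      linarith
    have hlog0 : 0 ≤ 1 + log (M:ℝ) := by have := Real.log_nonneg hMpos; linarith
    have hMY : (M:ℝ)^(-(1/4):ℝ) ≤ 2^(1/4:ℝ) * Y^(-(1/4):ℝ) := by
      have h1 : (2 * (M:ℝ))^(-(1/4):ℝ) ≤ Y^(-(1/4):ℝ) := Real.rpow_le_rpow_of_nonpos hY0 hYM (by norm_num)
      rw [Real.mul_rpow (by norm_num) hM0.le] at h1
      have h2 : (2:ℝ)^(1/4:ℝ) * 2^(-(1/4):ℝ) = 1 := by rw [← Real.rpow_add (by norm_num)]; norm_num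
      calc (M:ℝ)^(-(1/4):ℝ) = 2^(1/4:ℝ) * (2^(-(1/4):ℝ) * (M:ℝ)^(-(1/4):ℝ)) := by rw [← mul_assoc, h2, one_mul]
        _ ≤ _ := by gcongr
    have hMk : (M:ℝ)^(-(1/16):ℝ) ≤ ∏ i, ((2:ℝ) ^ (-(1/64):ℝ))^(k i) := by
      have h1 : ∀ i, (M:ℝ)^(-(1/64):ℝ) ≤ ((2:ℝ) ^ (-(1/64):ℝ))^(k i) := by
        intro i
        have : ((2:ℝ) ^ (-(1/64):ℝ))^(k i) = (N i:ℝ)^(-(1/64):ℝ) := by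
          rw [hN]; push_cast
          rw [← Real.rpow_natCast, ← Real.rpow_natCast, ← Real.rpow_mul (by norm_num), ← Real.rpow_mul (by norm_num), mul_comm]
        rw [this]
        exact Real.rpow_le_rpow_of_nonpos (by exact_mod_cast hN1 i) (by exact_mod_cast hM1 i) (by norm_num)
      calc (M:ℝ)^(-(1/16):ℝ) = ∏ i : Fin 4, (M:ℝ)^(-(1/64):ℝ) := by
            simp only [Finset.prod_const, Finset.card_univ, Fintype.card_fin]
            rw [← Real.rpow_natCast, ← Real.rpow_mul hM0.le]; norm_num
        _ ≤ _ := Finset.prod_le_prod (fun i _ => by positivity) (fun i _ => h1 i)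
    have hMexp : (M:ℝ)^(1/16:ℝ) * (M:ℝ)^(-(1/2):ℝ) * (M:ℝ)^(1/16:ℝ) ≤ (M:ℝ)^(-(1/4):ℝ) * (M:ℝ)^(-(1/16):ℝ) := by
      rw [← Real.rpow_add hM0, ← Real.rpow_add hM0, ← Real.rpow_add hM0]
      exact Real.rpow_le_rpow_of_exponent_le hMpos (by norm_num)
    calc ∑ n ∈ S', wt n ≤ ∑ n ∈ S', C1^4 * 2^(1/16:ℝ) * (M:ℝ)^(1/16:ℝ) * Q⁻¹ := Finset.sum_le_sum hw
      _ = S'.card * (C1^4 * 2^(1/16:ℝ) * (M:ℝ)^(1/16:ℝ) * Q⁻¹) := by rw [Finset.sum_const, nsmul_eq_mul]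
      _ ≤ (8 * 2400 * (C2 * (M:ℝ)^(1/16:ℝ)) * (M:ℝ) ^ (-(1/2):ℝ) * Q) * (C1^4 * 2^(1/16:ℝ) * (M:ℝ)^(1/16:ℝ) * Q⁻¹) := by
        apply mul_le_mul_of_nonneg_right _ (by positivity)
        refine hcard.trans ?_
        gcongr
      _ = 8 * 2400 * C2 * (C1^4 * 2^(1/16:ℝ)) * ((M:ℝ)^(1/16:ℝ) * (M:ℝ)^(-(1/2):ℝ) * (M:ℝ)^(1/16:ℝ)) := by field_simp
      _ ≤ 8 * 2400 * C2 * (C1^4 * 2^(1/16:ℝ)) * ((M:ℝ)^(-(1/4):ℝ) * (M:ℝ)^(-(1/16):ℝ)) := by gcongr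
      _ ≤ 8 * 2400 * C2 * (C1^4 * 2^(1/16:ℝ)) * ((2^(1/4:ℝ) * Y^(-(1/4):ℝ)) * ∏ i, ((2:ℝ) ^ (-(1/64):ℝ))^(k i)) := by gcongr
      _ = _ := by rw [hA]; ring
  refine (Finset.sum_le_sum hbox).trans ?_
  rw [← Finset.mul_sum]
  have hprod : ∑ k ∈ t, ∏ i, ((2:ℝ) ^ (-(1/64):ℝ))^(k i) ≤ G ^ 4 := by
    obtain ⟨m, hm⟩ : ∃ m : ℕ, t ⊆ Fintype.piFinset (fun _ => range m) := by
      refine ⟨t.sup (fun k => ∑ i, k i) + 1, fun k hk => ?_⟩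
      rw [Fintype.mem_piFinset]
      intro i
      rw [Finset.mem_range, Nat.lt_succ_iff]
      exact (Finset.single_le_sum (f := k) (fun _ _ => Nat.zero_le _) (Finset.mem_univ i)).trans
        (Finset.le_sup (f := fun k : Fin 4 → ℕ => ∑ i, k i) hk)
    calc _ ≤ ∑ k ∈ Fintype.piFinset (fun _ : Fin 4 => range m), ∏ i, ((2:ℝ) ^ (-(1/64):ℝ))^(k i) :=
          Finset.sum_le_sum_of_subset_of_nonneg hm (fun k _ _ => Finset.prod_nonneg (fun i _ => by positivity))
      _ = ∏ i : Fin 4, ∑ k ∈ range m, ((2:ℝ) ^ (-(1/64):ℝ))^k := (Finset.prod_univ_sum (fun _ => range m) (fun _ k => ((2:ℝ) ^ (-(1/64):ℝ))^k)).symm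
      _ = (∑ k ∈ range m, ((2:ℝ) ^ (-(1/64):ℝ))^k)^4 := by simp
      _ ≤ G ^ 4 := by
        have := hsum.sum_le_tsum (range m) (fun i _ => by positivity)
        have h0 : 0 ≤ (∑ k ∈ range m, ((2:ℝ) ^ (-(1/64):ℝ))^k) := Finset.sum_nonneg (fun i _ => by positivity)
        gcongr
  have hA0 : 0 ≤ A := by rw [hA]; positivity
  calc _ ≤ A * Y ^ (-(1/4):ℝ) * G ^ 4 := by gcongr
    _ = G ^ 4 * A * Y ^ (-(1/4):ℝ) := by ring
    _ ≤ _ := by gcongr; exact le_max_right _ _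

/-- twisted divisor sum -/
def cph (M₁ M₂ ℓ₁ ℓ₂ : ℕ) (e : ℤ) (n : ℕ) : ℂ :=
  ∑ p ∈ Nat.divisorsAntidiagonal n, Complex.exp (((2 * π * ((e:ℝ) * phase M₁ M₂ ℓ₁ ℓ₂ p) : ℝ) : ℂ) * Complex.I)

theorem card_divAnti (n : ℕ) : (Nat.divisorsAntidiagonal n).card = (Nat.divisors n).card := by
  rw [← Nat.map_div_right_divisors, Finset.card_map]

theorem norm_cph_le (M₁ M₂ ℓ₁ ℓ₂ : ℕ) (e : ℤ) (n : ℕ) : ‖cph M₁ M₂ ℓ₁ ℓ₂ e n‖ ≤ (Nat.divisors n).card := by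
  unfold cph
  refine (norm_sum_le _ _).trans ?_
  simp only [Complex.norm_exp_ofReal_mul_I, Finset.sum_const, nsmul_eq_mul, mul_one]
  rw [card_divAnti]

theorem conj_cph (M₁ M₂ ℓ₁ ℓ₂ : ℕ) (e : ℤ) (n : ℕ) : (starRingEnd ℂ) (cph M₁ M₂ ℓ₁ ℓ₂ e n) = cph M₁ M₂ ℓ₁ ℓ₂ (-e) n := by
  unfold cph
  rw [map_sum]
  refine Finset.sum_congr rfl (fun p _ => ?_)
  rw [← Complex.exp_conj, map_mul, Complex.conj_I, Complex.conj_ofReal]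
  congr 1
  push_cast; ring

/-- diagonal term -/
def Fd (M₁ M₂ ℓ₁ ℓ₂ : ℕ) (e : Fin 4 → ℤ) (n : Fin 4 → ℕ) : ℝ :=
  if (∀ i, 1 ≤ n i) ∧ Del e n = 0 then
    (∏ i, (n i:ℝ) ^ (-(3:ℝ)/4)) * (∏ i, cph M₁ M₂ ℓ₁ ℓ₂ (e i) (n i)).re else 0

theorem prod_wt (M₁ M₂ ℓ₁ ℓ₂ : ℕ) (e : Fin 4 → ℤ) (n : Fin 4 → ℕ) :
    (∏ i, (n i:ℝ) ^ (-(3:ℝ)/4)) * ‖∏ i, cph M₁ M₂ ℓ₁ ℓ₂ (e i) (n i)‖ ≤ wt n := by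
  unfold wt
  rw [Finset.prod_mul_distrib, mul_comm, norm_prod]
  have : 0 ≤ (∏ i, (n i:ℝ) ^ (-(3:ℝ)/4)) := Finset.prod_nonneg (fun i _ => by positivity)
  gcongr
  exact norm_cph_le _ _ _ _ _ _

theorem abs_Fd_le (M₁ M₂ ℓ₁ ℓ₂ : ℕ) (e : Fin 4 → ℤ) (n : Fin 4 → ℕ) : |Fd M₁ M₂ ℓ₁ ℓ₂ e n| ≤ wt n := by
  unfold Fd
  split_ifs with h
  · rw [abs_mul, abs_of_nonneg (Finset.prod_nonneg (fun i _ => by positivity))]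
    refine le_trans ?_ (prod_wt M₁ M₂ ℓ₁ ℓ₂ e n)
    have : 0 ≤ (∏ i, (n i:ℝ) ^ (-(3:ℝ)/4)) := Finset.prod_nonneg (fun i _ => by positivity)
    gcongr
    exact Complex.abs_re_le_norm _
  · rw [abs_zero]; exact wt_nonneg n

theorem Fd_perm (M₁ M₂ ℓ₁ ℓ₂ : ℕ) (σ : Equiv.Perm (Fin 4)) (e : Fin 4 → ℤ) (n : Fin 4 → ℕ) :
    Fd M₁ M₂ ℓ₁ ℓ₂ (e ∘ σ) (n ∘ σ) = Fd M₁ M₂ ℓ₁ ℓ₂ e n := by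
  unfold Fd
  rw [Del_perm]
  have h1 : (∀ i, 1 ≤ (n ∘ σ) i) ↔ (∀ i, 1 ≤ n i) := ⟨fun h i => by simpa using h (σ.symm i), fun h i => h (σ i)⟩
  have h2 := Equiv.prod_comp σ (fun i => (n i:ℝ) ^ (-(3:ℝ)/4))
  have h3 := Equiv.prod_comp σ (fun i => cph M₁ M₂ ℓ₁ ℓ₂ (e i) (n i))
  have hA : (∏ i, (((n ∘ σ) i : ℕ):ℝ) ^ (-(3:ℝ)/4)) = ∏ i, (n i:ℝ) ^ (-(3:ℝ)/4) := h2
  have hB : (∏ i, cph M₁ M₂ ℓ₁ ℓ₂ ((e ∘ σ) i) ((n ∘ σ) i)) = ∏ i, cph M₁ M₂ ℓ₁ ℓ₂ (e i) (n i) := h3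
  rw [hA, hB]
  by_cases h : (∀ i, 1 ≤ n i) ∧ Del e n = 0
  · rw [if_pos h, if_pos ⟨h1.2 h.1, h.2⟩]
  · rw [if_neg h, if_neg (fun h' => h ⟨h1.1 h'.1, h'.2⟩)]

/-- full diagonal series -/
def Sd (M₁ M₂ ℓ₁ ℓ₂ : ℕ) (e : Fin 4 → ℤ) : ℝ := ∑' n, Fd M₁ M₂ ℓ₁ ℓ₂ e n

theorem Sd_perm (M₁ M₂ ℓ₁ ℓ₂ : ℕ) (σ : Equiv.Perm (Fin 4)) (e : Fin 4 → ℤ) :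
    Sd M₁ M₂ ℓ₁ ℓ₂ (e ∘ σ) = Sd M₁ M₂ ℓ₁ ℓ₂ e := by
  unfold Sd
  rw [← Equiv.tsum_eq (Equiv.arrowCongr σ.symm (Equiv.refl ℕ))]
  refine tsum_congr (fun n => ?_)
  have : (Equiv.arrowCongr σ.symm (Equiv.refl ℕ)) n = n ∘ σ := by
    funext i; simp [Equiv.arrowCongr]
  rw [this, Fd_perm]

theorem Fd_tail_set (M₁ M₂ ℓ₁ ℓ₂ : ℕ) : ∃ C : ℝ, 1 ≤ C ∧ ∀ (e : Fin 4 → ℤ),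
    (∀ i, e i = 1 ∨ e i = -1) → ∀ Y : ℝ, 1 ≤ Y → ∀ S : Finset (Fin 4 → ℕ),
    (∀ n ∈ S, (∀ i, 1 ≤ n i) → ∃ i, Y ≤ n i) →
    ∑ n ∈ S, |Fd M₁ M₂ ℓ₁ ℓ₂ e n| ≤ C * Y ^ (-(1/4):ℝ) := by
  obtain ⟨C, hC, h⟩ := diag_tail
  refine ⟨C, hC, fun e he Y hY S hS => ?_⟩
  have h1 := h e he Y hY (S.filter (fun n => (∀ i, 1 ≤ n i) ∧ Del e n = 0)) (by
    intro n hn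
    rw [Finset.mem_filter] at hn
    exact ⟨hn.2.2, hn.2.1, hS n hn.1 hn.2.1⟩)
  refine le_trans ?_ h1
  rw [Finset.sum_filter]
  refine Finset.sum_le_sum (fun n _ => ?_)
  split_ifs with hc
  · exact abs_Fd_le _ _ _ _ _ _
  · unfold Fd
    rw [if_neg hc, abs_zero]

theorem Fd_summable (M₁ M₂ ℓ₁ ℓ₂ : ℕ) (e : Fin 4 → ℤ) (he : ∀ i, e i = 1 ∨ e i = -1) :
    Summable (Fd M₁ M₂ ℓ₁ ℓ₂ e) := by
  obtain ⟨C, hC, h⟩ := Fd_tail_set M₁ M₂ ℓ₁ ℓ₂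
  apply Summable.of_abs
  refine summable_of_sum_le (c := C * 1 ^ (-(1/4):ℝ)) (fun n => abs_nonneg _) (fun u => ?_)
  exact h e he 1 le_rfl u (fun n _ hn => ⟨0, by exact_mod_cast hn 0⟩)

theorem Sd_trunc (M₁ M₂ ℓ₁ ℓ₂ : ℕ) : ∃ C : ℝ, 1 ≤ C ∧ ∀ (e : Fin 4 → ℤ),
    (∀ i, e i = 1 ∨ e i = -1) → ∀ Y : ℝ, 1 ≤ Y →
    |∑ n ∈ Fintype.piFinset (fun _ : Fin 4 => Icc 1 ⌊Y⌋₊), Fd M₁ M₂ ℓ₁ ℓ₂ e n - Sd M₁ M₂ ℓ₁ ℓ₂ e| ≤ C * Y ^ (-(1/4):ℝ) := by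
  obtain ⟨C, hC, h⟩ := Fd_tail_set M₁ M₂ ℓ₁ ℓ₂
  refine ⟨C, hC, fun e he Y hY => ?_⟩
  set B := Fintype.piFinset (fun _ : Fin 4 => Icc 1 ⌊Y⌋₊) with hB
  have hs := (Fd_summable M₁ M₂ ℓ₁ ℓ₂ e he).hasSum
  have ht : Filter.Tendsto (fun S => |∑ n ∈ B, Fd M₁ M₂ ℓ₁ ℓ₂ e n - ∑ n ∈ S, Fd M₁ M₂ ℓ₁ ℓ₂ e n|) Filter.atTop
      (nhds |∑ n ∈ B, Fd M₁ M₂ ℓ₁ ℓ₂ e n - Sd M₁ M₂ ℓ₁ ℓ₂ e|) := (tendsto_const_nhds.sub hs).abs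
  refine le_of_tendsto ht ?_
  filter_upwards [Filter.eventually_ge_atTop B] with S hS
  have h1 := Finset.sum_sdiff (f := Fd M₁ M₂ ℓ₁ ℓ₂ e) hS
  have h2 : ∑ n ∈ B, Fd M₁ M₂ ℓ₁ ℓ₂ e n - ∑ n ∈ S, Fd M₁ M₂ ℓ₁ ℓ₂ e n = - ∑ n ∈ S \ B, Fd M₁ M₂ ℓ₁ ℓ₂ e n := by linarith
  rw [h2, abs_neg]
  refine (Finset.abs_sum_le_sum_abs _ _).trans (h e he Y hY _ ?_)
  intro n hn hn1
  rw [Finset.mem_sdiff, hB, Fintype.mem_piFinset] at hn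
  have := hn.2
  push Not at this
  obtain ⟨i, hi⟩ := this
  rw [Finset.mem_Icc] at hi
  push Not at hi
  have h3 := hi (hn1 i)
  exact ⟨i, ((Nat.floor_lt (by linarith)).1 h3).le⟩

theorem nested_prod {α : Type*} (A B C D : Finset α) (f g h k : α → ℂ) :
    (∑ a ∈ A, f a) * (∑ a ∈ B, g a) * (∑ a ∈ C, h a) * (∑ a ∈ D, k a) =
      ∑ a ∈ A, ∑ b ∈ B, ∑ c ∈ C, ∑ d ∈ D, f a * g b * h c * k d := by
  rw [Finset.sum_mul, Finset.sum_mul, Finset.sum_mul]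
  refine Finset.sum_congr rfl (fun a _ => ?_)
  rw [Finset.mul_sum B g, Finset.sum_mul, Finset.sum_mul]
  refine Finset.sum_congr rfl (fun b _ => ?_)
  rw [Finset.mul_sum C h, Finset.sum_mul]
  refine Finset.sum_congr rfl (fun c _ => ?_)
  rw [Finset.mul_sum]

theorem s4_eq (M₁ M₂ ℓ₁ ℓ₂ : ℕ) (e : Fin 4 → ℤ) (he : e 0 = 1) :
    s4 M₁ M₂ ℓ₁ ℓ₂ (e 1) (e 2) (e 3) = Sd M₁ M₂ ℓ₁ ℓ₂ e := by
  unfold s4 Sd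
  let E : (ℕ × ℕ × ℕ × ℕ) ≃ (Fin 4 → ℕ) :=
    { toFun := fun q => ![q.1, q.2.1, q.2.2.1, q.2.2.2]
      invFun := fun n => (n 0, n 1, n 2, n 3)
      left_inv := fun q => by simp
      right_inv := fun n => by funext i; fin_cases i <;> rfl }
  rw [← Equiv.tsum_eq E]
  refine tsum_congr (fun q => ?_)
  obtain ⟨a, b, c, d⟩ := q
  have hE : E (a, b, c, d) = ![a, b, c, d] := rfl
  rw [hE]
  unfold Fd
  have hc : (0 < a ∧ 0 < b ∧ 0 < c ∧ 0 < d ∧ √(a:ℝ) + (e 1:ℝ) * √(b:ℝ) + (e 2:ℝ) * √(c:ℝ) + (e 3:ℝ) * √(d:ℝ) = 0) ↔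
      ((∀ i, 1 ≤ (![a,b,c,d] : Fin 4 → ℕ) i) ∧ Del e ![a,b,c,d] = 0) := by
    unfold Del
    rw [Fin.sum_univ_four, he]
    simp [Fin.forall_fin_succ, Nat.one_le_iff_ne_zero, Nat.pos_iff_ne_zero, and_assoc]
  by_cases h : ((∀ i, 1 ≤ (![a,b,c,d] : Fin 4 → ℕ) i) ∧ Del e ![a,b,c,d] = 0)
  · rw [if_pos h]
    simp only
    rw [if_pos (hc.2 h)]
    congr 1
    · rw [Fin.prod_univ_four]
      simp only [Matrix.cons_val_zero, Matrix.cons_val_one, Matrix.cons_val]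
      rw [Real.mul_rpow (by positivity) (by positivity), Real.mul_rpow (by positivity) (by positivity), Real.mul_rpow (by positivity) (by positivity)]
    · rw [Fin.prod_univ_four]
      simp only [Matrix.cons_val_zero, Matrix.cons_val_one, Matrix.cons_val]
      unfold cph
      rw [nested_prod]
      simp only [Complex.re_sum]
      refine Finset.sum_congr rfl (fun p1 _ => Finset.sum_congr rfl (fun p2 _ => Finset.sum_congr rfl (fun p3 _ => Finset.sum_congr rfl (fun p4 _ => ?_))))
      rw [← Complex.exp_add, ← Complex.exp_add, ← Complex.exp_add, ← add_mul, ← add_mul, ← add_mul]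
      rw [← Complex.ofReal_add, ← Complex.ofReal_add, ← Complex.ofReal_add, Complex.exp_ofReal_mul_I_re, he]
      congr 1; push_cast; ring
  · rw [if_neg h]
    simp only
    rw [if_neg (fun h' => h (hc.1 h'))]

/-- the eight sign patterns with first sign `+` -/
def pat : Fin 8 → Fin 4 → ℤ :=
  ![![1,1,1,1], ![1,1,1,-1], ![1,1,-1,1], ![1,1,-1,-1], ![1,-1,1,1], ![1,-1,1,-1], ![1,-1,-1,1], ![1,-1,-1,-1]]

theorem pat_sign : ∀ k i, pat k i = 1 ∨ pat k i = -1 := by decide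

/-- sum of `Sd` over patterns is `C4` -/
theorem sum_Sd (M₁ M₂ ℓ₁ ℓ₂ : ℕ) : ∑ k, Sd M₁ M₂ ℓ₁ ℓ₂ (pat k) = C4 M₁ M₂ ℓ₁ ℓ₂ := by
  have h0 : Sd M₁ M₂ ℓ₁ ℓ₂ (pat 0) = 0 := by
    unfold Sd
    have : ∀ n, Fd M₁ M₂ ℓ₁ ℓ₂ (pat 0) n = 0 := by
      intro n
      unfold Fd
      rw [if_neg]
      rintro ⟨h1, h2⟩
      unfold Del at h2
      rw [Fin.sum_univ_four] at h2
      simp [pat] at h2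
      have : 0 < √(n 0:ℝ) := Real.sqrt_pos.2 (by exact_mod_cast h1 0)
      have a1 := Real.sqrt_nonneg (n 1:ℝ)
      have a2 := Real.sqrt_nonneg (n 2:ℝ)
      have a3 := Real.sqrt_nonneg (n 3:ℝ)
      linarith
    simp only [this, tsum_zero]
  have h2 : Sd M₁ M₂ ℓ₁ ℓ₂ (pat 2) = Sd M₁ M₂ ℓ₁ ℓ₂ (pat 1) := by
    rw [← Sd_perm M₁ M₂ ℓ₁ ℓ₂ (Equiv.swap 2 3) (pat 1)]; congr 1; decide
  have h4 : Sd M₁ M₂ ℓ₁ ℓ₂ (pat 4) = Sd M₁ M₂ ℓ₁ ℓ₂ (pat 1) := by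
    rw [← Sd_perm M₁ M₂ ℓ₁ ℓ₂ (Equiv.swap 1 3) (pat 1)]; congr 1; decide
  have h5 : Sd M₁ M₂ ℓ₁ ℓ₂ (pat 5) = Sd M₁ M₂ ℓ₁ ℓ₂ (pat 3) := by
    rw [← Sd_perm M₁ M₂ ℓ₁ ℓ₂ (Equiv.swap 1 2) (pat 3)]; congr 1; decide
  have h6 : Sd M₁ M₂ ℓ₁ ℓ₂ (pat 6) = Sd M₁ M₂ ℓ₁ ℓ₂ (pat 3) := by
    rw [← Sd_perm M₁ M₂ ℓ₁ ℓ₂ (Equiv.swap 1 3) (pat 3)]; congr 1; decide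
  have e1 := s4_eq M₁ M₂ ℓ₁ ℓ₂ (pat 1) (by decide)
  have e3 := s4_eq M₁ M₂ ℓ₁ ℓ₂ (pat 3) (by decide)
  have e7 := s4_eq M₁ M₂ ℓ₁ ℓ₂ (pat 7) (by decide)
  rw [Fin.sum_univ_eight, h0, h2, h4, h5, h6, ← e1, ← e3, ← e7]
  unfold C4
  have q1 : pat 1 1 = 1 := by decide
  have q2 : pat 1 2 = 1 := by decide
  have q3 : pat 1 3 = -1 := by decide
  have r1 : pat 3 1 = 1 := by decide
  have r2 : pat 3 2 = -1 := by decide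
  have r3 : pat 3 3 = -1 := by decide
  have t1 : pat 7 1 = -1 := by decide
  have t2 : pat 7 2 = -1 := by decide
  have t3 : pat 7 3 = -1 := by decide
  rw [q1, q2, q3, r1, r2, r3, t1, t2, t3]
  push_cast
  ring

theorem osc_int_real (T c φ : ℝ) (hT : 0 < T) (hc : c ≠ 0) :
    |∫ x in (T/2)..T, x * cos (c * √x - φ)| ≤ 7 * T ^ (3/2:ℝ) / |c| := by
  have hpos : ∀ x ∈ Set.uIcc (T/2) T, 0 < x := by
    intro x hx
    rw [Set.uIcc_of_le (by linarith)] at hx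
    linarith [hx.1]
  have hT32 : T * √T = T ^ (3/2:ℝ) := by
    rw [Real.sqrt_eq_rpow]
    nth_rewrite 1 [← Real.rpow_one T]
    rw [← Real.rpow_add hT]; norm_num
  have hder : ∀ x ∈ Set.uIcc (T/2) T, HasDerivAt (fun x => (2/c) * (x * √x) * sin (c * √x - φ))
      ((3/c) * √x * sin (c * √x - φ) + x * cos (c * √x - φ)) x := by
    intro x hx
    have hx0 := hpos x hx
    have hs := Real.hasDerivAt_sqrt hx0.ne'
    have h1 := (((hasDerivAt_id x).mul hs).const_mul (2/c)).mul (((hs.const_mul c).sub_const φ).sin)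
    refine h1.congr_deriv ?_
    have hsx : 0 < √x := Real.sqrt_pos.2 hx0
    have hsq : x = √x * √x := (Real.mul_self_sqrt hx0.le).symm
    simp only [Pi.mul_apply, id]
    generalize √x = s at *
    subst hsq
    field_simp
    ring
  have hcont1 : IntervalIntegrable (fun x => (3/c) * √x * sin (c * √x - φ)) volume (T/2) T := by
    apply Continuous.intervalIntegrable
    fun_prop
  have hcont2 : IntervalIntegrable (fun x => x * cos (c * √x - φ)) volume (T/2) T := by
    apply Continuous.intervalIntegrable
    fun_prop
  have hintegral := intervalIntegral.integral_eq_sub_of_hasDerivAt hder (hcont1.add hcont2)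
  rw [intervalIntegral.integral_add hcont1 hcont2] at hintegral
  have hb1 : |∫ x in (T/2)..T, (3/c) * √x * sin (c * √x - φ)| ≤ (3/|c|) * √T * |T - T/2| := by
    rw [← Real.norm_eq_abs]
    apply intervalIntegral.norm_integral_le_of_norm_le_const
    intro x hx
    rw [Set.uIoc_of_le (by linarith)] at hx
    rw [norm_mul, norm_mul, Real.norm_eq_abs, Real.norm_eq_abs, Real.norm_eq_abs, abs_div, abs_of_nonneg (Real.sqrt_nonneg x)]
    rw [abs_of_nonneg (by norm_num : (0:ℝ) ≤ 3)]
    have h1 : √x ≤ √T := Real.sqrt_le_sqrt hx.2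
    calc 3 / |c| * √x * |sin (c * √x - φ)| ≤ 3 / |c| * √T * 1 := by
          gcongr
          exact Real.abs_sin_le_one _
      _ = _ := by ring
  have hb2 : ∀ x, 0 < x → x ≤ T → |(2/c) * (x * √x) * sin (c * √x - φ)| ≤ 2 / |c| * (T * √T) := by
    intro x hx hxT
    rw [abs_mul, abs_mul, abs_div, abs_of_nonneg (by norm_num : (0:ℝ) ≤ 2), abs_of_nonneg (by positivity : 0 ≤ x * √x)]
    calc 2 / |c| * (x * √x) * |sin (c * √x - φ)| ≤ 2 / |c| * (T * √T) * 1 := by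
          gcongr
          exact Real.abs_sin_le_one _
      _ = _ := by ring
  have hA := hb2 T hT le_rfl
  have hB := hb2 (T/2) (by linarith) (by linarith)
  have : ∫ x in (T/2)..T, x * cos (c * √x - φ) = (2/c) * (T * √T) * sin (c * √T - φ) - (2/c) * (T/2 * √(T/2)) * sin (c * √(T/2) - φ)
    - ∫ x in (T/2)..T, (3/c) * √x * sin (c * √x - φ) := by linarith
  rw [this]
  have h0 : |T - T/2| = T/2 := by rw [abs_of_nonneg] <;> linarith
  rw [h0] at hb1
  refine (abs_sub _ _).trans ?_
  have h3 := abs_sub ((2/c) * (T * √T) * sin (c * √T - φ)) ((2/c) * (T/2 * √(T/2)) * sin (c * √(T/2) - φ))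
  rw [← hT32]
  have hc0 : 0 < |c| := abs_pos.2 hc
  have e1 : 3 / |c| * √T * (T/2) = (T * √T / |c|) * (3/2) := by ring
  have e2 : 2 / |c| * (T * √T) = (T * √T / |c|) * 2 := by ring
  have e3 : 7 * (T * √T) / |c| = (T * √T / |c|) * 7 := by ring
  have e4 : 0 ≤ T * √T / |c| := by positivity
  rw [e3]; rw [e2] at hA hB; rw [e1] at hb1
  linarith

theorem osc_int_real' (T Δ φ : ℝ) (hT : 0 < T) (hΔ : Δ ≠ 0) :
    |∫ x in (T/2)..T, x * cos (4 * π * Δ * √x - φ)| ≤ T ^ (3/2:ℝ) * min (T ^ (1/2:ℝ)) (1 / |Δ|) := by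
  rw [mul_min_of_nonneg _ _ (by positivity)]
  apply le_min
  · have h1 : |∫ x in (T/2)..T, x * cos (4 * π * Δ * √x - φ)| ≤ T * |T - T/2| := by
      rw [← Real.norm_eq_abs]
      apply intervalIntegral.norm_integral_le_of_norm_le_const
      intro x hx
      rw [Set.uIoc_of_le (by linarith)] at hx
      rw [norm_mul, Real.norm_eq_abs, Real.norm_eq_abs, abs_of_nonneg (by linarith [hx.1])]
      calc x * |cos (4 * π * Δ * √x - φ)| ≤ T * 1 := by
            gcongr
            · exact hx.2
            · exact Real.abs_cos_le_one _
        _ = T := mul_one T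
    have h0 : |T - T/2| = T/2 := by rw [abs_of_nonneg] <;> linarith
    rw [h0] at h1
    refine h1.trans ?_
    rw [← Real.rpow_add hT]
    have : T ^ ((3/2:ℝ) + 1/2) = T * T := by
      rw [show (3/2:ℝ) + 1/2 = ((2:ℕ):ℝ) by norm_num, Real.rpow_natCast, sq]
    rw [this]; nlinarith
  · have h := osc_int_real T (4 * π * Δ) φ hT (by positivity)
    refine h.trans ?_
    rw [abs_mul, abs_of_nonneg (by positivity : 0 ≤ 4 * π)]
    have hD : 0 < |Δ| := abs_pos.2 hΔ
    rw [div_le_iff₀ (by positivity)]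
    have : T ^ (3/2:ℝ) * (1/|Δ|) * (4 * π * |Δ|) = T ^ (3/2:ℝ) * (4 * π) := by field_simp
    rw [this, mul_comm]
    gcongr
    linarith [Real.pi_gt_three]

theorem osc_int (T Δ : ℝ) (z : ℂ) (hT : 0 < T) (hΔ : Δ ≠ 0) :
    |∫ x in (T/2)..T, x * (Complex.exp (((4 * π * Δ * √x : ℝ):ℂ) * Complex.I) * z).re| ≤
      2 * ‖z‖ * (T ^ (3/2:ℝ) * min (T ^ (1/2:ℝ)) (1 / |Δ|)) := by
  have h1 : ∀ x : ℝ, x * (Complex.exp (((4 * π * Δ * √x : ℝ):ℂ) * Complex.I) * z).re =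
      z.re * (x * cos (4 * π * Δ * √x - 0)) + (- z.im) * (x * cos (4 * π * Δ * √x - π/2)) := by
    intro x
    rw [Complex.mul_re, Complex.exp_ofReal_mul_I_re, Complex.exp_ofReal_mul_I_im, Real.cos_sub_pi_div_two, sub_zero]
    ring
  simp_rw [h1]
  have hc : ∀ φ : ℝ, Continuous (fun x => x * cos (4 * π * Δ * √x - φ)) := by intro φ; fun_prop
  rw [intervalIntegral.integral_add (((hc 0).const_mul z.re).intervalIntegrable _ _) (((hc (π/2)).const_mul (-z.im)).intervalIntegrable _ _),
    intervalIntegral.integral_const_mul, intervalIntegral.integral_const_mul]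
  have a := osc_int_real' T Δ 0 hT hΔ
  have b := osc_int_real' T Δ (π/2) hT hΔ
  set X := T ^ (3/2:ℝ) * min (T ^ (1/2:ℝ)) (1 / |Δ|)
  refine (abs_add_le _ _).trans ?_
  rw [abs_mul, abs_mul, abs_neg]
  have h3 := Complex.abs_re_le_norm z
  have h4 := Complex.abs_im_le_norm z
  calc _ ≤ ‖z‖ * X + ‖z‖ * X := by gcongr
    _ = _ := by ring

/-- conj depending on sign -/
def cj (e : ℤ) (z : ℂ) : ℂ := if e = 1 then z else (starRingEnd ℂ) z

theorem re_prod_four (z : Fin 4 → ℂ) : ∏ i, (z i).re = (1/8) * ∑ k, (∏ i, cj (pat k i) (z i)).re := by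
  rw [Fin.sum_univ_eight]
  simp only [Fin.prod_univ_four]
  simp [pat, cj, Complex.mul_re, Complex.mul_im]
  ring

theorem cj_z (M₁ M₂ ℓ₁ ℓ₂ : ℕ) (e : ℤ) (he : e = 1 ∨ e = -1) (θ : ℝ) (n : ℕ) :
    cj e (Complex.exp ((θ:ℂ) * Complex.I) * cph M₁ M₂ ℓ₁ ℓ₂ (-1) n) =
      Complex.exp ((((e:ℝ) * θ : ℝ):ℂ) * Complex.I) * cph M₁ M₂ ℓ₁ ℓ₂ (-e) n := by
  unfold cj
  rcases he with rfl | rfl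
  · simp
  · rw [if_neg (by norm_num), map_mul, conj_cph, ← Complex.exp_conj, map_mul, Complex.conj_I, Complex.conj_ofReal]
    congr 2
    push_cast; ring

theorem tau_eq (M₁ M₂ ℓ₁ ℓ₂ : ℕ) (n : ℕ) (x : ℝ) :
    tau M₁ M₂ ℓ₁ ℓ₂ n x = (Complex.exp (((4 * π * (√n * √x) : ℝ):ℂ) * Complex.I) * cph M₁ M₂ ℓ₁ ℓ₂ (-1) n).re := by
  unfold tau cph
  rw [Finset.mul_sum, Complex.re_sum]
  refine Finset.sum_congr rfl (fun p _ => ?_)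
  rw [← Complex.exp_add, ← add_mul, ← Complex.ofReal_add, Complex.exp_ofReal_mul_I_re, Real.sqrt_mul (by positivity)]
  congr 1; push_cast; ring

theorem tau_prod (M₁ M₂ ℓ₁ ℓ₂ : ℕ) (n : Fin 4 → ℕ) (x : ℝ) :
    ∏ i, tau M₁ M₂ ℓ₁ ℓ₂ (n i) x = (1/8) * ∑ k, (Complex.exp (((4 * π * Del (pat k) n * √x : ℝ):ℂ) * Complex.I) *
      ∏ i, cph M₁ M₂ ℓ₁ ℓ₂ (- pat k i) (n i)).re := by
  simp_rw [tau_eq]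
  rw [re_prod_four]
  congr 1
  refine Finset.sum_congr rfl (fun k _ => ?_)
  congr 1
  rw [Finset.prod_congr rfl (fun i _ => cj_z M₁ M₂ ℓ₁ ℓ₂ (pat k i) (pat_sign k i) _ (n i)), Finset.prod_mul_distrib,
    ← Complex.exp_sum]
  congr 2
  rw [← Finset.sum_mul, ← Complex.ofReal_sum]
  congr 2
  unfold Del
  rw [Finset.mul_sum, Finset.sum_mul]
  refine Finset.sum_congr rfl (fun i _ => ?_)
  ring

theorem R0_pow_four (M₁ M₂ ℓ₁ ℓ₂ : ℕ) (y x : ℝ) (hx : 0 ≤ x) :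
    R0 M₁ M₂ ℓ₁ ℓ₂ y x ^ 4 = 1 / (32 * π ^ 4) * ∑ n ∈ Fintype.piFinset (fun _ : Fin 4 => Icc 1 ⌊y⌋₊), ∑ k,
      (∏ i, (n i:ℝ) ^ (-(3:ℝ)/4)) * (x * (Complex.exp (((4 * π * Del (pat k) n * √x : ℝ):ℂ) * Complex.I) *
      ∏ i, cph M₁ M₂ ℓ₁ ℓ₂ (- pat k i) (n i)).re) := by
  unfold R0
  rw [mul_pow]
  have h1 : (x ^ ((1:ℝ)/4) / (√2 * π))^4 = x / (4 * π ^ 4) := by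
    rw [div_pow, mul_pow, ← Real.rpow_natCast (x ^ ((1:ℝ)/4)) 4, ← Real.rpow_mul hx]
    have : √2 ^ 4 = 4 := by
      rw [show √2 ^ 4 = (√2 ^ 2)^2 by ring, Real.sq_sqrt (by norm_num)]; norm_num
    rw [this]
    norm_num
  have h2 : (∑ n ∈ Icc 1 ⌊y⌋₊, tau M₁ M₂ ℓ₁ ℓ₂ n x * (n:ℝ) ^ (-(3:ℝ)/4))^4 =
      ∑ n ∈ Fintype.piFinset (fun _ : Fin 4 => Icc 1 ⌊y⌋₊), ∏ i, (tau M₁ M₂ ℓ₁ ℓ₂ (n i) x * (n i:ℝ) ^ (-(3:ℝ)/4)) := by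
    rw [← Finset.prod_univ_sum (fun _ : Fin 4 => Icc 1 ⌊y⌋₊) (fun _ n => tau M₁ M₂ ℓ₁ ℓ₂ n x * (n:ℝ) ^ (-(3:ℝ)/4))]
    simp
  rw [h1, h2, Finset.mul_sum, Finset.mul_sum]
  refine Finset.sum_congr rfl (fun n _ => ?_)
  rw [Finset.prod_mul_distrib, tau_prod, ← Finset.mul_sum, ← Finset.mul_sum]
  generalize (∑ k, (Complex.exp (((4 * π * Del (pat k) n * √x : ℝ):ℂ) * Complex.I) *
      ∏ i, cph M₁ M₂ ℓ₁ ℓ₂ (- pat k i) (n i)).re) = S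
  generalize (∏ i, (n i:ℝ) ^ (-(3:ℝ)/4)) = S2
  ring

theorem R0_cont (M₁ M₂ ℓ₁ ℓ₂ : ℕ) (y : ℝ) : Continuous (fun x => R0 M₁ M₂ ℓ₁ ℓ₂ y x) := by
  unfold R0 tau
  have : Continuous (fun x : ℝ => x ^ ((1:ℝ)/4)) := Real.continuous_rpow_const (by norm_num)
  fun_prop

theorem diag_term_eq (M₁ M₂ ℓ₁ ℓ₂ : ℕ) (e : Fin 4 → ℤ) (n : Fin 4 → ℕ) :
    (∏ i, cph M₁ M₂ ℓ₁ ℓ₂ (- e i) (n i)).re = (∏ i, cph M₁ M₂ ℓ₁ ℓ₂ (e i) (n i)).re := by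
  rw [← Complex.conj_re, map_prod]
  congr 1
  refine Finset.prod_congr rfl (fun i _ => ?_)
  rw [conj_cph, neg_neg]

theorem R0_fourth (M₁ M₂ ℓ₁ ℓ₂ : ℕ) (ε : ℝ) (hε : 0 < ε) : ∃ C : ℝ, 1 ≤ C ∧ ∀ T : ℝ, 1 ≤ T →
    |(∫ x in (T/2)..T, R0 M₁ M₂ ℓ₁ ℓ₂ (T ^ ((3:ℝ)/4)) x ^ 4) - 1 / (32 * π ^ 4) * C4 M₁ M₂ ℓ₁ ℓ₂ * ∫ x in (T/2)..T, x|
      ≤ C * T ^ (2 - 1/8 + ε) := by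
  obtain ⟨C1, hC1, hoff⟩ := offdiag ε hε
  obtain ⟨C2, hC2, htr⟩ := Sd_trunc M₁ M₂ ℓ₁ ℓ₂
  refine ⟨8 * (2 * C1 + C2), by linarith, fun T hT => ?_⟩
  have hT0 : 0 < T := by linarith
  set y := T ^ ((3:ℝ)/4) with hy
  have hy1 : 1 ≤ y := Real.one_le_rpow hT (by norm_num)
  set B := Fintype.piFinset (fun _ : Fin 4 => Icc 1 ⌊y⌋₊) with hB
  have hBm : ∀ n ∈ B, ∀ i, 1 ≤ n i ∧ (n i:ℝ) ≤ y := by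
    intro n hn i
    rw [hB, Fintype.mem_piFinset] at hn
    have := Finset.mem_Icc.1 (hn i)
    exact ⟨this.1, (Nat.le_floor_iff (by linarith)).1 this.2⟩
  set W : (Fin 4 → ℕ) → ℝ := fun n => ∏ i, (n i:ℝ) ^ (-(3:ℝ)/4) with hW
  have hW0 : ∀ n, 0 ≤ W n := fun n => Finset.prod_nonneg (fun i _ => by positivity)
  set K : Fin 8 → (Fin 4 → ℕ) → ℂ := fun k n => ∏ i, cph M₁ M₂ ℓ₁ ℓ₂ (- pat k i) (n i) with hK
  set Iv : Fin 8 → (Fin 4 → ℕ) → ℝ := fun k n => ∫ x in (T/2)..T, x * (Complex.exp (((4 * π * Del (pat k) n * √x : ℝ):ℂ) * Complex.I) * K k n).re with hIv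
  have hI4 : ∫ x in (T/2)..T, R0 M₁ M₂ ℓ₁ ℓ₂ y x ^ 4 = 1 / (32 * π ^ 4) * ∑ n ∈ B, ∑ k, W n * Iv k n := by
    have h1 : ∫ x in (T/2)..T, R0 M₁ M₂ ℓ₁ ℓ₂ y x ^ 4 = ∫ x in (T/2)..T, 1 / (32 * π ^ 4) * ∑ n ∈ B, ∑ k,
      W n * (x * (Complex.exp (((4 * π * Del (pat k) n * √x : ℝ):ℂ) * Complex.I) * K k n).re) := by
      apply intervalIntegral.integral_congr
      intro x hx
      rw [Set.uIcc_of_le (by linarith)] at hx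
      exact R0_pow_four M₁ M₂ ℓ₁ ℓ₂ y x (by linarith [hx.1])
    have hct : ∀ k n, Continuous (fun x : ℝ => x * (Complex.exp (((4 * π * Del (pat k) n * √x : ℝ):ℂ) * Complex.I) * K k n).re) := by
      intro k n; fun_prop
    rw [h1, intervalIntegral.integral_const_mul, intervalIntegral.integral_finsetSum]
    · congr 1
      refine Finset.sum_congr rfl (fun n _ => ?_)
      rw [intervalIntegral.integral_finsetSum]
      · refine Finset.sum_congr rfl (fun k _ => ?_)
        rw [intervalIntegral.integral_const_mul]
      · intro k _
        exact ((hct k n).const_mul _).intervalIntegrable _ _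
    · intro n _
      apply Continuous.intervalIntegrable
      exact continuous_finsetSum _ (fun k _ => (hct k n).const_mul _)
  set X := ∫ x in (T/2)..T, x with hX
  have hX0 : 0 ≤ X ∧ X ≤ T ^ 2 := by
    rw [hX, integral_id]; constructor <;> nlinarith
  have hsplit : ∀ k, |∑ n ∈ B, W n * Iv k n - Sd M₁ M₂ ℓ₁ ℓ₂ (pat k) * X| ≤ (2 * C1 + C2) * T ^ (2 - 1/8 + ε) := by
    intro k
    have hterm : ∀ n ∈ B, W n * Iv k n = Fd M₁ M₂ ℓ₁ ℓ₂ (pat k) n * X + if Del (pat k) n ≠ 0 then W n * Iv k n else 0 := by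
      intro n hn
      by_cases h : Del (pat k) n = 0
      · rw [if_neg (by simpa using h), add_zero]
        unfold Fd
        rw [if_pos ⟨fun i => (hBm n hn i).1, h⟩, mul_assoc]
        congr 1
        simp only [hIv, hK, h]
        rw [← diag_term_eq]
        simp only [mul_zero, zero_mul, Complex.ofReal_zero, Complex.exp_zero, one_mul]
        rw [intervalIntegral.integral_mul_const, mul_comm]
      · rw [if_pos h]
        unfold Fd
        rw [if_neg (fun h' => h h'.2), zero_mul, zero_add]
    rw [Finset.sum_congr rfl hterm, Finset.sum_add_distrib, ← Finset.sum_mul, ← Finset.sum_filter]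
    have h1 := htr (pat k) (pat_sign k) y hy1
    have h2 : |∑ n ∈ B.filter (fun n => Del (pat k) n ≠ 0), W n * Iv k n| ≤ 2 * T ^ (3/2:ℝ) * (C1 * T ^ (3/8 + ε)) := by
      have h3 := hoff T hT (pat k) (pat_sign k) (B.filter (fun n => Del (pat k) n ≠ 0)) (by
        intro n hn
        rw [Finset.mem_filter] at hn
        exact ⟨hn.2, hBm n hn.1⟩)
      refine (Finset.abs_sum_le_sum_abs _ _).trans ?_
      refine le_trans ?_ (mul_le_mul_of_nonneg_left h3 (by positivity : 0 ≤ 2 * T ^ (3/2:ℝ)))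
      rw [Finset.mul_sum]
      refine Finset.sum_le_sum (fun n hn => ?_)
      rw [Finset.mem_filter] at hn
      have h4 := osc_int T (Del (pat k) n) (K k n) hT0 hn.2
      have h5 := prod_wt M₁ M₂ ℓ₁ ℓ₂ (fun i => - pat k i) n
      rw [abs_mul, abs_of_nonneg (hW0 n)]
      have hm : 0 ≤ min (T ^ (1/2:ℝ)) (1 / |Del (pat k) n|) := le_min (by positivity) (by positivity)
      calc W n * |Iv k n| ≤ W n * (2 * ‖K k n‖ * (T ^ (3/2:ℝ) * min (T ^ (1/2:ℝ)) (1 / |Del (pat k) n|))) :=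
            mul_le_mul_of_nonneg_left h4 (hW0 n)
        _ = 2 * T ^ (3/2:ℝ) * ((W n * ‖K k n‖) * min (T ^ (1/2:ℝ)) (1 / |Del (pat k) n|)) := by ring
        _ ≤ _ := by gcongr
    have e1 : T ^ (3/2:ℝ) * T ^ (3/8 + ε) = T ^ (2 - 1/8 + ε) := by
      rw [← Real.rpow_add hT0]; congr 1; ring
    have e2 : y ^ (-(1/4):ℝ) * T ^ 2 ≤ T ^ (2 - 1/8 + ε) := by
      rw [hy, ← Real.rpow_mul hT0.le, ← Real.rpow_natCast T 2, ← Real.rpow_add hT0]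
      apply Real.rpow_le_rpow_of_exponent_le hT
      push_cast; linarith
    have h6 : |(∑ n ∈ B, Fd M₁ M₂ ℓ₁ ℓ₂ (pat k) n - Sd M₁ M₂ ℓ₁ ℓ₂ (pat k)) * X| ≤ C2 * T ^ (2 - 1/8 + ε) := by
      rw [abs_mul, abs_of_nonneg hX0.1]
      calc _ ≤ C2 * y ^ (-(1/4):ℝ) * T ^ 2 := mul_le_mul h1 hX0.2 hX0.1 (by positivity)
        _ = C2 * (y ^ (-(1/4):ℝ) * T ^ 2) := by ring
        _ ≤ _ := by gcongr
    have e3 : (∑ n ∈ B, Fd M₁ M₂ ℓ₁ ℓ₂ (pat k) n) * X + (∑ n ∈ B.filter (fun n => Del (pat k) n ≠ 0), W n * Iv k n) - Sd M₁ M₂ ℓ₁ ℓ₂ (pat k) * X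
      = (∑ n ∈ B, Fd M₁ M₂ ℓ₁ ℓ₂ (pat k) n - Sd M₁ M₂ ℓ₁ ℓ₂ (pat k)) * X + (∑ n ∈ B.filter (fun n => Del (pat k) n ≠ 0), W n * Iv k n) := by ring
    rw [e3]
    refine (abs_add_le _ _).trans ?_
    have e4 : 2 * T ^ (3/2:ℝ) * (C1 * T ^ (3/8 + ε)) = 2 * C1 * T ^ (2 - 1/8 + ε) := by rw [← e1]; ring
    rw [e4] at h2
    linarith
  rw [hI4, Finset.sum_comm, ← sum_Sd]
  have e5 : 1 / (32 * π ^ 4) * (∑ k, ∑ n ∈ B, W n * Iv k n) - 1 / (32 * π ^ 4) * (∑ k, Sd M₁ M₂ ℓ₁ ℓ₂ (pat k)) * X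
      = 1 / (32 * π ^ 4) * ∑ k, (∑ n ∈ B, W n * Iv k n - Sd M₁ M₂ ℓ₁ ℓ₂ (pat k) * X) := by
    rw [Finset.sum_sub_distrib, ← Finset.sum_mul]; ring
  rw [e5, abs_mul, abs_of_nonneg (by positivity)]
  have h7 : |∑ k, (∑ n ∈ B, W n * Iv k n - Sd M₁ M₂ ℓ₁ ℓ₂ (pat k) * X)| ≤ 8 * ((2 * C1 + C2) * T ^ (2 - 1/8 + ε)) := by
    refine (Finset.abs_sum_le_sum_abs _ _).trans ((Finset.sum_le_sum (fun k _ => hsplit k)).trans ?_)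
    simp
  have h8 : 1 / (32 * π ^ 4) ≤ 1 := by
    rw [div_le_one (by positivity)]
    have : 1 ≤ π ^ 4 := one_le_pow₀ (by linarith [Real.pi_gt_three])
    linarith
  calc _ ≤ 1 * (8 * ((2 * C1 + C2) * T ^ (2 - 1/8 + ε))) := by
        apply mul_le_mul h8 h7 (abs_nonneg _) (by norm_num)
    _ = _ := by ring

/-- `e(t) = exp(2 pi i t)` -/
def ee (t : ℝ) : ℂ := Complex.exp (((2 * π * t : ℝ):ℂ) * Complex.I)

theorem norm_ee (t : ℝ) : ‖ee t‖ = 1 := Complex.norm_exp_ofReal_mul_I _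

theorem ee_add (s t : ℝ) : ee (s + t) = ee s * ee t := by
  unfold ee
  rw [← Complex.exp_add]; congr 1; push_cast; ring

theorem ee_zero : ee 0 = 1 := by simp [ee]

theorem ee_re (t : ℝ) : (ee t).re = cos (2 * π * t) := Complex.exp_ofReal_mul_I_re _

theorem ee_cont : Continuous ee := by unfold ee; fun_prop

theorem ee_deriv (f : ℝ → ℝ) (f' x : ℝ) (hf : HasDerivAt f f' x) :
    HasDerivAt (fun t => ee (f t)) (((2 * π * f' : ℝ):ℂ) * Complex.I * ee (f x)) x := by
  unfold ee
  have h1 : HasDerivAt (fun t => (2 * π * f t : ℝ)) (2 * π * f') x := hf.const_mul _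
  have h2 := (h1.ofReal_comp.mul_const Complex.I).cexp
  refine h2.congr_deriv ?_
  ring

theorem parts_bound (a b M : ℝ) (hab : a ≤ b) (w w' : ℝ → ℝ) (U U' : ℝ → ℂ)
    (hw : ∀ x ∈ Set.Icc a b, HasDerivAt w (w' x) x) (hU : ∀ x ∈ Set.Icc a b, HasDerivAt U (U' x) x)
    (hw'c : ContinuousOn w' (Set.Icc a b)) (hU'c : ContinuousOn U' (Set.Icc a b))
    (hs : ∀ x ∈ Set.Icc a b, w' x ≤ 0) (hwb : 0 ≤ w b) (hM : ∀ x ∈ Set.Icc a b, ‖U x‖ ≤ M) :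
    ‖∫ x in a..b, (w x:ℂ) * U' x‖ ≤ 2 * M * w a := by
  have huI : Set.uIcc a b = Set.Icc a b := Set.uIcc_of_le hab
  have hi1 : IntervalIntegrable (fun x => (w' x:ℂ)) volume a b := by
    apply ContinuousOn.intervalIntegrable
    rw [huI]
    exact Complex.continuous_ofReal.comp_continuousOn hw'c
  have hi1' : IntervalIntegrable w' volume a b := by
    apply ContinuousOn.intervalIntegrable
    rwa [huI]
  have hi2 : IntervalIntegrable U' volume a b := by
    apply ContinuousOn.intervalIntegrable
    rwa [huI]
  have hp := intervalIntegral.integral_mul_deriv_eq_deriv_mul (a := a) (b := b) (u := fun x => (w x:ℂ)) (v := U)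
    (u' := fun x => (w' x:ℂ)) (v' := U') (fun x hx => (hw x (huI ▸ hx)).ofReal_comp) (fun x hx => hU x (huI ▸ hx)) hi1 hi2
  rw [hp]
  have hM0 : 0 ≤ M := (norm_nonneg _).trans (hM a ⟨le_rfl, hab⟩)
  have hFTC : ∫ x in a..b, w' x = w b - w a :=
    intervalIntegral.integral_eq_sub_of_hasDerivAt (fun x hx => hw x (huI ▸ hx)) hi1'
  have hb : ‖∫ x in a..b, (w' x:ℂ) * U x‖ ≤ ∫ x in a..b, M * (- w' x) := by
    apply intervalIntegral.norm_integral_le_of_norm_le hab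
    · filter_upwards with x hx
      have hx' : x ∈ Set.Icc a b := ⟨hx.1.le, hx.2⟩
      rw [norm_mul, Complex.norm_real, Real.norm_eq_abs, abs_of_nonpos (hs x hx'), mul_comm]
      exact mul_le_mul_of_nonneg_right (hM x hx') (by linarith [hs x hx'])
    · exact (hi1'.neg).const_mul M
  rw [intervalIntegral.integral_const_mul, intervalIntegral.integral_neg, hFTC] at hb
  have hI0 : 0 ≤ w a - w b := by
    have : ∫ x in a..b, w' x ≤ 0 := by
      have := intervalIntegral.integral_nonneg (μ := volume) (f := fun x => - w' x) hab (fun x hx => by linarith [hs x hx])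
      rw [intervalIntegral.integral_neg] at this
      linarith
    linarith
  have e1 : ‖(w b:ℂ) * U b‖ ≤ M * w b := by
    rw [norm_mul, Complex.norm_real, Real.norm_eq_abs, abs_of_nonneg hwb, mul_comm]
    exact mul_le_mul_of_nonneg_right (hM b ⟨hab, le_rfl⟩) hwb
  have hwa : 0 ≤ w a := by linarith
  have e2 : ‖(w a:ℂ) * U a‖ ≤ M * w a := by
    rw [norm_mul, Complex.norm_real, Real.norm_eq_abs, abs_of_nonneg hwa, mul_comm]
    exact mul_le_mul_of_nonneg_right (hM a ⟨le_rfl, hab⟩) hwa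
  calc _ ≤ ‖(w b:ℂ) * U b - (w a:ℂ) * U a‖ + ‖∫ x in a..b, (w' x:ℂ) * U x‖ := norm_sub_le _ _
    _ ≤ (M * w b + M * w a) + M * (-(w b - w a)) := by
        gcongr
        exact (norm_sub_le _ _).trans (by linarith)
    _ = _ := by ring

/-- first derivative test -/
theorem first_deriv (a b : ℝ) (hab : a ≤ b) (g f f' w w' : ℝ → ℝ)
    (hf : ∀ x ∈ Set.Icc a b, HasDerivAt f (f' x) x) (hf'c : ContinuousOn f' (Set.Icc a b))
    (hw : ∀ x ∈ Set.Icc a b, HasDerivAt w (w' x) x)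
    (hw'c : ContinuousOn w' (Set.Icc a b)) (hs : ∀ x ∈ Set.Icc a b, w' x ≤ 0) (hwb : 0 ≤ w b)
    (hg : ∀ x ∈ Set.Icc a b, g x = w x * f' x) :
    ‖∫ x in a..b, (g x:ℂ) * ee (f x)‖ ≤ w a := by
  have hfc : ContinuousOn f (Set.Icc a b) := fun x hx => (hf x hx).continuousAt.continuousWithinAt
  have h := parts_bound a b (1/(2*π)) hab w w' (fun x => (1/(2*π*Complex.I)) * ee (f x)) (fun x => (f' x:ℂ) * ee (f x)) hw (by
      intro x hx
      refine ((ee_deriv f (f' x) x (hf x hx)).const_mul _).congr_deriv ?_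
      have hpi : (π:ℂ) ≠ 0 := by exact_mod_cast Real.pi_ne_zero
      have := Complex.I_ne_zero
      push_cast
      field_simp) hw'c (by
      apply ContinuousOn.mul
      · exact Complex.continuous_ofReal.comp_continuousOn hf'c
      · exact ee_cont.comp_continuousOn hfc) hs hwb (by
      intro x hx
      rw [norm_mul, norm_ee, mul_one, norm_div, norm_mul, norm_mul, Complex.norm_I, Complex.norm_real, Real.norm_eq_abs, abs_of_pos Real.pi_pos]
      simp)
  have hcongr : ∫ x in a..b, (g x:ℂ) * ee (f x) = ∫ x in a..b, (w x:ℂ) * ((f' x:ℂ) * ee (f x)) := by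
    apply intervalIntegral.integral_congr
    intro x hx
    rw [Set.uIcc_of_le hab] at hx
    simp only
    rw [hg x hx]; push_cast; ring
  rw [hcongr]
  refine h.trans ?_
  have hI0 : 0 ≤ w a := by
    have hle : w b ≤ w a := by
      have : AntitoneOn w (Set.Icc a b) := by
        apply antitoneOn_of_deriv_nonpos (convex_Icc a b)
        · exact fun x hx => (hw x hx).continuousAt.continuousWithinAt
        · exact fun x hx => (hw x (interior_subset hx)).differentiableAt.differentiableWithinAt
        · intro x hx
          rw [(hw x (interior_subset hx)).deriv]
          exact hs x (interior_subset hx)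
      exact this ⟨le_rfl, hab⟩ ⟨hab, le_rfl⟩ hab
    linarith
  have : 2 * (1/(2*π)) = 1/π := by field_simp
  rw [this]
  have : 1/π ≤ 1 := by rw [div_le_one Real.pi_pos]; linarith [Real.pi_gt_three]
  nlinarith

/-- Fresnel integral -/
def Fr (X : ℝ) : ℂ := ∫ u in (0:ℝ)..X, ee (-u^2)

theorem ee_sq_cont : Continuous (fun u : ℝ => ee (-u^2)) := ee_cont.comp (by fun_prop)

theorem Fr_sub (X Y : ℝ) : Fr Y - Fr X = ∫ u in X..Y, ee (-u^2) := by
  unfold Fr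
  exact intervalIntegral.integral_interval_sub_left (ee_sq_cont.intervalIntegrable _ _) (ee_sq_cont.intervalIntegrable _ _)

theorem Fr_cauchy (X Y : ℝ) (hX : 0 < X) (hXY : X ≤ Y) : ‖Fr Y - Fr X‖ ≤ 1 / X := by
  rw [Fr_sub]
  have h := first_deriv X Y hXY (fun _ => -1) (fun u => -u^2) (fun u => -(2*u)) (fun u => (2*u)⁻¹) (fun u => -(2 / (2*u)^2))
    (fun x _ => by
      have := (hasDerivAt_pow 2 x).neg
      refine this.congr_deriv ?_
      norm_num)
    (by fun_prop)
    (fun x hx => by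
      have hx0 : 0 < x := lt_of_lt_of_le hX hx.1
      have := ((hasDerivAt_id x).const_mul 2).inv (by simp; exact hx0.ne')
      refine this.congr_deriv ?_
      simp only [id]; ring)
    (by
      apply ContinuousOn.neg
      apply ContinuousOn.div continuousOn_const (by fun_prop)
      intro x hx
      have hx0 : 0 < x := lt_of_lt_of_le hX hx.1
      positivity)
    (fun x hx => by
      have : 0 ≤ 2 / (2*x)^2 := by positivity
      linarith)
    (by
      have : 0 < Y := by linarith
      positivity)
    (fun x hx => by
      have hx0 : 0 < x := lt_of_lt_of_le hX hx.1
      field_simp)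
  have e1 : ∫ x in X..Y, (((fun _ => -1 : ℝ → ℝ) x : ℝ):ℂ) * ee (-x^2) = - ∫ u in X..Y, ee (-u^2) := by
    rw [← intervalIntegral.integral_neg]
    congr 1
    funext x
    push_cast; ring
  rw [e1, norm_neg] at h
  refine h.trans ?_
  rw [inv_eq_one_div]
  apply one_div_le_one_div_of_le hX
  linarith

theorem Fr_lim : ∃ L : ℂ, ∀ X : ℝ, 0 < X → ‖Fr X - L‖ ≤ 1 / X := by
  have hc : CauchySeq (fun n : ℕ => Fr ((n:ℝ) + 1)) := by
    apply cauchySeq_of_le_tendsto_0 (fun n : ℕ => 2 * (1 / ((n:ℝ) + 1)))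
    · intro n m N hn hm
      have key : ∀ k : ℕ, N ≤ k → ‖Fr ((k:ℝ)+1) - Fr ((N:ℝ)+1)‖ ≤ 1 / ((N:ℝ)+1) := by
        intro k hk
        apply Fr_cauchy _ _ (by positivity)
        have : (N:ℝ) ≤ k := by exact_mod_cast hk
        linarith
      rw [dist_eq_norm]
      have e : Fr ((n:ℝ)+1) - Fr ((m:ℝ)+1) = (Fr ((n:ℝ)+1) - Fr ((N:ℝ)+1)) - (Fr ((m:ℝ)+1) - Fr ((N:ℝ)+1)) := by ring
      rw [e]
      refine (norm_sub_le _ _).trans ?_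
      have := key n hn
      have := key m hm
      linarith
    · have := tendsto_one_div_add_atTop_nhds_zero_nat (𝕜 := ℝ)
      simpa using this.const_mul 2
  obtain ⟨L, hL⟩ := cauchySeq_tendsto_of_complete hc
  refine ⟨L, fun X hX => ?_⟩
  have ht : Filter.Tendsto (fun n : ℕ => ‖Fr X - Fr ((n:ℝ)+1)‖) Filter.atTop (nhds ‖Fr X - L‖) :=
    (tendsto_const_nhds.sub hL).norm
  refine le_of_tendsto ht ?_
  filter_upwards [Filter.eventually_ge_atTop ⌈X⌉₊] with n hn
  rw [norm_sub_rev]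
  apply Fr_cauchy X _ hX
  have := (Nat.le_ceil X).trans (by exact_mod_cast hn : ((⌈X⌉₊:ℕ):ℝ) ≤ n)
  linarith

/-- limit of Fresnel integral -/
def FrL : ℂ := Fr_lim.choose

theorem Fr_neg (X : ℝ) : Fr (-X) = - Fr X := by
  unfold Fr
  have h := intervalIntegral.integral_comp_neg (a := 0) (b := X) (fun u : ℝ => ee (-u^2))
  simp only [neg_zero] at h
  rw [intervalIntegral.integral_symm, ← h]
  simp

theorem Fr_le (X : ℝ) : ‖Fr X‖ ≤ |X| := by
  unfold Fr
  have := intervalIntegral.norm_integral_le_of_norm_le_const (a := 0) (b := X) (C := 1) (f := fun u : ℝ => ee (-u^2))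
    (fun x _ => (norm_ee _).le)
  simpa using this

theorem FrL_spec (X : ℝ) (hX : 0 < X) : ‖Fr X - FrL‖ ≤ 1 / X := Fr_lim.choose_spec X hX

theorem FrL_le : ‖FrL‖ ≤ 2 := by
  have h1 := FrL_spec 1 one_pos
  have h2 := Fr_le 1
  have e : FrL = Fr 1 - (Fr 1 - FrL) := by ring
  rw [e]
  refine (norm_sub_le _ _).trans ?_
  rw [abs_one] at h2
  linarith

/-- sign -/
def sg (X : ℝ) : ℝ := if 0 < X then 1 else -1

theorem Fr_approx (X : ℝ) : ‖Fr X - sg X * FrL‖ ≤ 3 / max 1 |X| := by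
  have hpos : ∀ X : ℝ, 0 ≤ X → ‖Fr X - FrL‖ ≤ 3 / max 1 |X| := by
    intro X hX
    by_cases h : 1 ≤ X
    · have h1 := FrL_spec X (by linarith)
      rw [abs_of_nonneg hX, max_eq_right h]
      refine h1.trans ?_
      gcongr
      norm_num
    · push Not at h
      have h2 := Fr_le X
      rw [abs_of_nonneg hX] at h2 ⊢
      rw [max_eq_left h.le]
      refine (norm_sub_le _ _).trans ?_
      have := FrL_le
      linarith
  unfold sg
  split_ifs with h
  · simpa using hpos X h.le
  · have := hpos (-X) (by linarith)
    rw [Fr_neg, abs_neg] at this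
    have e : Fr X - ((-1:ℝ):ℂ) * FrL = - (- Fr X - FrL) := by push_cast; ring
    rw [e, norm_neg]; exact this

theorem sum_dist_le (N : ℕ) (z : ℝ) (G : ℝ → ℝ) (hG0 : ∀ t, 0 ≤ G t) (hG : ∀ s t, 0 ≤ s → s ≤ t → G t ≤ G s) :
    ∑ n ∈ range N, G |(n:ℝ) - z| ≤ 2 * ∑ i ∈ range N, G i := by
  set n0 := ⌈z⌉₊ with hn0
  have hup : ∑ n ∈ (range N).filter (fun n => n0 ≤ n), G |(n:ℝ) - z| ≤ ∑ i ∈ range N, G i := by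
    have e : (range N).filter (fun n => n0 ≤ n) = Ico n0 N := by
      ext n; simp; tauto
    rw [e]
    rw [Finset.sum_Ico_eq_sum_range]
    calc _ ≤ ∑ i ∈ range (N - n0), G i := by
          apply sum_le_sum
          intro i _
          apply hG _ _ (Nat.cast_nonneg _)
          refine le_trans ?_ (le_abs_self _)
          have := Nat.le_ceil z
          push_cast
          linarith
      _ ≤ _ := sum_le_sum_of_subset_of_nonneg (by intro i; simp; omega) (fun _ _ _ => hG0 _)
  have hdn : ∑ n ∈ (range N).filter (fun n => ¬ n0 ≤ n), G |(n:ℝ) - z| ≤ ∑ i ∈ range N, G i := by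
    have e : (range N).filter (fun n => ¬ n0 ≤ n) = range (min n0 N) := by
      ext n; simp; tauto
    rw [e, ← Finset.sum_range_reflect]
    calc _ ≤ ∑ i ∈ range (min n0 N), G i := by
          apply sum_le_sum
          intro i hi
          rw [mem_range] at hi
          apply hG _ _ (Nat.cast_nonneg _)
          rw [abs_sub_comm]
          refine le_trans ?_ (le_abs_self _)
          have h1 : (n0 - 1 : ℝ) < z := by
            have : 1 ≤ n0 := by omega
            have h2 : n0 - 1 < n0 := by omega
            rw [hn0] at h2
            have := (Nat.lt_ceil).1 (h2)
            rw [← hn0] at this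
            push_cast [Nat.cast_sub ‹1 ≤ n0›] at this
            exact this
          have h3 : ((min n0 N - 1 - i : ℕ):ℝ) + i + 1 ≤ n0 := by
            have : (min n0 N - 1 - i : ℕ) + i + 1 ≤ n0 := by omega
            exact_mod_cast this
          linarith
      _ ≤ _ := sum_le_sum_of_subset_of_nonneg (by intro i; simp) (fun _ _ _ => hG0 _)
  have := Finset.sum_filter_add_sum_filter_not (range N) (fun n => n0 ≤ n) (fun n => G |(n:ℝ) - z|)
  linarith

theorem max_mono_aux (Q : ℝ) (hQ : 0 < Q) (s t : ℝ) (hst : s ≤ t) :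
    1 / max 1 (t / Q) ≤ 1 / max 1 (s / Q) := by
  apply one_div_le_one_div_of_le (by positivity)
  gcongr

theorem sum_dist_log (N : ℕ) (z Q : ℝ) (hQ : 0 < Q) :
    ∑ n ∈ range N, 1 / max 1 (|(n:ℝ) - z| / Q) ≤ 2 + 2 * Q * (1 + log (N + 1)) := by
  have h := sum_dist_le N z (fun t => 1 / max 1 (t / Q)) (fun t => by positivity)
    (fun s t _ hst => max_mono_aux Q hQ s t hst)
  refine h.trans ?_
  have h2 : ∑ i ∈ range N, 1 / max 1 ((i:ℝ) / Q) ≤ 1 + Q * (1 + log (N + 1)) := by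
    calc _ ≤ ∑ i ∈ range (N + 1), 1 / max 1 ((i:ℝ) / Q) :=
          sum_le_sum_of_subset_of_nonneg (by intro i; simp; omega) (fun _ _ _ => by positivity)
      _ = ∑ i ∈ range N, 1 / max 1 (((i+1:ℕ):ℝ) / Q) + 1 / max 1 (((0:ℕ):ℝ) / Q) := sum_range_succ' _ _
      _ ≤ ∑ i ∈ range N, Q * (1 / ((i + 1 : ℕ):ℝ)) + 1 := by
          gcongr with i hi
          · rw [mul_one_div]
            rw [div_le_div_iff₀ (by positivity) (by positivity)]
            have : ((i+1:ℕ):ℝ) / Q ≤ max 1 (((i+1:ℕ):ℝ) / Q) := le_max_right _ _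
            rw [div_le_iff₀ hQ] at this
            linarith
          · simp
      _ ≤ _ := by
          rw [← mul_sum]
          have e : ∑ i ∈ range N, (1:ℝ) / ((i + 1 : ℕ):ℝ) = ∑ l ∈ Icc 1 N, (1:ℝ) / l := by
            rw [Finset.range_eq_Ico, Finset.sum_Ico_add' (fun l : ℕ => (1:ℝ)/(l:ℝ)) 0 N 1]
            rfl
          rw [e]
          have := sum_inv_le_log N (N+1) (by omega)
          push_cast at this
          nlinarith
  linarith

/-- the oscillatory integral -/
def Jint (k A B μ : ℝ) : ℂ := ∫ s in A..B, (((√s)⁻¹ : ℝ):ℂ) * ee (2 * k * s - μ * s^2)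

theorem Jint_aux (A B σ : ℝ) (hA : 0 < A) (hAB : A ≤ B) (k μ : ℝ) (hσ : σ = 1 ∨ σ = -1)
    (hp : ∀ s ∈ Set.Icc A B, 0 < σ * (2 * k - 2 * μ * s)) (hm : σ * μ ≤ 0) :
    ‖Jint k A B μ‖ ≤ (√A * (σ * (2 * k - 2 * μ * A)))⁻¹ := by
  have hσ2 : σ * σ = 1 := by rcases hσ with h | h <;> rw [h] <;> norm_num
  have h := first_deriv A B hAB (fun s => σ * (√s)⁻¹) (fun s => 2 * k * s - μ * s^2)
    (fun s => 2 * k - 2 * μ * s) (fun s => (√s * (σ * (2 * k - 2 * μ * s)))⁻¹)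
    (fun s => -((1/(2*√s)) * (σ * (2 * k - 2 * μ * s)) + √s * (σ * (-(2 * μ)))) / (√s * (σ * (2 * k - 2 * μ * s)))^2)
    (fun x hx => by
      have h1 := ((hasDerivAt_id x).const_mul (2*k)).sub ((hasDerivAt_pow 2 x).const_mul μ)
      refine h1.congr_deriv ?_
      norm_num; ring)
    (by fun_prop)
    (fun x hx => by
      have hx0 : 0 < x := lt_of_lt_of_le hA hx.1
      have h1 := Real.hasDerivAt_sqrt hx0.ne'
      have h2 : HasDerivAt (fun s : ℝ => σ * (2 * k - 2 * μ * s)) (σ * (-(2*μ))) x := by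
        have := (((hasDerivAt_id x).const_mul (2*μ)).const_sub (2*k)).const_mul σ
        refine this.congr_deriv ?_
        ring
      have h3 := (h1.mul h2).inv (by
        have := hp x hx
        have := Real.sqrt_pos.2 hx0
        simp only [Pi.mul_apply]
        positivity)
      exact h3)
    (by
      apply ContinuousOn.div
      · apply ContinuousOn.neg
        apply ContinuousOn.add
        · apply ContinuousOn.mul _ (by fun_prop)
          apply ContinuousOn.div continuousOn_const (by fun_prop)
          intro x hx
          have hx0 : 0 < x := lt_of_lt_of_le hA hx.1
          have := Real.sqrt_pos.2 hx0
          positivity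
        · fun_prop
      · fun_prop
      · intro x hx
        have hx0 : 0 < x := lt_of_lt_of_le hA hx.1
        have := Real.sqrt_pos.2 hx0
        have := hp x hx
        positivity)
    (fun x hx => by
      have hx0 : 0 < x := lt_of_lt_of_le hA hx.1
      have h1 := Real.sqrt_pos.2 hx0
      have h2 := hp x hx
      apply div_nonpos_of_nonpos_of_nonneg _ (by positivity)
      have h3 : 0 ≤ (1/(2*√x)) * (σ * (2 * k - 2 * μ * x)) := by positivity
      have h4 : 0 ≤ √x * (σ * (-(2 * μ))) := by
        apply mul_nonneg h1.le
        linarith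
      linarith)
    (by
      have hx0 : 0 < B := by linarith
      have h1 := Real.sqrt_pos.2 hx0
      have h2 := hp B ⟨hAB, le_rfl⟩
      positivity)
    (fun x hx => by
      have hx0 : 0 < x := lt_of_lt_of_le hA hx.1
      have h1 := Real.sqrt_pos.2 hx0
      have h2 := hp x hx
      have h3 : 2 * k - 2 * μ * x ≠ 0 := by
        intro h; rw [h] at h2; simp at h2
      have h4 : σ ≠ 0 := by rintro rfl; simp at hσ2
      field_simp
      rw [pow_two, hσ2, div_self]
      intro h
      apply h3
      linear_combination 2 * h)
  have e : ∫ x in A..B, ((((fun s => σ * (√s)⁻¹) x : ℝ)):ℂ) * ee (2 * k * x - μ * x^2) = σ * Jint k A B μ := by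
    unfold Jint
    rw [← intervalIntegral.integral_const_mul]
    congr 1; funext x; push_cast; ring
  rw [e, norm_mul] at h
  have : ‖(σ:ℂ)‖ = 1 := by
    rcases hσ with h | h <;> rw [h] <;> simp
  rw [this, one_mul] at h
  exact h

theorem Jint_neg (k A B μ : ℝ) (hk : 0 < k) (hA : 0 < A) (hAB : A ≤ B) (hμ : μ ≤ 0) :
    ‖Jint k A B μ‖ ≤ (2 * √A * (k - μ * A))⁻¹ := by
  have h := Jint_aux A B 1 hA hAB k μ (Or.inl rfl) (fun s hs => by
    have : 0 < s := lt_of_lt_of_le hA hs.1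
    nlinarith) (by linarith)
  refine h.trans (le_of_eq ?_)
  congr 1; ring

theorem Jint_big (k A B μ : ℝ) (hk : 0 < k) (hA : 0 < A) (hAB : A ≤ B) (hμ : k < μ * A) :
    ‖Jint k A B μ‖ ≤ (2 * √A * (μ * A - k))⁻¹ := by
  have hμ0 : 0 < μ := by
    by_contra h
    nlinarith
  have h := Jint_aux A B (-1) hA hAB k μ (Or.inr rfl) (fun s hs => by
    have := mul_le_mul_of_nonneg_left hs.1 hμ0.le
    linarith) (by linarith)
  refine h.trans (le_of_eq ?_)
  congr 1; ring

theorem quad_int (A B μ s0 : ℝ) (hμ : 0 < μ) :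
    ∫ s in A..B, ee (-(μ * (s - s0)^2)) = (((√μ)⁻¹ : ℝ):ℂ) * (Fr (√μ * (B - s0)) - Fr (√μ * (A - s0))) := by
  have hs : √μ ≠ 0 := (Real.sqrt_pos.2 hμ).ne'
  have h := intervalIntegral.integral_comp_mul_sub (a := A) (b := B) (fun u : ℝ => ee (-u^2)) hs (√μ * s0)
  rw [Fr_sub]
  have e : ∀ s, ee (-(μ * (s - s0)^2)) = ee (-(√μ * s - √μ * s0)^2) := by
    intro s
    congr 1
    have := Real.sq_sqrt hμ.le
    linear_combination (s - s0)^2 * this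
  simp_rw [e]
  rw [h, Complex.real_smul]
  congr 2 <;> ring

theorem ktilde_int (A B μ s0 : ℝ) (hμ : 0 < μ) (hA : 0 < A) (hAB : A ≤ B) (hs0 : 0 < s0) :
    ‖∫ s in A..B, (((√s * √s0 * (√s + √s0))⁻¹ : ℝ):ℂ) * (((s - s0 : ℝ):ℂ) * ee (-(μ * (s - s0)^2)))‖ ≤ 1 / (μ * √A * s0) := by
  have hq := Real.sqrt_pos.2 hs0
  have hA' := Real.sqrt_pos.2 hA
  have h := parts_bound A B (1/(4*π*μ)) hAB (fun s => (√s * √s0 * (√s + √s0))⁻¹)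
    (fun s => -((1/(2*√s)) * √s0 * (√s + √s0) + √s * √s0 * (1/(2*√s))) / (√s * √s0 * (√s + √s0))^2)
    (fun s => (-(1/(4*π*μ*Complex.I))) * ee (-(μ * (s - s0)^2)))
    (fun s => ((s - s0 : ℝ):ℂ) * ee (-(μ * (s - s0)^2)))
    (fun x hx => by
      have hx0 : 0 < x := lt_of_lt_of_le hA hx.1
      have h1 := Real.hasDerivAt_sqrt hx0.ne'
      have h3 := ((h1.mul_const (√s0)).mul (h1.add_const (√s0))).inv (by
        have := Real.sqrt_pos.2 hx0
        simp only [Pi.mul_apply]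
        positivity)
      exact h3)
    (fun x hx => by
      have h1 : HasDerivAt (fun s : ℝ => -(μ * (s - s0)^2)) (-(2 * μ * (x - s0))) x := by
        have := ((((hasDerivAt_id x).sub_const s0).pow 2).const_mul μ).neg
        refine this.congr_deriv ?_
        simp; ring
      refine ((ee_deriv _ _ x h1).const_mul _).congr_deriv ?_
      have hpi : (π:ℂ) ≠ 0 := by exact_mod_cast Real.pi_ne_zero
      have hm : (μ:ℂ) ≠ 0 := by exact_mod_cast hμ.ne'
      have := Complex.I_ne_zero
      push_cast
      field_simp
      ring)
    (by
      have hne : ∀ x ∈ Set.Icc A B, 0 < √x := fun x hx => Real.sqrt_pos.2 (lt_of_lt_of_le hA hx.1)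
      have hc : ContinuousOn (fun s : ℝ => 1/(2*√s)) (Set.Icc A B) := by
        apply ContinuousOn.div continuousOn_const (by fun_prop)
        intro x hx
        have := hne x hx
        positivity
      apply ContinuousOn.div
      · apply ContinuousOn.neg
        apply ContinuousOn.add
        · apply ContinuousOn.mul _ (by fun_prop)
          exact hc.mul continuousOn_const
        · apply ContinuousOn.mul _ hc
          fun_prop
      · fun_prop
      · intro x hx
        have := hne x hx
        positivity)
    (by
      apply Continuous.continuousOn
      apply Continuous.mul (by fun_prop)
      exact ee_cont.comp (by fun_prop))
    (fun x hx => by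
      have h1 := Real.sqrt_pos.2 (lt_of_lt_of_le hA hx.1)
      rw [neg_div]
      have : 0 ≤ ((1/(2*√x)) * √s0 * (√x + √s0) + √x * √s0 * (1/(2*√x))) / (√x * √s0 * (√x + √s0))^2 := by positivity
      linarith)
    (by positivity)
    (fun x hx => by
      rw [norm_mul, norm_ee, mul_one, norm_neg, norm_div, norm_mul, norm_mul, norm_mul, Complex.norm_I, Complex.norm_real, Complex.norm_real, Real.norm_eq_abs, Real.norm_eq_abs, abs_of_pos Real.pi_pos, abs_of_pos hμ]
      simp)
  refine h.trans ?_
  have h1 : √A * √s0 * (√A + √s0) ≥ √A * s0 := by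
    have := Real.mul_self_sqrt hs0.le
    nlinarith [mul_pos hA' (mul_pos hA' hq)]
  have h2 : (√A * √s0 * (√A + √s0))⁻¹ ≤ (√A * s0)⁻¹ := by
    apply inv_anti₀ (by positivity) h1
  calc _ ≤ 2 * (1/(4*π*μ)) * (√A * s0)⁻¹ := by gcongr
    _ = (1/(2*π)) * (1 / (μ * √A * s0)) := by field_simp; norm_num
    _ ≤ 1 * (1 / (μ * √A * s0)) := by
        gcongr
        rw [div_le_one (by positivity)]
        linarith [Real.pi_gt_three]
    _ = _ := one_mul _

theorem Jint_stat (k A B μ : ℝ) (hk : 0 < k) (hμ : 0 < μ) (hA : 0 < A) (hAB : A ≤ B) :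
    ‖Jint k A B μ - (((√k)⁻¹ : ℝ):ℂ) * ee (k^2/μ) * (Fr (√μ * (B - k/μ)) - Fr (√μ * (A - k/μ)))‖ ≤ 1 / (k * √A) := by
  set s0 := k / μ with hs0
  have hs0p : 0 < s0 := by positivity
  have hid : ∀ s ∈ Set.uIcc A B, (((√s)⁻¹ : ℝ):ℂ) * ee (2 * k * s - μ * s^2)
      = ((((√s0)⁻¹ : ℝ):ℂ) * ee (k^2/μ)) * ee (-(μ * (s - s0)^2))
        - ee (k^2/μ) * ((((√s * √s0 * (√s + √s0))⁻¹ : ℝ):ℂ) * (((s - s0 : ℝ):ℂ) * ee (-(μ * (s - s0)^2)))) := by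
    intro s hs
    rw [Set.uIcc_of_le hAB] at hs
    have hsp : 0 < s := lt_of_lt_of_le hA hs.1
    have e1 : 2 * k * s - μ * s^2 = k^2/μ + (-(μ * (s - s0)^2)) := by
      rw [hs0]; field_simp; ring
    rw [e1, ee_add]
    have h1 := Real.sqrt_pos.2 hsp
    have h2 := Real.sqrt_pos.2 hs0p
    have e2 : (√s)⁻¹ = (√s0)⁻¹ - (√s * √s0 * (√s + √s0))⁻¹ * (s - s0) := by
      have h3 := Real.sq_sqrt hsp.le
      have h4 := Real.sq_sqrt hs0p.le
      have : s - s0 = (√s - √s0) * (√s + √s0) := by linear_combination h4 - h3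
      rw [this]
      field_simp
      ring
    rw [e2]
    push_cast
    ring
  have hJ : Jint k A B μ = ((((√s0)⁻¹ : ℝ):ℂ) * ee (k^2/μ)) * (∫ s in A..B, ee (-(μ * (s - s0)^2)))
      - ee (k^2/μ) * (∫ s in A..B, ((((√s * √s0 * (√s + √s0))⁻¹ : ℝ):ℂ) * (((s - s0 : ℝ):ℂ) * ee (-(μ * (s - s0)^2))))) := by
    unfold Jint
    rw [intervalIntegral.integral_congr hid, intervalIntegral.integral_sub, intervalIntegral.integral_const_mul, intervalIntegral.integral_const_mul]
    · apply Continuous.intervalIntegrable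
      exact continuous_const.mul (ee_cont.comp (by fun_prop))
    · apply ContinuousOn.intervalIntegrable
      rw [Set.uIcc_of_le hAB]
      apply ContinuousOn.mul continuousOn_const
      apply ContinuousOn.mul
      · apply Complex.continuous_ofReal.comp_continuousOn
        apply ContinuousOn.inv₀ (by fun_prop)
        intro x hx
        have h1 := Real.sqrt_pos.2 (lt_of_lt_of_le hA hx.1)
        have h2 := Real.sqrt_pos.2 hs0p
        positivity
      · apply Continuous.continuousOn
        apply Continuous.mul (by fun_prop)
        exact ee_cont.comp (by fun_prop)
  rw [hJ, quad_int A B μ s0 hμ]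
  have hkk : (√k)⁻¹ = (√s0)⁻¹ * (√μ)⁻¹ := by
    rw [← mul_inv, ← Real.sqrt_mul hs0p.le, hs0, div_mul_cancel₀ _ hμ.ne']
  rw [hkk]
  have e3 : ∀ I F : ℂ, ((((√s0)⁻¹ : ℝ):ℂ) * ee (k^2/μ)) * ((((√μ)⁻¹ : ℝ):ℂ) * F) - ee (k^2/μ) * I
      - ((((√s0)⁻¹ * (√μ)⁻¹ : ℝ)):ℂ) * ee (k^2/μ) * F = - (ee (k^2/μ) * I) := by
    intro I F; push_cast; ring
  rw [e3, norm_neg, norm_mul, norm_ee, one_mul]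
  refine (ktilde_int A B μ s0 hμ hA hAB hs0p).trans (le_of_eq ?_)
  rw [hs0]
  field_simp

theorem Jint_stat2 (k A B μ : ℝ) (hk : 0 < k) (hμ : 0 < μ) (hA : 0 < A) (hAB : A ≤ B) (hμ2 : μ ≤ 2 * (k/A)) :
    ‖Jint k A B μ - 2 * FrL * (((√k)⁻¹ : ℝ):ℂ) * (if k/B < μ ∧ μ ≤ k/A then ee (k^2/μ) else 0)‖
     ≤ 1 / (k * √A) + (√k)⁻¹ * (3 * (1 / max 1 (|μ - k/B| / (√(2*(k/A))/A))) + 3 * (1 / max 1 (|μ - k/A| / (√(2*(k/A))/A)))) := by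
  have hB : 0 < B := by linarith
  have hsμ := Real.sqrt_pos.2 hμ
  have hkA : 0 < k / A := by positivity
  have hsk := Real.sqrt_pos.2 hk
  have hfr : ∀ D : ℝ, A ≤ D → ‖Fr (√μ * (D - k/μ)) - sg (√μ * (D - k/μ)) * FrL‖ ≤ 3 * (1 / max 1 (|μ - k/D| / (√(2*(k/A))/A))) := by
    intro D hD
    have hD0 : 0 < D := by linarith
    refine (Fr_approx _).trans ?_
    rw [mul_one_div]
    have : |μ - k/D| / (√(2*(k/A))/A) ≤ |√μ * (D - k/μ)| := by
      have e : √μ * (D - k/μ) = (D / √μ) * (μ - k / D) := by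
        have := Real.mul_self_sqrt hμ.le
        field_simp
        rw [pow_two, this]
      rw [e, abs_mul, abs_of_pos (by positivity : 0 < D / √μ)]
      rw [div_div_eq_mul_div, mul_div_assoc, mul_comm]
      gcongr
    gcongr
  have hB' := hfr B hAB
  have hA' := hfr A le_rfl
  have hst := Jint_stat k A B μ hk hμ hA hAB
  have hsg : ∀ D : ℝ, 0 < D → sg (√μ * (D - k/μ)) = if k/D < μ then 1 else -1 := by
    intro D hD
    unfold sg
    have : 0 < √μ * (D - k/μ) ↔ k/D < μ := by
      rw [mul_pos_iff_of_pos_left hsμ, sub_pos, div_lt_iff₀ hμ, div_lt_iff₀ hD, mul_comm]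
    by_cases h : k/D < μ
    · rw [if_pos (this.2 h), if_pos h]
    · rw [if_neg (fun h' => h (this.1 h')), if_neg h]
  rw [hsg B hB] at hB'
  rw [hsg A hA] at hA'
  have hBA : k / B ≤ k / A := by gcongr
  have hm : (2 * (if k/B < μ ∧ μ ≤ k/A then ee (k^2/μ) else 0) : ℂ) = (((if k/B < μ then 1 else -1 : ℝ):ℂ) - ((if k/A < μ then 1 else -1:ℝ):ℂ)) * ee (k^2/μ) := by
    by_cases h1 : k/A < μ
    · have h2 : k/B < μ := by linarith
      rw [if_pos h1, if_pos h2, if_neg (by push Not; intro; exact h1)]; simp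
    · rw [if_neg h1]
      by_cases h2 : k/B < μ
      · rw [if_pos h2, if_pos ⟨h2, not_lt.1 h1⟩]; push_cast; ring
      · rw [if_neg h2, if_neg (fun h => h2 h.1)]; simp
  generalize hsB : (if k/B < μ then 1 else -1 : ℝ) = sB at *
  generalize hsA : (if k/A < μ then 1 else -1 : ℝ) = sA at *
  generalize (if k/B < μ ∧ μ ≤ k/A then ee (k^2/μ) else 0) = Y at *
  set FB := Fr (√μ * (B - k/μ))
  set FA := Fr (√μ * (A - k/μ))
  have e : Jint k A B μ - 2 * FrL * (((√k)⁻¹ : ℝ):ℂ) * Y = (Jint k A B μ - (((√k)⁻¹ : ℝ):ℂ) * ee (k^2/μ) * (FB - FA))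
      + (((√k)⁻¹ : ℝ):ℂ) * ee (k^2/μ) * ((FB - sB * FrL) - (FA - sA * FrL)) := by
    linear_combination (-FrL * (((√k)⁻¹ : ℝ):ℂ)) * hm
  rw [e]
  refine (norm_add_le _ _).trans ?_
  refine add_le_add hst ?_
  rw [norm_mul, norm_mul, norm_ee, mul_one, Complex.norm_real, Real.norm_eq_abs, abs_of_pos (by positivity)]
  gcongr
  exact (norm_sub_le _ _).trans (add_le_add hB' hA')

theorem sum_range_inv (V : ℕ) : ∑ n ∈ range V, (1:ℝ) / ((n + 1 : ℕ):ℝ) ≤ 1 + log (V + 2) := by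
  have e : ∑ i ∈ range V, (1:ℝ) / ((i + 1 : ℕ):ℝ) = ∑ l ∈ Icc 1 V, (1:ℝ) / l := by
    rw [Finset.range_eq_Ico, Finset.sum_Ico_add' (fun l : ℕ => (1:ℝ)/(l:ℝ)) 0 V 1]
    rfl
  rw [e]
  have := sum_inv_le_log V (V+2) (by omega)
  push_cast at this
  exact this

theorem Jneg_sum (k A B θ : ℝ) (V : ℕ) (hk : 0 < k) (hA : 0 < A) (hAB : A ≤ B) (hθ1 : θ ≤ 1) :
    ‖∑ n ∈ range V, Jint k A B (θ - (n + 1))‖ ≤ 1 / (k * √A) + 1 / (A * √A) * (1 + log (V + 2)) := by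
  have hsA := Real.sqrt_pos.2 hA
  have hV : ∑ n ∈ range V, (if n = 0 then 1 / (k * √A) else 0) ≤ 1 / (k * √A) := by
    rw [Finset.sum_ite_eq' (range V) 0 (fun _ => 1 / (k * √A))]
    split_ifs
    · exact le_rfl
    · positivity
  have hV2 := sum_range_inv V
  have hp : ∀ n ∈ range V, ‖Jint k A B (θ - (n + 1))‖ ≤ (if n = 0 then 1 / (k * √A) else 0) + 1 / (A * √A) * ((1:ℝ) / ((n + 1 : ℕ):ℝ)) := by
    intro n _
    have hn0 : (0:ℝ) ≤ n := Nat.cast_nonneg _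
    have hJ := Jint_neg k A B (θ - (n + 1)) hk hA hAB (by linarith)
    refine hJ.trans ?_
    rcases Nat.eq_zero_or_pos n with h | h
    · subst h
      rw [if_pos rfl]
      have h1 : (2 * √A * (k - (θ - ((0:ℕ) + 1)) * A))⁻¹ ≤ 1 / (k * √A) := by
        rw [inv_eq_one_div]
        apply one_div_le_one_div_of_le (by positivity)
        have : 0 ≤ (1 - θ) * A := mul_nonneg (by linarith) hA.le
        push_cast
        nlinarith [mul_pos hsA hk, mul_nonneg hsA.le this]
      have : 0 ≤ 1 / (A * √A) * ((1:ℝ) / ((0 + 1 : ℕ):ℝ)) := by positivity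
      linarith
    · rw [if_neg (by omega), zero_add]
      have hn1 : (1:ℝ) ≤ n := by exact_mod_cast h
      rw [inv_eq_one_div, one_div_mul_one_div]
      apply one_div_le_one_div_of_le (by positivity)
      push_cast
      have h1 : (n + 1 : ℝ) * A ≤ 2 * (k - (θ - (n + 1)) * A) := by
        nlinarith [mul_le_mul_of_nonneg_right hθ1 hA.le, mul_le_mul_of_nonneg_right hn1 hA.le]
      calc A * √A * (n + 1) = √A * ((n+1) * A) := by ring
        _ ≤ √A * (2 * (k - (θ - (n + 1)) * A)) := by gcongr
        _ = _ := by ring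
  refine (norm_sum_le _ _).trans ((sum_le_sum hp).trans ?_)
  rw [sum_add_distrib, ← mul_sum]
  refine add_le_add hV ?_
  gcongr

theorem Jpos_sum (k A B θ : ℝ) (V : ℕ) (hk : 0 < k) (hA : 0 < A) (hAB : A ≤ B) (hθ0 : 0 < θ) :
    ‖∑ n ∈ range V, Jint k A B (n + θ) - 2 * FrL * (((√k)⁻¹ : ℝ):ℂ) * ∑ n ∈ range V, (if k/B < n + θ ∧ n + θ ≤ k/A then ee (k^2/(n + θ)) else 0)‖
      ≤ 1 / (k * √A) + 12 / √k + 28 / (A * √A) * (1 + log (V + 2)) := by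
  have hsA := Real.sqrt_pos.2 hA
  have hsk := Real.sqrt_pos.2 hk
  have hB : 0 < B := by linarith
  have hkA : 0 < k / A := by positivity
  set Q := √(2*(k/A))/A with hQ
  have hQ0 : 0 < Q := by rw [hQ]; positivity
  have hV : ∑ n ∈ range V, (if n = 0 then 1 / (k * √A) else 0) ≤ 1 / (k * √A) := by
    rw [Finset.sum_ite_eq' (range V) 0 (fun _ => 1 / (k * √A))]
    split_ifs
    · exact le_rfl
    · positivity
  have hV2 := sum_range_inv V
  rw [mul_sum, ← sum_sub_distrib]
  have hp : ∀ n ∈ range V, ‖Jint k A B (n + θ) - 2 * FrL * (((√k)⁻¹ : ℝ):ℂ) * (if k/B < n + θ ∧ n + θ ≤ k/A then ee (k^2/(n + θ)) else 0)‖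
      ≤ ((if n = 0 then 1 / (k * √A) else 0) + 4 / (A * √A) * ((1:ℝ) / ((n + 1 : ℕ):ℝ)))
        + (√k)⁻¹ * (3 * (1 / max 1 (|(n:ℝ) - (k/B - θ)| / Q)) + 3 * (1 / max 1 (|(n:ℝ) - (k/A - θ)| / Q))) := by
    intro n _
    have hn0 : (0:ℝ) ≤ n := Nat.cast_nonneg _
    by_cases hc : n + θ ≤ 2 * (k/A)
    · have h := Jint_stat2 k A B (n + θ) hk (by linarith) hA hAB hc
      rw [← hQ] at h
      have e1 : (n:ℝ) + θ - k/B = n - (k/B - θ) := by ring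
      have e2 : (n:ℝ) + θ - k/A = n - (k/A - θ) := by ring
      rw [e1, e2] at h
      refine h.trans (add_le_add ?_ le_rfl)
      rcases Nat.eq_zero_or_pos n with h | h
      · rw [if_pos h]
        have : 0 ≤ 4 / (A * √A) * ((1:ℝ) / ((n + 1 : ℕ):ℝ)) := by positivity
        linarith
      · rw [if_neg (by omega), zero_add]
        have hn1 : (1:ℝ) ≤ n := by exact_mod_cast h
        rw [mul_one_div, div_div, div_le_div_iff₀ (by positivity) (by positivity)]
        have h2 : (n + θ) * A ≤ 2 * k := by
          rw [← mul_div_assoc, le_div_iff₀ hA] at hc; linarith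
        have h3 : ((n:ℝ) + 1) * A ≤ 4 * k := by nlinarith [mul_pos hθ0 hA, mul_le_mul_of_nonneg_right hn1 hA.le]
        push_cast
        calc 1 * (A * √A * (n + 1)) = √A * ((n+1) * A) := by ring
          _ ≤ √A * (4 * k) := by gcongr
          _ = _ := by ring
    · push Not at hc
      have hd : 2 * k < (n + θ) * A := by
        rw [← mul_div_assoc, div_lt_iff₀ hA] at hc; exact hc
      rw [if_neg (by push Not; intro _; linarith), mul_zero, sub_zero]
      have hJ := Jint_big k A B (n + θ) hk hA hAB (by linarith)
      have hfr : 0 ≤ (√k)⁻¹ * (3 * (1 / max 1 (|(n:ℝ) - (k/B - θ)| / Q)) + 3 * (1 / max 1 (|(n:ℝ) - (k/A - θ)| / Q))) := by positivity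
      refine hJ.trans (le_trans ?_ (le_add_of_nonneg_right hfr))
      rcases Nat.eq_zero_or_pos n with h | h
      · rw [if_pos h]
        have h1 : (2 * √A * ((n + θ) * A - k))⁻¹ ≤ 1 / (k * √A) := by
          rw [inv_eq_one_div]
          apply one_div_le_one_div_of_le (by positivity)
          nlinarith [mul_pos hsA hk, mul_lt_mul_of_pos_left hd hsA]
        have : 0 ≤ 4 / (A * √A) * ((1:ℝ) / ((n + 1 : ℕ):ℝ)) := by positivity
        linarith
      · rw [if_neg (by omega), zero_add]
        have hn1 : (1:ℝ) ≤ n := by exact_mod_cast h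
        have hx : 0 < (n + θ) * A - k := by linarith
        rw [mul_one_div, div_div, inv_eq_one_div, div_le_div_iff₀ (by positivity) (by positivity)]
        push_cast
        have h3 : ((n:ℝ) + 1) * A ≤ 8 * ((n + θ) * A - k) := by nlinarith [mul_pos hθ0 hA, mul_le_mul_of_nonneg_right hn1 hA.le]
        calc 1 * (A * √A * (n + 1)) = √A * ((n+1) * A) := by ring
          _ ≤ √A * (8 * ((n + θ) * A - k)) := by gcongr
          _ = _ := by ring
  refine (norm_sum_le _ _).trans ((sum_le_sum hp).trans ?_)
  rw [sum_add_distrib, sum_add_distrib, ← mul_sum, ← mul_sum, sum_add_distrib, ← mul_sum, ← mul_sum]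
  have hf1 := sum_dist_log V (k/B - θ) Q hQ0
  have hf2 := sum_dist_log V (k/A - θ) Q hQ0
  set S1 := ∑ n ∈ range V, 1 / max 1 (|(n:ℝ) - (k/B - θ)| / Q)
  set S2 := ∑ n ∈ range V, 1 / max 1 (|(n:ℝ) - (k/A - θ)| / Q)
  have hlog : log (V + 1) ≤ log ((V:ℝ) + 2) := Real.log_le_log (by positivity) (by linarith)
  have hlog0 : 0 ≤ log ((V:ℝ) + 2) := Real.log_nonneg (by linarith [(Nat.cast_nonneg V : (0:ℝ) ≤ V)])
  have hS : 3 * S1 + 3 * S2 ≤ 12 + 12 * Q * (1 + log (V + 2)) := by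
    have : Q * log (V + 1) ≤ Q * log (V + 2) := by gcongr
    linarith
  have hQk : (√k)⁻¹ * Q ≤ 2 / (A * √A) := by
    rw [hQ, Real.sqrt_mul (by norm_num), Real.sqrt_div hk.le]
    have h2 : √2 ≤ 2 := by rw [Real.sqrt_le_left (by norm_num)]; norm_num
    have e : (√k)⁻¹ * (√2 * (√k / √A) / A) = √2 / (A * √A) := by field_simp
    rw [e]
    gcongr
  have h4 : (√k)⁻¹ * (3 * S1 + 3 * S2) ≤ 12 / √k + 24 / (A * √A) * (1 + log (V + 2)) := by
    calc _ ≤ (√k)⁻¹ * (12 + 12 * Q * (1 + log (V + 2))) := by gcongr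
      _ = 12 / √k + 12 * ((√k)⁻¹ * Q) * (1 + log (V + 2)) := by field_simp
      _ ≤ 12 / √k + 12 * (2 / (A * √A)) * (1 + log (V + 2)) := by gcongr
      _ = _ := by ring
  have h5 : 4 / (A * √A) * ∑ n ∈ range V, (1:ℝ) / ((n + 1 : ℕ):ℝ) ≤ 4 / (A * √A) * (1 + log (V + 2)) := by gcongr
  calc _ ≤ 1 / (k * √A) + 4 / (A * √A) * (1 + log (V + 2)) + (12 / √k + 24 / (A * √A) * (1 + log (V + 2))) := by
        refine add_le_add (add_le_add hV h5) h4
    _ = _ := by ring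

/-- partial Fourier sum of the sawtooth -/
def PV (V : ℕ) (t : ℝ) : ℝ := ∑ n ∈ range V, sin (2 * π * (n + 1) * t) / (π * (n + 1))
/-- Dirichlet kernel -/
def KV (V : ℕ) (t : ℝ) : ℝ := 1 + ∑ n ∈ range V, 2 * cos (2 * π * (n + 1) * t)
/-- sawtooth remainder -/
def DV (V : ℕ) (t : ℝ) : ℝ := 1/2 - Int.fract t - PV V t

theorem PV_cont (V : ℕ) : Continuous (PV V) := by unfold PV; fun_prop
theorem KV_cont (V : ℕ) : Continuous (KV V) := by unfold KV; fun_prop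

theorem PV_deriv (V : ℕ) (t : ℝ) : HasDerivAt (fun t => t + 1/2 + PV V t) (KV V t) t := by
  unfold PV KV
  apply HasDerivAt.add
  · exact (hasDerivAt_id t).add_const _
  · apply HasDerivAt.fun_sum
    intro n _
    have h1 : HasDerivAt (fun t : ℝ => 2 * π * (n + 1) * t) (2 * π * (n + 1)) t := by
      simpa using (hasDerivAt_id t).const_mul (2 * π * (n + 1))
    refine (h1.sin.div_const _).congr_deriv ?_
    have : (n:ℝ) + 1 ≠ 0 := by positivity
    field_simp

theorem KV_sin (V : ℕ) (t : ℝ) : KV V t * sin (π * t) = sin ((2 * V + 1) * π * t) := by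
  unfold KV
  induction V with
  | zero => simp
  | succ V ih =>
    rw [sum_range_succ, ← add_assoc, add_mul, ih]
    push_cast
    have h1 : (2 * V + 1) * π * t = 2 * π * (V + 1) * t - π * t := by ring
    have h2 : (2 * (V + 1) + 1) * π * t = 2 * π * (V + 1) * t + π * t := by ring
    rw [h1, h2, sin_sub, sin_add]
    ring

theorem PV_le (V : ℕ) (t : ℝ) : |PV V t| ≤ (1 + log (V + 2)) / 2 := by
  unfold PV
  refine (abs_sum_le_sum_abs _ _).trans ?_
  have h := sum_range_inv V
  calc _ ≤ ∑ n ∈ range V, (1/2) * ((1:ℝ) / ((n + 1 : ℕ):ℝ)) := by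
        apply sum_le_sum
        intro n _
        rw [abs_div, abs_of_pos (by positivity : 0 < π * ((n:ℝ) + 1)), one_div_mul_one_div]
        push_cast
        have := Real.abs_sin_le_one (2 * π * (n + 1) * t)
        have hpi := Real.pi_gt_three
        gcongr
        linarith
    _ ≤ _ := by rw [← mul_sum]; linarith

theorem DV_le (V : ℕ) (t : ℝ) : |DV V t| ≤ 1 + log (V + 2) := by
  have h := abs_le.1 (PV_le V t)
  have h1 := Int.fract_nonneg t
  have h2 := (Int.fract_lt_one t).le
  have hlog0 : 0 ≤ log ((V:ℝ) + 2) := Real.log_nonneg (by linarith [(Nat.cast_nonneg V : (0:ℝ) ≤ V)])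
  unfold DV
  rw [abs_le]
  constructor <;> linarith

theorem DV_half (V : ℕ) (hV : 1 ≤ V) (t : ℝ) (ht : 0 < t) (ht2 : t ≤ 1/2) : |DV V t| ≤ 1 / (V * t) := by
  have hfr : Int.fract t = t := Int.fract_eq_self.2 ⟨ht.le, by linarith⟩
  have hhalf : PV V (1/2) = 0 := by
    unfold PV
    apply sum_eq_zero
    intro n _
    have : 2 * π * (n + 1) * (1/2) = ((n + 1 : ℕ):ℝ) * π := by push_cast; ring
    rw [this, Real.sin_nat_mul_pi, zero_div]
  have hsin : ∀ x ∈ Set.Icc t (1/2), 0 < sin (π * x) := by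
    intro x hx
    apply Real.sin_pos_of_pos_of_lt_pi
    · have := hx.1; have : 0 < x := by linarith
      positivity
    · have := hx.2
      nlinarith [Real.pi_pos]
  have hFTC : ∫ u in t..(1/2), KV V u = (1/2 + 1/2 + PV V (1/2)) - (t + 1/2 + PV V t) :=
    intervalIntegral.integral_eq_sub_of_hasDerivAt (f := fun t => t + 1/2 + PV V t) (fun x _ => PV_deriv V x) ((KV_cont V).intervalIntegrable _ _)
  have hD : DV V t = ∫ u in t..(1/2), KV V u := by
    rw [hFTC, hhalf]; unfold DV; rw [hfr]; ring
  set W : ℝ := (2 * V + 1) * π with hW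
  have hW0 : 0 < W := by positivity
  have h := parts_bound t (1/2) (1/W) ht2 (fun u => (sin (π * u))⁻¹) (fun u => -(cos (π * u) * π) / (sin (π * u))^2)
    (fun u => ((-(cos (W * u) / W) : ℝ):ℂ)) (fun u => ((sin (W * u) : ℝ):ℂ))
    (fun x hx => by
      have h1 : HasDerivAt (fun u : ℝ => π * u) π x := by simpa using (hasDerivAt_id x).const_mul π
      exact h1.sin.inv (hsin x hx).ne')
    (fun x hx => by
      apply HasDerivAt.ofReal_comp
      have h1 : HasDerivAt (fun u : ℝ => W * u) W x := by simpa using (hasDerivAt_id x).const_mul W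
      refine ((h1.cos.div_const W).neg).congr_deriv ?_
      field_simp)
    (by
      apply ContinuousOn.div (by fun_prop) (by fun_prop)
      intro x hx
      exact (pow_pos (hsin x hx) 2).ne')
    (by fun_prop)
    (fun x hx => by
      apply div_nonpos_of_nonpos_of_nonneg _ (sq_nonneg _)
      have : 0 ≤ cos (π * x) := by
        apply Real.cos_nonneg_of_neg_pi_div_two_le_of_le
        · have := hx.1
          have : 0 < π * x := mul_pos Real.pi_pos (by linarith)
          linarith [Real.pi_pos]
        · have := hx.2
          nlinarith [Real.pi_pos]
      have := mul_nonneg this Real.pi_pos.le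
      linarith)
    (inv_nonneg.2 (hsin (1/2) ⟨ht2, le_rfl⟩).le)
    (fun x hx => by
      rw [Complex.norm_real, Real.norm_eq_abs, abs_neg, abs_div, abs_of_pos hW0]
      gcongr
      exact Real.abs_cos_le_one _)
  have hintegral : ∫ u in t..(1/2), ((((fun u => (sin (π * u))⁻¹) u : ℝ)):ℂ) * ((sin (W * u) : ℝ):ℂ) = ((DV V t : ℝ):ℂ) := by
    rw [hD, ← intervalIntegral.integral_ofReal]
    apply intervalIntegral.integral_congr
    intro u hu
    rw [Set.uIcc_of_le ht2] at hu
    have h1 := KV_sin V u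
    have h2 := hsin u hu
    simp only
    rw [hW, ← h1, ← Complex.ofReal_mul]
    congr 1
    field_simp
  rw [hintegral, Complex.norm_real, Real.norm_eq_abs] at h
  refine h.trans ?_
  have hms := Real.mul_le_sin (x := π * t) (by positivity) (by nlinarith [Real.pi_pos])
  have e : 2 / π * (π * t) = 2 * t := by field_simp
  rw [e] at hms
  have hV' : (1:ℝ) ≤ V := by exact_mod_cast hV
  calc 2 * (1 / W) * (sin (π * t))⁻¹ ≤ 2 * (1 / W) * (2 * t)⁻¹ := by gcongr
    _ = 1 / (W * t) := by field_simp
    _ ≤ 1 / (V * t) := by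
        gcongr
        rw [hW]
        nlinarith [Real.pi_gt_three]

theorem DV_symm (V : ℕ) (t : ℝ) (ht : 0 ≤ t) (ht2 : t ≤ 1/2) : |DV V (1 - t)| = |DV V t| := by
  have hP : PV V (1 - t) = - PV V t := by
    unfold PV
    rw [← sum_neg_distrib]
    apply sum_congr rfl
    intro n _
    have : 2 * π * (n + 1) * (1 - t) = -(2 * π * (n + 1) * t) + ((n + 1 : ℕ):ℝ) * (2 * π) := by push_cast; ring
    rw [this, Real.sin_add_nat_mul_two_pi, Real.sin_neg, neg_div]
  rcases eq_or_lt_of_le ht with h | h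
  · subst h
    unfold DV PV
    simp
    have : ∑ n ∈ range V, sin (2 * π * ((n:ℝ) + 1)) / (π * (n + 1)) = 0 := by
      apply sum_eq_zero
      intro n _
      have : 2 * π * ((n:ℝ) + 1) = 0 + ((n + 1 : ℕ):ℝ) * (2 * π) := by push_cast; ring
      rw [this, Real.sin_add_nat_mul_two_pi]; simp
    simp [this]
  · have h1 : Int.fract t = t := Int.fract_eq_self.2 ⟨ht, by linarith⟩
    have h2 : Int.fract (1 - t) = 1 - t := Int.fract_eq_self.2 ⟨by linarith, by linarith⟩
    unfold DV
    rw [hP, h1, h2, ← abs_neg]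
    congr 1; ring

theorem DV_meas (V : ℕ) : Measurable (DV V) := by
  unfold DV
  exact (measurable_const.sub measurable_fract).sub (PV_cont V).measurable

theorem DV_int (V : ℕ) (a b : ℝ) : IntervalIntegrable (DV V) volume a b := by
  apply (intervalIntegrable_const (c := 1 + log ((V:ℝ) + 2)) : IntervalIntegrable _ volume a b).mono_fun
  · exact (DV_meas V).aestronglyMeasurable
  · filter_upwards with x
    rw [Real.norm_eq_abs, Real.norm_eq_abs]
    exact (DV_le V x).trans (le_abs_self _)

theorem DV_L1 (V : ℕ) (hV : 4 ≤ V) : ∫ t in (0:ℝ)..1, |DV V t| ≤ 2 * (2 + log (V + 2)) / √V := by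
  have hV' : (4:ℝ) ≤ V := by exact_mod_cast hV
  have hsV : 2 ≤ √(V:ℝ) := by
    apply Real.le_sqrt_of_sq_le; norm_num; linarith
  have hs2 : √(V:ℝ) * √V = V := Real.mul_self_sqrt (by linarith)
  have hlog0 : 0 ≤ log ((V:ℝ) + 2) := Real.log_nonneg (by linarith)
  set δ := 1 / √(V:ℝ) with hδ
  have hδ0 : 0 < δ := by positivity
  have hδ2 : δ ≤ 1/2 := by rw [hδ]; apply one_div_le_one_div_of_le <;> linarith
  have hi : ∀ a b, IntervalIntegrable (fun t => |DV V t|) volume a b := fun a b => (DV_int V a b).abs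
  have h1 : ∫ t in (0:ℝ)..δ, |DV V t| ≤ (1 + log (V + 2)) * δ := by
    have := intervalIntegral.norm_integral_le_of_norm_le_const (a := 0) (b := δ) (C := 1 + log ((V:ℝ) + 2)) (f := fun t => |DV V t|)
      (fun x _ => by rw [Real.norm_eq_abs, abs_abs]; exact DV_le V x)
    rw [Real.norm_eq_abs, sub_zero, abs_of_pos hδ0] at this
    exact (le_abs_self _).trans this
  have h2 : ∫ t in δ..(1/2), |DV V t| ≤ δ := by
    have := intervalIntegral.norm_integral_le_of_norm_le_const (a := δ) (b := 1/2) (C := δ) (f := fun t => |DV V t|)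
      (fun x hx => by
        rw [Real.norm_eq_abs, abs_abs]
        rw [Set.uIoc_of_le hδ2] at hx
        refine (DV_half V (by omega) x (by linarith [hx.1]) hx.2).trans ?_
        have : 1 / (V * x) ≤ 1 / (V * δ) := by
          have := hx.1.le
          gcongr
        refine this.trans (le_of_eq ?_)
        rw [hδ]
        field_simp
        rw [pow_two, hs2])
    rw [Real.norm_eq_abs, abs_of_nonneg (by linarith : 0 ≤ 1/2 - δ)] at this
    refine (le_abs_self _).trans (this.trans ?_)
    nlinarith
  have h3 : ∫ t in (0:ℝ)..(1/2), |DV V t| ≤ (2 + log (V + 2)) * δ := by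
    rw [← intervalIntegral.integral_add_adjacent_intervals (hi 0 δ) (hi δ (1/2))]
    linarith
  have h4 : ∫ t in (1/2:ℝ)..1, |DV V t| = ∫ t in (0:ℝ)..(1/2), |DV V t| := by
    have := intervalIntegral.integral_comp_sub_left (a := 0) (b := 1/2) (fun t => |DV V t|) 1
    norm_num at this
    norm_num
    rw [← this]
    apply intervalIntegral.integral_congr
    intro x hx
    rw [Set.uIcc_of_le (by norm_num)] at hx
    exact DV_symm V x hx.1 hx.2
  rw [← intervalIntegral.integral_add_adjacent_intervals (hi 0 (1/2)) (hi (1/2) 1), h4]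
  have : 2 * (2 + log (V + 2)) / √V = 2 * ((2 + log (V + 2)) * δ) := by rw [hδ]; ring
  rw [this]; linarith

theorem DV_L1' (V : ℕ) (hV : 4 ≤ V) (a b : ℝ) (ha : 0 ≤ a) (hab : a ≤ b) :
    ∫ t in a..b, |DV V t| ≤ (b + 1) * (2 * (2 + log (V + 2)) / √V) := by
  have hper : Function.Periodic (fun t => |DV V t|) 1 := by
    intro t
    have hP : PV V (t + 1) = PV V t := by
      unfold PV
      apply sum_congr rfl
      intro n _
      have : 2 * π * (n + 1) * (t + 1) = (2 * π * (n + 1) * t) + ((n + 1 : ℕ):ℝ) * (2 * π) := by push_cast; ring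
      rw [this, Real.sin_add_nat_mul_two_pi]
    simp only [DV, hP, Int.fract_add_one]
  have hi : ∀ a b, IntervalIntegrable (fun t => |DV V t|) volume a b := fun a b => (DV_int V a b).abs
  set N : ℕ := ⌈b⌉₊
  have hN : b ≤ N := Nat.le_ceil b
  have hN2 : (N:ℝ) ≤ b + 1 := (Nat.ceil_lt_add_one (by linarith)).le
  have h1 : ∫ t in a..b, |DV V t| ≤ ∫ t in (0:ℝ)..N, |DV V t| := by
    apply intervalIntegral.integral_mono_interval ha hab hN
    · filter_upwards with x using abs_nonneg _
    · exact hi _ _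
  have h2 := hper.intervalIntegral_add_zsmul_eq (N:ℤ) 0
  simp at h2
  rw [h2 hi] at h1
  refine h1.trans ?_
  have h3 := DV_L1 V hV
  have h4 : 0 ≤ ∫ t in (0:ℝ)..1, |DV V t| := intervalIntegral.integral_nonneg (by norm_num) (fun _ _ => abs_nonneg _)
  exact mul_le_mul hN2 h3 h4 (by linarith)

theorem poisson (V : ℕ) (hV : 4 ≤ V) (F F' : ℝ → ℂ) (a b K m : ℝ) (ha : 0 ≤ a) (hab : a ≤ b)
    (hF : ∀ t ∈ Set.Icc a b, HasDerivAt F (F' t) t) (hF'c : ContinuousOn F' (Set.Icc a b))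
    (hK : ∀ t ∈ Set.Icc a b, ‖F' t‖ ≤ K) (hma : ‖F a‖ ≤ m) (hmb : ‖F b‖ ≤ m) :
    ‖∑ n ∈ Ioc ⌊a⌋₊ ⌊b⌋₊, F n - ∫ t in a..b, F t * (KV V t : ℂ)‖ ≤
      2 * m * (1 + log (V + 2)) + K * ((b + 1) * (2 * (2 + log (V + 2)) / √V)) := by
  have huI : Set.uIcc a b = Set.Icc a b := Set.uIcc_of_le hab
  have hderiv : ∀ t ∈ Set.Icc a b, deriv F t = F' t := fun t ht => (hF t ht).deriv
  have hFc : ContinuousOn F (Set.Icc a b) := fun t ht => (hF t ht).continuousAt.continuousWithinAt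
  have hintegral : IntegrableOn (deriv F) (Set.Icc a b) := by
    have : IntegrableOn F' (Set.Icc a b) := hF'c.integrableOn_Icc
    exact this.congr_fun (fun t ht => (hderiv t ht).symm) measurableSet_Icc
  have habel := sum_mul_eq_sub_sub_integral_mul (𝕜 := ℂ) (fun _ => (1:ℂ)) ha hab (fun t ht => (hF t ht).differentiableAt) hintegral
  simp only [mul_one, sum_const, Nat.card_Icc, tsub_zero, nsmul_eq_mul] at habel
  have hfl : ∀ t : ℝ, 0 ≤ t → (((⌊t⌋₊ + 1 : ℕ):ℂ)) = (((t + 1/2 + PV V t) : ℝ):ℂ) + ((DV V t : ℝ):ℂ) := by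
    intro t ht
    rw [← Complex.ofReal_add]
    have h1 : ((⌊t⌋₊ : ℕ):ℝ) = t - Int.fract t := by
      rw [natCast_floor_eq_intCast_floor ht]
      linarith [Int.floor_add_fract t]
    have : (((⌊t⌋₊ + 1 : ℕ)):ℝ) = (t + 1/2 + PV V t) + DV V t := by
      push_cast; rw [h1]; unfold DV; ring
    rw [← this]; push_cast; rfl
  have hi1 : IntervalIntegrable F' volume a b := by
    apply ContinuousOn.intervalIntegrable; rwa [huI]
  have hiS : IntervalIntegrable (fun t => F' t * (((t + 1/2 + PV V t) : ℝ):ℂ)) volume a b := by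
    apply ContinuousOn.intervalIntegrable; rw [huI]
    apply hF'c.mul
    apply Continuous.continuousOn
    have := PV_cont V
    fun_prop
  have hiD : IntervalIntegrable (fun t => F' t * ((DV V t : ℝ):ℂ)) volume a b := by
    have h1 : IntervalIntegrable (fun t => ((DV V t : ℝ):ℂ)) volume a b := ⟨(DV_int V a b).1.ofReal, (DV_int V a b).2.ofReal⟩
    have := h1.continuousOn_mul (g := F') (by rwa [huI])
    exact this
  have hI : ∫ t in Set.Ioc a b, deriv F t * (((⌊t⌋₊ + 1 : ℕ):ℂ)) = (∫ t in a..b, F' t * (((t + 1/2 + PV V t) : ℝ):ℂ)) + ∫ t in a..b, F' t * ((DV V t : ℝ):ℂ) := by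
    rw [← intervalIntegral.integral_add hiS hiD, ← intervalIntegral.integral_of_le hab]
    apply intervalIntegral.integral_congr
    intro t ht
    rw [huI] at ht
    simp only
    rw [hderiv t ht, hfl t (by linarith [ht.1])]
    ring
  have hparts := intervalIntegral.integral_mul_deriv_eq_deriv_mul (a := a) (b := b) (u := F) (v := fun t => (((t + 1/2 + PV V t) : ℝ):ℂ))
    (u' := F') (v' := fun t => (KV V t : ℂ)) (fun x hx => hF x (huI ▸ hx)) (fun x _ => (PV_deriv V x).ofReal_comp) hi1
    ((Complex.continuous_ofReal.comp (KV_cont V)).intervalIntegrable _ _)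
  rw [habel, hI, hfl b (by linarith), hfl a ha, hparts]
  have e : ∀ Fb Fa Sb Sa Db Da I1 I2 : ℂ, Fb * (Sb + Db) - Fa * (Sa + Da) - (I1 + I2) - (Fb * Sb - Fa * Sa - I1) = Fb * Db - Fa * Da - I2 := by
    intros; ring
  rw [e]
  have hL := DV_le V
  have hn : ∀ t, ‖((DV V t : ℝ):ℂ)‖ ≤ 1 + log (V + 2) := by
    intro t; rw [Complex.norm_real, Real.norm_eq_abs]; exact hL t
  have hL0 : 0 ≤ 1 + log ((V:ℝ) + 2) := (abs_nonneg _).trans (hL 0)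
  have hm0 : 0 ≤ m := (norm_nonneg _).trans hma
  have hK0 : 0 ≤ K := (norm_nonneg _).trans (hK a ⟨le_rfl, hab⟩)
  have h1 : ‖F b * ((DV V b : ℝ):ℂ)‖ ≤ m * (1 + log (V + 2)) := by
    rw [norm_mul]; exact mul_le_mul hmb (hn b) (norm_nonneg _) hm0
  have h2 : ‖F a * ((DV V a : ℝ):ℂ)‖ ≤ m * (1 + log (V + 2)) := by
    rw [norm_mul]; exact mul_le_mul hma (hn a) (norm_nonneg _) hm0
  have h3 : ‖∫ t in a..b, F' t * ((DV V t : ℝ):ℂ)‖ ≤ K * ((b + 1) * (2 * (2 + log (V + 2)) / √V)) := by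
    have : ‖∫ t in a..b, F' t * ((DV V t : ℝ):ℂ)‖ ≤ ∫ t in a..b, K * |DV V t| := by
      apply intervalIntegral.norm_integral_le_of_norm_le hab
      · filter_upwards with t ht
        rw [norm_mul, Complex.norm_real, Real.norm_eq_abs]
        exact mul_le_mul_of_nonneg_right (hK t ⟨ht.1.le, ht.2⟩) (abs_nonneg _)
      · exact ((DV_int V a b).abs).const_mul K
    rw [intervalIntegral.integral_const_mul] at this
    refine this.trans ?_
    exact mul_le_mul_of_nonneg_left (DV_L1' V hV a b ha hab) hK0
  refine (norm_sub_le _ _).trans ?_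
  have := norm_sub_le (F b * ((DV V b : ℝ):ℂ)) (F a * ((DV V a : ℝ):ℂ))
  linarith

/-- the exponential summand -/
def Fh (κ θ t : ℝ) : ℂ := ((t^(-(3:ℝ)/4) : ℝ):ℂ) * ee (2 * √(κ * t) - θ * t)
/-- its derivative -/
def Fh' (κ θ t : ℝ) : ℂ := ((-(3:ℝ)/4 * t^(-(3:ℝ)/4 - 1) : ℝ):ℂ) * ee (2 * √(κ * t) - θ * t)
  + ((t^(-(3:ℝ)/4) : ℝ):ℂ) * (((2 * π * (2 * (κ / (2 * √(κ * t))) - θ) : ℝ):ℂ) * Complex.I * ee (2 * √(κ * t) - θ * t))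

theorem Fh_deriv (κ θ t : ℝ) (hκ : 0 < κ) (ht : 0 < t) : HasDerivAt (Fh κ θ) (Fh' κ θ t) t := by
  unfold Fh Fh'
  have h1 : HasDerivAt (fun t : ℝ => ((t^(-(3:ℝ)/4) : ℝ):ℂ)) ((-(3:ℝ)/4 * t^(-(3:ℝ)/4 - 1) : ℝ):ℂ) t :=
    (Real.hasDerivAt_rpow_const (Or.inl ht.ne')).ofReal_comp
  have h2 : HasDerivAt (fun t : ℝ => 2 * √(κ * t) - θ * t) (2 * (κ / (2 * √(κ * t))) - θ) t := by
    have hk : HasDerivAt (fun t : ℝ => κ * t) κ t := by simpa using (hasDerivAt_id t).const_mul κ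
    have := (hk.sqrt (by positivity)).const_mul 2
    have h3 : HasDerivAt (fun t : ℝ => θ * t) θ t := by simpa using (hasDerivAt_id t).const_mul θ
    exact this.sub h3
  exact h1.mul (ee_deriv _ _ t h2)

theorem Fh'_cont (κ θ a b : ℝ) (hκ : 0 < κ) (ha : 0 < a) : ContinuousOn (Fh' κ θ) (Set.Icc a b) := by
  have hp : ∀ t ∈ Set.Icc a b, 0 < t := fun t ht => lt_of_lt_of_le ha ht.1
  have hr : ∀ e : ℝ, ContinuousOn (fun t : ℝ => t ^ e) (Set.Icc a b) := fun e =>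
    continuousOn_id.rpow_const (fun t ht => Or.inl (hp t ht).ne')
  have hee : ContinuousOn (fun t : ℝ => ee (2 * √(κ * t) - θ * t)) (Set.Icc a b) :=
    (ee_cont.comp (by fun_prop)).continuousOn
  unfold Fh'
  apply ContinuousOn.add
  · exact (Complex.continuous_ofReal.comp_continuousOn (continuousOn_const.mul (hr _))).mul hee
  · apply (Complex.continuous_ofReal.comp_continuousOn (hr _)).mul
    apply ContinuousOn.mul _ hee
    apply ContinuousOn.mul _ continuousOn_const
    apply Complex.continuous_ofReal.comp_continuousOn
    apply ContinuousOn.mul continuousOn_const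
    apply ContinuousOn.sub _ continuousOn_const
    apply ContinuousOn.mul continuousOn_const
    apply ContinuousOn.div continuousOn_const (by fun_prop)
    intro t ht
    have := hp t ht
    have := Real.sqrt_pos.2 (mul_pos hκ this)
    positivity

theorem Fh'_le (κ θ t : ℝ) (hκ : 1 ≤ κ) (ht : 1 ≤ t) (hθ0 : 0 ≤ θ) (hθ1 : θ ≤ 1) : ‖Fh' κ θ t‖ ≤ 20 * κ := by
  have ht0 : 0 < t := by linarith
  have h1 : t^(-(3:ℝ)/4 - 1) ≤ 1 := Real.rpow_le_one_of_one_le_of_nonpos ht (by norm_num)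
  have h2 : t^(-(3:ℝ)/4) ≤ 1 := Real.rpow_le_one_of_one_le_of_nonpos ht (by norm_num)
  have h1' : 0 < t^(-(3:ℝ)/4 - 1) := Real.rpow_pos_of_pos ht0 _
  have h2' : 0 < t^(-(3:ℝ)/4) := Real.rpow_pos_of_pos ht0 _
  have hs : 1 ≤ √(κ * t) := by
    apply Real.le_sqrt_of_sq_le
    nlinarith
  have hq : 0 ≤ κ / (2 * √(κ * t)) ∧ κ / (2 * √(κ * t)) ≤ κ / 2 := by
    constructor
    · positivity
    · apply div_le_div_of_nonneg_left (by linarith) (by norm_num); linarith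
  unfold Fh'
  refine (norm_add_le _ _).trans ?_
  rw [norm_mul, norm_ee, mul_one, norm_mul, norm_mul, norm_mul, norm_ee, Complex.norm_I, mul_one, mul_one, Complex.norm_real, Complex.norm_real, Complex.norm_real,
    Real.norm_eq_abs, Real.norm_eq_abs, Real.norm_eq_abs]
  have b1 : |(-(3:ℝ)/4 * t^(-(3:ℝ)/4 - 1))| ≤ 1 := by rw [abs_le]; constructor <;> linarith
  have b2 : |t^(-(3:ℝ)/4)| ≤ 1 := by rw [abs_of_pos h2']; exact h2
  have b3 : |2 * π * (2 * (κ / (2 * √(κ * t))) - θ)| ≤ 8 * (2 * κ) := by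
    rw [abs_mul, abs_of_pos (by positivity : 0 < 2 * π)]
    have : |2 * (κ / (2 * √(κ * t))) - θ| ≤ 2 * κ := by
      rw [abs_le]; constructor <;> linarith
    have hpi := Real.pi_lt_four
    exact mul_le_mul (by linarith) this (abs_nonneg _) (by norm_num)
  have := mul_le_mul b2 b3 (abs_nonneg _) zero_le_one
  linarith

theorem Fh_cont (κ θ a b : ℝ) (ha : 0 < a) : ContinuousOn (Fh κ θ) (Set.Icc a b) := by
  have hp : ∀ t ∈ Set.Icc a b, 0 < t := fun t ht => lt_of_lt_of_le ha ht.1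
  have hr : ∀ e : ℝ, ContinuousOn (fun t : ℝ => t ^ e) (Set.Icc a b) := fun e =>
    continuousOn_id.rpow_const (fun t ht => Or.inl (hp t ht).ne')
  have hee : ContinuousOn (fun t : ℝ => ee (2 * √(κ * t) - θ * t)) (Set.Icc a b) :=
    (ee_cont.comp (by fun_prop)).continuousOn
  unfold Fh
  exact (Complex.continuous_ofReal.comp_continuousOn (hr _)).mul hee

theorem Fh_Jint (k θ A B : ℝ) (hk : 0 < k) (hA : 0 < A) (hAB : A ≤ B) :
    ∫ t in (A^2)..(B^2), Fh (k^2) θ t = 2 * Jint k A B θ := by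
  have h := intervalIntegral.integral_deriv_smul_comp'' (a := A) (b := B) (f := fun s : ℝ => s^2) (f' := fun s => 2 * s) (g := Fh (k^2) θ)
    (by fun_prop) (fun x _ => by
      have := (hasDerivAt_pow 2 x).hasDerivWithinAt (s := Set.Ioi x)
      simpa using this) (by fun_prop) (by
      rw [Set.uIcc_of_le hAB]
      have := Fh_cont (k^2) θ (A^2) (B^2) (by positivity)
      apply this.mono
      rintro _ ⟨x, hx, rfl⟩
      have := hx.1
      have := hx.2
      have : 0 < x := by linarith
      constructor <;> simp only <;> gcongr)
  rw [← h]
  unfold Jint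
  rw [← intervalIntegral.integral_const_mul]
  apply intervalIntegral.integral_congr
  intro s hs
  rw [Set.uIcc_of_le hAB] at hs
  have hs0 : 0 < s := lt_of_lt_of_le hA hs.1
  simp only [Function.comp, Fh, Complex.real_smul]
  have e1 : √(k^2 * s^2) = k * s := by
    rw [← mul_pow, Real.sqrt_sq (by positivity)]
  have e2 : (2 * s) * (s^2)^(-(3:ℝ)/4) = 2 * (√s)⁻¹ := by
    rw [Real.sqrt_eq_rpow, ← Real.rpow_neg hs0.le, ← Real.rpow_natCast s 2, ← Real.rpow_mul hs0.le, mul_assoc]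
    congr 1
    nth_rewrite 1 [← Real.rpow_one s]
    rw [← Real.rpow_add hs0]
    norm_num
  rw [e1, ← mul_assoc, ← Complex.ofReal_mul, e2]
  push_cast
  rw [mul_assoc]
  congr 4
  ring

theorem Fh_mul_ee (κ θ ν t : ℝ) : Fh κ θ t * ee (-(ν * t)) = Fh κ (θ + ν) t := by
  unfold Fh
  rw [mul_assoc, ← ee_add]
  congr 2
  ring

theorem ee_pair (s : ℝ) : ((2 * cos (2 * π * s) : ℝ):ℂ) = ee (-s) + ee s := by
  unfold ee
  have e : ((2 * π * (-s) : ℝ):ℂ) * Complex.I = -(((2 * π * s : ℝ):ℂ)) * Complex.I := by push_cast; ring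
  rw [e, Complex.ofReal_mul, Complex.ofReal_cos, Complex.ofReal_ofNat, Complex.two_cos]
  ring

theorem Fh_KV (κ θ : ℝ) (V : ℕ) (t : ℝ) : Fh κ θ t * (KV V t : ℂ) = Fh κ θ t + (∑ n ∈ range V, Fh κ (θ + (n + 1)) t + ∑ n ∈ range V, Fh κ (θ - (n + 1)) t) := by
  unfold KV
  rw [Complex.ofReal_add, Complex.ofReal_one, mul_add, mul_one, Complex.ofReal_sum, mul_sum, ← sum_add_distrib]
  congr 1
  apply sum_congr rfl
  intro n _
  have : 2 * π * ((n:ℝ) + 1) * t = 2 * π * ((n + 1) * t) := by ring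
  rw [this, ee_pair, mul_add, Fh_mul_ee]
  congr 1
  have e : ((n:ℝ) + 1) * t = -((-(n + 1)) * t) := by ring
  rw [e, Fh_mul_ee]
  congr 1

theorem Fh_KV_int (k θ A B : ℝ) (V : ℕ) (hk : 0 < k) (hA : 0 < A) (hAB : A ≤ B) :
    ∫ t in (A^2)..(B^2), Fh (k^2) θ t * (KV V t : ℂ) =
      2 * (∑ n ∈ range (V+1), Jint k A B (n + θ) + ∑ n ∈ range V, Jint k A B (θ - (n + 1))) := by
  have hAB2 : A^2 ≤ B^2 := by gcongr
  have hi : ∀ μ, IntervalIntegrable (Fh (k^2) μ) volume (A^2) (B^2) := by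
    intro μ
    apply ContinuousOn.intervalIntegrable
    rw [Set.uIcc_of_le hAB2]
    exact Fh_cont _ _ _ _ (by positivity)
  have hi1 : IntervalIntegrable (fun t => ∑ n ∈ range V, Fh (k^2) (θ + (n + 1)) t) volume (A^2) (B^2) := by
    apply ContinuousOn.intervalIntegrable
    rw [Set.uIcc_of_le hAB2]
    exact continuousOn_finsetSum _ (fun n _ => Fh_cont _ _ _ _ (by positivity))
  have hi2 : IntervalIntegrable (fun t => ∑ n ∈ range V, Fh (k^2) (θ - (n + 1)) t) volume (A^2) (B^2) := by
    apply ContinuousOn.intervalIntegrable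
    rw [Set.uIcc_of_le hAB2]
    exact continuousOn_finsetSum _ (fun n _ => Fh_cont _ _ _ _ (by positivity))
  simp_rw [Fh_KV]
  rw [intervalIntegral.integral_add (hi θ) (hi1.add hi2), intervalIntegral.integral_add hi1 hi2,
    intervalIntegral.integral_finsetSum (fun n _ => hi _), intervalIntegral.integral_finsetSum (fun n _ => hi _)]
  simp_rw [Fh_Jint k _ A B hk hA hAB]
  rw [sum_range_succ', ← mul_sum, ← mul_sum]
  simp only [Nat.cast_add, Nat.cast_one, Nat.cast_zero, zero_add]
  have : ∑ n ∈ range V, Jint k A B (θ + ((n:ℝ) + 1)) = ∑ n ∈ range V, Jint k A B ((n:ℝ) + 1 + θ) := by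
    apply sum_congr rfl; intro n _; congr 1; ring
  rw [this]
  ring

theorem hsum (k θ A B : ℝ) (V : ℕ) (hV : 4 ≤ V) (hk : 1 ≤ k) (hA : 1 ≤ A) (hAB : A ≤ B) (hθ0 : 0 < θ) (hθ1 : θ ≤ 1) :
    ‖∑ n ∈ Ioc ⌊A^2⌋₊ ⌊B^2⌋₊, Fh (k^2) θ n - 4 * FrL * (((√k)⁻¹ : ℝ):ℂ) * ∑ n ∈ range (V+1), (if k/B < n + θ ∧ n + θ ≤ k/A then ee (k^2/(n + θ)) else 0)‖
      ≤ 4 / (k * √A) + 24 / √k + 60 / (A * √A) * (1 + log (V + 3)) + 20 * k^2 * ((B^2 + 1) * (2 * (2 + log (V + 2)) / √V)) := by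
  have hA0 : 0 < A := by linarith
  have hk0 : 0 < k := by linarith
  have hsA := Real.sqrt_pos.2 hA0
  have hFn : ∀ t : ℝ, A^2 ≤ t → ‖Fh (k^2) θ t‖ ≤ 1 / (A * √A) := by
    intro t ht
    unfold Fh
    have hA2 : 0 < A^2 := by positivity
    rw [norm_mul, norm_ee, mul_one, Complex.norm_real, Real.norm_eq_abs, abs_of_pos (Real.rpow_pos_of_pos (by linarith) _)]
    have h1 : t^(-(3:ℝ)/4) ≤ (A^2)^(-(3:ℝ)/4) := Real.rpow_le_rpow_of_nonpos hA2 ht (by norm_num)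
    refine h1.trans (le_of_eq ?_)
    have h2 : A * √A = A^((3:ℝ)/2) := by
      rw [Real.sqrt_eq_rpow]
      nth_rewrite 1 [← Real.rpow_one A]
      rw [← Real.rpow_add hA0]; norm_num
    rw [h2, one_div, ← Real.rpow_neg hA0.le, ← Real.rpow_natCast A 2, ← Real.rpow_mul hA0.le]
    norm_num
  have hAB2 : A^2 ≤ B^2 := by gcongr
  have hA2 : 1 ≤ A^2 := by nlinarith
  have hP := poisson V hV (Fh (k^2) θ) (Fh' (k^2) θ) (A^2) (B^2) (20 * k^2) (1 / (A * √A)) (by positivity) hAB2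
    (fun t ht => Fh_deriv _ _ _ (by positivity) (by linarith [ht.1])) (Fh'_cont _ _ _ _ (by positivity) (by positivity))
    (fun t ht => Fh'_le _ _ _ (by nlinarith) (by linarith [ht.1]) hθ0.le hθ1) (hFn _ le_rfl) (hFn _ hAB2)
  rw [Fh_KV_int k θ A B V hk0 hA0 hAB] at hP
  have h1 := Jpos_sum k A B θ (V+1) hk0 hA0 hAB hθ0
  have h2 := Jneg_sum k A B θ V hk0 hA0 hAB hθ1
  set S := ∑ n ∈ Ioc ⌊A^2⌋₊ ⌊B^2⌋₊, Fh (k^2) θ n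
  set J1 := ∑ n ∈ range (V+1), Jint k A B (n + θ)
  set J2 := ∑ n ∈ range V, Jint k A B (θ - (n + 1))
  set Y := ∑ n ∈ range (V+1), (if k/B < n + θ ∧ n + θ ≤ k/A then ee (k^2/(n + θ)) else 0)
  have e : S - 4 * FrL * (((√k)⁻¹ : ℝ):ℂ) * Y = (S - 2 * (J1 + J2)) + (2 * (J1 - 2 * FrL * (((√k)⁻¹ : ℝ):ℂ) * Y) + 2 * J2) := by ring
  rw [e]
  have hlog : log ((V:ℝ) + 2) ≤ log (V + 3) := Real.log_le_log (by positivity) (by linarith)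
  have hc : ((V + 1 : ℕ):ℝ) + 2 = V + 3 := by push_cast; ring
  rw [hc] at h1
  have n1 : ‖(S - 2 * (J1 + J2)) + (2 * (J1 - 2 * FrL * (((√k)⁻¹ : ℝ):ℂ) * Y) + 2 * J2)‖ ≤ ‖S - 2 * (J1 + J2)‖ + (2 * ‖J1 - 2 * FrL * (((√k)⁻¹ : ℝ):ℂ) * Y‖ + 2 * ‖J2‖) := by
    refine (norm_add_le _ _).trans (add_le_add le_rfl ?_)
    refine (norm_add_le _ _).trans (le_of_eq ?_)
    rw [norm_mul, norm_mul]; norm_num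
  refine n1.trans ?_
  have hE : 1 / (A * √A) * (1 + log ((V:ℝ) + 2)) ≤ 1 / (A * √A) * (1 + log (V + 3)) := by gcongr
  have e1 : 28 / (A * √A) * (1 + log ((V:ℝ) + 3)) = 28 * (1 / (A * √A) * (1 + log (V + 3))) := by ring
  have e2 : 60 / (A * √A) * (1 + log ((V:ℝ) + 3)) = 60 * (1 / (A * √A) * (1 + log (V + 3))) := by ring
  have e3 : 2 * (1 / (A * √A)) * (1 + log ((V:ℝ) + 2)) = 2 * (1 / (A * √A) * (1 + log (V + 2))) := by ring
  have e4 : 4 / (k * √A) = 4 * (1 / (k * √A)) := by ring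
  have e5 : 24 / √k = 2 * (12 / √k) := by ring
  rw [e1] at h1
  rw [e3] at hP
  rw [e2, e4, e5]
  linarith

theorem ee_int (n : ℤ) : ee n = 1 := by
  unfold ee
  rw [Complex.exp_eq_one_iff]
  exact ⟨n, by push_cast; ring⟩

theorem ee_nat_mul (n : ℕ) (t : ℝ) : ee (n * t) = ee t ^ n := by
  induction n with
  | zero => simp [ee_zero]
  | succ n ih => rw [pow_succ, ← ih, ← ee_add]; congr 1; push_cast; ring

theorem ee_sub_one (δ : ℝ) (hδ : |δ| ≤ 1/2) : 4 * |δ| ≤ ‖1 - ee δ‖ := by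
  have h1 : ‖1 - ee δ‖^2 = (2 * sin (π * δ))^2 := by
    rw [← Complex.normSq_eq_norm_sq, Complex.normSq_apply]
    have hre : (1 - ee δ).re = 1 - cos (2 * π * δ) := by rw [Complex.sub_re, ee_re]; simp
    have him : (1 - ee δ).im = - sin (2 * π * δ) := by
      rw [Complex.sub_im]; unfold ee; rw [Complex.exp_ofReal_mul_I_im]; simp
    rw [hre, him]
    have e : 2 * π * δ = 2 * (π * δ) := by ring
    rw [e, cos_two_mul, sin_two_mul]
    have := sin_sq_add_cos_sq (π * δ)
    nlinarith
  have h2 : 2 * |δ| ≤ |sin (π * δ)| := by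
    have hms := Real.mul_le_sin (x := π * |δ|) (by positivity) (by nlinarith [Real.pi_pos])
    have e : 2 / π * (π * |δ|) = 2 * |δ| := by field_simp
    rw [e] at hms
    have : sin (π * |δ|) ≤ |sin (π * δ)| := by
      rcases abs_cases δ with ⟨h, _⟩ | ⟨h, _⟩
      · rw [h]; exact le_abs_self _
      · rw [h, mul_neg, sin_neg]; exact neg_le_abs _
    linarith
  have h3 : ‖1 - ee δ‖ = |2 * sin (π * δ)| := by
    rw [← Real.sqrt_sq (norm_nonneg (1 - ee δ)), h1, Real.sqrt_sq_eq_abs]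
  rw [h3, abs_mul, abs_two]
  linarith

theorem abel_geom (z : ℂ) (hz : ‖z‖ = 1) (m : ℕ) (hm : 1 ≤ m) (n : ℕ) (hn : m ≤ n) :
    ‖(1 - z) * ∑ h ∈ Icc m n, ((1 / (h:ℝ) : ℝ):ℂ) * z^h + ((1 / (n:ℝ) : ℝ):ℂ) * z^(n+1)‖ ≤ 2 / (m:ℝ) - 1 / n := by
  induction n, hn using Nat.le_induction with
  | base =>
    rw [Icc_self, sum_singleton]
    have : (1 - z) * (((1 / (m:ℝ) : ℝ):ℂ) * z^m) + ((1 / (m:ℝ) : ℝ):ℂ) * z^(m+1) = ((1 / (m:ℝ) : ℝ):ℂ) * z^m := by ring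
    rw [this, norm_mul, norm_pow, hz, one_pow, mul_one, Complex.norm_real, Real.norm_eq_abs, abs_of_nonneg (by positivity)]
    apply le_of_eq; ring
  | succ n hn ih =>
    rw [Finset.sum_Icc_succ_top (by omega)]
    set S := ∑ h ∈ Icc m n, ((1 / (h:ℝ) : ℝ):ℂ) * z^h
    have e : (1 - z) * (S + ((1 / ((n+1:ℕ):ℝ) : ℝ):ℂ) * z^(n+1)) + ((1 / ((n+1:ℕ):ℝ) : ℝ):ℂ) * z^(n+1+1)
       = ((1 - z) * S + ((1 / (n:ℝ) : ℝ):ℂ) * z^(n+1)) - ((1 / (n:ℝ) - 1 / ((n+1:ℕ):ℝ) : ℝ):ℂ) * z^(n+1) := by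
      push_cast; ring
    rw [e]
    refine (norm_sub_le _ _).trans ?_
    have hn0 : (0:ℝ) < n := by exact_mod_cast (by omega : 0 < n)
    rw [norm_mul ((1 / (n:ℝ) - 1 / ((n+1:ℕ):ℝ) : ℝ):ℂ), norm_pow, hz, one_pow, mul_one, Complex.norm_real, Real.norm_eq_abs, abs_of_nonneg (by
      rw [sub_nonneg]; apply one_div_le_one_div_of_le hn0; push_cast; linarith)]
    linarith

theorem ee_sum_le (ξ : ℝ) (e : ℤ) (he : |ξ - e| ≤ 1/2) (hne : ξ - e ≠ 0) (m n : ℕ) (hm : 1 ≤ m) :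
    ‖∑ h ∈ Icc m n, ((1 / (h:ℝ) : ℝ):ℂ) * ee (h * ξ)‖ ≤ 1 / (m * |ξ - e|) := by
  have hm0 : (0:ℝ) < m := by exact_mod_cast hm
  have hd : 0 < |ξ - e| := abs_pos.2 hne
  by_cases hmn : m ≤ n
  · have hz : ee ξ = ee (ξ - e) := by
      have : ξ = (ξ - e) + (e:ℝ) := by ring
      rw [this, ee_add, ee_int, mul_one]
      congr 1; ring
    simp_rw [ee_nat_mul]
    have h := abel_geom (ee ξ) (norm_ee ξ) m hm n hmn
    set S := ∑ h ∈ Icc m n, ((1 / (h:ℝ) : ℝ):ℂ) * ee ξ^h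
    have hn0 : (0:ℝ) < n := by exact_mod_cast (by omega : 0 < n)
    have h1 : ‖(1 - ee ξ) * S‖ ≤ 2 / (m:ℝ) := by
      have e1 : (1 - ee ξ) * S = ((1 - ee ξ) * S + ((1 / (n:ℝ) : ℝ):ℂ) * ee ξ^(n+1)) - ((1 / (n:ℝ) : ℝ):ℂ) * ee ξ^(n+1) := by ring
      rw [e1]
      refine (norm_sub_le _ _).trans ?_
      rw [norm_mul ((1 / (n:ℝ) : ℝ):ℂ), norm_pow, norm_ee, one_pow, mul_one, Complex.norm_real, Real.norm_eq_abs, abs_of_nonneg (by positivity)]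
      linarith
    rw [norm_mul] at h1
    have h2 := ee_sub_one (ξ - e) he
    rw [← hz] at h2
    have h3 : 4 * |ξ - e| * ‖S‖ ≤ 2 / m := (mul_le_mul_of_nonneg_right h2 (norm_nonneg _)).trans h1
    rw [le_div_iff₀ (by positivity)]
    rw [le_div_iff₀ hm0] at h3
    nlinarith [mul_nonneg hd.le (mul_nonneg (norm_nonneg S) hm0.le)]
  · rw [Icc_eq_empty hmn, sum_empty, norm_zero]
    positivity

theorem ee_sum_triv (ξ : ℝ) (m n : ℕ) (hm : 1 ≤ m) :
    ‖∑ h ∈ Icc m n, ((1 / (h:ℝ) : ℝ):ℂ) * ee (h * ξ)‖ ≤ 1 + log (n + 1) := by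
  refine (norm_sum_le _ _).trans ?_
  calc _ = ∑ h ∈ Icc m n, 1 / (h:ℝ) := by
        apply sum_congr rfl
        intro h _
        rw [norm_mul, norm_ee, mul_one, Complex.norm_real, Real.norm_eq_abs, abs_of_nonneg (by positivity)]
    _ ≤ ∑ h ∈ Icc 1 n, 1 / (h:ℝ) := by
        apply sum_le_sum_of_subset_of_nonneg
        · intro i; simp; omega
        · intros; positivity
    _ ≤ _ := by
        have := sum_inv_le_log n (n+1) (by omega)
        push_cast at this
        exact this

/-- the integer close to `x M₁ M₂` attached to `n` -/
def jn (M₁ M₂ ℓ₁ ℓ₂ : ℕ) (x : ℝ) (n : ℕ) : ℤ :=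
  (n * M₁ + ℓ₁) * (M₂ * round (x / ((n:ℝ) + (ℓ₁:ℝ)/M₁) - (ℓ₂:ℝ)/M₂) + ℓ₂)

theorem jn_dist (M₁ M₂ ℓ₁ ℓ₂ : ℕ) (hM1 : 1 ≤ M₁) (hM2 : 1 ≤ M₂) (hl1 : 1 ≤ ℓ₁) (x : ℝ) (n : ℕ) :
    (jn M₁ M₂ ℓ₁ ℓ₂ x n : ℝ) - x * M₁ * M₂ = - (((n:ℝ) + (ℓ₁:ℝ)/M₁) * M₁ * M₂) *
      ((x / ((n:ℝ) + (ℓ₁:ℝ)/M₁) - (ℓ₂:ℝ)/M₂) - round (x / ((n:ℝ) + (ℓ₁:ℝ)/M₁) - (ℓ₂:ℝ)/M₂)) := by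
  have h1 : (0:ℝ) < M₁ := by exact_mod_cast hM1
  have h2 : (0:ℝ) < M₂ := by exact_mod_cast hM2
  have h3 : (0:ℝ) < ℓ₁ := by exact_mod_cast hl1
  unfold jn
  have hμ : (n:ℝ) * M₁ + ℓ₁ ≠ 0 := by positivity
  generalize round (x / ((n:ℝ) + (ℓ₁:ℝ)/M₁) - (ℓ₂:ℝ)/M₂) = r
  push_cast
  have e : (n:ℝ) + (ℓ₁:ℝ)/M₁ = (n * M₁ + ℓ₁) / M₁ := by field_simp
  rw [e]
  field_simp
  ring

theorem inner_bound (M₁ M₂ ℓ₁ ℓ₂ : ℕ) (hM1 : 1 ≤ M₁) (hM2 : 1 ≤ M₂) (hl1 : 1 ≤ ℓ₁) (x y : ℝ) (hx : 0 < x) (hy : 0 < y)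
    (n m H : ℕ) (hm : 1 ≤ m) (hm2 : ((n:ℝ) + (ℓ₁:ℝ)/M₁) * √(y/x) ≤ m) :
    ‖∑ h ∈ Icc m H, ((1 / (h:ℝ) : ℝ):ℂ) * ee (h * (x / ((n:ℝ) + (ℓ₁:ℝ)/M₁) - (ℓ₂:ℝ)/M₂))‖ ≤
      (1 + log (H + 1)) * (1 / max 1 (|(jn M₁ M₂ ℓ₁ ℓ₂ x n : ℝ) - x * M₁ * M₂| / (M₁ * M₂ * √(x/y)))) := by
  have h1 : (0:ℝ) < M₁ := by exact_mod_cast hM1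
  have h2 : (0:ℝ) < M₂ := by exact_mod_cast hM2
  have h3 : (0:ℝ) < ℓ₁ := by exact_mod_cast hl1
  have hQ : 0 < √(x/y) := Real.sqrt_pos.2 (by positivity)
  have hlog : 0 ≤ log ((H:ℝ) + 1) := Real.log_nonneg (by linarith [(Nat.cast_nonneg H : (0:ℝ) ≤ H)])
  have hjd := jn_dist M₁ M₂ ℓ₁ ℓ₂ hM1 hM2 hl1 x n
  set μ : ℝ := (n:ℝ) + (ℓ₁:ℝ)/M₁ with hμ
  have hμ0 : 0 < μ := by positivity
  set ξ := x / μ - (ℓ₂:ℝ)/M₂ with hξ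
  have hm0 : (0:ℝ) < m := by exact_mod_cast hm
  rcases le_or_gt (|(jn M₁ M₂ ℓ₁ ℓ₂ x n : ℝ) - x * M₁ * M₂| / (M₁ * M₂ * √(x/y))) 1 with hc | hc
  · rw [max_eq_left hc, div_one, mul_one]
    exact ee_sum_triv ξ m H hm
  · rw [max_eq_right hc.le]
    have hab : |(jn M₁ M₂ ℓ₁ ℓ₂ x n : ℝ) - x * M₁ * M₂| = μ * M₁ * M₂ * |ξ - round ξ| := by
      rw [hjd, abs_mul, abs_neg, abs_of_pos (by positivity)]
    have hne : ξ - round ξ ≠ 0 := by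
      intro h
      rw [hab, h, abs_zero, mul_zero, zero_div] at hc
      linarith
    have hδ : 0 < |ξ - round ξ| := abs_pos.2 hne
    refine (ee_sum_le ξ (round ξ) (abs_sub_round ξ) hne m H hm).trans ?_
    have : 1 / (m * |ξ - round ξ|) ≤ 1 / (|(jn M₁ M₂ ℓ₁ ℓ₂ x n : ℝ) - x * M₁ * M₂| / (M₁ * M₂ * √(x/y))) := by
      apply one_div_le_one_div_of_le (by linarith)
      rw [hab]
      have e : μ * M₁ * M₂ * |ξ - round ξ| / (M₁ * M₂ * √(x/y)) = (μ * √(y/x)) * |ξ - round ξ| := by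
        have : √(y/x) = (√(x/y))⁻¹ := by rw [← Real.sqrt_inv, inv_div]
        rw [this]; field_simp
      rw [e]
      gcongr
    refine this.trans ?_
    have hp : 0 < 1 / (|(jn M₁ M₂ ℓ₁ ℓ₂ x n : ℝ) - x * M₁ * M₂| / (M₁ * M₂ * √(x/y))) := by positivity
    nlinarith

theorem sum_jn (M₁ M₂ ℓ₁ ℓ₂ : ℕ) (hM1 : 1 ≤ M₁) (hM2 : 1 ≤ M₂) (hl1 : 1 ≤ ℓ₁) (x : ℝ) (G : Finset ℕ) (N : ℕ) (D : ℝ) (hD0 : 0 ≤ D)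
    (hD : ∀ j : ℕ, 1 ≤ j → j < N → ((Nat.divisors j).card : ℝ) ≤ D)
    (hG : ∀ n ∈ G, 0 < jn M₁ M₂ ℓ₁ ℓ₂ x n ∧ jn M₁ M₂ ℓ₁ ℓ₂ x n < N) (g : ℝ → ℝ) (hg : ∀ t, 0 ≤ g t) :
    ∑ n ∈ G, g (jn M₁ M₂ ℓ₁ ℓ₂ x n) ≤ D * ∑ j ∈ range N, g j := by
  have hmaps : ∀ n ∈ G, (jn M₁ M₂ ℓ₁ ℓ₂ x n).toNat ∈ range N := by
    intro n hn
    have := hG n hn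
    rw [mem_range]; omega
  rw [← Finset.sum_fiberwise_of_maps_to hmaps, mul_sum]
  apply sum_le_sum
  intro j hj
  rw [mem_range] at hj
  set S := G.filter (fun n => (jn M₁ M₂ ℓ₁ ℓ₂ x n).toNat = j) with hS
  have hmem : ∀ n ∈ S, n ∈ G ∧ jn M₁ M₂ ℓ₁ ℓ₂ x n = (j:ℤ) := by
    intro n hn
    rw [hS, mem_filter] at hn
    have := hG n hn.1
    exact ⟨hn.1, by omega⟩
  have e : ∑ n ∈ S, g (jn M₁ M₂ ℓ₁ ℓ₂ x n) = (S.card:ℝ) * g j := by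
    rw [sum_congr rfl (g := fun _ => g (j:ℝ)) (fun n hn => by rw [(hmem n hn).2]; simp), sum_const, nsmul_eq_mul]
  rw [e]
  rcases S.eq_empty_or_nonempty with h0 | ⟨n0, hn0⟩
  · rw [h0, card_empty]
    simpa using mul_nonneg hD0 (hg j)
  · have hj1 : 1 ≤ j := by
      have := hmem n0 hn0
      have := hG n0 this.1
      omega
    have hcard : S.card ≤ (Nat.divisors j).card := by
      apply Finset.card_le_card_of_injOn (fun n => n * M₁ + ℓ₁)
      · intro n hn
        have := (hmem n hn).2
        rw [Finset.mem_coe, Nat.mem_divisors]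
        refine ⟨?_, by omega⟩
        have hd : ((n * M₁ + ℓ₁ : ℕ):ℤ) ∣ (j:ℤ) := by
          rw [← this]; unfold jn; push_cast; exact Dvd.intro _ rfl
        exact_mod_cast hd
      · intro n _ n' _ h
        simp only at h
        have : n * M₁ = n' * M₁ := by omega
        exact Nat.eq_of_mul_eq_mul_right (by omega) this
    have := hD j hj1 hj
    have hc' : (S.card:ℝ) ≤ D := le_trans (by exact_mod_cast hcard) this
    exact mul_le_mul_of_nonneg_right hc' (hg _)

theorem main_core (M₁ M₂ ℓ₁ ℓ₂ : ℕ) (hM1 : 1 ≤ M₁) (hM2 : 1 ≤ M₂) (hl1 : 1 ≤ ℓ₁) (x y : ℝ) (hx : 0 < x) (hy : 0 < y)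
    (P : ℕ → Prop) (hP : ∀ n, P n → (n:ℝ) + (ℓ₁:ℝ)/M₁ < 2 * x) (N H V : ℕ) (hN : 2 * x * M₁ * M₂ ≤ N) (D : ℝ) (hD0 : 0 ≤ D)
    (hD : ∀ j : ℕ, 1 ≤ j → j < N → ((Nat.divisors j).card : ℝ) ≤ D) :
    ‖∑ h ∈ Icc 1 H, ((1 / (h:ℝ) : ℝ):ℂ) * ee (-(h * ((ℓ₂:ℝ)/M₂))) * ∑ n ∈ range V,
        (if P n ∧ ((n:ℝ) + (ℓ₁:ℝ)/M₁) * √(y/x) ≤ h then ee (h * x / ((n:ℝ) + (ℓ₁:ℝ)/M₁)) else 0)‖ ≤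
      (1 + log (H + 1)) * (D * (2 + 2 * (M₁ * M₂ * √(x/y)) * (1 + log (N + 1)))) := by
  have h1 : (0:ℝ) < M₁ := by exact_mod_cast hM1
  have h2 : (0:ℝ) < M₂ := by exact_mod_cast hM2
  have h3 : (0:ℝ) < ℓ₁ := by exact_mod_cast hl1
  have hQ : 0 < √(x/y) := Real.sqrt_pos.2 (by positivity)
  have hq : 0 < √(y/x) := Real.sqrt_pos.2 (by positivity)
  have hlog : 0 ≤ log ((H:ℝ) + 1) := Real.log_nonneg (by linarith [(Nat.cast_nonneg H : (0:ℝ) ≤ H)])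
  set G := (range V).filter P with hG
  set F : ℝ → ℝ := fun t => 1 / max 1 (|t - x * M₁ * M₂| / (M₁ * M₂ * √(x/y))) with hF
  have hF0 : ∀ t, 0 ≤ F t := fun t => by simp only [hF]; positivity
  have key : ∀ n ∈ G, ‖∑ h ∈ Icc 1 H, (if ((n:ℝ) + (ℓ₁:ℝ)/M₁) * √(y/x) ≤ h then
      ((1 / (h:ℝ) : ℝ):ℂ) * ee (h * (x / ((n:ℝ) + (ℓ₁:ℝ)/M₁) - (ℓ₂:ℝ)/M₂)) else 0)‖ ≤
      (1 + log (H + 1)) * F (jn M₁ M₂ ℓ₁ ℓ₂ x n) := by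
    intro n hn
    set m : ℕ := ⌈((n:ℝ) + (ℓ₁:ℝ)/M₁) * √(y/x)⌉₊ with hm
    have hm1 : 1 ≤ m := Nat.one_le_iff_ne_zero.2 (by
      have : 0 < m := Nat.ceil_pos.2 (by positivity)
      omega)
    have e : ∑ h ∈ Icc 1 H, (if ((n:ℝ) + (ℓ₁:ℝ)/M₁) * √(y/x) ≤ h then
      ((1 / (h:ℝ) : ℝ):ℂ) * ee (h * (x / ((n:ℝ) + (ℓ₁:ℝ)/M₁) - (ℓ₂:ℝ)/M₂)) else 0) =
      ∑ h ∈ Icc m H, ((1 / (h:ℝ) : ℝ):ℂ) * ee (h * (x / ((n:ℝ) + (ℓ₁:ℝ)/M₁) - (ℓ₂:ℝ)/M₂)) := by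
      rw [← sum_filter]
      apply sum_congr _ (fun _ _ => rfl)
      ext h
      rw [mem_filter, mem_Icc, mem_Icc, hm, Nat.ceil_le]
      constructor
      · rintro ⟨⟨_, b⟩, d⟩; exact ⟨d, b⟩
      · rintro ⟨a, b⟩
        refine ⟨⟨?_, b⟩, a⟩
        have := Nat.ceil_le.2 a
        omega
    rw [e]
    exact inner_bound M₁ M₂ ℓ₁ ℓ₂ hM1 hM2 hl1 x y hx hy n m H hm1 (Nat.le_ceil _)
  have swap : ∑ h ∈ Icc 1 H, ((1 / (h:ℝ) : ℝ):ℂ) * ee (-(h * ((ℓ₂:ℝ)/M₂))) * ∑ n ∈ range V,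
        (if P n ∧ ((n:ℝ) + (ℓ₁:ℝ)/M₁) * √(y/x) ≤ h then ee (h * x / ((n:ℝ) + (ℓ₁:ℝ)/M₁)) else 0) =
      ∑ n ∈ G, ∑ h ∈ Icc 1 H, (if ((n:ℝ) + (ℓ₁:ℝ)/M₁) * √(y/x) ≤ h then
      ((1 / (h:ℝ) : ℝ):ℂ) * ee (h * (x / ((n:ℝ) + (ℓ₁:ℝ)/M₁) - (ℓ₂:ℝ)/M₂)) else 0) := by
    rw [sum_comm]
    apply sum_congr rfl
    intro h _
    rw [hG, sum_filter, mul_sum]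
    apply sum_congr rfl
    intro n _
    by_cases hp : P n
    · rw [if_pos hp]
      by_cases hh : ((n:ℝ) + (ℓ₁:ℝ)/M₁) * √(y/x) ≤ h
      · rw [if_pos hh, if_pos ⟨hp, hh⟩, mul_assoc, ← ee_add]
        congr 2; ring
      · rw [if_neg hh, if_neg (fun h => hh h.2), mul_zero]
    · rw [if_neg hp, if_neg (fun h => hp h.1), mul_zero]
  rw [swap]
  refine (norm_sum_le _ _).trans ((sum_le_sum key).trans ?_)
  rw [← mul_sum]
  apply mul_le_mul_of_nonneg_left _ (by linarith)
  refine (sum_jn M₁ M₂ ℓ₁ ℓ₂ hM1 hM2 hl1 x G N D hD0 hD ?_ F hF0).trans ?_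
  · intro n hn
    have hp : P n := (mem_filter.1 hn).2
    have hμ := hP n hp
    have hd := jn_dist M₁ M₂ ℓ₁ ℓ₂ hM1 hM2 hl1 x n
    set ξ := x / ((n:ℝ) + (ℓ₁:ℝ)/M₁) - (ℓ₂:ℝ)/M₂
    have hr := abs_le.1 (abs_sub_round ξ)
    have hμ0 : 0 < (n:ℝ) + (ℓ₁:ℝ)/M₁ := by positivity
    set μ := (n:ℝ) + (ℓ₁:ℝ)/M₁
    have a1 : μ * M₁ * M₂ < 2 * x * M₁ * M₂ := by gcongr
    have a0 : 0 < μ * M₁ * M₂ := by positivity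
    have b1 : (0:ℝ) < jn M₁ M₂ ℓ₁ ℓ₂ x n := by nlinarith
    have b2 : (jn M₁ M₂ ℓ₁ ℓ₂ x n : ℝ) < N := by nlinarith
    exact ⟨by exact_mod_cast b1, by exact_mod_cast b2⟩
  · apply mul_le_mul_of_nonneg_left _ hD0
    exact sum_dist_log N (x * M₁ * M₂) (M₁ * M₂ * √(x/y)) (by positivity)

theorem log_T8 (T : ℝ) (hT : 1 ≤ T) (H : ℕ) (hH : (H:ℝ) ≤ T ^ 8) : 1 + log ((H:ℝ) + 1) ≤ 8 * (1 + log (4 * T)) := by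
  have h0 : (0:ℝ) ≤ H := Nat.cast_nonneg H
  have h8 : (1:ℝ) ≤ T ^ 8 := one_le_pow₀ hT
  have a : log ((H:ℝ) + 1) ≤ log ((4 * T) ^ 8) := by
    apply Real.log_le_log (by positivity)
    have : (4 * T) ^ 8 = 65536 * T ^ 8 := by ring
    rw [this]; linarith
  rw [Real.log_pow] at a
  push_cast at a
  linarith

theorem sqrt_xy (T x : ℝ) (hT : 1 ≤ T) (hx : x ≤ T) : √(x / T ^ ((3:ℝ)/4)) ≤ T ^ ((1:ℝ)/8) := by
  have hT0 : 0 < T := by linarith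
  rw [Real.sqrt_le_left (by positivity)]
  rw [div_le_iff₀ (by positivity), ← Real.rpow_natCast, ← Real.rpow_mul hT0.le, ← Real.rpow_add hT0]
  norm_num
  exact hx

theorem main_sum (M₁ M₂ ℓ₁ ℓ₂ : ℕ) (hM1 : 1 ≤ M₁) (hM2 : 1 ≤ M₂) (hl1 : 1 ≤ ℓ₁) (ε : ℝ) (hε : 0 < ε) :
    ∃ C : ℝ, 1 ≤ C ∧ ∀ T x : ℝ, 1 ≤ T → 0 < x → x ≤ T → ∀ P : ℕ → Prop, (∀ n, P n → (n:ℝ) + (ℓ₁:ℝ)/M₁ < 2 * x) →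
      ∀ H V : ℕ, (H:ℝ) ≤ T ^ 8 →
    ‖∑ h ∈ Icc 1 H, ((1 / (h:ℝ) : ℝ):ℂ) * ee (-(h * ((ℓ₂:ℝ)/M₂))) * ∑ n ∈ range V,
        (if P n ∧ ((n:ℝ) + (ℓ₁:ℝ)/M₁) * √(T ^ ((3:ℝ)/4)/x) ≤ h then ee (h * x / ((n:ℝ) + (ℓ₁:ℝ)/M₁)) else 0)‖ ≤
      C * T ^ (1/8 + ε) := by
  have h1 : (1:ℝ) ≤ M₁ := by exact_mod_cast hM1
  have h2 : (1:ℝ) ≤ M₂ := by exact_mod_cast hM2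
  set M : ℝ := M₁ * M₂ with hM
  have hMM : 1 ≤ M := by rw [hM]; nlinarith
  set e := ε / 3 with he
  have he0 : 0 < e := by positivity
  obtain ⟨Cd, hCd, hdiv⟩ := divisor_bound e he0
  obtain ⟨Cl, hCl, hlog⟩ := log_pow_bound e he0
  have hMe : 1 ≤ M ^ e := Real.one_le_rpow hMM he0.le
  have h3e : (1:ℝ) ≤ 3 ^ e := Real.one_le_rpow (by norm_num) he0.le
  have h3M : 1 ≤ (3 * M) ^ e := Real.one_le_rpow (by linarith) he0.le
  refine ⟨8 * Cl * (Cd * (3 * M) ^ e * (4 * M * (Cl * M ^ e))), ?_, ?_⟩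
  · have p1 : 1 ≤ Cd * (3 * M) ^ e := one_le_mul_of_one_le_of_one_le hCd h3M
    have p2 : 1 ≤ Cl * M ^ e := one_le_mul_of_one_le_of_one_le hCl hMe
    have p3 : 1 ≤ 4 * M * (Cl * M ^ e) := one_le_mul_of_one_le_of_one_le (by linarith) p2
    exact one_le_mul_of_one_le_of_one_le (by linarith) (one_le_mul_of_one_le_of_one_le p1 p3)
  intro T x hT hx0 hx P hP H V hH
  have hT0 : 0 < T := by linarith
  set y := T ^ ((3:ℝ)/4) with hy
  have hy0 : 0 < y := by positivity
  set N : ℕ := ⌈2 * T * M⌉₊ with hN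
  have hTM : 1 ≤ T * M := one_le_mul_of_one_le_of_one_le hT hMM
  have hN1 : 2 * T * M ≤ N := Nat.le_ceil _
  have hN2 : (N:ℝ) < 2 * T * M + 1 := Nat.ceil_lt_add_one (by positivity)
  have hTe : 1 ≤ T ^ e := Real.one_le_rpow hT he0.le
  have h := main_core M₁ M₂ ℓ₁ ℓ₂ hM1 hM2 hl1 x y hx0 hy0 P hP N H V
    (by refine le_trans ?_ hN1
        have : 2 * x * M₁ * M₂ = 2 * x * M := by rw [hM]; ring
        rw [this]; gcongr) (Cd * (3 * (T * M)) ^ e) (by positivity)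
    (by intro j hj hjN
        refine (hdiv j hj).trans ?_
        have : (j:ℝ) ≤ 3 * (T * M) := by
          have : (j:ℝ) < N := by exact_mod_cast hjN
          have : (j:ℝ) + 1 ≤ N := by exact_mod_cast hjN
          linarith
        gcongr)
  refine h.trans ?_
  have l1 : 1 + log ((H:ℝ) + 1) ≤ 8 * Cl * T ^ e := by
    have := log_T8 T hT H hH
    have := hlog T hT
    linarith
  have l2 : 1 + log ((N:ℝ) + 1) ≤ Cl * M ^ e * T ^ e := by
    have a : log ((N:ℝ) + 1) ≤ log (4 * (T * M)) := by
      apply Real.log_le_log (by positivity)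
      linarith
    have b := hlog (T * M) hTM
    rw [Real.mul_rpow hT0.le (by linarith)] at b
    linarith
  have l3 := sqrt_xy T x hT hx
  have l3' : (1:ℝ) ≤ T ^ ((1:ℝ)/8) := Real.one_le_rpow hT (by norm_num)
  have p2 : 1 ≤ Cl * M ^ e * T ^ e := one_le_mul_of_one_le_of_one_le (one_le_mul_of_one_le_of_one_le hCl hMe) hTe
  have l4 : 2 + 2 * (M * √(x/y)) * (1 + log ((N:ℝ) + 1)) ≤ 4 * M * T ^ ((1:ℝ)/8) * (Cl * M ^ e * T ^ e) := by
    have a : 2 * (M * √(x/y)) * (1 + log ((N:ℝ) + 1)) ≤ 2 * (M * T ^ ((1:ℝ)/8)) * (Cl * M ^ e * T ^ e) := by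
      gcongr
      have := Real.log_nonneg (by linarith [(Nat.cast_nonneg N : (0:ℝ) ≤ N)] : (1:ℝ) ≤ N + 1)
      linarith
    have b : 1 ≤ M * T ^ ((1:ℝ)/8) * (Cl * M ^ e * T ^ e) :=
      one_le_mul_of_one_le_of_one_le (one_le_mul_of_one_le_of_one_le hMM l3') p2
    linarith
  have e3 : (3 * (T * M)) ^ e = (3 * M) ^ e * T ^ e := by
    rw [← Real.mul_rpow (by linarith) hT0.le]; congr 1; ring
  rw [e3]
  have eT : T ^ (1/8 + ε) = T ^ e * T ^ e * T ^ e * T ^ ((1:ℝ)/8) := by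
    rw [← Real.rpow_add hT0, ← Real.rpow_add hT0, ← Real.rpow_add hT0]
    congr 1; rw [he]; ring
  rw [eT]
  have hl0 : 0 ≤ 1 + log ((H:ℝ) + 1) := by
    have := Real.log_nonneg (by linarith [(Nat.cast_nonneg H : (0:ℝ) ≤ H)] : (1:ℝ) ≤ H + 1)
    linarith
  calc _ ≤ (8 * Cl * T ^ e) * (Cd * ((3 * M) ^ e * T ^ e) * (4 * M * T ^ ((1:ℝ)/8) * (Cl * M ^ e * T ^ e))) := by
        gcongr
        have hN0 : 0 ≤ log ((N:ℝ) + 1) := Real.log_nonneg (by linarith [(Nat.cast_nonneg N : (0:ℝ) ≤ N)] : (1:ℝ) ≤ N + 1)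
        positivity
    _ = _ := by ring

theorem two_log_le (u : ℝ) (hu : 0 < u) : 2 * log u ≤ u := by
  have h := Real.log_le_sub_one_of_pos (by positivity : 0 < u / 2)
  rw [Real.log_div hu.ne' (by norm_num)] at h
  have := Real.log_two_lt_d9
  linarith

theorem L_ge (T : ℝ) (hT : 10 ≤ T) : 2 ≤ (2:ℝ) ^ (Jof T + 1) := by
  have hl : 0 < log T := Real.log_pos (by linarith)
  have h := two_log_le (log T) hl
  have hJ : 0 ≤ Jof T := by
    unfold Jof
    apply Int.floor_nonneg.2
    have := Real.log_pos (by norm_num : (1:ℝ) < 2)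
    apply div_nonneg <;> linarith
  calc (2:ℝ) = 2 ^ (1:ℤ) := by norm_num
    _ ≤ _ := zpow_le_zpow_right₀ (by norm_num) (by omega)

theorem L_le (T : ℝ) (hT : 10 ≤ T) : (2:ℝ) ^ (Jof T + 1) ≤ 2 * T := by
  have hT0 : 0 < T := by linarith
  have h2 := Real.log_pos (by norm_num : (1:ℝ) < 2)
  have hl1 : 1 ≤ log T := by
    rw [Real.le_log_iff_exp_le hT0]
    have := Real.exp_one_lt_d9
    linarith
  have hll : 0 ≤ log (log T) := Real.log_nonneg hl1
  have hJ : (Jof T : ℝ) ≤ log T / log 2 := by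
    unfold Jof
    refine (Int.floor_le _).trans ?_
    gcongr
    linarith
  rw [zpow_add₀ (by norm_num), zpow_one, mul_comm]
  have : (2:ℝ) ^ (Jof T) ≤ T := by
    rw [← Real.rpow_intCast]
    calc (2:ℝ) ^ (Jof T : ℝ) ≤ 2 ^ (log T / log 2) := Real.rpow_le_rpow_of_exponent_le (by norm_num) hJ
      _ = T := by
        rw [Real.rpow_def_of_pos (by norm_num), mul_div_cancel₀ _ h2.ne', Real.exp_log hT0]
  linarith

theorem pair_sum (S : Finset ℕ) (A B : ℕ) (H : ℝ) (hA : A = ⌊H⌋₊) (hH : 0 ≤ H) (hS : ∀ n ∈ S, 1 ≤ n ∧ n ≤ B) (F : ℕ × ℕ → ℝ) :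
    ∑ n ∈ S, ∑ p ∈ n.divisorsAntidiagonal, (if (p.1:ℝ) ≤ H then F p else 0) =
      ∑ h ∈ Icc 1 A, ∑ r ∈ Icc 1 B, if h * r ∈ S then F (h, r) else 0 := by
  have e : ∀ n ∈ S, ∑ p ∈ n.divisorsAntidiagonal, (if (p.1:ℝ) ≤ H then F p else 0) =
      ∑ p ∈ Icc 1 A ×ˢ Icc 1 B, if p.1 * p.2 = n then F p else 0 := by
    intro n hn
    rw [← sum_filter, ← sum_filter]
    apply sum_congr _ (fun _ _ => rfl)
    ext ⟨h, r⟩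
    have hn' := hS n hn
    simp only [mem_filter, Nat.mem_divisorsAntidiagonal, mem_product, mem_Icc]
    rw [hA, Nat.le_floor_iff hH]
    constructor
    · rintro ⟨⟨a, b⟩, d⟩
      have hh : 1 ≤ h := Nat.one_le_iff_ne_zero.2 (by rintro rfl; omega)
      have hr : 1 ≤ r := Nat.one_le_iff_ne_zero.2 (by rintro rfl; omega)
      refine ⟨⟨⟨hh, d⟩, hr, ?_⟩, a⟩
      have : r ≤ h * r := Nat.le_mul_of_pos_left _ hh
      omega
    · rintro ⟨⟨⟨a, b⟩, d⟩, f⟩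
      exact ⟨⟨f, by omega⟩, b⟩
  rw [sum_congr rfl e, sum_comm, sum_product]
  apply sum_congr rfl; intro h _
  apply sum_congr rfl; intro r _
  rw [sum_ite_eq]

/-- the inner `r`-sum -/
def Wh (M₁ M₂ ℓ₁ : ℕ) (T y x : ℝ) (N : ℕ) (h : ℕ) : ℂ :=
  ∑ r ∈ Icc 1 N, if y < (h:ℝ) * r then
    ((wprime ((h : ℝ) * M₁ / M₂) ((2:ℝ) ^ (Jof T + 1) * h * M₁ / M₂) (r : ℝ) : ℝ) : ℂ) * Fh (h * x) ((ℓ₁:ℝ)/M₁) r else 0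

theorem wprime_supp (α β t : ℝ) (h : wprime α β t ≠ 0) (hab : α ≤ β) : α ≤ t ∧ t ≤ β := by
  unfold wprime at h
  by_contra hc
  apply h
  rw [if_neg, if_neg, if_neg]
  · norm_num
  · rintro rfl; exact hc ⟨hab, le_rfl⟩
  · rintro rfl; exact hc ⟨le_rfl, hab⟩
  · rintro ⟨a, b⟩; exact hc ⟨a.le, b.le⟩

theorem Rstar_reindex (M₁ M₂ ℓ₁ ℓ₂ : ℕ) (hM1 : 1 ≤ M₁) (hM2 : 1 ≤ M₂) (T y H x : ℝ) (hT : 10 ≤ T) (hH : 0 ≤ H) :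
    Rstar12 M₁ M₂ ℓ₁ ℓ₂ T y H x = x ^ ((1:ℝ)/4) / (√2 * π) *
      (∑ h ∈ Icc 1 ⌊H⌋₊, (((h:ℝ) ^ (-(3:ℝ)/4) : ℝ):ℂ) * ee (-(h * ((ℓ₂:ℝ)/M₂))) * ee (-(1/8)) *
        Wh M₁ M₂ ℓ₁ T y x ⌊(2:ℝ) ^ (Jof T + 1) * H ^ 2 * M₁ / M₂⌋₊ h).re := by
  have h1 : (0:ℝ) < M₁ := by exact_mod_cast hM1
  have h2 : (0:ℝ) < M₂ := by exact_mod_cast hM2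
  have hL := L_ge T hT
  unfold Rstar12
  congr 1
  set L := (2:ℝ) ^ (Jof T + 1) with hLd
  set N := ⌊L * H ^ 2 * M₁ / M₂⌋₊ with hN
  set S := (Icc 1 N).filter (fun n : ℕ => y < (n:ℝ)) with hS
  have e1 : ∀ n ∈ S, tau12H M₁ M₂ ℓ₁ ℓ₂ T H n x * (n:ℝ) ^ (-(3:ℝ)/4) =
     ∑ p ∈ n.divisorsAntidiagonal, (if (p.1:ℝ) ≤ H then 
      (wprime ((p.1 : ℝ) * M₁ / M₂) (L * p.1 * M₁ / M₂) (p.2 : ℝ) *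
        Real.cos (4 * π * Real.sqrt (((p.1 * p.2 : ℕ):ℝ) * x) - 2 * π * phase M₁ M₂ ℓ₁ ℓ₂ p) * ((p.1 * p.2 : ℕ):ℝ) ^ (-(3:ℝ)/4)) else 0) := by
    intro n hn
    unfold tau12H
    rw [sum_mul]
    apply sum_congr rfl
    intro p hp
    rw [(Nat.mem_divisorsAntidiagonal.1 hp).1]
    by_cases hc : (p.1:ℝ) ≤ H
    · rw [if_pos hc, if_pos hc]
    · rw [if_neg hc, if_neg hc, zero_mul]
  rw [sum_congr rfl e1, pair_sum S ⌊H⌋₊ N H rfl hH (by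
    intro n hn
    rw [hS, mem_filter, mem_Icc] at hn
    exact hn.1), Complex.re_sum]
  apply sum_congr rfl
  intro h hh
  rw [mem_Icc, Nat.le_floor_iff hH] at hh
  have hh0 : (0:ℝ) < h := by exact_mod_cast hh.1
  unfold Wh
  rw [mul_sum, Complex.re_sum]
  apply sum_congr rfl
  intro r hr
  rw [mem_Icc] at hr
  have hr0 : (0:ℝ) < r := by exact_mod_cast hr.1
  have hmem : h * r ∈ S ↔ (h * r ≤ N ∧ y < (h:ℝ) * r) := by
    rw [hS, mem_filter, mem_Icc]
    push_cast
    have : 1 ≤ h * r := Nat.mul_pos hh.1 hr.1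
    tauto
  rw [← hLd]
  by_cases hy : y < (h:ℝ) * r
  · rw [if_pos hy]
    have eq : wprime ((h : ℝ) * M₁ / M₂) (L * h * M₁ / M₂) (r : ℝ) *
        Real.cos (4 * π * Real.sqrt (((h * r : ℕ):ℝ) * x) - 2 * π * phase M₁ M₂ ℓ₁ ℓ₂ (h, r)) * ((h * r : ℕ):ℝ) ^ (-(3:ℝ)/4) =
      ((((h:ℝ) ^ (-(3:ℝ)/4) : ℝ):ℂ) * ee (-(h * ((ℓ₂:ℝ)/M₂))) * ee (-(1/8)) *
        (((wprime ((h : ℝ) * M₁ / M₂) (L * h * M₁ / M₂) (r : ℝ) : ℝ) : ℂ) * Fh (h * x) ((ℓ₁:ℝ)/M₁) r)).re := by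
      unfold Fh
      generalize wprime ((h : ℝ) * M₁ / M₂) (L * h * M₁ / M₂) (r : ℝ) = w
      have : (((h:ℝ) ^ (-(3:ℝ)/4) : ℝ):ℂ) * ee (-(h * ((ℓ₂:ℝ)/M₂))) * ee (-(1/8)) *
        ((w : ℂ) * ((((r:ℝ) ^ (-(3:ℝ)/4) : ℝ):ℂ) * ee (2 * √(h * x * r) - (ℓ₁:ℝ)/M₁ * r))) =
        ((w * ((h:ℝ) ^ (-(3:ℝ)/4) * (r:ℝ) ^ (-(3:ℝ)/4)) : ℝ):ℂ) * ee (2 * √(h * x * r) - (ℓ₁:ℝ)/M₁ * r + -(h * ((ℓ₂:ℝ)/M₂)) + -(1/8)) := by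
        rw [ee_add, ee_add]; push_cast; ring
      rw [this, Complex.re_ofReal_mul, ee_re]
      push_cast
      rw [Real.mul_rpow hh0.le hr0.le]
      have c : 4 * π * √(h * r * x) - 2 * π * phase M₁ M₂ ℓ₁ ℓ₂ (h, r) =
        2 * π * (2 * √(h * x * r) - (ℓ₁:ℝ)/M₁ * r + -(h * ((ℓ₂:ℝ)/M₂)) + -(1/8)) := by
        unfold phase
        rw [show (h:ℝ) * r * x = h * x * r by ring]
        simp only
        ring
      rw [c]; ring
    rw [← eq]
    by_cases hn : h * r ≤ N
    · rw [if_pos (hmem.2 ⟨hn, hy⟩)]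
    · rw [if_neg (fun hc => hn (hmem.1 hc).1)]
      have : wprime ((h : ℝ) * M₁ / M₂) (L * h * M₁ / M₂) (r : ℝ) = 0 := by
        by_contra hne
        have hab : (h : ℝ) * M₁ / M₂ ≤ L * h * M₁ / M₂ := by
          gcongr
          nlinarith
        have := (wprime_supp _ _ _ hne hab).2
        apply hn
        rw [hN]
        apply Nat.le_floor
        push_cast
        calc (h:ℝ) * r ≤ h * (L * h * M₁ / M₂) := by gcongr
          _ = L * (h * h) * M₁ / M₂ := by ring
          _ ≤ L * (H * H) * M₁ / M₂ := by gcongr <;> exact hh.2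
          _ = _ := by ring
      rw [this]; ring
  · rw [if_neg hy, if_neg (fun hc => hy (hmem.1 hc).2), mul_zero, Complex.zero_re]

theorem Fh_norm (κ θ : ℝ) (r : ℕ) : ‖Fh κ θ r‖ = (r:ℝ) ^ (-(3:ℝ)/4) := by
  unfold Fh
  rw [norm_mul, norm_ee, mul_one, Complex.norm_real, Real.norm_eq_abs, abs_of_nonneg (by positivity)]

theorem Wh_zero (M₁ M₂ ℓ₁ : ℕ) (hM1 : 1 ≤ M₁) (hM2 : 1 ≤ M₂) (T y x : ℝ) (hT : 10 ≤ T) (N h : ℕ) (hh : 1 ≤ h)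
    (hab : (2:ℝ) ^ (Jof T + 1) * h * M₁ / M₂ ≤ max ((h:ℝ) * M₁ / M₂) (y / h)) : Wh M₁ M₂ ℓ₁ T y x N h = 0 := by
  have h1 : (0:ℝ) < M₁ := by exact_mod_cast hM1
  have h2 : (0:ℝ) < M₂ := by exact_mod_cast hM2
  have hh0 : (0:ℝ) < h := by exact_mod_cast hh
  have hL := L_ge T hT
  unfold Wh
  set L := (2:ℝ) ^ (Jof T + 1) with hLd
  have hlt : (h:ℝ) * M₁ / M₂ < L * h * M₁ / M₂ := by
    gcongr
    nlinarith
  apply sum_eq_zero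
  intro r hr
  by_cases hy : y < (h:ℝ) * r
  · rw [if_pos hy]
    have : wprime ((h : ℝ) * M₁ / M₂) (L * h * M₁ / M₂) (r : ℝ) = 0 := by
      by_contra hne
      have hs := wprime_supp _ _ _ hne hlt.le
      rcases le_max_iff.1 hab with hc | hc
      · linarith
      · have : y / h < r := by rw [div_lt_iff₀ hh0]; linarith
        linarith
    rw [this]; simp
  · rw [if_neg hy]

theorem Wh_approx (M₁ M₂ ℓ₁ : ℕ) (hM1 : 1 ≤ M₁) (hM2 : 1 ≤ M₂) (T y x H : ℝ) (hT : 10 ≤ T) (hH : 1 ≤ H) (h : ℕ) (hh : 1 ≤ h)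
    (hhH : (h:ℝ) ≤ H) (a b : ℝ) (ha : a = max ((h:ℝ) * M₁ / M₂) (y / h)) (hb : b = (2:ℝ) ^ (Jof T + 1) * h * M₁ / M₂)
    (hab : a < b) : ‖Wh M₁ M₂ ℓ₁ T y x ⌊(2:ℝ) ^ (Jof T + 1) * H ^ 2 * M₁ / M₂⌋₊ h - 
      ∑ r ∈ Ioc ⌊a⌋₊ ⌊b⌋₊, Fh (h * x) ((ℓ₁:ℝ)/M₁) r‖ ≤ a ^ (-(3:ℝ)/4) := by
  have h1 : (0:ℝ) < M₁ := by exact_mod_cast hM1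
  have h2 : (0:ℝ) < M₂ := by exact_mod_cast hM2
  have hh0 : (0:ℝ) < h := by exact_mod_cast hh
  have hL := L_ge T hT
  unfold Wh
  rw [← hb]
  set L := (2:ℝ) ^ (Jof T + 1) with hLd
  set c0 := (h:ℝ) * M₁ / M₂ with hc0
  have hc0p : 0 < c0 := by positivity
  have ha1 : c0 ≤ a := ha ▸ le_max_left _ _
  have ha2 : y / h ≤ a := ha ▸ le_max_right _ _
  have ha0 : 0 < a := by linarith
  set N := ⌊L * H ^ 2 * M₁ / M₂⌋₊ with hN
  have hbN : ⌊b⌋₊ ≤ N := by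
    apply Nat.floor_le_floor
    rw [hb]
    gcongr
    nlinarith
  have e : ∑ r ∈ Ioc ⌊a⌋₊ ⌊b⌋₊, Fh (h * x) ((ℓ₁:ℝ)/M₁) r = ∑ r ∈ Icc 1 N, if a < (r:ℝ) ∧ (r:ℝ) ≤ b then Fh (h * x) ((ℓ₁:ℝ)/M₁) r else 0 := by
    rw [← sum_filter]
    apply sum_congr _ (fun _ _ => rfl)
    ext r
    rw [mem_filter, mem_Ioc, mem_Icc, Nat.floor_lt ha0.le, Nat.le_floor_iff (by linarith)]
    constructor
    · rintro ⟨p, q⟩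
      refine ⟨⟨?_, le_trans (Nat.le_floor q) hbN⟩, p, q⟩
      have : (0:ℝ) < r := by linarith
      exact_mod_cast this
    · rintro ⟨_, p⟩; exact p
  rw [e, ← sum_sub_distrib]
  have pt : ∀ r ∈ Icc 1 N, ‖(if y < (h:ℝ) * r then ((wprime c0 b (r : ℝ) : ℝ) : ℂ) * Fh (h * x) ((ℓ₁:ℝ)/M₁) r else 0) -
      (if a < (r:ℝ) ∧ (r:ℝ) ≤ b then Fh (h * x) ((ℓ₁:ℝ)/M₁) r else 0)‖ ≤
      (if (r:ℝ) = a then a ^ (-(3:ℝ)/4) / 2 else 0) + (if (r:ℝ) = b then a ^ (-(3:ℝ)/4) / 2 else 0) := by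
    intro r hr
    have hrp : 0 ≤ a ^ (-(3:ℝ)/4) / 2 := by positivity
    have n1 : 0 ≤ (if (r:ℝ) = a then a ^ (-(3:ℝ)/4) / 2 else 0) := by split_ifs <;> simp [hrp]
    have n2 : 0 ≤ (if (r:ℝ) = b then a ^ (-(3:ℝ)/4) / 2 else 0) := by split_ifs <;> simp [hrp]
    have hFa : a ≤ r → ‖Fh (h * x) ((ℓ₁:ℝ)/M₁) r‖ ≤ a ^ (-(3:ℝ)/4) := by
      intro har
      rw [Fh_norm]
      exact Real.rpow_le_rpow_of_nonpos ha0 har (by norm_num)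
    generalize Fh (h * x) ((ℓ₁:ℝ)/M₁) r = F at *
    rcases lt_trichotomy (r:ℝ) a with hra | hra | hra
    · -- below
      have : (if y < (h:ℝ) * r then ((wprime c0 b (r : ℝ) : ℝ) : ℂ) * F else 0) = 0 := by
        by_cases hy' : y < (h:ℝ) * r
        · rw [if_pos hy']
          have : wprime c0 b (r : ℝ) = 0 := by
            by_contra hne
            have hs := wprime_supp _ _ _ hne (by linarith)
            have : y / h < r := by rw [div_lt_iff₀ hh0]; linarith
            have : a ≤ r := by rw [ha]; exact max_le hs.1 this.le
            linarith
          rw [this]; simp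
        · rw [if_neg hy']
      rw [this, if_neg (fun hc => by linarith [hc.1]), sub_zero, norm_zero]
      linarith
    · have hno : ¬ (a < (r:ℝ) ∧ (r:ℝ) ≤ b) := fun hc => by linarith [hc.1]
      rw [if_pos hra, if_neg hno, sub_zero]
      have hF := hFa hra.symm.le
      by_cases hy' : y < (h:ℝ) * r
      · rw [if_pos hy', norm_mul]
        have hyr : y / h < r := by rw [div_lt_iff₀ hh0]; linarith
        have : a = c0 := by
          rcases max_choice c0 (y / h) with hm | hm
          · rw [ha, hm]
          · rw [← ha] at hm; linarith
        have hw : wprime c0 b r = 1/2 := by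
          unfold wprime
          rw [if_neg (fun hc => by linarith [hc.1]), if_pos (by linarith), if_neg (by intro hc; linarith)]
          norm_num
        rw [hw, Complex.norm_real]
        norm_num
        norm_num at hF n2
        linarith
      · rw [if_neg hy', norm_zero]; linarith
    · have hyr : y / h < r := by linarith
      have hy' : y < (h:ℝ) * r := by rw [div_lt_iff₀ hh0] at hyr; linarith
      rw [if_pos hy', if_neg hra.ne']
      have hF := hFa hra.le
      rcases lt_trichotomy (r:ℝ) b with hrb | hrb | hrb
      · have hw : wprime c0 b r = 1 := by
          unfold wprime
          rw [if_pos ⟨by linarith, hrb⟩, if_neg (by intro hc; linarith), if_neg hrb.ne]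
          norm_num
        rw [hw, if_pos ⟨hra, hrb.le⟩, if_neg hrb.ne]
        simp
      · have hw : wprime c0 b r = 1/2 := by
          unfold wprime
          rw [if_neg (fun hc => by linarith [hc.2]), if_neg (by intro hc; linarith), if_pos hrb]
          norm_num
        rw [hw, if_pos ⟨hra, hrb.le⟩, if_pos hrb]
        have : ((1/2 : ℝ):ℂ) * F - F = -(1/2) * F := by push_cast; ring
        rw [this, norm_mul]
        norm_num
        norm_num at hF
        linarith
      · have hw : wprime c0 b r = 0 := by
          by_contra hne
          have hs := wprime_supp _ _ _ hne (by linarith)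
          linarith [hs.2]
        rw [hw, if_neg (fun hc => by linarith [hc.2]), if_neg hrb.ne']
        simp
  have one : ∀ t : ℝ, ∑ r ∈ Icc 1 N, (if (r:ℝ) = t then a ^ (-(3:ℝ)/4) / 2 else 0) ≤ a ^ (-(3:ℝ)/4) / 2 := by
    intro t
    rw [← sum_filter, sum_const, nsmul_eq_mul]
    have hcard : ((Icc 1 N).filter (fun r : ℕ => (r:ℝ) = t)).card ≤ 1 := by
      apply Finset.card_le_one.2
      intro p hp q hq
      rw [mem_filter] at hp hq
      exact_mod_cast hp.2.trans hq.2.symm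
    have : (((Icc 1 N).filter (fun r : ℕ => (r:ℝ) = t)).card : ℝ) ≤ 1 := by exact_mod_cast hcard
    have hrp : 0 ≤ a ^ (-(3:ℝ)/4) / 2 := by positivity
    nlinarith
  refine (norm_sum_le _ _).trans ((sum_le_sum pt).trans ?_)
  rw [sum_add_distrib]
  linarith [one a, one b]

theorem q_k (x h : ℝ) (hx : 0 < x) (hh : 0 < h) : x ^ ((1:ℝ)/4) * h ^ (-(3:ℝ)/4) = √(√(h * x)) / h := by
  rw [Real.sqrt_eq_rpow, Real.sqrt_eq_rpow, ← Real.rpow_mul (by positivity), Real.mul_rpow hh.le hx.le]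
  have : h ^ ((1:ℝ)/2 * (1/2)) / h = h ^ (-(3:ℝ)/4) := by
    rw [div_eq_mul_inv, ← Real.rpow_neg_one h, ← Real.rpow_add hh]; norm_num
  rw [← this]
  norm_num
  ring

theorem a34 (a : ℝ) (ha : 0 < a) : a ^ (-(3:ℝ)/4) = 1 / (√a * √(√a)) := by
  rw [Real.sqrt_eq_rpow, Real.sqrt_eq_rpow, ← Real.rpow_mul ha.le, ← Real.rpow_add ha, one_div, ← Real.rpow_neg ha.le]
  norm_num

theorem a_low (M₁ M₂ : ℕ) (hM1 : 1 ≤ M₁) (hM2 : 1 ≤ M₂) (T x h a : ℝ) (hT : 1 ≤ T) (hx : 0 < x) (hxT : x ≤ T) (hh : 0 < h)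
    (ha1 : h * M₁ / M₂ ≤ a) (ha2 : T ^ ((3:ℝ)/4) / h ≤ a) :
    √(√(h * x)) * (1 / (√a * √(√a))) ≤ M₂ * T ^ ((1:ℝ)/8) := by
  have hT0 : 0 < T := by linarith
  have h1 : (1:ℝ) ≤ M₁ := by exact_mod_cast hM1
  have h2 : (1:ℝ) ≤ M₂ := by exact_mod_cast hM2
  have hc : 0 < h * M₁ / M₂ := by positivity
  have ha0 : 0 < a := by linarith
  rw [mul_one_div, div_le_iff₀ (by positivity)]
  rw [← pow_le_pow_iff_left₀ (by positivity) (by positivity) (by norm_num : 2 ≠ 0),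
    ← pow_le_pow_iff_left₀ (by positivity) (by positivity) (by norm_num : 2 ≠ 0)]
  have e1 : (√(√(h * x)) ^ 2) ^ 2 = h * x := by
    rw [Real.sq_sqrt (by positivity), Real.sq_sqrt (by positivity)]
  have e2 : ((M₂ * T ^ ((1:ℝ)/8) * (√a * √√a)) ^ 2) ^ 2 = M₂ ^ 4 * (T ^ ((1:ℝ)/8)) ^ 4 * a ^ 3 := by
    have : ((M₂ * T ^ ((1:ℝ)/8) * (√a * √√a)) ^ 2) ^ 2 = M₂ ^ 4 * (T ^ ((1:ℝ)/8)) ^ 4 * (((√a) ^ 2) ^ 2 * (√√a ^ 2) ^ 2) := by ring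
    rw [this, Real.sq_sqrt (by positivity : 0 ≤ √a), Real.sq_sqrt ha0.le]; ring
  rw [e1, e2]
  have e3 : (T ^ ((1:ℝ)/8)) ^ 4 = T ^ ((1:ℝ)/4) * T ^ ((1:ℝ)/4) := by
    rw [← Real.rpow_natCast, ← Real.rpow_mul hT0.le, ← Real.rpow_add hT0]; norm_num
  have e4 : T ^ ((1:ℝ)/4) * T ^ ((3:ℝ)/4) = T := by
    rw [← Real.rpow_add hT0]; norm_num
  have hq : 1 ≤ T ^ ((1:ℝ)/4) := Real.one_le_rpow hT (by norm_num)
  have hp : 0 < T ^ ((3:ℝ)/4) := by positivity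
  have hm : h / M₂ ≤ h * M₁ / M₂ := by
    gcongr; nlinarith
  have a3 : (h / M₂) ^ 2 * (T ^ ((3:ℝ)/4) / h) ≤ a ^ 3 := by
    calc _ ≤ a ^ 2 * a := by gcongr; linarith
      _ = _ := by ring
  rw [e3]
  calc h * x ≤ h * T := by gcongr
    _ = 1 * 1 * (h * (T ^ ((1:ℝ)/4) * T ^ ((3:ℝ)/4))) := by rw [e4]; ring
    _ ≤ M₂ ^ 2 * T ^ ((1:ℝ)/4) * (h * (T ^ ((1:ℝ)/4) * T ^ ((3:ℝ)/4))) := by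
        gcongr
        exact one_le_pow₀ h2
    _ = M₂ ^ 4 * (T ^ ((1:ℝ)/4) * T ^ ((1:ℝ)/4)) * ((h / M₂) ^ 2 * (T ^ ((3:ℝ)/4) / h)) := by
        field_simp
    _ ≤ _ := by gcongr

theorem V_facts (T : ℝ) (hT : 1 ≤ T) (V : ℕ) (hV : V = ⌈T ^ 120⌉₊ + 3) :
    1 + log ((V:ℝ) + 3) ≤ 120 * (1 + log (4 * T)) ∧ 2 * (2 + log ((V:ℝ) + 2)) / √V ≤ 24 / T ^ 30 := by
  have hT0 : 0 < T := by linarith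
  have h120 : 1 ≤ T ^ 120 := one_le_pow₀ hT
  have c1 : T ^ 120 ≤ ⌈T ^ 120⌉₊ := Nat.le_ceil _
  have c2 : (⌈T ^ 120⌉₊ : ℝ) < T ^ 120 + 1 := Nat.ceil_lt_add_one (by positivity)
  have hV' : (V:ℝ) = ⌈T ^ 120⌉₊ + 3 := by rw [hV]; push_cast; ring
  have v1 : T ^ 120 ≤ V := by linarith
  have v2 : (V:ℝ) ≤ T ^ 120 + 4 := by linarith
  have v3 : 4 ≤ (V:ℝ) := by linarith
  constructor
  · have a : log ((V:ℝ) + 3) ≤ log ((4 * T) ^ 120) := by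
      apply Real.log_le_log (by positivity)
      rw [mul_pow]
      have : (8:ℝ) ≤ 4 ^ 120 := by norm_num
      nlinarith
    rw [Real.log_pow] at a
    push_cast at a
    linarith
  · have hV0 : (0:ℝ) < V := by linarith
    set s := √(√(V:ℝ)) with hs
    have hs0 : 0 < s := by positivity
    have hs2 : s ^ 2 = √V := Real.sq_sqrt (by positivity)
    have hs4 : s ^ 4 = V := by
      have : s ^ 4 = (s ^ 2) ^ 2 := by ring
      rw [this, hs2, Real.sq_sqrt hV0.le]
    have hsT : T ^ 30 ≤ s := by
      rw [← pow_le_pow_iff_left₀ (by positivity) hs0.le (by norm_num : 4 ≠ 0), hs4, ← pow_mul]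
      exact v1
    have hs1 : 1 ≤ s := le_trans (one_le_pow₀ hT) hsT
    have hl : log ((V:ℝ) + 2) ≤ 10 * s := by
      have l1 : log ((V:ℝ) + 2) ≤ log ((2 * s) ^ 4) := by
        apply Real.log_le_log (by positivity)
        rw [mul_pow, hs4]; linarith
      rw [Real.log_pow] at l1
      have l2 := Real.log_le_sub_one_of_pos (by positivity : 0 < 2 * s)
      push_cast at l1
      linarith
    rw [← hs2, div_le_div_iff₀ (by positivity) (by positivity)]
    calc 2 * (2 + log ((V:ℝ) + 2)) * T ^ 30 ≤ 2 * (2 * s + 10 * s) * s := by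
          gcongr
          linarith
      _ = _ := by ring

/-- the dual sum -/
def Yh (M₁ M₂ ℓ₁ : ℕ) (T y x : ℝ) (V h : ℕ) : ℂ :=
  ∑ n ∈ range (V+1), (if √(h * x) / √((2:ℝ) ^ (Jof T + 1) * h * M₁ / M₂) < (n:ℝ) + (ℓ₁:ℝ)/M₁ ∧
    (n:ℝ) + (ℓ₁:ℝ)/M₁ ≤ √(h * x) / √(max ((h:ℝ) * M₁ / M₂) (y / h)) then ee (h * x / ((n:ℝ) + (ℓ₁:ℝ)/M₁)) else 0)

theorem W_est (M₁ M₂ ℓ₁ : ℕ) (hM1 : 1 ≤ M₁) (hM2 : 1 ≤ M₂) (hl1 : 1 ≤ ℓ₁) (hl1' : ℓ₁ ≤ M₁) (T y x H : ℝ) (hT : 10 ≤ T)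
    (hx : 1 ≤ x) (hH : 1 ≤ H) (h V : ℕ) (hV : 4 ≤ V) (hh : 1 ≤ h)
    (hhH : (h:ℝ) ≤ H) (a b : ℝ) (ha : a = max ((h:ℝ) * M₁ / M₂) (y / h)) (hb : b = (2:ℝ) ^ (Jof T + 1) * h * M₁ / M₂)
    (ha1 : 1 ≤ a) : ‖Wh M₁ M₂ ℓ₁ T y x ⌊(2:ℝ) ^ (Jof T + 1) * H ^ 2 * M₁ / M₂⌋₊ h - 
      4 * FrL * (((√(√(h * x)))⁻¹:ℝ):ℂ) * Yh M₁ M₂ ℓ₁ T y x V h‖ ≤ 1 / (√a * √√a) +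
      (4 / (√(h * x) * √√a) + 24 / √√(h * x) + 60 / (√a * √√a) * (1 + log (V + 3)) + 
        20 * (h * x) * ((b + 1) * (2 * (2 + log (V + 2)) / √V))) := by
  have h1 : (0:ℝ) < M₁ := by exact_mod_cast hM1
  have h2 : (0:ℝ) < M₂ := by exact_mod_cast hM2
  have h3 : (0:ℝ) < ℓ₁ := by exact_mod_cast hl1
  have hh1 : (1:ℝ) ≤ h := by exact_mod_cast hh
  have hL := L_ge T hT
  have hb0 : 0 < b := by rw [hb]; positivity
  have hhx : 1 ≤ (h:ℝ) * x := one_le_mul_of_one_le_of_one_le hh1 hx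
  have ha0 : 0 < a := by linarith
  have hlV : 0 ≤ log ((V:ℝ) + 3) := Real.log_nonneg (by linarith [(Nat.cast_nonneg V : (0:ℝ) ≤ V)])
  have hlV' : 0 ≤ log ((V:ℝ) + 2) := Real.log_nonneg (by linarith [(Nat.cast_nonneg V : (0:ℝ) ≤ V)])
  rcases le_or_gt b a with hab | hab
  · rw [Wh_zero M₁ M₂ ℓ₁ hM1 hM2 T y x hT _ h hh (by rw [← ha, ← hb]; exact hab)]
    have : Yh M₁ M₂ ℓ₁ T y x V h = 0 := by
      unfold Yh
      apply sum_eq_zero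
      intro n _
      apply if_neg
      rintro ⟨p, q⟩
      rw [← hb] at p
      rw [← ha] at q
      have : √(h * x) / √a ≤ √(h * x) / √b := by gcongr
      linarith
    rw [this, mul_zero, sub_zero, norm_zero]
    positivity
  · have w := Wh_approx M₁ M₂ ℓ₁ hM1 hM2 T y x H hT hH h hh hhH a b ha hb hab
    rw [a34 a ha0] at w
    have hs := hsum (√(h * x)) ((ℓ₁:ℝ)/M₁) (√a) (√b) V hV (Real.one_le_sqrt.2 hhx) (Real.one_le_sqrt.2 ha1)
      (Real.sqrt_le_sqrt hab.le) (by positivity) (by rw [div_le_one h1]; exact_mod_cast hl1')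
    rw [Real.sq_sqrt ha0.le, Real.sq_sqrt hb0.le, Real.sq_sqrt (by linarith)] at hs
    have hY : Yh M₁ M₂ ℓ₁ T y x V h = ∑ n ∈ range (V+1), (if √(h * x) / √b < (n:ℝ) + (ℓ₁:ℝ)/M₁ ∧
      (n:ℝ) + (ℓ₁:ℝ)/M₁ ≤ √(h * x) / √a then ee (h * x / ((n:ℝ) + (ℓ₁:ℝ)/M₁)) else 0) := by
      unfold Yh
      rw [← ha, ← hb]
    rw [← hY] at hs
    have := norm_add_le_of_le w hs
    rw [sub_add_sub_cancel] at this
    exact this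

theorem junk_le (T M s w b z : ℝ) (hT : 1 ≤ T) (hM : 1 ≤ M) (hs0 : 0 ≤ s) (hs : s ≤ w) (hw0 : 0 ≤ w) (hw : w ≤ T ^ 9) (hb0 : 0 ≤ b)
    (hb : b ≤ 2 * M * T ^ 9) (hz0 : 0 ≤ z) (hz : z ≤ 24 / T ^ 30) : s * (20 * w * ((b + 1) * z)) ≤ 1440 * M := by
  have hT0 : 0 < T := by linarith
  have hT9 : 1 ≤ T ^ 9 := one_le_pow₀ hT
  have hMT : 1 ≤ M * T ^ 9 := one_le_mul_of_one_le_of_one_le hM hT9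
  have hb1 : b + 1 ≤ 3 * M * T ^ 9 := by linarith
  have hs9 : s ≤ T ^ 9 := hs.trans hw
  calc s * (20 * w * ((b + 1) * z)) ≤ T ^ 9 * (20 * T ^ 9 * ((3 * M * T ^ 9) * (24 / T ^ 30))) := by
        gcongr
    _ = 1440 * M / T ^ 3 := by field_simp; ring
    _ ≤ _ := div_le_self (by linarith) (one_le_pow₀ hT)

set_option maxHeartbeats 1000000 in
theorem per_h (M₁ M₂ ℓ₁ : ℕ) (hM1 : 1 ≤ M₁) (hM2 : 1 ≤ M₂) (hl1 : 1 ≤ ℓ₁) (hl1' : ℓ₁ ≤ M₁) (T x : ℝ) (hT : 10 ≤ T)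
    (hx : 1 ≤ x) (hxT : x ≤ T) (h V : ℕ) (hV : V = ⌈T ^ 120⌉₊ + 3) (hh : 1 ≤ h)
    (hhH : (h:ℝ) ≤ T ^ 8) (hcy : M₂ ≤ T ^ ((3:ℝ)/4)) :
    √√(h * x) * ‖Wh M₁ M₂ ℓ₁ T (T ^ ((3:ℝ)/4)) x ⌊(2:ℝ) ^ (Jof T + 1) * (T ^ 8) ^ 2 * M₁ / M₂⌋₊ h - 
      4 * FrL * (((√(√(h * x)))⁻¹:ℝ):ℂ) * Yh M₁ M₂ ℓ₁ T (T ^ ((3:ℝ)/4)) x V h‖ ≤ 9000 * M₁ * M₂ * T ^ ((1:ℝ)/8) * (1 + log (4 * T)) := by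
  have hT1 : 1 ≤ T := by linarith
  have hT0 : 0 < T := by linarith
  have h1 : (1:ℝ) ≤ M₁ := by exact_mod_cast hM1
  have h2 : (1:ℝ) ≤ M₂ := by exact_mod_cast hM2
  have hh1 : (1:ℝ) ≤ h := by exact_mod_cast hh
  have hL := L_ge T hT
  have hL2 := L_le T hT
  have hhx : 1 ≤ (h:ℝ) * x := one_le_mul_of_one_le_of_one_le hh1 hx
  set y := T ^ ((3:ℝ)/4) with hy
  obtain ⟨a, ha⟩ : ∃ a, a = max ((h:ℝ) * M₁ / M₂) (y / h) := ⟨_, rfl⟩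
  obtain ⟨b, hb⟩ : ∃ b, b = (2:ℝ) ^ (Jof T + 1) * h * M₁ / M₂ := ⟨_, rfl⟩
  have ha1 : (h:ℝ) * M₁ / M₂ ≤ a := ha ▸ le_max_left _ _
  have ha2 : y / h ≤ a := ha ▸ le_max_right _ _
  have ha0 : 0 < a := lt_of_lt_of_le (by positivity) ha1
  have hone : 1 ≤ a := by
    have : 1 ≤ a * a := by
      calc (1:ℝ) ≤ ((h:ℝ) * 1 / M₂) * (M₂ / h) := by
            apply le_of_eq; field_simp
        _ ≤ ((h:ℝ) * M₁ / M₂) * (y / h) := by gcongr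
        _ ≤ a * a := by gcongr
    nlinarith
  have hT8 : 1 ≤ T ^ 8 := one_le_pow₀ hT1
  have hV4 : 4 ≤ V := by
    have : 0 < ⌈T ^ 120⌉₊ := Nat.ceil_pos.2 (by positivity)
    omega
  have hw := W_est M₁ M₂ ℓ₁ hM1 hM2 hl1 hl1' T y x (T ^ 8) hT hx hT8 h V hV4 hh hhH a b ha hb hone
  have hal := a_low M₁ M₂ hM1 hM2 T x h a hT1 (by linarith) hxT (by linarith) ha1 ha2
  obtain ⟨hv1, hv2⟩ := V_facts T hT1 V hV
  have hk1 : 1 ≤ √(h * x) := Real.one_le_sqrt.2 hhx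
  have hs1 : 1 ≤ √√(h * x) := Real.one_le_sqrt.2 hk1
  have hs2 : √√(h * x) ^ 2 = √(h * x) := Real.sq_sqrt (by positivity)
  have hs4 : √(h * x) ^ 2 = h * x := Real.sq_sqrt (by positivity)
  have hta : 1 ≤ √√a := Real.one_le_sqrt.2 (Real.one_le_sqrt.2 hone)
  refine (mul_le_mul_of_nonneg_left hw (by positivity)).trans ?_
  have hlV : 0 ≤ log ((V:ℝ) + 3) := Real.log_nonneg (by linarith [(Nat.cast_nonneg V : (0:ℝ) ≤ V)])
  have hlT : 0 ≤ log (4 * T) := Real.log_nonneg (by linarith)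
  have hT8' : (1:ℝ) ≤ T ^ ((1:ℝ)/8) := Real.one_le_rpow hT1 (by norm_num)
  generalize T ^ ((1:ℝ)/8) = t at *
  generalize √√(h * x) = s at *
  generalize √(h * x) = k at *
  have hks : s ≤ k := by nlinarith
  have hkk : k ≤ h * x := by nlinarith
  have hx9 : (h:ℝ) * x ≤ T ^ 9 := by
    calc (h:ℝ) * x ≤ T ^ 8 * T := by gcongr
      _ = _ := by ring
  have hb9 : b ≤ 2 * M₁ * T ^ 9 := by
    rw [hb]
    calc (2:ℝ) ^ (Jof T + 1) * h * M₁ / M₂ ≤ (2:ℝ) ^ (Jof T + 1) * h * M₁ := div_le_self (by positivity) h2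
      _ ≤ (2 * T) * T ^ 8 * M₁ := by gcongr
      _ = _ := by ring
  have hb0 : 0 < b := by rw [hb]; positivity
  have hT9 : 1 ≤ T ^ 9 := one_le_pow₀ hT1
  have t1 : s * (4 / (k * √√a)) ≤ 4 := by
    rw [mul_div_assoc', div_le_iff₀ (mul_pos (by linarith) (by linarith))]
    have := mul_le_mul_of_nonneg_left hta (by linarith : 0 ≤ k)
    linarith
  have t2 : s * (24 / s) = 24 := by field_simp
  have t3 : s * (60 / (√a * √√a) * (1 + log (V + 3))) ≤ 60 * (M₂ * t) * (120 * (1 + log (4 * T))) := by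
    calc s * (60 / (√a * √√a) * (1 + log (V + 3))) = 60 * (s * (1 / (√a * √√a))) * (1 + log (V + 3)) := by ring
      _ ≤ _ := by gcongr
  have hz0 : 0 ≤ 2 * (2 + log ((V:ℝ) + 2)) / √V := by
    have : 0 ≤ log ((V:ℝ) + 2) := Real.log_nonneg (by linarith [(Nat.cast_nonneg V : (0:ℝ) ≤ V)])
    positivity
  have t4 : s * (20 * (h * x) * ((b + 1) * (2 * (2 + log (V + 2)) / √V))) ≤ 1440 * M₁ :=
    junk_le T M₁ s (h * x) b _ hT1 h1 (by linarith) (by linarith) (by linarith) hx9 hb0.le hb9 hz0 hv2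
  have total : s * (1 / (√a * √√a) +
      (4 / (k * √√a) + 24 / s + 60 / (√a * √√a) * (1 + log (V + 3)) + 
        20 * (h * x) * ((b + 1) * (2 * (2 + log (V + 2)) / √V)))) ≤ M₂ * t + (4 + 24 + 60 * (M₂ * t) * (120 * (1 + log (4 * T))) + 1440 * M₁) := by
    rw [mul_add, mul_add, mul_add, mul_add]
    linarith
  refine total.trans ?_
  set l := 1 + log (4 * T) with hl
  have hl1 : 1 ≤ l := by linarith
  have u1 : (M₂:ℝ) * t ≤ M₁ * M₂ * t * l := by
    have : (1:ℝ) ≤ M₁ * l := one_le_mul_of_one_le_of_one_le h1 hl1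
    have := mul_le_mul_of_nonneg_left this (by positivity : (0:ℝ) ≤ M₂ * t)
    linarith
  have u2 : (M₂:ℝ) * t * l ≤ M₁ * M₂ * t * l := by
    have := mul_le_mul_of_nonneg_left h1 (by positivity : (0:ℝ) ≤ M₂ * t * l)
    linarith
  have u3 : (M₁:ℝ) ≤ M₁ * M₂ * t * l := by
    have : (1:ℝ) ≤ M₂ * t * l := one_le_mul_of_one_le_of_one_le (one_le_mul_of_one_le_of_one_le h2 hT8') hl1
    have := mul_le_mul_of_nonneg_left this (by positivity : (0:ℝ) ≤ M₁)
    linarith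
  linarith

theorem Yh_eq (M₁ M₂ ℓ₁ : ℕ) (hM1 : 1 ≤ M₁) (hM2 : 1 ≤ M₂) (hl1 : 1 ≤ ℓ₁) (T y x : ℝ) (hy : 0 < y)
    (hx : 0 < x) (V h : ℕ) (hh : 1 ≤ h) :
    Yh M₁ M₂ ℓ₁ T y x V h = ∑ n ∈ range (V+1), (if (√(x * M₂ / ((2:ℝ) ^ (Jof T + 1) * M₁)) < (n:ℝ) + (ℓ₁:ℝ)/M₁ ∧ 
      ((n:ℝ) + (ℓ₁:ℝ)/M₁) ^ 2 * (M₁ / M₂) ≤ x) ∧ ((n:ℝ) + (ℓ₁:ℝ)/M₁) * √(y/x) ≤ h then ee (h * x / ((n:ℝ) + (ℓ₁:ℝ)/M₁)) else 0) := by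
  have h1 : (0:ℝ) < M₁ := by exact_mod_cast hM1
  have h2 : (0:ℝ) < M₂ := by exact_mod_cast hM2
  have h3 : (0:ℝ) < ℓ₁ := by exact_mod_cast hl1
  have hh0 : (0:ℝ) < h := by exact_mod_cast hh
  have hL : (0:ℝ) < (2:ℝ) ^ (Jof T + 1) := by positivity
  unfold Yh
  apply sum_congr rfl
  intro n _
  have hμ : 0 < (n:ℝ) + (ℓ₁:ℝ)/M₁ := by positivity
  generalize (n:ℝ) + (ℓ₁:ℝ)/M₁ = μ at *
  generalize (2:ℝ) ^ (Jof T + 1) = L at *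
  have e1 : √(h * x) / √(L * h * M₁ / M₂) = √(x * M₂ / (L * M₁)) := by
    rw [← Real.sqrt_div (by positivity)]
    congr 1; field_simp
  have e2 : μ ≤ √(h * x) / √(max ((h:ℝ) * M₁ / M₂) (y / h)) ↔ μ ^ 2 * (M₁ / M₂) ≤ x ∧ μ * √(y/x) ≤ h := by
    have hmax : 0 < max ((h:ℝ) * M₁ / M₂) (y / h) := lt_max_of_lt_right (by positivity)
    rw [← Real.sqrt_div (by positivity), Real.le_sqrt' hμ, le_div_iff₀ hmax,
      mul_max_of_nonneg _ _ (by positivity), max_le_iff]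
    apply and_congr
    · rw [show μ ^ 2 * (h * M₁ / M₂) = h * (μ ^ 2 * (M₁ / M₂)) by ring]
      exact mul_le_mul_iff_right₀ hh0
    · have : μ * √(y/x) = √(μ ^ 2 * (y / x)) := by
        rw [Real.sqrt_mul (by positivity), Real.sqrt_sq hμ.le]
      rw [this, Real.sqrt_le_left hh0.le]
      rw [mul_div_assoc', mul_div_assoc', div_le_iff₀ hh0, div_le_iff₀ hx]
      constructor <;> intro hc <;> nlinarith
  rw [e1]
  by_cases hc : (√(x * M₂ / (L * M₁)) < μ ∧ μ ^ 2 * (M₁ / M₂) ≤ x) ∧ μ * √(y/x) ≤ h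
  · rw [if_pos hc, if_pos ⟨hc.1.1, e2.2 ⟨hc.1.2, hc.2⟩⟩]
  · rw [if_neg hc, if_neg (fun hd => hc ⟨⟨hd.1, (e2.1 hd.2).1⟩, (e2.1 hd.2).2⟩)]

theorem sqrt2pi_ge : 1 ≤ √2 * π := by
  have : 1 ≤ √2 := Real.one_le_sqrt.2 (by norm_num)
  have := Real.pi_gt_three
  nlinarith

theorem Rstar_pre (M₁ M₂ ℓ₁ ℓ₂ : ℕ) (hM1 : 1 ≤ M₁) (hM2 : 1 ≤ M₂) (hl1 : 1 ≤ ℓ₁) (hl1' : ℓ₁ ≤ M₁) (T x : ℝ) (hT : 10 ≤ T)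
    (hx : 1 ≤ x) (hxT : x ≤ T) (hcy : M₂ ≤ T ^ ((3:ℝ)/4)) (V : ℕ) (hV : V = ⌈T ^ 120⌉₊ + 3) :
    |Rstar12 M₁ M₂ ℓ₁ ℓ₂ T (T ^ ((3:ℝ)/4)) (T ^ 8) x| ≤
      8 * (1 + log (4 * T)) * (9000 * M₁ * M₂ * T ^ ((1:ℝ)/8) * (1 + log (4 * T))) +
      8 * ‖∑ h ∈ Icc 1 ⌊T ^ 8⌋₊, ((1 / (h:ℝ) : ℝ):ℂ) * ee (-(h * ((ℓ₂:ℝ)/M₂))) * Yh M₁ M₂ ℓ₁ T (T ^ ((3:ℝ)/4)) x V h‖ := by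
  have hT1 : 1 ≤ T := by linarith
  have hT0 : 0 < T := by linarith
  have hx0 : 0 < x := by linarith
  have hT8 : 1 ≤ T ^ 8 := one_le_pow₀ hT1
  have hpi := sqrt2pi_ge
  rw [Rstar_reindex M₁ M₂ ℓ₁ ℓ₂ hM1 hM2 T _ _ x hT (by linarith), div_mul_eq_mul_div, abs_div, abs_of_pos (by linarith : 0 < √2 * π)]
  refine (div_le_self (abs_nonneg _) hpi).trans ?_
  rw [abs_mul, abs_of_nonneg (by positivity)]
  have hE := fun h : ℕ => fun hh : h ∈ Icc 1 ⌊T ^ 8⌋₊ => per_h M₁ M₂ ℓ₁ hM1 hM2 hl1 hl1' T x hT hx hxT h V hV (mem_Icc.1 hh).1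
    ((Nat.le_floor_iff (by linarith)).1 (mem_Icc.1 hh).2) hcy
  set E := 9000 * M₁ * M₂ * T ^ ((1:ℝ)/8) * (1 + log (4 * T)) with hEd
  set N := ⌊(2:ℝ) ^ (Jof T + 1) * (T ^ 8) ^ 2 * M₁ / M₂⌋₊ with hN
  set y := T ^ ((3:ℝ)/4) with hy
  set φ := (ℓ₂:ℝ)/M₂ with hφ
  have hlT : 0 ≤ log (4 * T) := Real.log_nonneg (by linarith)
  have hE0 : 0 ≤ E := by positivity
  refine (mul_le_mul_of_nonneg_left (Complex.abs_re_le_norm _) (by positivity)).trans ?_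
  have e0 : x ^ ((1:ℝ)/4) * ‖∑ h ∈ Icc 1 ⌊T ^ 8⌋₊, (((h:ℝ) ^ (-(3:ℝ)/4) : ℝ):ℂ) * ee (-(h * φ)) * ee (-(1/8)) * Wh M₁ M₂ ℓ₁ T y x N h‖ =
     ‖((x ^ ((1:ℝ)/4) : ℝ):ℂ) * ∑ h ∈ Icc 1 ⌊T ^ 8⌋₊, (((h:ℝ) ^ (-(3:ℝ)/4) : ℝ):ℂ) * ee (-(h * φ)) * ee (-(1/8)) * Wh M₁ M₂ ℓ₁ T y x N h‖ := by
    rw [norm_mul, Complex.norm_real, Real.norm_eq_abs, abs_of_nonneg (by positivity)]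
  rw [e0]
  have e1 : ((x ^ ((1:ℝ)/4) : ℝ):ℂ) * ∑ h ∈ Icc 1 ⌊T ^ 8⌋₊, (((h:ℝ) ^ (-(3:ℝ)/4) : ℝ):ℂ) * ee (-(h * φ)) * ee (-(1/8)) * Wh M₁ M₂ ℓ₁ T y x N h =
      ∑ h ∈ Icc 1 ⌊T ^ 8⌋₊, ((√√(h * x) / h : ℝ):ℂ) * (ee (-(h * φ)) * ee (-(1/8))) * (Wh M₁ M₂ ℓ₁ T y x N h -
        4 * FrL * (((√(√(h * x)))⁻¹:ℝ):ℂ) * Yh M₁ M₂ ℓ₁ T y x V h) + 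
      (4 * FrL * ee (-(1/8))) * ∑ h ∈ Icc 1 ⌊T ^ 8⌋₊, ((1 / (h:ℝ) : ℝ):ℂ) * ee (-(h * φ)) * Yh M₁ M₂ ℓ₁ T y x V h := by
    rw [mul_sum, mul_sum, ← sum_add_distrib]
    apply sum_congr rfl
    intro h hh
    have hh0 : (0:ℝ) < h := by exact_mod_cast (mem_Icc.1 hh).1
    have hs : 0 < √√(h * x) := by positivity
    rw [← q_k x h hx0 hh0]
    have : ((x ^ ((1:ℝ)/4) * (h:ℝ) ^ (-(3:ℝ)/4) : ℝ):ℂ) * (((√(√(h * x)))⁻¹:ℝ):ℂ) = ((1 / (h:ℝ) : ℝ):ℂ) := by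
      rw [← Complex.ofReal_mul, q_k x h hx0 hh0]
      congr 1; field_simp
    rw [← this]
    push_cast
    ring
  rw [e1]
  refine (norm_add_le _ _).trans (add_le_add ?_ ?_)
  · refine (norm_sum_le _ _).trans ?_
    have : ∀ h ∈ Icc 1 ⌊T ^ 8⌋₊, ‖((√√(h * x) / h : ℝ):ℂ) * (ee (-(h * φ)) * ee (-(1/8))) * (Wh M₁ M₂ ℓ₁ T y x N h -
        4 * FrL * (((√(√(h * x)))⁻¹:ℝ):ℂ) * Yh M₁ M₂ ℓ₁ T y x V h)‖ ≤ (1 / (h:ℝ)) * E := by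
      intro h hh
      have hh0 : (0:ℝ) < h := by exact_mod_cast (mem_Icc.1 hh).1
      rw [norm_mul, norm_mul, norm_mul, norm_ee, norm_ee, Complex.norm_real, Real.norm_eq_abs, abs_of_nonneg (by positivity)]
      calc _ = (1 / (h:ℝ)) * (√√(h * x) * ‖Wh M₁ M₂ ℓ₁ T y x N h -
        4 * FrL * (((√(√(h * x)))⁻¹:ℝ):ℂ) * Yh M₁ M₂ ℓ₁ T y x V h‖) := by ring
        _ ≤ _ := mul_le_mul_of_nonneg_left (hE h hh) (by positivity)
    refine (sum_le_sum this).trans ?_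
    rw [← sum_mul]
    apply mul_le_mul_of_nonneg_right _ hE0
    refine (sum_inv_le_log _ _ le_rfl).trans ?_
    have h8 := log_T8 T hT1 ⌊T ^ 8⌋₊ (Nat.floor_le (by linarith))
    have hf1 : 1 ≤ ⌊T ^ 8⌋₊ := Nat.le_floor (by simpa using hT8)
    have hf : (1:ℝ) ≤ ⌊T ^ 8⌋₊ := by exact_mod_cast hf1
    have : log (⌊T ^ 8⌋₊:ℝ) ≤ log ((⌊T ^ 8⌋₊:ℝ) + 1) := Real.log_le_log (by linarith) (by linarith)
    linarith
  · rw [norm_mul, norm_mul, norm_mul, norm_ee, mul_one]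
    have := FrL_le
    apply mul_le_mul_of_nonneg_right _ (norm_nonneg _)
    norm_num
    linarith

theorem Rstar_large (M₁ M₂ ℓ₁ ℓ₂ : ℕ) (hM1 : 1 ≤ M₁) (hM2 : 1 ≤ M₂) (hl1 : 1 ≤ ℓ₁) (hl1' : ℓ₁ ≤ M₁) (ε : ℝ) (hε : 0 < ε) :
    ∃ C : ℝ, 1 ≤ C ∧ ∀ T x : ℝ, 10 ≤ T → (M₂:ℝ) ^ 2 ≤ T → T / 2 ≤ x → x ≤ T →
      |Rstar12 M₁ M₂ ℓ₁ ℓ₂ T (T ^ ((3:ℝ)/4)) (T ^ 8) x| ≤ C * T ^ (1/8 + ε) := by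
  have h1 : (1:ℝ) ≤ M₁ := by exact_mod_cast hM1
  have h2 : (1:ℝ) ≤ M₂ := by exact_mod_cast hM2
  obtain ⟨C, hC, hmain⟩ := main_sum M₁ M₂ ℓ₁ ℓ₂ hM1 hM2 hl1 ε hε
  obtain ⟨Cl, hCl, hlog⟩ := log_pow_bound (ε / 2) (by positivity)
  refine ⟨72000 * M₁ * M₂ * Cl ^ 2 + 8 * C, ?_, ?_⟩
  · have : 0 ≤ 72000 * M₁ * M₂ * Cl ^ 2 := by positivity
    linarith
  intro T x hT hTM hx hxT
  have hT1 : 1 ≤ T := by linarith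
  have hT0 : 0 < T := by linarith
  have hx1 : 1 ≤ x := by linarith
  have hlT : 0 ≤ log (4 * T) := Real.log_nonneg (by linarith)
  have hcy : (M₂:ℝ) ≤ T ^ ((3:ℝ)/4) := by
    calc (M₂:ℝ) ≤ √T := Real.le_sqrt_of_sq_le hTM
      _ = T ^ ((1:ℝ)/2) := Real.sqrt_eq_rpow T
      _ ≤ _ := Real.rpow_le_rpow_of_exponent_le hT1 (by norm_num)
  have hp := Rstar_pre M₁ M₂ ℓ₁ ℓ₂ hM1 hM2 hl1 hl1' T x hT hx1 hxT hcy _ rfl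
  set V := ⌈T ^ 120⌉₊ + 3 with hV
  have hm := hmain T x hT1 (by linarith) hxT (fun n => √(x * M₂ / ((2:ℝ) ^ (Jof T + 1) * M₁)) < (n:ℝ) + (ℓ₁:ℝ)/M₁ ∧ 
      ((n:ℝ) + (ℓ₁:ℝ)/M₁) ^ 2 * (M₁ / M₂) ≤ x) (by
        rintro n ⟨_, hn⟩
        by_contra hc
        push Not at hc
        have a1 : (2 * x) ^ 2 ≤ ((n:ℝ) + (ℓ₁:ℝ)/M₁) ^ 2 := by gcongr
        have a2 : (1:ℝ) / M₂ ≤ M₁ / M₂ := by gcongr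
        have a3 : (2 * x) ^ 2 * (1 / M₂) ≤ x := by
          refine le_trans ?_ hn
          gcongr
        rw [mul_one_div, div_le_iff₀ (by linarith)] at a3
        have a4 : (M₂:ℝ) < 4 * x := by nlinarith
        nlinarith) ⌊T ^ 8⌋₊ (V + 1) (Nat.floor_le (by positivity))
  have e : ∑ h ∈ Icc 1 ⌊T ^ 8⌋₊, ((1 / (h:ℝ) : ℝ):ℂ) * ee (-(h * ((ℓ₂:ℝ)/M₂))) * Yh M₁ M₂ ℓ₁ T (T ^ ((3:ℝ)/4)) x V h =
    ∑ h ∈ Icc 1 ⌊T ^ 8⌋₊, ((1 / (h:ℝ) : ℝ):ℂ) * ee (-(h * ((ℓ₂:ℝ)/M₂))) * ∑ n ∈ range (V+1), (if (√(x * M₂ / ((2:ℝ) ^ (Jof T + 1) * M₁)) < (n:ℝ) + (ℓ₁:ℝ)/M₁ ∧ 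
      ((n:ℝ) + (ℓ₁:ℝ)/M₁) ^ 2 * (M₁ / M₂) ≤ x) ∧ ((n:ℝ) + (ℓ₁:ℝ)/M₁) * √(T ^ ((3:ℝ)/4)/x) ≤ h then ee (h * x / ((n:ℝ) + (ℓ₁:ℝ)/M₁)) else 0) := by
    apply sum_congr rfl
    intro h hh
    rw [Yh_eq M₁ M₂ ℓ₁ hM1 hM2 hl1 T _ x (by positivity) (by linarith) V h (mem_Icc.1 hh).1]
  rw [e] at hp
  refine hp.trans ?_
  have hl := hlog T hT1
  have hl2 : (1 + log (4 * T)) * (1 + log (4 * T)) ≤ Cl ^ 2 * T ^ ε := by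
    calc _ ≤ (Cl * T ^ (ε / 2)) * (Cl * T ^ (ε / 2)) := by gcongr
      _ = Cl ^ 2 * (T ^ (ε / 2) * T ^ (ε / 2)) := by ring
      _ = _ := by rw [← Real.rpow_add hT0]; norm_num
  have eT : T ^ (1/8 + ε) = T ^ ((1:ℝ)/8) * T ^ ε := Real.rpow_add hT0 _ _
  have f1 : 8 * (1 + log (4 * T)) * (9000 * M₁ * M₂ * T ^ ((1:ℝ)/8) * (1 + log (4 * T))) ≤ 72000 * M₁ * M₂ * Cl ^ 2 * T ^ (1/8 + ε) := by
    rw [eT]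
    have := mul_le_mul_of_nonneg_left hl2 (by positivity : 0 ≤ 72000 * M₁ * M₂ * T ^ ((1:ℝ)/8))
    linarith
  have f2 := mul_le_mul_of_nonneg_left hm (by norm_num : (0:ℝ) ≤ 8)
  rw [add_mul, mul_assoc 8 C]
  refine add_le_add f1 (le_trans (le_of_eq (by congr!)) f2)

theorem Rstar_cont (M₁ M₂ ℓ₁ ℓ₂ : ℕ) (T y H : ℝ) : Continuous (fun x => Rstar12 M₁ M₂ ℓ₁ ℓ₂ T y H x) := by
  unfold Rstar12 tau12H
  apply Continuous.mul
  · exact (Real.continuous_rpow_const (by norm_num)).div_const _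
  · apply continuous_finset_sum
    intro n _
    apply Continuous.mul _ continuous_const
    apply continuous_finset_sum
    intro p _
    by_cases h : (p.1:ℝ) ≤ H
    · simp only [if_pos h]
      fun_prop
    · simp only [if_neg h]
      fun_prop

theorem wprime_le (α β t : ℝ) : |wprime α β t| ≤ 2 := by
  unfold wprime
  split_ifs <;> norm_num

theorem Rstar_crude (M₁ M₂ ℓ₁ ℓ₂ : ℕ) (hM2 : 1 ≤ M₂) (T x : ℝ) (hT : 10 ≤ T) (hx : 0 ≤ x) (hxT : x ≤ T) (y : ℝ) :
    |Rstar12 M₁ M₂ ℓ₁ ℓ₂ T y (T ^ 8) x| ≤ 8 * M₁ ^ 2 * T ^ 35 := by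
  have hT1 : 1 ≤ T := by linarith
  have hT0 : 0 < T := by linarith
  have h2 : (1:ℝ) ≤ M₂ := by exact_mod_cast hM2
  have hL := L_ge T hT
  have hL2 := L_le T hT
  unfold Rstar12
  set N := ⌊(2:ℝ) ^ (Jof T + 1) * (T ^ 8) ^ 2 * M₁ / M₂⌋₊ with hN
  have hNle : (N:ℝ) ≤ 2 * M₁ * T ^ 17 := by
    calc (N:ℝ) ≤ (2:ℝ) ^ (Jof T + 1) * (T ^ 8) ^ 2 * M₁ / M₂ := Nat.floor_le (by positivity)
      _ ≤ (2:ℝ) ^ (Jof T + 1) * (T ^ 8) ^ 2 * M₁ := div_le_self (by positivity) h2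
      _ ≤ (2 * T) * (T ^ 8) ^ 2 * M₁ := by gcongr
      _ = _ := by ring
  have hpi := sqrt2pi_ge
  have hx4 : x ^ ((1:ℝ)/4) / (√2 * π) ≤ T := by
    refine (div_le_self (by positivity) hpi).trans ?_
    calc x ^ ((1:ℝ)/4) ≤ T ^ ((1:ℝ)/4) := Real.rpow_le_rpow hx hxT (by norm_num)
      _ ≤ T ^ (1:ℝ) := Real.rpow_le_rpow_of_exponent_le hT1 (by norm_num)
      _ = T := Real.rpow_one T
  rw [abs_mul, abs_of_nonneg (by positivity)]
  have hterm : ∀ n ∈ (Icc 1 N).filter (fun n : ℕ => y < (n:ℝ)), |tau12H M₁ M₂ ℓ₁ ℓ₂ T (T ^ 8) n x * (n:ℝ) ^ (-(3:ℝ)/4)| ≤ 2 * N := by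
    intro n hn
    have hn1 := mem_Icc.1 (mem_filter.1 hn).1
    have hn1' : (1:ℝ) ≤ n := by exact_mod_cast hn1.1
    rw [abs_mul, abs_of_nonneg (by positivity : 0 ≤ (n:ℝ) ^ (-(3:ℝ)/4))]
    have hr : (n:ℝ) ^ (-(3:ℝ)/4) ≤ 1 := Real.rpow_le_one_of_one_le_of_nonpos hn1' (by norm_num)
    have ht : |tau12H M₁ M₂ ℓ₁ ℓ₂ T (T ^ 8) n x| ≤ 2 * N := by
      unfold tau12H
      refine (abs_sum_le_sum_abs _ _).trans ?_
      have : ∀ p ∈ n.divisorsAntidiagonal, |(if (p.1 : ℝ) ≤ T ^ 8 then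
        wprime ((p.1 : ℝ) * M₁ / M₂) ((2:ℝ) ^ (Jof T + 1) * p.1 * M₁ / M₂) (p.2 : ℝ) *
        Real.cos (4 * π * Real.sqrt (n * x) - 2 * π * phase M₁ M₂ ℓ₁ ℓ₂ p) else 0)| ≤ 2 := by
        intro p _
        split_ifs
        · rw [abs_mul]
          have a := wprime_le ((p.1 : ℝ) * M₁ / M₂) ((2:ℝ) ^ (Jof T + 1) * p.1 * M₁ / M₂) (p.2 : ℝ)
          have b := Real.abs_cos_le_one (4 * π * Real.sqrt (n * x) - 2 * π * phase M₁ M₂ ℓ₁ ℓ₂ p)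
          calc _ ≤ (2:ℝ) * 1 := mul_le_mul a b (abs_nonneg _) (by norm_num)
            _ = 2 := by norm_num
        · norm_num
      refine (sum_le_sum this).trans ?_
      rw [sum_const, nsmul_eq_mul]
      have hc : (n.divisorsAntidiagonal).card ≤ n := by
        rw [← Nat.map_div_right_divisors, card_map]
        exact Nat.card_divisors_le_self n
      have : ((n.divisorsAntidiagonal).card : ℝ) ≤ N := by exact_mod_cast hc.trans hn1.2
      linarith
    calc _ ≤ (2 * N : ℝ) * 1 := mul_le_mul ht hr (by positivity) (by positivity)
      _ = _ := by ring
  have hsum : |∑ n ∈ (Icc 1 N).filter (fun n : ℕ => y < (n:ℝ)), tau12H M₁ M₂ ℓ₁ ℓ₂ T (T ^ 8) n x * (n:ℝ) ^ (-(3:ℝ)/4)| ≤ N * (2 * N) := by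
    refine (abs_sum_le_sum_abs _ _).trans ((sum_le_sum hterm).trans ?_)
    rw [sum_const, nsmul_eq_mul]
    have hc : ((Icc 1 N).filter (fun n : ℕ => y < (n:ℝ))).card ≤ N := by
      refine (card_filter_le _ _).trans ?_
      simp
    have : (((Icc 1 N).filter (fun n : ℕ => y < (n:ℝ))).card : ℝ) ≤ N := by exact_mod_cast hc
    gcongr
  calc _ ≤ T * (N * (2 * N)) := mul_le_mul hx4 hsum (abs_nonneg _) hT0.le
    _ ≤ T * ((2 * M₁ * T ^ 17) * (2 * (2 * M₁ * T ^ 17))) := by gcongr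
    _ = _ := by ring

theorem Rstar_bound (M₁ M₂ ℓ₁ ℓ₂ : ℕ) (hM1 : 1 ≤ M₁) (hM2 : 1 ≤ M₂) (hl1 : 1 ≤ ℓ₁) (hl1' : ℓ₁ ≤ M₁) (ε : ℝ) (hε : 0 < ε) :
    ∃ C : ℝ, 1 ≤ C ∧ ∀ T x : ℝ, 10 ≤ T → T / 2 ≤ x → x ≤ T →
      |Rstar12 M₁ M₂ ℓ₁ ℓ₂ T (T ^ ((3:ℝ)/4)) (T ^ 8) x| ≤ C * T ^ (1/8 + ε) := by
  obtain ⟨C, hC, hb⟩ := Rstar_large M₁ M₂ ℓ₁ ℓ₂ hM1 hM2 hl1 hl1' ε hε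
  refine ⟨C + 8 * M₁ ^ 2 * ((M₂:ℝ) ^ 2) ^ 35, ?_, ?_⟩
  · have : 0 ≤ 8 * (M₁:ℝ) ^ 2 * ((M₂:ℝ) ^ 2) ^ 35 := by positivity
    linarith
  intro T x hT hx hxT
  have hp : 1 ≤ T ^ (1/8 + ε) := Real.one_le_rpow (by linarith) (by positivity)
  have hn : 0 ≤ 8 * (M₁:ℝ) ^ 2 * ((M₂:ℝ) ^ 2) ^ 35 := by positivity
  rcases le_or_gt ((M₂:ℝ) ^ 2) T with h | h
  · refine (hb T x hT h hx hxT).trans ?_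
    rw [add_mul]
    nlinarith
  · refine (Rstar_crude M₁ M₂ ℓ₁ ℓ₂ hM2 T x hT (by linarith) hxT _).trans ?_
    have : 8 * (M₁:ℝ) ^ 2 * T ^ 35 ≤ 8 * (M₁:ℝ) ^ 2 * ((M₂:ℝ) ^ 2) ^ 35 := by
      gcongr
    rw [add_mul]
    nlinarith

theorem fourth_diff (a g G : ℝ) (hg : |g| ≤ G) : |(a + g) ^ 4 - a ^ 4| ≤ 15 * G * (|a| ^ 3 + G ^ 3) := by
  have hG : 0 ≤ G := le_trans (abs_nonneg _) hg
  have hA := abs_nonneg a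
  have hgn := abs_nonneg g
  have e : (a + g) ^ 4 - a ^ 4 = 4 * (a ^ 3 * g) + 6 * (a ^ 2 * g ^ 2) + 4 * (a * g ^ 3) + g ^ 4 := by ring
  have b : |(a + g) ^ 4 - a ^ 4| ≤ 4 * (|a| ^ 3 * |g|) + 6 * (|a| ^ 2 * |g| ^ 2) + 4 * (|a| * |g| ^ 3) + |g| ^ 4 := by
    rw [e]
    refine (abs_add_le _ _).trans (add_le_add ((abs_add_le _ _).trans (add_le_add ((abs_add_le _ _).trans (add_le_add ?_ ?_)) ?_)) ?_) <;>
    simp [abs_mul, abs_pow]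
  have c : 4 * (|a| ^ 3 * |g|) + 6 * (|a| ^ 2 * |g| ^ 2) + 4 * (|a| * |g| ^ 3) + |g| ^ 4 ≤
      4 * (|a| ^ 3 * G) + 6 * (|a| ^ 2 * G ^ 2) + 4 * (|a| * G ^ 3) + G ^ 4 := by gcongr
  refine b.trans (c.trans ?_)
  generalize |a| = A at *
  have k1 : A ^ 2 * G ≤ A ^ 3 + G ^ 3 := by nlinarith [mul_nonneg (add_nonneg hA hG) (sq_nonneg (A - G)), mul_nonneg hA (sq_nonneg G), mul_nonneg hG (sq_nonneg A), pow_nonneg hA 3, pow_nonneg hG 3]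
  have k2 : A * G ^ 2 ≤ A ^ 3 + G ^ 3 := by nlinarith [mul_nonneg (add_nonneg hA hG) (sq_nonneg (A - G)), mul_nonneg hA (sq_nonneg G), mul_nonneg hG (sq_nonneg A), pow_nonneg hA 3, pow_nonneg hG 3]
  have k1' := mul_le_mul_of_nonneg_right k1 hG
  have k2' := mul_le_mul_of_nonneg_right k2 hG
  have k3 : 0 ≤ G * A ^ 3 := by positivity
  have k4 : 0 ≤ G * G ^ 3 := by positivity
  nlinarith

theorem cube_le (a t : ℝ) (ht : 0 < t) : |a| ^ 3 ≤ a ^ 4 / t + t ^ 3 := by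
  have hA := abs_nonneg a
  have e : a ^ 4 = |a| ^ 4 := by rw [← abs_pow]; exact (abs_of_nonneg (by positivity)).symm
  rw [e]
  generalize |a| = A at *
  rcases le_or_gt A t with h | h
  · have : A ^ 3 ≤ t ^ 3 := by gcongr
    have : 0 ≤ A ^ 4 / t := by positivity
    linarith
  · have : A ^ 3 ≤ A ^ 4 / t := by
      rw [le_div_iff₀ ht]
      have := mul_le_mul_of_nonneg_left h.le (by positivity : 0 ≤ A ^ 3)
      linarith [this, show A ^ 3 * A = A ^ 4 by ring]
    have : 0 ≤ t ^ 3 := by positivity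
    linarith

theorem fourth_moment_aux (M₁ M₂ ℓ₁ ℓ₂ : ℕ) (hM₁ : 0 < M₁) (hM₂ : 0 < M₂)
    (hℓ₁ : 1 ≤ ℓ₁) (hℓ₁' : ℓ₁ ≤ M₁) (hℓ₂ : 1 ≤ ℓ₂) (hℓ₂' : ℓ₂ ≤ M₂)
    (ε : ℝ) (hε : 0 < ε) :
    ∃ C > 0, ∀ T : ℝ, 10 ≤ T →
      |(∫ x in (T/2)..T, (Rfull M₁ M₂ ℓ₁ ℓ₂ T x) ^ 4)
          - 1 / (32 * π ^ 4) * C4 M₁ M₂ ℓ₁ ℓ₂ * ∫ x in (T/2)..T, x|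
        ≤ C * T ^ (2 - 1/8 + ε) := by
  set δ := min ε (1/16) with hδ
  have hδ0 : 0 < δ := lt_min hε (by norm_num)
  have hδ1 : δ ≤ ε := min_le_left _ _
  have hδ2 : δ ≤ 1/16 := min_le_right _ _
  obtain ⟨C1, hC1, hR1⟩ := Rstar_bound M₁ M₂ ℓ₁ ℓ₂ hM₁ hM₂ hℓ₁ hℓ₁' δ hδ0
  obtain ⟨C2, hC2, hR2⟩ := Rstar_bound M₂ M₁ ℓ₂ ℓ₁ hM₂ hM₁ hℓ₂ hℓ₂' δ hδ0
  obtain ⟨C3, hC3, hF⟩ := R0_fourth M₁ M₂ ℓ₁ ℓ₂ ε hε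
  obtain ⟨C5, hC5, hF'⟩ := R0_fourth M₁ M₂ ℓ₁ ℓ₂ (1/8) (by norm_num)
  set c := 1 / (32 * π ^ 4) * C4 M₁ M₂ ℓ₁ ℓ₂ with hc
  set B := C1 + C2 with hB
  have hB0 : 0 < B := by linarith
  refine ⟨C3 + 15 * B * (C5 + |c| + 1 + B ^ 3), by positivity, ?_⟩
  intro T hT
  have hT1 : 1 ≤ T := by linarith
  have hT0 : 0 < T := by linarith
  set f := fun x => R0 M₁ M₂ ℓ₁ ℓ₂ (T ^ ((3:ℝ)/4)) x with hf
  have hfc : Continuous f := R0_cont _ _ _ _ _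
  set g := fun x => Rstar12 M₁ M₂ ℓ₁ ℓ₂ T (T ^ ((3:ℝ)/4)) (T ^ 8) x + Rstar12 M₂ M₁ ℓ₂ ℓ₁ T (T ^ ((3:ℝ)/4)) (T ^ 8) x with hg
  have hgc : Continuous g := (Rstar_cont _ _ _ _ _ _ _).add (Rstar_cont _ _ _ _ _ _ _)
  have hRf : ∀ x, Rfull M₁ M₂ ℓ₁ ℓ₂ T x = f x + g x := by
    intro x; unfold Rfull; simp only [hf, hg]; ring
  set G := B * T ^ (1/8 + δ) with hG
  have hG0 : 0 < G := by positivity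
  have hgG : ∀ x ∈ Set.Icc (T/2) T, |g x| ≤ G := by
    intro x hx
    have a := hR1 T x hT hx.1 hx.2
    have b := hR2 T x hT hx.1 hx.2
    calc |g x| ≤ _ := abs_add_le _ _
      _ ≤ C1 * T ^ (1/8 + δ) + C2 * T ^ (1/8 + δ) := add_le_add a b
      _ = _ := by rw [hG, hB]; ring
  have hIx : ∫ x in (T/2)..T, x = 3/8 * T ^ 2 := by
    rw [integral_id]; ring
  have h4 : ∫ x in (T/2)..T, f x ^ 4 ≤ (C5 + |c|) * T ^ 2 := by
    have h := hF' T hT1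
    have e : T ^ ((2:ℝ) - 1/8 + 1/8) = T ^ 2 := by
      rw [← Real.rpow_natCast]; norm_num
    rw [e, hIx] at h
    have h' := (abs_le.1 h).2
    have hcc : c * (3/8 * T ^ 2) ≤ |c| * T ^ 2 := by
      have q1 : c * (3/8 * T ^ 2) ≤ |c| * (3/8 * T ^ 2) := mul_le_mul_of_nonneg_right (le_abs_self c) (by positivity)
      have q2 : 0 ≤ |c| * T ^ 2 := by positivity
      linarith
    simp only [hf]
    linarith
  set t := T ^ ((1:ℝ)/4) with ht
  have ht0 : 0 < t := by positivity
  have hdiff : |(∫ x in (T/2)..T, (f x + g x) ^ 4) - ∫ x in (T/2)..T, f x ^ 4| ≤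
      15 * G * (((C5 + |c|) * T ^ 2) / t + T * (t ^ 3 + G ^ 3)) := by
    rw [← intervalIntegral.integral_sub (Continuous.intervalIntegrable (by fun_prop) _ _) (Continuous.intervalIntegrable (by fun_prop) _ _)]
    have hle : T / 2 ≤ T := by linarith
    calc |∫ x in (T/2)..T, ((f x + g x) ^ 4 - f x ^ 4)| ≤ ∫ x in (T/2)..T, |(f x + g x) ^ 4 - f x ^ 4| :=
          intervalIntegral.abs_integral_le_integral_abs hle
      _ ≤ ∫ x in (T/2)..T, 15 * G * (f x ^ 4 / t + (t ^ 3 + G ^ 3)) := by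
          apply intervalIntegral.integral_mono_on hle (Continuous.intervalIntegrable (by fun_prop) _ _) (Continuous.intervalIntegrable (by fun_prop) _ _)
          intro x hx
          refine (fourth_diff (f x) (g x) G (hgG x hx)).trans ?_
          have := cube_le (f x) t ht0
          apply mul_le_mul_of_nonneg_left _ (by positivity)
          linarith
      _ = 15 * G * ((∫ x in (T/2)..T, f x ^ 4) / t + (T / 2) * (t ^ 3 + G ^ 3)) := by
          rw [intervalIntegral.integral_const_mul, intervalIntegral.integral_add (Continuous.intervalIntegrable (by fun_prop) _ _) (Continuous.intervalIntegrable (by fun_prop) _ _),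
            intervalIntegral.integral_div, intervalIntegral.integral_const, smul_eq_mul]
          ring
      _ ≤ _ := by
          gcongr
  have e1 : T ^ 2 / t = T ^ ((7:ℝ)/4) := by
    rw [ht, ← Real.rpow_natCast, ← Real.rpow_sub hT0]; norm_num
  have e2 : T * t ^ 3 = T ^ ((7:ℝ)/4) := by
    rw [ht, ← Real.rpow_natCast, ← Real.rpow_mul hT0.le]
    nth_rewrite 1 [← Real.rpow_one T]
    rw [← Real.rpow_add hT0]; norm_num
  have e3 : T * G ^ 3 ≤ B ^ 3 * T ^ ((7:ℝ)/4) := by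
    rw [hG, mul_pow, ← Real.rpow_natCast (T ^ (1/8 + δ)), ← Real.rpow_mul hT0.le]
    have : T * T ^ ((1/8 + δ) * ((3:ℕ):ℝ)) ≤ T ^ ((7:ℝ)/4) := by
      nth_rewrite 1 [← Real.rpow_one T]
      rw [← Real.rpow_add hT0]
      apply Real.rpow_le_rpow_of_exponent_le hT1
      push_cast
      linarith
    have := mul_le_mul_of_nonneg_left this (by positivity : 0 ≤ B ^ 3)
    linarith
  have e4 : T ^ (1/8 + δ) * T ^ ((7:ℝ)/4) ≤ T ^ (2 - 1/8 + ε) := by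
    rw [← Real.rpow_add hT0]
    apply Real.rpow_le_rpow_of_exponent_le hT1
    linarith
  have hfin : 15 * G * (((C5 + |c|) * T ^ 2) / t + T * (t ^ 3 + G ^ 3)) ≤ 15 * B * (C5 + |c| + 1 + B ^ 3) * T ^ (2 - 1/8 + ε) := by
    rw [mul_div_assoc, e1, mul_add T, e2]
    have s1 : (C5 + |c|) * T ^ ((7:ℝ)/4) + (T ^ ((7:ℝ)/4) + T * G ^ 3) ≤ (C5 + |c| + 1 + B ^ 3) * T ^ ((7:ℝ)/4) := by linarith
    calc _ ≤ 15 * G * ((C5 + |c| + 1 + B ^ 3) * T ^ ((7:ℝ)/4)) := by gcongr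
      _ = 15 * B * (C5 + |c| + 1 + B ^ 3) * (T ^ (1/8 + δ) * T ^ ((7:ℝ)/4)) := by rw [hG]; ring
      _ ≤ _ := mul_le_mul_of_nonneg_left e4 (by positivity)
  have hI : ∫ x in (T/2)..T, (Rfull M₁ M₂ ℓ₁ ℓ₂ T x) ^ 4 = ∫ x in (T/2)..T, (f x + g x) ^ 4 := by
    congr 1; funext x; rw [hRf]
  rw [hI]
  have h3 := hF T hT1
  have tri := abs_sub_le (∫ x in (T/2)..T, (f x + g x) ^ 4) (∫ x in (T/2)..T, f x ^ 4) (c * ∫ x in (T/2)..T, x)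
  simp only [hf] at tri hdiff ⊢
  rw [add_mul]
  linarith

theorem fourth_moment_of_R (M₁ M₂ ℓ₁ ℓ₂ : ℕ) (hM₁ : 0 < M₁) (hM₂ : 0 < M₂)
    (hℓ₁ : 1 ≤ ℓ₁) (hℓ₁' : ℓ₁ ≤ M₁) (hℓ₂ : 1 ≤ ℓ₂) (hℓ₂' : ℓ₂ ≤ M₂)
    (ε : ℝ) (hε : 0 < ε) :
    ∃ C > 0, ∀ T : ℝ, 10 ≤ T →
      |(∫ x in (T/2)..T, (Rfull M₁ M₂ ℓ₁ ℓ₂ T x) ^ 4)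
          - 1 / (32 * π ^ 4) * C4 M₁ M₂ ℓ₁ ℓ₂ * ∫ x in (T/2)..T, x|
        ≤ C * T ^ (2 - 1/8 + ε) := by
  exact fourth_moment_aux M₁ M₂ ℓ₁ ℓ₂ hM₁ hM₂ hℓ₁ hℓ₁' hℓ₂ hℓ₂' ε hε
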